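/- Critical exponent γ for the average cluster volume: Assume ν < α/2, ν < 3, and that d is the graph distance d_gr. Then for every x ∈ G, with 𝒦^a the open cluster of x in E^{≥a}, the limit γ := −lim_{a→0} log 𝔼[|𝒦^a| 1{|𝒦^a| < ∞}] / log |a| exists and equals 2α/ν − 2. -/

import Mathlib

open MeasureTheory ProbabilityTheory Real Filter Topology
open scoped ENNReal NNReal BigOperators Classical

noncomputable section

/-! ## Generic exponents and corrections -/

/-- The exponent `b₁`: equal to `1` if `ν = 1` and `0` otherwise. -/
def bOne (ν : ℝ) : ℝ := if ν = 1 then 1 else 0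

/-- The exponent `b₂`: equal to `1` if `α = 2ν` and `0` otherwise. -/
def bTwo (ν α : ℝ) : ℝ := if α = 2 * ν then 1 else 0

/-- The polylogarithmic correction `q(r)` from Theorem 1.1. -/
def qArm (ν α r : ℝ) : ℝ :=
  if ν = 1 then Real.log (Real.log r)
  else if ν < α / 2 then Real.log r ^ ((ν - 1) / 2) * Real.log (Real.log r) ^ ν
  else Real.log r ^ ν * Real.log (Real.log r) ^ ν

/-- `exp(-t)` for an extended nonnegative real `t`. -/
def expNegE (t : ℝ≥0∞) : ℝ≥0∞ := if t = ⊤ then 0 else ENNReal.ofReal (Real.exp (-t.toReal))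

/-! ## Transient weighted graphs

A weighted graph `𝒢 = (G, λ)`, connected and locally finite, with controlled weights,
equipped with a metric `d`, a distinguished base point `o`, and exponents `α` (volume
growth) and `ν` (Green's function decay). -/

structure WGraph where
  (V : Type) (countableV : Countable V) (o : V)
  (lam : V → V → ℝ)
  (lam_nonneg : ∀ x y, 0 ≤ lam x y)
  (lam_symm : ∀ x y, lam x y = lam y x)
  (locFin : ∀ x, (Function.support (lam x)).Finite)
  (connectedG : ∀ x y, Relation.ReflTransGen (fun u v => 0 < lam u v) x y)
  -- controlled weights: `λ_{x,y}/λ_x ≥ c₀` for all neighbours `x ∼ y`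
  (ctrl : ∃ c₀ > (0:ℝ), ∀ x y, 0 < lam x y → c₀ * (∑ᶠ z, lam x z) ≤ lam x y)
  (d : V → V → ℝ)
  (d_symm : ∀ x y, d x y = d y x)
  (d_self : ∀ x, d x x = 0)
  (d_pos : ∀ x y, x ≠ y → 0 < d x y)
  (d_triangle : ∀ x y z, d x z ≤ d x y + d y z)
  (α : ℝ) (ν : ℝ)

namespace WGraph

variable (M : WGraph)

/-- Total weight `λ_x = Σ_{y} λ_{x,y}` at a vertex. -/
def lamTot (x : M.V) : ℝ := ∑ᶠ y, M.lam x y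

/-- The (closed) ball `B(x,r)` for the metric `d`. -/
def ball (x : M.V) (r : ℝ) : Set M.V := {y | M.d x y ≤ r}

/-- One-step transition probability of the random walk on `(G,λ)`. -/
def p (x y : M.V) : ℝ := M.lam x y / M.lamTot x

/-- `n`-step transition probability of the random walk. -/
def pstep : ℕ → M.V → M.V → ℝ
  | 0, x, y => if x = y then 1 else 0
  | n + 1, x, y => ∑ᶠ z, M.p x z * pstep n z y

/-- The Green's function `g(x,y) = λ_y^{-1} Σ_{n ≥ 0} P_x[Z_n = y]` of the walk. -/
def green (x y : M.V) : ℝ := (∑' n, M.pstep n x y) / M.lamTot y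

/-- Transience of the random walk on `𝒢`. -/
def Transient : Prop := ∀ x, Summable fun n => M.pstep n x x

/-- The volume growth condition `(V_α)`. -/
def VolGrowth : Prop :=
  ∃ c > (0:ℝ), ∃ C > (0:ℝ), ∀ (x : M.V) (r : ℝ), 1 ≤ r →
    c * r ^ M.α ≤ (∑ᶠ y ∈ M.ball x r, M.lamTot y) ∧
      (∑ᶠ y ∈ M.ball x r, M.lamTot y) ≤ C * r ^ M.α

/-- The Green's function decay condition `(G_ν)`. -/
def GreenDecay : Prop :=
  ∃ c > (0:ℝ), ∃ C > (0:ℝ),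
    (∀ x : M.V, c ≤ M.green x x ∧ M.green x x ≤ C) ∧
    ∀ x y : M.V, x ≠ y →
      c * M.d x y ^ (-M.ν) ≤ M.green x y ∧ M.green x y ≤ C * M.d x y ^ (-M.ν)

/-- The standing assumptions on the graph: transience, `(V_α)` and `(G_ν)`. -/
def Standing : Prop := M.Transient ∧ M.VolGrowth ∧ M.GreenDecay

/-- The graph distance `d_gr` on `𝒢`. -/
def graphDist (x y : M.V) : ℝ :=
  sInf {r : ℝ | ∃ n : ℕ, r = n ∧ ∃ γ : Fin (n + 1) → M.V, γ 0 = x ∧ γ (Fin.last n) = y ∧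
    ∀ i : Fin n, 0 < M.lam (γ i.castSucc) (γ i.succ)}

/-- Capacity of a finite set of vertices, via the variational characterization
`cap(K) = (inf_μ Σ_{x,y} μ(x) g(x,y) μ(y))⁻¹`, the infimum being over probability
measures supported on `K`. -/
def capFinset (K : Finset M.V) : ℝ :=
  (sInf {E : ℝ | ∃ μ : M.V → ℝ, (∀ x, 0 ≤ μ x) ∧ (∀ x, x ∉ K → μ x = 0) ∧
    (∑ x ∈ K, μ x) = 1 ∧ E = ∑ x ∈ K, ∑ y ∈ K, μ x * M.green x y * μ y})⁻¹

/-- Capacity of an arbitrary set of vertices. -/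
def cap (S : Set M.V) : ℝ := ⨆ K : {K : Finset M.V // ↑K ⊆ S}, M.capFinset K.1

/-- Weight `∏_{i<n} p(x_i, x_{i+1})` of a finite random walk trajectory. -/
def pathWt {n : ℕ} (γ : Fin (n + 1) → M.V) : ℝ := ∏ i : Fin n, M.p (γ i.castSucc) (γ i.succ)

/-- `P_z[H_x < H_O]`: the probability that the random walk started at `z` hits `x`
strictly before hitting the set `O`, expressed through a first-passage path decomposition. -/
def hitBefore (z x : M.V) (O : Set M.V) : ℝ :=
  ∑' n : ℕ, ∑' γ : Fin (n + 1) → M.V,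
    if γ 0 = z ∧ γ (Fin.last n) = x ∧ x ∉ O ∧
        (∀ i : Fin (n + 1), i ≠ Fin.last n → γ i ∉ O ∧ γ i ≠ x)
      then M.pathWt γ else 0

/-- Distance from a point to a set. -/
def dSet (x : M.V) (S : Set M.V) : ℝ := sInf (M.d x '' S)

/-! ### Discrete (rooted) loops

A rooted discrete loop visiting `m + 2` vertices (`m ≥ 0`), i.e. making at least two
jumps, encoded by its skeleton `Z_0, …, Z_{n-1}` (with `Z_n = Z_0`, indices mod `n`). -/

/-- The type of rooted discrete loops on `G` making `n = m + 2 ≥ 2` jumps. -/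
abbrev DLoop : Type := Σ m : ℕ, Fin (m + 2) → M.V

/-- The mass `(1/n) ∏_{0 ≤ i < n} λ_{x_i,x_{i+1}}/λ_{x_i}` that the loop measure `μ`
assigns to a given rooted discrete loop (its discrete skeleton intensity). -/
def dloopWt (γ : M.DLoop) : ℝ≥0∞ :=
  ENNReal.ofReal ((1 / ((γ.1 : ℝ) + 2)) * ∏ i : Fin (γ.1 + 2), M.p (γ.2 i) (γ.2 (i + 1)))

/-- The set of vertices visited by a discrete loop (`range(γ) ∩ G` for the
corresponding continuous loop). -/
def dloopRange (γ : M.DLoop) : Set M.V := Set.range γ.2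

/-- The loop measure `μ` evaluated on a set of (skeletons of) loops: since the events of
interest only depend on the vertices visited by a loop, the measure under `μ` of such an
event coincides with the total mass of the corresponding discrete skeletons. -/
def loopMeas (S : Set M.DLoop) : ℝ≥0∞ := ∑' γ : S, M.dloopWt γ

end WGraph

/-! ## Graphs equipped with an approximate renormalized lattice `Λ(L)` -/

structure LGraph extends WGraph where
  (Lat : ℝ → Set V)
  (Lat_base : ∀ L : ℝ, 1 ≤ L → o ∈ Lat L)
  (Lat_cover : ∀ L : ℝ, 1 ≤ L → ∀ x, ∃ y ∈ Lat L, d y x ≤ L)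
  (Lat_disj : ∀ L : ℝ, 1 ≤ L → ∀ y ∈ Lat L, ∀ z ∈ Lat L, y ≠ z →
    ∀ w, d y w ≤ L / 2 → ¬ d z w ≤ L / 2)
  (Lat_card : ∃ CΛ > (0:ℝ), ∀ L : ℝ, 1 ≤ L → ∀ (x : V) (N : ℕ), 1 ≤ N →
    {y | y ∈ Lat L ∧ d x y ≤ L * N}.Finite ∧
      ({y | y ∈ Lat L ∧ d x y ≤ L * N}.ncard : ℝ) ≤ CΛ * (N : ℝ) ^ α)

namespace LGraph

variable (M : LGraph)

/-- A path `π = (x_i)_{1 ≤ i ≤ M}` in `Λ(L)` from the base point `0` to `A ⊆ G`. -/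
def IsLatPath (L : ℝ) (A : Set M.V) {m : ℕ} (pa : Fin (m + 1) → M.V) : Prop :=
  pa 0 = M.o ∧ pa (Fin.last m) ∈ A ∧ (∀ i, pa i ∈ M.Lat L) ∧
    ∀ i : Fin m, ∃ x y, M.d (pa i.castSucc) x ≤ L ∧ M.d (pa i.succ) y ≤ L ∧ 0 < M.lam x y

/-- `𝒪 ⊆ G` is an `(L,R,n,κ)`-good obstacle: every path in `Λ(L)` from `0` to `B_R^c`
contains at least `n` points `y` (within `B_R`) with `cap(𝒪 ∩ B(y,L)) ≥ κ`. -/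
def GoodObstacle (O : Set M.V) (L R : ℝ) (n : ℝ) (κ : ℝ) : Prop :=
  ∀ (m : ℕ) (pa : Fin (m + 1) → M.V), M.IsLatPath L {y | R < M.d M.o y} pa →
    ∃ A : Finset M.V, (∀ y ∈ A, (∃ i, pa i = y) ∧ M.d M.o y ≤ R) ∧ n ≤ (A.card : ℝ) ∧
      ∀ y ∈ A, κ ≤ M.toWGraph.cap (O ∩ {z | M.d y z ≤ L})

/-- The layer `𝒜_k ⊆ Λ(L)` of lattice points whose `L`-ball meets the interior
boundary `∂B(0, C₁ k L)`. -/
def layer (C₁ L : ℝ) (k : ℕ) : Set M.V :=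
  {x | x ∈ M.Lat L ∧ ∃ y, M.d x y ≤ L ∧ M.d M.o y ≤ C₁ * k * L ∧
    ∃ z, 0 < M.lam y z ∧ C₁ * k * L < M.d M.o z}

/-- The annulus `𝔸_k = ∪_{x ∈ 𝒜_k} B(x,L)`. -/
def annulus (C₁ L : ℝ) (k : ℕ) : Set M.V := {v | ∃ x ∈ M.layer C₁ L k, M.d x v ≤ L}

end LGraph

/-! ## The Gaussian free field and its associated bond percolation `E^{≥a}` -/

/-- A transient weighted graph together with a Gaussian free field `φ` (law `ℙ`) and,
conditionally on `φ`, independent bond percolation configurations: each edge `{x,y}` is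
retained in `E^{≥a}` (i.e. `opn a`) independently with probability
`1 - exp(-2 λ_{x,y} (φ_x - a)_+ (φ_y - a)_+)`. -/
structure Model extends WGraph where
  (Ω : Type) [mΩ : MeasurableSpace Ω] (P : Measure Ω) (Pprob : IsProbabilityMeasure P)
  (φ : Ω → V → ℝ)
  (φ_meas : ∀ x, Measurable fun ω => φ ω x)
  -- `φ` is the centered Gaussian field with covariance the Green's function `g`
  (φ_gauss : ∀ (s : Finset V) (c : V → ℝ),
    Measure.map (fun ω => ∑ x ∈ s, c x * φ ω x) P =
      gaussianReal 0 (Real.toNNReal (∑ x ∈ s, ∑ y ∈ s, c x * c y * toWGraph.green x y)))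
  (opn : ℝ → Ω → V → V → Prop)
  (opn_symm : ∀ a ω x y, opn a ω x y → opn a ω y x)
  (opn_edge : ∀ a ω x y, opn a ω x y → 0 < lam x y)
  (opn_meas : ∀ a x y, MeasurableSet {ω | opn a ω x y})
  -- conditionally on `φ`, edges are open independently with the prescribed probabilities
  (opn_law : ∀ (a : ℝ) (s t : Finset (V × V)), Disjoint s t →
    (∀ e ∈ s ∪ t, ∀ f ∈ s ∪ t, e ≠ f → e ≠ Prod.swap f) →
    ∀ B : Set (V → ℝ), MeasurableSet B →
      P ({ω | φ ω ∈ B} ∩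
          {ω | (∀ e ∈ s, opn a ω e.1 e.2) ∧ (∀ e ∈ t, ¬ opn a ω e.1 e.2)}) =
      ∫⁻ ω in {ω | φ ω ∈ B},
        ENNReal.ofReal
          ((∏ e ∈ s,
            (1 - Real.exp (-(2 * lam e.1 e.2 * max (φ ω e.1 - a) 0 * max (φ ω e.2 - a) 0)))) *
           ∏ e ∈ t,
            Real.exp (-(2 * lam e.1 e.2 * max (φ ω e.1 - a) 0 * max (φ ω e.2 - a) 0))) ∂P)

attribute [instance] Model.mΩ

namespace Model

variable (M : Model)

/-- `x` and `y` are connected by a path of open edges of `E^{≥a}`. -/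
def conn (a : ℝ) (ω : M.Ω) (x y : M.V) : Prop :=
  Relation.ReflTransGen (fun u v => M.opn a ω u v) x y

/-- The open cluster `𝒦^a` of `x` in `E^{≥a}`. -/
def cluster (a : ℝ) (ω : M.Ω) (x : M.V) : Set M.V := {y | M.conn a ω x y}

/-- The probability of an event. -/
def prob (s : Set M.Ω) : ℝ := (M.P s).toReal

/-- The one-arm event `{x ↔ B(x,R)^c}` in `E^{≥0}`. -/
def armEvent (x : M.V) (R : ℝ) : Set M.Ω := {ω | ∃ y, R < M.d x y ∧ M.conn 0 ω x y}

/-- The truncated two-point function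
`τ_a^tr(x,y) = ℙ(x ↔ y in E^{≥a}, x ↮ ∞ in E^{≥a})`. -/
def tau (a : ℝ) (x y : M.V) : ℝ :=
  M.prob {ω | M.conn a ω x y ∧ (M.cluster a ω x).Finite}

/-- The truncated expected cluster volume `𝔼[|𝒦^a| 1_{|𝒦^a| < ∞}]`. -/
def clusterVol (a : ℝ) (x : M.V) : ℝ≥0∞ :=
  ∫⁻ ω, (if (M.cluster a ω x).Finite then ((M.cluster a ω x).ncard : ℝ≥0∞) else 0) ∂M.P

end Model

/-! ## The concrete case `G = ℤ³` with unit weights and the Euclidean distance -/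

/-- The vertex set `ℤ³`. -/
abbrev Z3 : Type := Fin 3 → ℤ

/-- Euclidean distance on `ℤ³`. -/
def dZ (x y : Z3) : ℝ := Real.sqrt (∑ i, ((x i : ℝ) - (y i : ℝ)) ^ 2)

/-- Unit weights: `λ_{x,y} = 1_{|x-y| = 1}`. -/
def lamZ (x y : Z3) : ℝ := if dZ x y = 1 then 1 else 0

/-- Transition probabilities of simple random walk on `ℤ³`. -/
def pZ (x y : Z3) : ℝ := lamZ x y / 6

/-- `n`-step transition probabilities of simple random walk on `ℤ³`. -/
def pstepZ : ℕ → Z3 → Z3 → ℝ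
  | 0, x, y => if x = y then 1 else 0
  | n + 1, x, y => ∑ᶠ z, pZ x z * pstepZ n z y

/-- The Green's function of simple random walk on `ℤ³` (with the normalization
`g(x,y) = λ_y^{-1} Σ_n P_x[Z_n = y]`, `λ_y = 6`). -/
def greenZ (x y : Z3) : ℝ := (∑' n, pstepZ n x y) / 6

/-- Euclidean distance between a point of `ℝ³` and a point of `ℤ³`. -/
def dMix (u : Fin 3 → ℝ) (z : Z3) : ℝ := Real.sqrt (∑ i, (u i - (z i : ℝ)) ^ 2)

/-- The Gaussian free field on `ℤ³` together with the associated bond percolation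
configurations `E^{≥a}`. -/
structure PercZ3 where
  (Ω : Type) [mΩ : MeasurableSpace Ω] (P : Measure Ω) (Pprob : IsProbabilityMeasure P)
  (φ : Ω → Z3 → ℝ)
  (φ_meas : ∀ x, Measurable fun ω => φ ω x)
  (φ_gauss : ∀ (s : Finset Z3) (c : Z3 → ℝ),
    Measure.map (fun ω => ∑ x ∈ s, c x * φ ω x) P =
      gaussianReal 0 (Real.toNNReal (∑ x ∈ s, ∑ y ∈ s, c x * c y * greenZ x y)))
  (opn : ℝ → Ω → Z3 → Z3 → Prop)
  (opn_symm : ∀ a ω x y, opn a ω x y → opn a ω y x)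
  (opn_edge : ∀ a ω x y, opn a ω x y → 0 < lamZ x y)
  (opn_meas : ∀ a x y, MeasurableSet {ω | opn a ω x y})
  (opn_law : ∀ (a : ℝ) (s t : Finset (Z3 × Z3)), Disjoint s t →
    (∀ e ∈ s ∪ t, ∀ f ∈ s ∪ t, e ≠ f → e ≠ Prod.swap f) →
    ∀ B : Set (Z3 → ℝ), MeasurableSet B →
      P ({ω | φ ω ∈ B} ∩
          {ω | (∀ e ∈ s, opn a ω e.1 e.2) ∧ (∀ e ∈ t, ¬ opn a ω e.1 e.2)}) =
      ∫⁻ ω in {ω | φ ω ∈ B},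
        ENNReal.ofReal
          ((∏ e ∈ s,
            (1 - Real.exp (-(2 * lamZ e.1 e.2 * max (φ ω e.1 - a) 0 * max (φ ω e.2 - a) 0)))) *
           ∏ e ∈ t,
            Real.exp (-(2 * lamZ e.1 e.2 * max (φ ω e.1 - a) 0 * max (φ ω e.2 - a) 0))) ∂P)

attribute [instance] PercZ3.mΩ

namespace PercZ3

variable (M : PercZ3)

/-- Connectivity by open edges in `E^{≥a}`. -/
def conn (a : ℝ) (ω : M.Ω) (x y : Z3) : Prop :=
  Relation.ReflTransGen (fun u v => M.opn a ω u v) x y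

/-- The open cluster of `x` in `E^{≥a}`. -/
def cluster (a : ℝ) (ω : M.Ω) (x : Z3) : Set Z3 := {y | M.conn a ω x y}

/-- The truncated two-point function on `ℤ³`. -/
def tau (a : ℝ) (x y : Z3) : ℝ :=
  ((M.P {ω | M.conn a ω x y ∧ (M.cluster a ω x).Finite}).toReal)

end PercZ3

/-! ## The metric graph (cable system) `𝔾̃`, killed Green's functions and killed GFFs -/

/-- The cable system `𝔾̃` over a graph `𝒢` (with renormalized lattice), together with the
killed Green's functions `g_U` and the laws `ℙ_U` of the Gaussian free field on open sets
`U ⊆ 𝔾̃` (the field killed outside `U`). -/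
structure CableG extends LGraph where
  (Gt : Type) [topGt : TopologicalSpace Gt] [msGt : MeasurableSpace Gt]
  (ι : V → Gt) (ι_inj : Function.Injective ι)
  (gU : Set Gt → Gt → Gt → ℝ)
  (gU_symm : ∀ U x y, gU U x y = gU U y x)
  (gU_zero : ∀ U x y, x ∉ U → gU U x y = 0)
  -- the Green's function of the full cable system restricts to `g` on `G`
  (gU_univ : ∀ x y : V, gU Set.univ (ι x) (ι y) = toWGraph.green x y)
  (PU : Set Gt → Measure (Gt → ℝ))
  (PU_prob : ∀ U, IsProbabilityMeasure (PU U))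
  -- `ℙ_U` is the law of the centered Gaussian field with covariance `g_U`
  (PU_gauss : ∀ (U : Set Gt) (s : Finset Gt) (c : Gt → ℝ),
    Measure.map (fun h => ∑ q ∈ s, c q * h q) (PU U) =
      gaussianReal 0 (Real.toNNReal (∑ q ∈ s, ∑ q' ∈ s, c q * c q' * gU U q q')))

attribute [instance] CableG.topGt CableG.msGt

/-- A probability space. -/
structure ProbSpace where
  (Ω : Type) [mΩ : MeasurableSpace Ω] (P : Measure Ω) (Pprob : IsProbabilityMeasure P)

attribute [instance] ProbSpace.mΩ

/-- A cable system as above, together with the laws of the vacant sets `Ṽ^u` of random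
interlacements at level `u > 0` on `𝔾̃`, axiomatized through their characterizing
properties: `Ṽ^u` is open and `ℙ(F ⊆ Ṽ^u) = exp(-u cap(F))` for finite `F ⊆ G`. -/
structure CableRI extends CableG where
  [msSetGt : MeasurableSpace (Set Gt)]
  (RIVacant : ℝ → Measure (Set Gt))
  (RIVacant_prob : ∀ u : ℝ, 0 < u → IsProbabilityMeasure (RIVacant u))
  (RIVacant_open : ∀ u : ℝ, 0 < u → ∀ᵐ S ∂(RIVacant u), @IsOpen Gt topGt S)
  (RIVacant_cap : ∀ u : ℝ, 0 < u → ∀ F : Finset V,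
    (RIVacant u {S | ∀ x ∈ F, ι x ∈ S}).toReal =
      Real.exp (-(u * toWGraph.capFinset F)))

attribute [instance] CableRI.msSetGt

/-! ## The Markovian loop soup at intensity `1/2` on the cable system -/

/-- The Poisson loop soup `ℒ` of intensity `(1/2)μ` on the cable system `𝔾̃` of a graph
`𝒢` (with renormalized lattice), under the law `Q`.  Continuous loops are axiomatized
through their ranges in `𝔾̃` and their discrete skeletons; the intensity measure `μ` is
pinned down via its (concrete) discrete skeleton intensity, and the law of the soup via
its void probabilities `Q(ℒ ∩ S = ∅) = exp(-μ(S)/2)`. -/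
structure LoopSoup extends LGraph where
  -- the cable system
  (Gt : Type) [topGt : TopologicalSpace Gt]
  (ι : V → Gt) (ι_inj : Function.Injective ι)
  (cable : V → V → Set Gt)
  (cable_symm : ∀ x y, cable x y = cable y x)
  (cable_ends : ∀ x y, 0 < lam x y → ι x ∈ cable x y ∧ ι y ∈ cable x y)
  (cable_vertices : ∀ x y, 0 < lam x y → ∀ v : V, ι v ∈ cable x y → v = x ∨ v = y)
  (cable_cover : ∀ q : Gt, (∃ v, q = ι v) ∨ ∃ x y, 0 < lam x y ∧ q ∈ cable x y)
  -- continuous loops on the cable system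
  (CLoop : Type) [msLoop : MeasurableSpace CLoop]
  (crange : CLoop → Set Gt)
  (traceG : CLoop → Set V)
  (trace_spec : ∀ γ, traceG γ = {v | ι v ∈ crange γ})
  -- the loop measure `μ` and its discrete skeleton
  (μC : Measure CLoop)
  (skel : CLoop → Option (Σ m : ℕ, Fin (m + 2) → V))
  (skel_spec : ∀ γ dγ, skel γ = some dγ → traceG γ = Set.range dγ.2)
  (skel_trivial : ∀ γ, skel γ = none → (traceG γ).Subsingleton)
  (μC_skel : ∀ S : Set (Σ m : ℕ, Fin (m + 2) → V),
    μC {γ | ∃ dγ ∈ S, skel γ = some dγ} = toWGraph.loopMeas S)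
  -- the loop soup and its law
  (Ωq : Type) [mΩq : MeasurableSpace Ωq] (Q : Measure Ωq) (Qprob : IsProbabilityMeasure Q)
  (soup : Ωq → Set CLoop)
  (soup_void : ∀ S : Set CLoop, MeasurableSet S →
    Q {ω | ∀ γ ∈ soup ω, γ ∉ S} = expNegE (μC S / 2))

attribute [instance] LoopSoup.topGt LoopSoup.msLoop LoopSoup.mΩq

namespace LoopSoup

variable (M : LoopSoup)

/-- Two loops of the soup are linked if they can be joined by a finite chain of loops of
the soup whose ranges successively intersect. -/
def linked (ω : M.Ωq) (γ γ' : M.CLoop) : Prop :=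
  Relation.ReflTransGen
    (fun g g' => g ∈ M.soup ω ∧ g' ∈ M.soup ω ∧ (M.crange g ∩ M.crange g').Nonempty) γ γ'

/-- The trace `𝒞` on `𝔾̃` of the cluster of loops of `ℒ` containing the base point `0`. -/
def C0 (ω : M.Ωq) : Set M.Gt :=
  {q | ∃ γ ∈ M.soup ω, q ∈ M.crange γ ∧
    ∃ γ₀ ∈ M.soup ω, M.ι M.o ∈ M.crange γ₀ ∧ M.linked ω γ γ₀}

/-- A loop is big (for the parameters `δ, L`) if `cap(range(γ) ∩ G) ≥ δ L^ν (log L)^{-b₂}`. -/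
def isBig (δ L : ℝ) (γ : M.CLoop) : Prop :=
  δ * L ^ M.ν * Real.log L ^ (-(bTwo M.ν M.α)) ≤ M.toWGraph.cap (M.traceG γ)

/-- The box `B̃(x,L) ⊆ 𝔾̃`: the ball `B(x,L)` together with all cables joining
neighbouring vertices of `B(x,L)`. -/
def Btilde (x : M.V) (L : ℝ) : Set M.Gt :=
  (M.ι '' {y | M.d x y ≤ L}) ∪
    ⋃ (u : M.V) (v : M.V) (_ : 0 < M.lam u v ∧ M.d x u ≤ L ∧ M.d x v ≤ L), M.cable u v

/-- A loop belongs to (the support of) `ℒ_k^b`: it is big and its range is contained in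
`B̃(x,L)` for some `x ∈ 𝒜_k`. -/
def inLayerBig (C₁ δ L : ℝ) (k : ℕ) (γ : M.CLoop) : Prop :=
  M.isBig δ L γ ∧ ∃ x ∈ M.toLGraph.layer C₁ L k, M.crange γ ⊆ M.Btilde x L

/-- The event `𝐁_k`: the cluster `𝒞` of `0` reaches `B_R^c` but contains no big loop of
`ℒ_k^b`. -/
def Bk (C₁ δ L R : ℝ) (k : ℕ) : Set M.Ωq :=
  {ω | (∃ y : M.V, R < M.d M.o y ∧ M.ι y ∈ M.C0 ω) ∧
    ∀ γ ∈ M.soup ω, M.inLayerBig C₁ δ L k γ → ¬ M.crange γ ⊆ M.C0 ω}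

/-- The number `N` of bad annuli among `k ∈ {1, …, ℓ}`. -/
def Nbad (C₁ δ L R : ℝ) (ℓ : ℕ) (ω : M.Ωq) : ℕ :=
  ((Finset.Icc 1 ℓ).filter fun k => ω ∈ M.Bk C₁ δ L R k).card

/-- The obstacle set `𝒪 = G ∩ 𝐼̃_D^b`: all vertices visited by a big loop of the soup
contained in a box `B̃(x,L)` with `x ∈ 𝒜_k` for some `k ∈ D`. -/
def obstacleD (C₁ δ L : ℝ) (D : Finset ℕ) (ω : M.Ωq) : Set M.V :=
  {v | ∃ γ ∈ M.soup ω, (∃ k ∈ D, M.inLayerBig C₁ δ L k γ) ∧ M.ι v ∈ M.crange γ}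

end LoopSoup

namespace BondPerc

section Edges

variable {ε : Type*} [DecidableEq ε]

/-- Weight of the configuration with open edges `A` among the edges `E`, when `e` is closed with
probability `k e`. -/
def wt (k : ε → ℝ) (E A : Finset ε) : ℝ := (∏ e ∈ A, (1 - k e)) * ∏ e ∈ E \ A, k e

/-- Probability that the random set of open edges has the property `p`. -/
def pr (k : ε → ℝ) (E : Finset ε) (p : Finset ε → Prop) : ℝ :=
  ∑ A ∈ E.powerset with p A, wt k E A

lemma wt_nonneg {k : ε → ℝ} {E A : Finset ε} (hk : ∀ e ∈ E, k e ∈ Set.Icc (0 : ℝ) 1)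
    (hA : A ⊆ E) : 0 ≤ wt k E A :=
  mul_nonneg (Finset.prod_nonneg fun e he => sub_nonneg.2 (hk e (hA he)).2)
    (Finset.prod_nonneg fun e he => (hk e (Finset.mem_sdiff.1 he).1).1)

lemma pr_nonneg {k : ε → ℝ} {E : Finset ε} (hk : ∀ e ∈ E, k e ∈ Set.Icc (0 : ℝ) 1)
    (p : Finset ε → Prop) : 0 ≤ pr k E p :=
  Finset.sum_nonneg fun _ hA =>
    wt_nonneg hk (Finset.mem_powerset.1 (Finset.mem_filter.1 hA).1)

lemma pr_true (k : ε → ℝ) (E : Finset ε) : pr k E (fun _ => True) = 1 := by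
  have h := Finset.prod_add (fun e => 1 - k e) k E
  simp only [sub_add_cancel, Finset.prod_const_one] at h
  simp only [pr, wt, Finset.filter_true]
  exact h.symm

lemma pr_congr_prop {k : ε → ℝ} {E : Finset ε} {p q : Finset ε → Prop}
    (h : ∀ A ⊆ E, p A ↔ q A) : pr k E p = pr k E q := by
  unfold pr
  congr 1
  exact Finset.filter_congr fun A hA => h A (Finset.mem_powerset.1 hA)

lemma pr_congr {k k' : ε → ℝ} {E : Finset ε} (h : ∀ e ∈ E, k e = k' e)
    (p : Finset ε → Prop) : pr k E p = pr k' E p := by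
  refine Finset.sum_congr rfl fun A hA => ?_
  have hA' := Finset.mem_powerset.1 (Finset.mem_filter.1 hA).1
  unfold wt
  congr 1
  · exact Finset.prod_congr rfl fun e he => by rw [h e (hA' he)]
  · exact Finset.prod_congr rfl fun e he => h e (Finset.mem_sdiff.1 he).1

lemma pr_mono {k : ε → ℝ} {E : Finset ε} (hk : ∀ e ∈ E, k e ∈ Set.Icc (0 : ℝ) 1)
    {p q : Finset ε → Prop} (h : ∀ A ⊆ E, p A → q A) : pr k E p ≤ pr k E q := by
  refine Finset.sum_le_sum_of_subset_of_nonneg ?_ fun A hA _ =>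
    wt_nonneg hk (Finset.mem_powerset.1 (Finset.mem_filter.1 hA).1)
  intro A hA
  rw [Finset.mem_filter] at hA ⊢
  exact ⟨hA.1, h A (Finset.mem_powerset.1 hA.1) hA.2⟩

lemma pr_le_one {k : ε → ℝ} {E : Finset ε} (hk : ∀ e ∈ E, k e ∈ Set.Icc (0 : ℝ) 1)
    (p : Finset ε → Prop) : pr k E p ≤ 1 :=
  (pr_mono hk fun _ _ _ => trivial).trans_eq (pr_true k E)

lemma sum_pr {k : ε → ℝ} {E : Finset ε} {β : Type*} (f : Finset ε → β) (I : Finset β)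
    (p : Finset ε → Prop) (h : ∀ A ⊆ E, p A → f A ∈ I) :
    ∑ i ∈ I, pr k E (fun A => f A = i ∧ p A) = pr k E p := by
  unfold pr
  rw [← Finset.sum_fiberwise_of_maps_to (s := E.powerset.filter p) (t := I) (g := f)]
  · refine Finset.sum_congr rfl fun i _ => Finset.sum_congr ?_ fun _ _ => rfl
    ext A
    simp only [Finset.mem_filter, Finset.mem_powerset]
    tauto
  · intro A hA
    rw [Finset.mem_filter] at hA
    exact h A (Finset.mem_powerset.1 hA.1) hA.2

lemma pr_union {k : ε → ℝ} {E₁ E₂ : Finset ε} (hd : Disjoint E₁ E₂)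
    {p p₁ p₂ : Finset ε → Prop} (h : ∀ A ⊆ E₁ ∪ E₂, p A ↔ p₁ (A ∩ E₁) ∧ p₂ (A ∩ E₂)) :
    pr k (E₁ ∪ E₂) p = pr k E₁ p₁ * pr k E₂ p₂ := by
  unfold pr
  rw [Finset.sum_mul_sum, ← Finset.sum_product']
  have key1 : ∀ A₁ ⊆ E₁, ∀ A₂ ⊆ E₂, (A₁ ∪ A₂) ∩ E₁ = A₁ := by
    intro A₁ h1 A₂ h2
    rw [Finset.union_inter_distrib_right, Finset.inter_eq_left.2 h1,
      Finset.disjoint_iff_inter_eq_empty.1 (hd.mono_right h2).symm, Finset.union_empty]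
  have key2 : ∀ A₁ ⊆ E₁, ∀ A₂ ⊆ E₂, (A₁ ∪ A₂) ∩ E₂ = A₂ := by
    intro A₁ h1 A₂ h2
    rw [Finset.union_inter_distrib_right, Finset.inter_eq_left.2 h2,
      Finset.disjoint_iff_inter_eq_empty.1 (hd.mono_left h1), Finset.empty_union]
  have key3 : ∀ A ⊆ E₁ ∪ E₂, A ∩ E₁ ∪ A ∩ E₂ = A := by
    intro A hA
    rw [← Finset.inter_union_distrib_left, Finset.inter_eq_left.2 hA]
  refine Finset.sum_nbij' (fun A => (A ∩ E₁, A ∩ E₂)) (fun q => q.1 ∪ q.2) ?_ ?_ ?_ ?_ ?_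
  · intro A hA
    simp only [Finset.mem_filter, Finset.mem_powerset, Finset.mem_product] at hA ⊢
    have := (h A hA.1).1 hA.2
    exact ⟨⟨Finset.inter_subset_right, this.1⟩, ⟨Finset.inter_subset_right, this.2⟩⟩
  · rintro ⟨A₁, A₂⟩ hA
    simp only [Finset.mem_filter, Finset.mem_powerset, Finset.mem_product] at hA ⊢
    have hs := Finset.union_subset_union hA.1.1 hA.2.1
    refine ⟨hs, (h _ hs).2 ?_⟩
    rw [key1 _ hA.1.1 _ hA.2.1, key2 _ hA.1.1 _ hA.2.1]
    exact ⟨hA.1.2, hA.2.2⟩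
  · intro A hA
    simp only [Finset.mem_filter, Finset.mem_powerset] at hA
    exact key3 A hA.1
  · rintro ⟨A₁, A₂⟩ hA
    simp only [Finset.mem_filter, Finset.mem_powerset, Finset.mem_product] at hA
    simp only [key1 _ hA.1.1 _ hA.2.1, key2 _ hA.1.1 _ hA.2.1]
  · intro A hA
    simp only [Finset.mem_filter, Finset.mem_powerset] at hA
    have hd' : Disjoint (A ∩ E₁) (A ∩ E₂) :=
      hd.mono Finset.inter_subset_right Finset.inter_subset_right
    have hd'' : Disjoint (E₁ \ (A ∩ E₁)) (E₂ \ (A ∩ E₂)) :=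
      hd.mono Finset.sdiff_subset Finset.sdiff_subset
    have e2 : (E₁ ∪ E₂) \ A = E₁ \ (A ∩ E₁) ∪ E₂ \ (A ∩ E₂) := by
      ext e
      simp only [Finset.mem_sdiff, Finset.mem_union, Finset.mem_inter]
      tauto
    unfold wt
    rw [e2, Finset.prod_union hd'']
    have e3 : ∏ e ∈ A, (1 - k e) = (∏ e ∈ A ∩ E₁, (1 - k e)) * ∏ e ∈ A ∩ E₂, (1 - k e) := by
      rw [← Finset.prod_union hd', key3 A hA.1]
    rw [e3]
    ring

lemma pr_empty (k : ε → ℝ) (E : Finset ε) : pr k E (fun A => A = ∅) = ∏ e ∈ E, k e := by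
  have : E.powerset.filter (fun A => A = ∅) = {∅} := by
    ext A
    simp only [Finset.mem_filter, Finset.mem_powerset, Finset.mem_singleton]
    constructor
    · exact fun h => h.2
    · rintro rfl
      exact ⟨Finset.empty_subset _, rfl⟩
  have h2 : pr k E (fun A => A = ∅) = ∑ A ∈ E.powerset.filter (fun A => A = ∅), wt k E A := by
    unfold pr
    congr!
  rw [h2, this, Finset.sum_singleton]
  simp [wt]

lemma exists_of_pr_ne_zero {k : ε → ℝ} {E : Finset ε} {p : Finset ε → Prop}
    (h : pr k E p ≠ 0) : ∃ A, (A ⊆ E ∧ p A) ∧ wt k E A ≠ 0 := by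
  obtain ⟨A, hA, hAw⟩ := Finset.exists_ne_zero_of_sum_ne_zero h
  rw [Finset.mem_filter, Finset.mem_powerset] at hA
  exact ⟨A, hA, hAw⟩

end Edges

section Vertices

variable {V : Type*}

/-- The set of pairs of distinct elements of `T`, each unordered pair being represented once. -/
def edges (T : Finset V) : Finset (V × V) :=
  (T ×ˢ T).filter fun e => WellOrderingRel e.1 e.2

/-- The pairs joining `T` and `U`, each unordered pair being represented once. -/
def crossEdges (T U : Finset V) : Finset (V × V) :=
  (T ×ˢ U ∪ U ×ˢ T).filter fun e => WellOrderingRel e.1 e.2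

lemma mem_edges {T : Finset V} {e : V × V} :
    e ∈ edges T ↔ (e.1 ∈ T ∧ e.2 ∈ T) ∧ WellOrderingRel e.1 e.2 := by
  simp [edges, Finset.mem_product]

lemma mem_crossEdges {T U : Finset V} {e : V × V} :
    e ∈ crossEdges T U ↔
      (e.1 ∈ T ∧ e.2 ∈ U ∨ e.1 ∈ U ∧ e.2 ∈ T) ∧ WellOrderingRel e.1 e.2 := by
  simp [crossEdges, Finset.mem_product]

lemma wor_irrefl (x : V) : ¬ WellOrderingRel x x := irrefl x

lemma wor_asymm {x y : V} (h : WellOrderingRel x y) : ¬ WellOrderingRel y x := asymm h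

lemma wor_total {x y : V} (h : x ≠ y) : WellOrderingRel x y ∨ WellOrderingRel y x := by
  rcases trichotomous_of WellOrderingRel x y with h1 | h1 | h1
  · exact Or.inl h1
  · exact absurd h1 h
  · exact Or.inr h1

lemma edges_split {N O : Finset V} (hO : O ⊆ N) :
    edges N = (edges O ∪ crossEdges O (N \ O)) ∪ edges (N \ O) := by
  ext e
  simp only [Finset.mem_union, mem_edges, mem_crossEdges, Finset.mem_sdiff]
  have h1 := @hO e.1
  have h2 := @hO e.2
  tauto

lemma edges_disjoint_cross (O U : Finset V) (h : Disjoint O U) :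
    Disjoint (edges O) (crossEdges O U) := by
  rw [Finset.disjoint_left]
  intro e h1 h2
  rw [mem_edges] at h1
  rw [mem_crossEdges] at h2
  rcases h2.1 with h3 | h3
  · exact Finset.disjoint_left.1 h h1.1.2 h3.2
  · exact Finset.disjoint_left.1 h h1.1.1 h3.1

lemma edges_cross_disjoint_edges (O U : Finset V) (h : Disjoint O U) :
    Disjoint (edges O ∪ crossEdges O U) (edges U) := by
  rw [Finset.disjoint_left]
  intro e h1 h2
  rw [mem_edges] at h2
  rw [Finset.mem_union, mem_edges, mem_crossEdges] at h1
  rcases h1 with h1 | ⟨h3 | h3, _⟩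
  · exact Finset.disjoint_left.1 h h1.1.1 h2.1.1
  · exact Finset.disjoint_left.1 h h3.1 h2.1.1
  · exact Finset.disjoint_left.1 h h3.2 h2.1.2

lemma prod_crossEdges {T U : Finset V} (h : Disjoint T U) (g : V → V → ℝ)
    (hg : ∀ x y, g x y = g y x) :
    ∏ e ∈ crossEdges T U, g e.1 e.2 = ∏ x ∈ T, ∏ z ∈ U, g x z := by
  rw [← Finset.prod_product']
  have hne : ∀ x ∈ T, ∀ z ∈ U, x ≠ z := fun x hx z hz => by
    rintro rfl
    exact Finset.disjoint_left.1 h hx hz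
  refine Finset.prod_nbij' (fun e => if e.1 ∈ T then e else (e.2, e.1))
    (fun e => if WellOrderingRel e.1 e.2 then e else (e.2, e.1)) ?_ ?_ ?_ ?_ ?_
  · intro e he
    rw [mem_crossEdges] at he
    split_ifs with h1
    · have h2 := Finset.disjoint_left.1 h h1
      rw [Finset.mem_product]
      tauto
    · rw [Finset.mem_product]
      tauto
  · intro e he
    rw [Finset.mem_product] at he
    rw [mem_crossEdges]
    split_ifs with h1
    · tauto
    · have := wor_total (hne _ he.1 _ he.2)
      simp only
      tauto
  · intro e he
    rw [mem_crossEdges] at he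
    by_cases h1 : e.1 ∈ T
    · simp [h1, he.2]
    · simp [h1, wor_asymm he.2]
  · intro e he
    rw [Finset.mem_product] at he
    by_cases h1 : WellOrderingRel e.1 e.2
    · simp [h1, he.1]
    · have := Finset.disjoint_right.1 h he.2
      simp [h1, this]
  · intro e he
    split_ifs with h1
    · rfl
    · exact hg _ _

lemma prod_edges_split {N O : Finset V} (hO : O ⊆ N) (g : V → V → ℝ)
    (hg : ∀ x y, g x y = g y x) :
    ∏ e ∈ edges N, g e.1 e.2 = (∏ e ∈ edges O, g e.1 e.2) *
      (∏ x ∈ O, ∏ z ∈ N \ O, g x z) * ∏ e ∈ edges (N \ O), g e.1 e.2 := by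
  have hd : Disjoint O (N \ O) := Finset.disjoint_sdiff
  rw [edges_split hO, Finset.prod_union (edges_cross_disjoint_edges _ _ hd),
    Finset.prod_union (edges_disjoint_cross _ _ hd), prod_crossEdges hd g hg]

/-- The vertices connected to `S` by edges of `A`. -/
def reach (A : Finset (V × V)) (S : Finset V) : Set V :=
  {y | ∃ x ∈ S, Relation.ReflTransGen (fun u v => (u, v) ∈ A ∨ (v, u) ∈ A) x y}

lemma subset_reach (A : Finset (V × V)) (S : Finset V) : (S : Set V) ⊆ reach A S :=
  fun x hx => ⟨x, hx, Relation.ReflTransGen.refl⟩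

lemma reach_mono {A B : Finset (V × V)} (h : A ⊆ B) (S : Finset V) : reach A S ⊆ reach B S := by
  rintro y ⟨x, hx, hxy⟩
  exact ⟨x, hx, Relation.ReflTransGen.mono
    (fun u v (huv : (u, v) ∈ A ∨ (v, u) ∈ A) => huv.imp (fun h' => h h') fun h' => h h') _ _ hxy⟩

lemma reach_step {A : Finset (V × V)} {S : Finset V} {u v : V} (hu : u ∈ reach A S)
    (h : (u, v) ∈ A ∨ (v, u) ∈ A) : v ∈ reach A S := by
  obtain ⟨x, hx, hxy⟩ := hu
  exact ⟨x, hx, hxy.tail h⟩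

lemma reach_induction {A : Finset (V × V)} {S : Finset V} {P : V → Prop} (h0 : ∀ x ∈ S, P x)
    (h : ∀ u v, u ∈ reach A S → P u → ((u, v) ∈ A ∨ (v, u) ∈ A) → P v) :
    ∀ y ∈ reach A S, P y := by
  rintro y ⟨x, hx, hxy⟩
  have : y ∈ reach A S ∧ P y := by
    induction hxy with
    | refl => exact ⟨subset_reach A S hx, h0 x hx⟩
    | tail _ h2 ih => exact ⟨reach_step ih.1 h2, h _ _ ih.1 ih.2 h2⟩
  exact this.2

lemma reach_subset {A : Finset (V × V)} {S N : Finset V} (hA : A ⊆ edges N) (hS : S ⊆ N) :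
    reach A S ⊆ (N : Set V) := by
  intro y hy
  refine reach_induction (P := fun y => y ∈ (N : Set V)) (fun x hx => hS hx) ?_ y hy
  rintro u v _ _ (h | h)
  · exact (mem_edges.1 (hA h)).1.2
  · exact (mem_edges.1 (hA h)).1.1

/-- The probability that, within `T`, every vertex is connected to `S`. -/
def conn (k : V → V → ℝ) (S T : Finset V) : ℝ :=
  pr (fun e => k e.1 e.2) (edges T) fun A => ∀ y ∈ T, y ∈ reach A S

lemma reach_eq_iff {A : Finset (V × V)} {S O N : Finset V} (hA : A ⊆ edges N) (hS : S ⊆ O) :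
    reach A S = O ↔ (∀ y ∈ O, y ∈ reach (A ∩ edges O) S) ∧
      A ∩ crossEdges O (N \ O) = ∅ := by
  constructor
  · intro h
    constructor
    · intro y hy
      have hy' : y ∈ reach A S := h ▸ hy
      refine reach_induction (P := fun y => y ∈ reach (A ∩ edges O) S)
        (fun x hx => subset_reach _ _ hx) ?_ y hy'
      intro u v hu hPu huv
      have hv : v ∈ O := by
        have := reach_step hu huv
        rw [h] at this
        exact this
      have hu' : u ∈ O := by
        rw [h] at hu
        exact hu
      refine reach_step hPu (huv.imp (fun h' => ?_) fun h' => ?_)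
      · exact Finset.mem_inter.2 ⟨h', mem_edges.2 ⟨⟨hu', hv⟩, (mem_edges.1 (hA h')).2⟩⟩
      · exact Finset.mem_inter.2 ⟨h', mem_edges.2 ⟨⟨hv, hu'⟩, (mem_edges.1 (hA h')).2⟩⟩
    · rw [Finset.eq_empty_iff_forall_notMem]
      rintro ⟨u, v⟩ he
      rw [Finset.mem_inter, mem_crossEdges] at he
      rcases he with ⟨he, ⟨hu, hv⟩ | ⟨hu, hv⟩, _⟩
      · have h1 : u ∈ reach A S := h ▸ hu
        have h2 := reach_step h1 (Or.inl he)
        rw [h] at h2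
        exact (Finset.mem_sdiff.1 hv).2 h2
      · have h1 : v ∈ reach A S := h ▸ hv
        have h2 := reach_step h1 (Or.inr he)
        rw [h] at h2
        exact (Finset.mem_sdiff.1 hu).2 h2
  · rintro ⟨h1, h2⟩
    refine Set.Subset.antisymm ?_ fun y hy => reach_mono Finset.inter_subset_left S (h1 y hy)
    intro y hy
    refine reach_induction (P := fun y => y ∈ (O : Set V)) (fun x hx => hS hx) ?_ y hy
    intro u v _ hu huv
    by_contra hv
    rw [Finset.eq_empty_iff_forall_notMem] at h2
    rcases huv with h | h
    · have h3 := mem_edges.1 (hA h)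
      exact h2 _ (Finset.mem_inter.2 ⟨h, mem_crossEdges.2
        ⟨Or.inl ⟨hu, Finset.mem_sdiff.2 ⟨h3.1.2, hv⟩⟩, h3.2⟩⟩)
    · have h3 := mem_edges.1 (hA h)
      exact h2 _ (Finset.mem_inter.2 ⟨h, mem_crossEdges.2
        ⟨Or.inr ⟨Finset.mem_sdiff.2 ⟨h3.1.1, hv⟩, hu⟩, h3.2⟩⟩)

/-- Cluster exploration: given that the cluster of `S` is `O`, the edges away from `O` are
distributed as an independent percolation. -/
theorem pr_cluster {k : V → V → ℝ} (hk : ∀ x y, k x y = k y x) {S O N : Finset V}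
    (hS : S ⊆ O) (hO : O ⊆ N) (q : Finset (V × V) → Prop) :
    pr (fun e => k e.1 e.2) (edges N) (fun A => reach A S = O ∧ q (A ∩ edges (N \ O))) =
      conn k S O * (∏ x ∈ O, ∏ z ∈ N \ O, k x z) *
        pr (fun e => k e.1 e.2) (edges (N \ O)) q := by
  have hd : Disjoint O (N \ O) := Finset.disjoint_sdiff
  have e1 := edges_split hO
  rw [e1, pr_union (edges_cross_disjoint_edges _ _ hd)
    (p₁ := fun A => (∀ y ∈ O, y ∈ reach (A ∩ edges O) S) ∧ A ∩ crossEdges O (N \ O) = ∅)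
    (p₂ := q),
    pr_union (edges_disjoint_cross _ _ hd)
      (p₁ := fun A => ∀ y ∈ O, y ∈ reach A S) (p₂ := fun A => A = ∅),
    pr_empty, prod_crossEdges hd k hk]
  · rfl
  · intro A _
    rfl
  · intro A hA
    rw [← e1] at hA
    rw [reach_eq_iff hA hS]
    have i1 : A ∩ (edges O ∪ crossEdges O (N \ O)) ∩ edges O = A ∩ edges O := by
      rw [Finset.inter_assoc, Finset.inter_eq_right.2 Finset.subset_union_left]
    have i2 : A ∩ (edges O ∪ crossEdges O (N \ O)) ∩ crossEdges O (N \ O)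
        = A ∩ crossEdges O (N \ O) := by
      rw [Finset.inter_assoc, Finset.inter_eq_right.2 Finset.subset_union_right]
    rw [i1, i2]

lemma reach_of_reach_eq {A : Finset (V × V)} {S O N : Finset V} (hA : A ⊆ edges N)
    (h : reach A S = O) {x : V} (hxN : x ∈ N) (hx : x ∉ O) :
    reach A {x} = reach (A ∩ edges (N \ O)) {x} := by
  refine Set.Subset.antisymm ?_ (reach_mono Finset.inter_subset_left _)
  intro y hy
  have := reach_induction (A := A) (S := {x})
    (P := fun y => y ∉ O ∧ y ∈ N ∧ y ∈ reach (A ∩ edges (N \ O)) {x}) ?_ ?_ y hy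
  · exact this.2.2
  · intro z hz
    rw [Finset.mem_singleton] at hz
    subst hz
    exact ⟨hx, hxN, subset_reach _ _ (by simp)⟩
  · rintro u v _ ⟨hu1, hu2, hu3⟩ huv
    have hvN : v ∈ N := by
      rcases huv with h' | h'
      · exact (mem_edges.1 (hA h')).1.2
      · exact (mem_edges.1 (hA h')).1.1
    have hvO : v ∉ O := fun hv => hu1 (by
      have h1 : v ∈ reach A S := h ▸ hv
      have h2 := reach_step h1 huv.symm
      rw [h] at h2
      exact h2)
    refine ⟨hvO, hvN, reach_step hu3 (huv.imp (fun h' => ?_) fun h' => ?_)⟩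
    · exact Finset.mem_inter.2 ⟨h', mem_edges.2 ⟨⟨Finset.mem_sdiff.2 ⟨hu2, hu1⟩,
        Finset.mem_sdiff.2 ⟨hvN, hvO⟩⟩, (mem_edges.1 (hA h')).2⟩⟩
    · exact Finset.mem_inter.2 ⟨h', mem_edges.2 ⟨⟨Finset.mem_sdiff.2 ⟨hvN, hvO⟩,
        Finset.mem_sdiff.2 ⟨hu2, hu1⟩⟩, (mem_edges.1 (hA h')).2⟩⟩

/-- Probability that the cluster of `S` in `N` is `T`. -/
def clus (k : V → V → ℝ) (N S T : Finset V) : ℝ :=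
  conn k S T * ∏ x ∈ T, ∏ z ∈ N \ T, k x z

lemma clus_eq {k : V → V → ℝ} (hk : ∀ x y, k x y = k y x) {S T N : Finset V}
    (hS : S ⊆ T) (hT : T ⊆ N) :
    clus k N S T = pr (fun e => k e.1 e.2) (edges N) (fun A => reach A S = T) := by
  have := pr_cluster hk hS hT (fun _ => True)
  rw [pr_true, mul_one] at this
  rw [clus, ← this]
  simp

lemma conn_nonneg {k : V → V → ℝ} (hk : ∀ x y, k x y ∈ Set.Icc (0 : ℝ) 1) (S T : Finset V) :
    0 ≤ conn k S T := pr_nonneg (fun _ _ => hk _ _) _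

lemma clus_nonneg {k : V → V → ℝ} (hk : ∀ x y, k x y ∈ Set.Icc (0 : ℝ) 1) (N S T : Finset V) :
    0 ≤ clus k N S T :=
  mul_nonneg (conn_nonneg hk S T)
    (Finset.prod_nonneg fun _ _ => Finset.prod_nonneg fun _ _ => (hk _ _).1)

lemma conn_congr {k k' : V → V → ℝ} {S T : Finset V} (h : ∀ x ∈ T, ∀ y ∈ T, k x y = k' x y) :
    conn k S T = conn k' S T :=
  pr_congr (fun _ he => h _ (mem_edges.1 he).1.1 _ (mem_edges.1 he).1.2) _

/-- A property that holds on `S` and spreads along edges that may be open holds on all of `T`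
whenever `T` has positive probability of being connected to `S`. -/
lemma conn_induction {k : V → V → ℝ} (hk : ∀ x y, k x y = k y x) {S T : Finset V}
    (h : conn k S T ≠ 0) {P : V → Prop} (h0 : ∀ x ∈ S, P x)
    (hP : ∀ u ∈ T, ∀ v ∈ T, k u v ≠ 1 → P u → P v) : ∀ y ∈ T, P y := by
  obtain ⟨A, hA, hAw⟩ := exists_of_pr_ne_zero h
  intro y hy
  have hne : ∀ e ∈ A, k e.1 e.2 ≠ 1 := fun e he h1 =>
    hAw (by
      unfold wt
      rw [Finset.prod_eq_zero he (by simp only [h1, sub_self]), zero_mul])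
  refine reach_induction h0 ?_ y (hA.2 y hy)
  rintro u v _ hu (h' | h')
  · exact hP u (mem_edges.1 (hA.1 h')).1.1 v (mem_edges.1 (hA.1 h')).1.2 (hne _ h') hu
  · exact hP u (mem_edges.1 (hA.1 h')).1.2 v (mem_edges.1 (hA.1 h')).1.1
      (by rw [hk]; exact hne _ h') hu

/-- The clusters of `S` that have property `p` exhaust the corresponding event. -/
lemma sum_clus {k : V → V → ℝ} (hk : ∀ x y, k x y = k y x) {S N : Finset V} (hS : S ⊆ N)
    (p : Finset V → Prop) :
    ∑ T ∈ N.powerset with S ⊆ T ∧ p T, clus k N S T =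
      pr (fun e => k e.1 e.2) (edges N) fun A => ∀ T : Finset V, reach A S = T → p T := by
  have hfin : ∀ A ⊆ edges N, ∃ T : Finset V, T ⊆ N ∧ reach A S = T := by
    intro A hA
    have h1 := reach_subset hA hS
    refine ⟨(N.finite_toSet.subset h1).toFinset, ?_, ?_⟩
    · intro y hy
      exact h1 ((Set.Finite.mem_toFinset _).1 hy)
    · simp
  choose! f hf1 hf2 using hfin
  rw [← sum_pr f (N.powerset.filter fun T => S ⊆ T ∧ p T)]
  · refine Finset.sum_congr rfl fun T hT => ?_
    rw [Finset.mem_filter, Finset.mem_powerset] at hT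
    rw [clus_eq hk hT.2.1 hT.1]
    refine pr_congr_prop fun A hA => ?_
    constructor
    · intro h
      have : f A = T := Finset.coe_injective ((hf2 A hA).symm.trans h)
      refine ⟨this, fun T' hT' => ?_⟩
      have h3 : T' = T := Finset.coe_injective (hT'.symm.trans h)
      rw [h3]
      exact hT.2.2
    · rintro ⟨h, _⟩
      rw [hf2 A hA, h]
  · intro A hA hp
    rw [Finset.mem_filter, Finset.mem_powerset]
    refine ⟨hf1 A hA, ?_, hp _ (hf2 A hA)⟩
    have := subset_reach A S
    rw [hf2 A hA] at this
    exact_mod_cast this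

end Vertices

end BondPerc

namespace GaussianMixture

lemma image_sub_div {y : ℝ} (hy : 0 < y) :
    (fun n : ℝ => n - y / n) '' Set.Ioi 0 = Set.univ := by
  refine Set.eq_univ_of_forall fun u => ?_
  have hs : 0 ≤ u ^ 2 + 4 * y := by positivity
  have h1 : |u| < √(u ^ 2 + 4 * y) := by
    rw [← Real.sqrt_sq_eq_abs]
    exact Real.sqrt_lt_sqrt (sq_nonneg u) (by linarith)
  have h2 : 0 < (u + √(u ^ 2 + 4 * y)) / 2 := by
    have := neg_abs_le u
    linarith
  refine ⟨(u + √(u ^ 2 + 4 * y)) / 2, h2, ?_⟩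
  have h3 := Real.sq_sqrt hs
  have h4 : u + √(u ^ 2 + 4 * y) ≠ 0 := by linarith
  simp only
  field_simp
  nlinarith

lemma image_div {y : ℝ} (hy : 0 < y) : (fun n : ℝ => y / n) '' Set.Ioi 0 = Set.Ioi 0 := by
  ext u
  constructor
  · rintro ⟨n, hn, rfl⟩
    exact div_pos hy hn
  · intro hu
    refine ⟨y / u, div_pos hy hu, ?_⟩
    have : u ≠ 0 := ne_of_gt hu
    simp only
    field_simp

lemma hasDerivAt_div' {y n : ℝ} (hn : n ≠ 0) :
    HasDerivAt (fun n : ℝ => y / n) (-(y / n ^ 2)) n := by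
  have h1 : HasDerivAt (fun n : ℝ => y * n⁻¹) (y * -(n ^ 2)⁻¹) n :=
    (hasDerivAt_inv hn).const_mul y
  have h2 : y * -(n ^ 2)⁻¹ = -(y / n ^ 2) := by rw [mul_neg, div_eq_mul_inv]
  rw [h2] at h1
  exact h1

lemma lintegral_gauss : ∫⁻ u : ℝ, ENNReal.ofReal (exp (-(u ^ 2 / 2))) =
    ENNReal.ofReal √(2 * π) := by
  have h := integral_gaussian (1 / 2)
  have hi := integrable_exp_neg_mul_sq (b := 1 / 2) (by norm_num)
  rw [← ofReal_integral_eq_lintegral_ofReal]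
  · congr 1
    rw [show (2 * π) = π / (1 / 2) by ring, ← h]
    congr 1
    ext u
    ring_nf
  · convert hi using 2
    ring_nf
  · exact Filter.Eventually.of_forall fun _ => (exp_pos _).le

lemma lintegral_gauss_Ioi : ∫⁻ u in Set.Ioi (0 : ℝ), ENNReal.ofReal (exp (-(u ^ 2 / 2))) =
    ENNReal.ofReal (√(2 * π) / 2) := by
  have h := integral_gaussian_Ioi (1 / 2)
  have hi := (integrable_exp_neg_mul_sq (b := 1 / 2) (by norm_num)).integrableOn (s := Set.Ioi 0)
  rw [← ofReal_integral_eq_lintegral_ofReal]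
  · congr 1
    rw [show (2 * π) = π / (1 / 2) by ring, ← h]
    congr 1
    ext u
    ring_nf
  · refine hi.congr (Filter.Eventually.of_forall fun u => ?_)
    ring_nf
  · exact Filter.Eventually.of_forall fun _ => (exp_pos _).le

lemma lintegral_gauss_sub_div {y : ℝ} (hy : 0 < y) :
    2 * ∫⁻ n in Set.Ioi (0 : ℝ), ENNReal.ofReal (exp (-((n - y / n) ^ 2 / 2))) =
      ENNReal.ofReal √(2 * π) := by
  set E : ℝ → ℝ≥0∞ := fun n => ENNReal.ofReal (exp (-((n - y / n) ^ 2 / 2))) with hE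
  have hEm : Measurable E := by fun_prop
  have h1 := lintegral_image_eq_lintegral_abs_deriv_mul (s := Set.Ioi (0 : ℝ)) measurableSet_Ioi
    (f := fun n => n - y / n) (f' := fun n => 1 + y / n ^ 2)
    (fun n hn => by
      have h1 : HasDerivAt (fun n : ℝ => n - y / n) (1 - -(y / n ^ 2)) n :=
        (hasDerivAt_id n).sub (hasDerivAt_div' (y := y) (ne_of_gt hn))
      rw [sub_neg_eq_add] at h1
      exact h1.hasDerivWithinAt)
    (by
      refine StrictMonoOn.injOn ?_
      intro a ha b hb hab
      have := div_lt_div_of_pos_left hy ha hab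
      simp only
      linarith)
    (fun u => ENNReal.ofReal (exp (-(u ^ 2 / 2))))
  have h2 := lintegral_image_eq_lintegral_abs_deriv_mul (s := Set.Ioi (0 : ℝ)) measurableSet_Ioi
    (f := fun n => y / n) (f' := fun n => -(y / n ^ 2))
    (fun n hn => (hasDerivAt_div' (ne_of_gt hn)).hasDerivWithinAt)
    (by
      refine StrictAntiOn.injOn ?_
      intro a ha b hb hab
      exact div_lt_div_of_pos_left hy ha hab)
    E
  rw [image_div hy] at h2
  rw [image_sub_div hy, setLIntegral_univ, lintegral_gauss] at h1
  rw [h1, two_mul]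
  nth_rw 2 [h2]
  rw [← lintegral_add_left hEm]
  refine setLIntegral_congr_fun measurableSet_Ioi fun n hn => ?_
  have hn0 : (0 : ℝ) < n := hn
  have hp : 0 ≤ y / n ^ 2 := by positivity
  have e1 : E (y / n) = E n := by
    simp only [hE]
    congr 3
    field_simp
    ring
  simp only [abs_neg]
  rw [e1, abs_of_nonneg hp, abs_of_nonneg (by linarith : (0 : ℝ) ≤ 1 + y / n ^ 2),
    ENNReal.ofReal_add zero_le_one hp, ENNReal.ofReal_one, add_mul, one_mul]

/-- The mixing measure expressing `exp(-y)` as a mixture of the functions `exp(-s y² / 2)`. -/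
def mix : Measure ℝ := (volume.restrict (Set.Ioi 0)).withDensity
  fun n => ENNReal.ofReal (2 / √(2 * π) * exp (-(n ^ 2 / 2)))

instance : SFinite mix := by
  unfold mix
  infer_instance

lemma exp_neg_eq_lintegral {y : ℝ} (hy : 0 ≤ y) :
    ENNReal.ofReal (exp (-y)) =
      ∫⁻ n, ENNReal.ofReal (exp (-(1 / 2) * ((n ^ 2)⁻¹ * y ^ 2))) ∂mix := by
  have hK : 0 < √(2 * π) := by positivity
  have hK2 : (0 : ℝ) ≤ 2 / √(2 * π) := by positivity
  unfold mix
  rw [lintegral_withDensity_eq_lintegral_mul _ (by fun_prop) (by fun_prop)]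
  simp only [Pi.mul_apply]
  rcases hy.eq_or_lt with rfl | hy
  · simp only [ne_eq, OfNat.ofNat_ne_zero, not_false_eq_true, zero_pow, mul_zero, exp_zero,
      ENNReal.ofReal_one, mul_one, neg_zero]
    simp_rw [ENNReal.ofReal_mul hK2]
    rw [lintegral_const_mul _ (by fun_prop), lintegral_gauss_Ioi, ← ENNReal.ofReal_mul hK2]
    rw [show 2 / √(2 * π) * (√(2 * π) / 2) = 1 by field_simp, ENNReal.ofReal_one]
  · have h := lintegral_gauss_sub_div hy
    have e : ∀ n ∈ Set.Ioi (0 : ℝ), ENNReal.ofReal (2 / √(2 * π) * exp (-(n ^ 2 / 2))) *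
        ENNReal.ofReal (exp (-(1 / 2) * ((n ^ 2)⁻¹ * y ^ 2))) =
        ENNReal.ofReal (1 / √(2 * π) * exp (-y)) *
          (2 * ENNReal.ofReal (exp (-((n - y / n) ^ 2 / 2)))) := by
      intro n hn
      have hn0 : (0 : ℝ) < n := hn
      rw [show (2 : ℝ≥0∞) = ENNReal.ofReal 2 by simp, ← ENNReal.ofReal_mul (by positivity),
        ← ENNReal.ofReal_mul (by positivity), ← ENNReal.ofReal_mul (by positivity)]
      congr 1
      have : exp (-(n ^ 2 / 2)) * exp (-(1 / 2) * ((n ^ 2)⁻¹ * y ^ 2)) =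
          exp (-y) * exp (-((n - y / n) ^ 2 / 2)) := by
        rw [← exp_add, ← exp_add]
        congr 1
        field_simp
        ring
      calc _ = 2 / √(2 * π) * (exp (-(n ^ 2 / 2)) *
          exp (-(1 / 2) * ((n ^ 2)⁻¹ * y ^ 2))) := by ring
        _ = _ := by
          rw [this]
          ring
    rw [setLIntegral_congr_fun measurableSet_Ioi e, lintegral_const_mul _ (by fun_prop),
      lintegral_const_mul _ (by fun_prop), h, ← ENNReal.ofReal_mul (by positivity)]
    congr 1
    field_simp

end GaussianMixture

namespace GaussianMixture

open Matrix

section Quadratic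

variable {κ : Type*} [Fintype κ]

/-- Symmetric positive definite real matrices. -/
def PD (A : Matrix κ κ ℝ) : Prop := Aᵀ = A ∧ ∀ ψ : κ → ℝ, ψ ≠ 0 → 0 < ψ ⬝ᵥ A *ᵥ ψ

lemma PD.symm {A : Matrix κ κ ℝ} (hA : PD A) (x y : κ → ℝ) : x ⬝ᵥ A *ᵥ y = y ⬝ᵥ A *ᵥ x := by
  rw [dotProduct_mulVec, ← mulVec_transpose, hA.1, dotProduct_comm]

lemma PD.nonneg {A : Matrix κ κ ℝ} (hA : PD A) (x : κ → ℝ) : 0 ≤ x ⬝ᵥ A *ᵥ x := by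
  by_cases h : x = 0
  · simp [h]
  · exact (hA.2 x h).le

lemma PD.eq_zero {A : Matrix κ κ ℝ} (hA : PD A) {x : κ → ℝ} (h : x ⬝ᵥ A *ᵥ x ≤ 0) : x = 0 := by
  by_contra h0
  exact absurd (hA.2 x h0) (not_lt.2 h)

lemma PD.exists_mulVec_eq [DecidableEq κ] {A : Matrix κ κ ℝ} (hA : PD A) (t : κ → ℝ) :
    ∃ h, A *ᵥ h = t := by
  have h1 : Function.Injective A.mulVec := by
    intro x y hxy
    have h2 : A *ᵥ (x - y) = 0 := by
      rw [mulVec_sub]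
      exact sub_eq_zero.2 hxy
    have h3 : x - y = 0 := hA.eq_zero (by rw [h2, dotProduct_zero])
    exact sub_eq_zero.1 h3
  exact mulVec_surjective_iff_isUnit.2 (mulVec_injective_iff_isUnit.1 h1) t

lemma PD.diag_pos [DecidableEq κ] {A : Matrix κ κ ℝ} (hA : PD A) (i : κ) : 0 < A i i := by
  have := hA.2 (Pi.single i 1) (by simp)
  simpa using this

/-- Adding a nonnegative diagonal entry. -/
def bump [DecidableEq κ] (A : Matrix κ κ ℝ) (i : κ) (s : ℝ) : Matrix κ κ ℝ :=
  A + Matrix.diagonal (Pi.single i s)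

lemma bump_mulVec [DecidableEq κ] (A : Matrix κ κ ℝ) (i : κ) (s : ℝ) (ψ : κ → ℝ) :
    bump A i s *ᵥ ψ = A *ᵥ ψ + Pi.single i (s * ψ i) := by
  unfold bump
  rw [add_mulVec]
  congr 1
  ext j
  rw [mulVec_diagonal]
  by_cases h : j = i
  · subst h
    simp
  · simp [h]

lemma bump_quad [DecidableEq κ] (A : Matrix κ κ ℝ) (i : κ) (s : ℝ) (ψ : κ → ℝ) :
    ψ ⬝ᵥ bump A i s *ᵥ ψ = ψ ⬝ᵥ A *ᵥ ψ + s * ψ i ^ 2 := by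
  rw [bump_mulVec, dotProduct_add, dotProduct_single]
  ring

lemma PD.bump [DecidableEq κ] {A : Matrix κ κ ℝ} (hA : PD A) (i : κ) {s : ℝ} (hs : 0 ≤ s) :
    PD (bump A i s) := by
  refine ⟨?_, fun ψ hψ => ?_⟩
  · unfold GaussianMixture.bump
    rw [transpose_add, hA.1, diagonal_transpose]
  · rw [bump_quad]
    have := hA.2 ψ hψ
    positivity

/-- Gaussian weight tilted by exponentials of absolute values of coordinates. -/
def gw (A : Matrix κ κ ℝ) (s : Finset κ) (c : κ → ℝ) (ψ : κ → ℝ) : ℝ≥0∞ :=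
  ENNReal.ofReal (exp (-(1 / 2) * (ψ ⬝ᵥ A *ᵥ ψ) - ∑ i ∈ s, c i * |ψ i|))

lemma continuous_quad (A : Matrix κ κ ℝ) : Continuous fun ψ : κ → ℝ => ψ ⬝ᵥ A *ᵥ ψ := by
  simp only [dotProduct, mulVec]
  fun_prop

@[fun_prop]
lemma measurable_gw (A : Matrix κ κ ℝ) (s : Finset κ) (c : κ → ℝ) : Measurable (gw A s c) := by
  have := (continuous_quad A).measurable
  unfold gw
  fun_prop

lemma gw_empty (A : Matrix κ κ ℝ) (c : κ → ℝ) (ψ : κ → ℝ) :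
    gw A ∅ c ψ = ENNReal.ofReal (exp (-(1 / 2) * (ψ ⬝ᵥ A *ᵥ ψ))) := by
  simp [gw]

lemma lintegral_gw_insert [DecidableEq κ] (A : Matrix κ κ ℝ) {s : Finset κ} {i : κ} (hi : i ∉ s)
    {c : κ → ℝ} (hc : 0 ≤ c i) {H : (κ → ℝ) → ℝ≥0∞} (hH : Measurable H) :
    ∫⁻ ψ, H ψ * gw A (insert i s) c ψ =
      ∫⁻ n, (∫⁻ ψ, H ψ * gw (bump A i ((n ^ 2)⁻¹ * c i ^ 2)) s c ψ) ∂mix := by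
  have hm : Measurable (Function.uncurry fun (ψ : κ → ℝ) (n : ℝ) =>
      H ψ * gw (bump A i ((n ^ 2)⁻¹ * c i ^ 2)) s c ψ) := by
    have := (continuous_quad A).measurable
    unfold gw
    simp only [bump_quad, Function.uncurry_def]
    fun_prop
  rw [← lintegral_lintegral_swap hm.aemeasurable]
  refine lintegral_congr fun ψ => ?_
  rw [lintegral_const_mul]
  · congr 1
    have h := exp_neg_eq_lintegral (mul_nonneg hc (abs_nonneg (ψ i)))
    have e1 : gw A (insert i s) c ψ = gw A s c ψ * ENNReal.ofReal (exp (-(c i * |ψ i|))) := by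
      unfold gw
      rw [← ENNReal.ofReal_mul (exp_pos _).le, ← exp_add, Finset.sum_insert hi]
      congr 2
      ring
    rw [e1, h, ← lintegral_const_mul]
    · refine lintegral_congr fun n => ?_
      unfold gw
      rw [← ENNReal.ofReal_mul (exp_pos _).le, ← exp_add, bump_quad]
      congr 2
      rw [mul_pow, sq_abs]
      ring
    · fun_prop
  · have := (continuous_quad A).measurable
    unfold gw
    simp only [bump_quad]
    fun_prop

lemma lintegral_exp_linear {A : Matrix κ κ ℝ} (hA : PD A) {t h : κ → ℝ} (hh : A *ᵥ h = t)
    (c : κ → ℝ) :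
    ∫⁻ ψ, ENNReal.ofReal (exp (t ⬝ᵥ ψ)) * gw A ∅ c ψ =
      ENNReal.ofReal (exp (1 / 2 * (t ⬝ᵥ h))) * ∫⁻ ψ, gw A ∅ c ψ := by
  rw [← lintegral_const_mul _ (by fun_prop)]
  have e := lintegral_add_right_eq_self (μ := (volume : Measure (κ → ℝ)))
    (fun ψ : κ → ℝ => ENNReal.ofReal (exp (t ⬝ᵥ ψ)) * gw A ∅ c ψ) h
  rw [← e]
  refine lintegral_congr fun ψ => ?_
  rw [gw_empty, gw_empty, ← ENNReal.ofReal_mul (exp_pos _).le,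
    ← ENNReal.ofReal_mul (exp_pos _).le, ← exp_add, ← exp_add]
  congr 2
  rw [mulVec_add, dotProduct_add, dotProduct_add, add_dotProduct, add_dotProduct, hh,
    hA.symm h ψ, hh, dotProduct_comm ψ t, dotProduct_comm h t]
  ring

/-- Comparison for Gaussian integrals with a linear tilt. -/
theorem lintegral_tilt_le [DecidableEq κ] {t : κ → ℝ} {q : ℝ} {c : κ → ℝ} (s : Finset κ)
    (hc : ∀ i ∈ s, 0 ≤ c i) : ∀ {A : Matrix κ κ ℝ}, PD A →
    (∀ ψ : κ → ℝ, 2 * (t ⬝ᵥ ψ) - ψ ⬝ᵥ A *ᵥ ψ ≤ q) →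
    ∫⁻ ψ, ENNReal.ofReal (exp (t ⬝ᵥ ψ)) * gw A s c ψ ≤
      ENNReal.ofReal (exp (q / 2)) * ∫⁻ ψ, gw A s c ψ := by
  induction s using Finset.induction_on with
  | empty =>
    intro A hA hq
    obtain ⟨h, hh⟩ := hA.exists_mulVec_eq t
    rw [lintegral_exp_linear hA hh]
    have := hq h
    rw [hh, dotProduct_comm h t] at this
    gcongr
    linarith
  | insert i s hi ih =>
    intro A hA hq
    have hci := hc i (Finset.mem_insert_self _ _)
    rw [lintegral_gw_insert A hi hci (by simp only [dotProduct]; fun_prop)]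
    have e2 := lintegral_gw_insert A hi hci (H := fun _ => 1) measurable_const
    simp only [one_mul] at e2
    rw [e2, ← lintegral_const_mul']
    · refine lintegral_mono fun n => ?_
      have hs : 0 ≤ (n ^ 2)⁻¹ * c i ^ 2 := by positivity
      refine ih (fun j hj => hc j (Finset.mem_insert_of_mem hj)) (hA.bump i hs) fun ψ => ?_
      rw [bump_quad]
      have := hq ψ
      have h3 : 0 ≤ (n ^ 2)⁻¹ * c i ^ 2 * ψ i ^ 2 := by positivity
      linarith
    · exact ENNReal.ofReal_ne_top

lemma PD.exists_lower_bound {A : Matrix κ κ ℝ} (hA : PD A) :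
    ∃ ε > 0, ∀ ψ : κ → ℝ, ε * ∑ i, ψ i ^ 2 ≤ ψ ⬝ᵥ A *ᵥ ψ := by
  rcases isEmpty_or_nonempty κ with hE | hN
  · exact ⟨1, one_pos, fun ψ => by simp [dotProduct]⟩
  have hcomp : IsCompact (Metric.sphere (0 : κ → ℝ) 1) := isCompact_sphere _ _
  obtain ⟨u, hu, hmin⟩ := hcomp.exists_isMinOn
    (NormedSpace.sphere_nonempty.2 zero_le_one) (continuous_quad A).continuousOn
  have hu0 : u ≠ 0 := by
    rintro rfl
    simp at hu
  have hpos := hA.2 u hu0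
  have hcard : (0 : ℝ) < Fintype.card κ := by exact_mod_cast Fintype.card_pos
  refine ⟨(u ⬝ᵥ A *ᵥ u) / Fintype.card κ, by positivity, fun ψ => ?_⟩
  by_cases hψ : ψ = 0
  · simp [hψ]
  have hn : 0 < ‖ψ‖ := norm_pos_iff.2 hψ
  have h1 : ‖ψ‖⁻¹ • ψ ∈ Metric.sphere (0 : κ → ℝ) 1 := by
    rw [mem_sphere_zero_iff_norm, norm_smul, norm_inv, norm_norm, inv_mul_cancel₀ hn.ne']
  have h2 := hmin h1
  simp only [Set.mem_ofPred_eq, mulVec_smul, dotProduct_smul, smul_dotProduct, smul_eq_mul] at h2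
  have h3 : (u ⬝ᵥ A *ᵥ u) * ‖ψ‖ ^ 2 ≤ ψ ⬝ᵥ A *ᵥ ψ := by
    calc _ ≤ (‖ψ‖⁻¹ * (‖ψ‖⁻¹ * (ψ ⬝ᵥ A *ᵥ ψ))) * ‖ψ‖ ^ 2 := by gcongr
      _ = _ := by field_simp
  refine le_trans ?_ h3
  have h4 : ∑ i, ψ i ^ 2 ≤ Fintype.card κ * ‖ψ‖ ^ 2 := by
    have : ∀ i ∈ Finset.univ, ψ i ^ 2 ≤ ‖ψ‖ ^ 2 := fun i _ => by
      have := norm_le_pi_norm ψ i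
      rw [Real.norm_eq_abs] at this
      rw [← sq_abs]
      gcongr
    have := Finset.sum_le_sum this
    simpa using this
  calc _ ≤ (u ⬝ᵥ A *ᵥ u) / Fintype.card κ * (Fintype.card κ * ‖ψ‖ ^ 2) := by gcongr
    _ = _ := by field_simp

lemma PD.lintegral_gw_ne_top {A : Matrix κ κ ℝ} (hA : PD A) (c : κ → ℝ) :
    ∫⁻ ψ, gw A ∅ c ψ ≠ ⊤ := by
  obtain ⟨ε, hε, h⟩ := hA.exists_lower_bound
  have hi : Integrable (fun ψ : κ → ℝ => ∏ i, exp (-(ε / 2) * ψ i ^ 2)) :=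
    Integrable.fintype_prod (f := fun (_ : κ) (x : ℝ) => exp (-(ε / 2) * x ^ 2))
      fun _ => integrable_exp_neg_mul_sq (by positivity)
  have hlt := hi.lintegral_lt_top
  refine ne_top_of_le_ne_top hlt.ne (lintegral_mono fun ψ => ?_)
  rw [gw_empty, ← exp_sum, ← Finset.mul_sum]
  have := h ψ
  refine ENNReal.ofReal_le_ofReal (exp_le_exp.2 ?_)
  linarith

lemma lintegral_gw_ne_zero (A : Matrix κ κ ℝ) (s : Finset κ) (c : κ → ℝ) :
    ∫⁻ ψ, gw A s c ψ ≠ 0 := by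
  rw [Ne, lintegral_eq_zero_iff (measurable_gw A s c)]
  intro h
  have h2 : ∀ᵐ ψ : κ → ℝ, False := by
    filter_upwards [h] with ψ hψ
    have h3 : 0 < gw A s c ψ := ENNReal.ofReal_pos.2 (exp_pos _)
    exact h3.ne' hψ
  rw [ae_iff] at h2
  simp only [not_false_eq_true, Set.ofPred_true, Measure.measure_univ_eq_zero] at h2
  exact NeZero.ne _ h2

end Quadratic

end GaussianMixture
namespace GaussianMixture

open Matrix

section Sign

variable {κ : Type*} [Fintype κ]

/-- Nonpositivity of the off-diagonal entries. -/
def OffNonpos (A : Matrix κ κ ℝ) : Prop := ∀ i j, i ≠ j → A i j ≤ 0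

lemma OffNonpos.bump [DecidableEq κ] {A : Matrix κ κ ℝ} (hA : OffNonpos A) (i : κ) (s : ℝ) :
    OffNonpos (bump A i s) := by
  intro j l hjl
  simp only [GaussianMixture.bump, Matrix.add_apply, diagonal_apply_ne _ hjl, add_zero]
  exact hA j l hjl

/-- The inverse of a positive definite matrix with nonpositive off-diagonal entries has
nonnegative entries. -/
lemma PD.nonneg_of_mulVec_nonneg {A : Matrix κ κ ℝ} (hA : PD A) (hO : OffNonpos A) {h : κ → ℝ}
    (hh : ∀ i, 0 ≤ (A *ᵥ h) i) (i : κ) : 0 ≤ h i := by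
  set m : κ → ℝ := fun i => max (-h i) 0 with hm
  set p : κ → ℝ := fun i => max (h i) 0 with hp
  have hpm : h = p - m := by
    ext j
    simp only [hm, hp, Pi.sub_apply]
    rcases le_total 0 (h j) with h1 | h1
    · rw [max_eq_left h1, max_eq_right (by linarith)]; ring
    · rw [max_eq_right h1, max_eq_left (by linarith)]; ring
  have hm0 : ∀ j, 0 ≤ m j := fun j => le_max_right _ _
  have hp0 : ∀ j, 0 ≤ p j := fun j => le_max_right _ _
  have hmp : ∀ j, m j * p j = 0 := by
    intro j
    simp only [hm, hp]
    rcases le_total 0 (h j) with h1 | h1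
    · rw [max_eq_right (by linarith : -h j ≤ 0), zero_mul]
    · rw [max_eq_right h1, mul_zero]
  have h1 : 0 ≤ m ⬝ᵥ A *ᵥ h := Finset.sum_nonneg fun j _ => mul_nonneg (hm0 j) (hh j)
  have h2 : m ⬝ᵥ A *ᵥ p ≤ 0 := by
    simp only [dotProduct, mulVec, Finset.mul_sum]
    refine Finset.sum_nonpos fun j _ => Finset.sum_nonpos fun l _ => ?_
    by_cases hjl : j = l
    · subst hjl
      have : m j * (A j j * p j) = A j j * (m j * p j) := by ring
      rw [this, hmp, mul_zero]
    · have := mul_nonneg (hm0 j) (hp0 l)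
      nlinarith [hO j l hjl]
  have h3 : m = 0 := hA.eq_zero (by
    rw [hpm, mulVec_sub, dotProduct_sub] at h1
    linarith)
  have h4 : m i = 0 := congrFun h3 i
  have h5 : -h i ≤ m i := le_max_left _ _
  linarith

variable [DecidableEq κ]

lemma PD.one_le_diag_mul {A : Matrix κ κ ℝ} (hA : PD A) (hO : OffNonpos A) {i : κ} {g : κ → ℝ}
    (hg : A *ᵥ g = Pi.single i 1) : 1 ≤ A i i * g i := by
  have hg0 : ∀ j, 0 ≤ g j := hA.nonneg_of_mulVec_nonneg hO fun j => by
    rw [hg]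
    by_cases h : j = i
    · subst h; simp
    · simp [h]
  have h1 : (A *ᵥ g) i = 1 := by rw [hg]; simp
  rw [← h1]
  simp only [mulVec, dotProduct]
  rw [← Finset.add_sum_erase _ _ (Finset.mem_univ i)]
  have : ∑ j ∈ Finset.univ.erase i, A i j * g j ≤ 0 := Finset.sum_nonpos fun j hj =>
    mul_nonpos_of_nonpos_of_nonneg (hO i j (Finset.ne_of_mem_erase hj).symm) (hg0 j)
  linarith

lemma bump_diag (A : Matrix κ κ ℝ) (i j : κ) (s : ℝ) :
    bump A i s j j = A j j + if j = i then s else 0 := by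
  simp only [GaussianMixture.bump, Matrix.add_apply, diagonal_apply_eq]
  congr 1
  split_ifs with h
  · subst h; simp
  · simp [h]

/-- The quantity controlling sign correlations decreases when mass is added. -/
lemma PD.bump_bound {A : Matrix κ κ ℝ} (hA : PD A) (hO : OffNonpos A) {o y : κ} (hoy : o ≠ y)
    (i : κ) {s : ℝ} (hs : 0 ≤ s) {h h' : κ → ℝ} (hh : A *ᵥ h = Pi.single y 1)
    (hh' : GaussianMixture.bump A i s *ᵥ h' = Pi.single y 1) :
    h' o ^ 2 * GaussianMixture.bump A i s o o * GaussianMixture.bump A i s y y ≤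
      h o ^ 2 * A o o * A y y := by
  have hy1 : ∀ j, (0 : ℝ) ≤ (Pi.single y 1 : κ → ℝ) j := fun j => by
    by_cases hj : j = y
    · subst hj; simp
    · simp [hj]
  have hp := hA.nonneg_of_mulVec_nonneg hO (h := h) (by rw [hh]; exact hy1)
  have hp' := (hA.bump i hs).nonneg_of_mulVec_nonneg (hO.bump i s) (h := h')
    (by rw [hh']; exact hy1)
  have hinj : ∀ u v : κ → ℝ, A *ᵥ u = A *ᵥ v → u = v := by
    intro u v huv
    exact sub_eq_zero.1 (hA.eq_zero (x := u - v) (by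
      rw [mulVec_sub, huv, sub_self, dotProduct_zero]))
  obtain ⟨g, hg⟩ := hA.exists_mulVec_eq (Pi.single i (1 : ℝ))
  have hg1 := hA.one_le_diag_mul hO hg
  have hd := hA.diag_pos
  have hgi : ∀ j, 0 ≤ g j := hA.nonneg_of_mulVec_nonneg hO fun j => by
    rw [hg]
    by_cases hj : j = i
    · subst hj; simp
    · simp [hj]
  have hrel : h = h' + (s * h' i) • g := by
    refine hinj _ _ ?_
    rw [mulVec_add, mulVec_smul, hg, hh, ← hh', bump_mulVec]
    congr 1
    ext j
    by_cases hj : j = i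
    · subst hj; simp
    · simp [hj]
  have hrelj : ∀ j, h j = h' j + s * h' i * g j := fun j => congrFun hrel j
  have hle : ∀ j, h' j ≤ h j := fun j => by
    rw [hrelj j]
    have := mul_nonneg (mul_nonneg hs (hp' i)) (hgi j)
    linarith
  have hkey : A i i + s ≤ A i i * (1 + s * g i) ^ 2 := by
    have e : A i i * (1 + s * g i) ^ 2 =
      A i i + 2 * s * (A i i * g i) + A i i * (s * g i) ^ 2 := by ring
    rw [e]
    have h5 : 0 ≤ A i i * (s * g i) ^ 2 := mul_nonneg (hd i).le (sq_nonneg _)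
    nlinarith
  simp only [bump_diag]
  by_cases hio : o = i
  · subst hio
    rw [if_pos rfl, if_neg (Ne.symm hoy), add_zero]
    have h1 : h o = h' o * (1 + s * g o) := by rw [hrelj o]; ring
    rw [h1]
    have h2 : h' o ^ 2 * (A o o + s) ≤ h' o ^ 2 * (A o o * (1 + s * g o) ^ 2) :=
      mul_le_mul_of_nonneg_left hkey (sq_nonneg _)
    calc _ ≤ h' o ^ 2 * (A o o * (1 + s * g o) ^ 2) * A y y :=
          mul_le_mul_of_nonneg_right h2 (hd y).le
      _ = _ := by ring
  · by_cases hiy : y = i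
    · subst hiy
      rw [if_neg hio, if_pos rfl, add_zero]
      have hgh : g = h := hinj _ _ (by rw [hg, hh])
      have h1 : h o = h' o * (1 + s * g y) := by
        have e1 := hrelj o
        have e2 := hrelj y
        rw [hgh] at e1 e2 ⊢
        have h4 : h' y * (1 + s * h y) = h y := by linarith
        linear_combination (1 + s * h y) * e1 + s * h o * h4
      rw [h1]
      have h2 : h' o ^ 2 * A o o * (A y y + s) ≤
          h' o ^ 2 * A o o * (A y y * (1 + s * g y) ^ 2) :=
        mul_le_mul_of_nonneg_left hkey (mul_nonneg (sq_nonneg _) (hd o).le)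
      calc _ ≤ _ := h2
        _ = _ := by ring
    · rw [if_neg hio, if_neg hiy, add_zero, add_zero]
      have h1 : h' o ^ 2 ≤ h o ^ 2 := pow_le_pow_left₀ (hp' o) (hle o) 2
      have := (hd o).le
      have := (hd y).le
      gcongr

end Sign

end GaussianMixture
namespace GaussianMixture

open Matrix

section Sign

variable {κ : Type*} [Fintype κ] [DecidableEq κ]

lemma update_quad {A : Matrix κ κ ℝ} (hA : PD A) (o : κ) (x : κ → ℝ) (u : ℝ) :
    Function.update x o u ⬝ᵥ A *ᵥ Function.update x o u =
      (x ⬝ᵥ A *ᵥ x - (A *ᵥ x) o ^ 2 / A o o) +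
        A o o * (u - (x o - (A *ᵥ x) o / A o o)) ^ 2 := by
  have hd := hA.diag_pos o
  have e : Function.update x o u = x + (u - x o) • (Pi.single o 1 : κ → ℝ) := by
    ext j
    by_cases hj : j = o
    · subst hj; simp
    · simp [hj]
  rw [e, mulVec_add, mulVec_smul, add_dotProduct, dotProduct_add, dotProduct_add,
    smul_dotProduct, smul_dotProduct, dotProduct_smul, dotProduct_smul,
    hA.symm x (Pi.single o 1), single_one_dotProduct, single_one_dotProduct]
  simp only [mulVec_single_one, col_apply, smul_eq_mul]
  field_simp
  ring

lemma le_lintegral_gauss {a : ℝ} (ha : 0 < a) (m : ℝ) :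
    1 ≤ ENNReal.ofReal √a * ∫⁻ u, ENNReal.ofReal (exp (-(1 / 2) * (a * (u - m) ^ 2))) := by
  have e := lintegral_sub_right_eq_self (μ := (volume : Measure ℝ))
    (fun u => ENNReal.ofReal (exp (-(1 / 2) * (a * u ^ 2)))) m
  rw [e]
  have hi := integrable_exp_neg_mul_sq (b := a / 2) (by positivity)
  have e2 : (fun u : ℝ => exp (-(1 / 2) * (a * u ^ 2))) = fun u => exp (-(a / 2) * u ^ 2) := by
    ext u
    congr 1
    ring
  rw [← ofReal_integral_eq_lintegral_ofReal (by rw [e2]; exact hi)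
    (Filter.Eventually.of_forall fun _ => (exp_pos _).le), e2, integral_gaussian,
    ← ENNReal.ofReal_mul (sqrt_nonneg _), ← Real.sqrt_mul ha.le]
  rw [ENNReal.one_le_ofReal, Real.one_le_sqrt]
  have : a * (π / (a / 2)) = 2 * π := by field_simp
  rw [this]
  have := Real.pi_gt_three
  linarith

lemma lintegral_window_le {A : Matrix κ κ ℝ} (hA : PD A) {o y : κ} (hoy : o ≠ y) {β : ℝ}
    (hβ : 0 ≤ β) (c : κ → ℝ) :
    ∫⁻ ψ, {ψ : κ → ℝ | |ψ o - β * ψ y| ≤ β * |ψ y|}.indicator 1 ψ * gw A ∅ c ψ ≤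
      ∫⁻ ψ, ENNReal.ofReal (2 * β * √(A o o) * |ψ y|) * gw A ∅ c ψ := by
  have hms : MeasurableSet {ψ : κ → ℝ | |ψ o - β * ψ y| ≤ β * |ψ y|} :=
    measurableSet_le (by fun_prop) (by fun_prop)
  have hmi : Measurable ({ψ : κ → ℝ | |ψ o - β * ψ y| ≤ β * |ψ y|}.indicator
      (1 : (κ → ℝ) → ℝ≥0∞)) := measurable_one.indicator hms
  refine lintegral_le_of_lmarginal_le (μ := fun _ : κ => (volume : Measure ℝ)) {o}
    (by fun_prop) (by fun_prop) ?_
  rw [lmarginal_singleton, lmarginal_singleton]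
  intro x
  simp only
  set E₀ := x ⬝ᵥ A *ᵥ x - (A *ᵥ x) o ^ 2 / A o o
  set m := x o - (A *ᵥ x) o / A o o
  have hd := hA.diag_pos o
  have hw : ∀ u : ℝ, gw A ∅ c (Function.update x o u) = ENNReal.ofReal (exp (-(1 / 2) * E₀)) *
      ENNReal.ofReal (exp (-(1 / 2) * (A o o * (u - m) ^ 2))) := by
    intro u
    rw [gw_empty, update_quad hA, ← ENNReal.ofReal_mul (exp_pos _).le, ← exp_add]
    congr 2
    ring
  have hyo : ∀ u : ℝ, Function.update x o u y = x y := fun u =>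
    Function.update_of_ne (Ne.symm hoy) _ _
  have hoo : ∀ u : ℝ, Function.update x o u o = u := fun u => Function.update_self _ _ _
  have hle : ∀ u : ℝ, {ψ : κ → ℝ | |ψ o - β * ψ y| ≤ β * |ψ y|}.indicator 1
      (Function.update x o u) * gw A ∅ c (Function.update x o u) ≤
      (Set.Icc (β * x y - β * |x y|) (β * x y + β * |x y|)).indicator
        (fun _ => ENNReal.ofReal (exp (-(1 / 2) * E₀))) u := by
    intro u
    by_cases hu : Function.update x o u ∈ {ψ : κ → ℝ | |ψ o - β * ψ y| ≤ β * |ψ y|}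
    · have hu' : u ∈ Set.Icc (β * x y - β * |x y|) (β * x y + β * |x y|) := by
        rw [Set.mem_ofPred_eq, hyo, hoo, abs_le] at hu
        constructor <;> linarith [hu.1, hu.2]
      rw [Set.indicator_of_mem hu, Set.indicator_of_mem hu', hw, Pi.one_apply, one_mul]
      have h1 : exp (-(1 / 2) * (A o o * (u - m) ^ 2)) ≤ 1 := by
        rw [exp_le_one_iff]
        have := mul_nonneg hd.le (sq_nonneg (u - m))
        linarith
      calc _ ≤ ENNReal.ofReal (exp (-(1 / 2) * E₀)) * ENNReal.ofReal 1 := by gcongr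
        _ = _ := by simp
    · rw [Set.indicator_of_notMem hu, zero_mul]
      exact zero_le
  refine (lintegral_mono hle).trans ?_
  rw [lintegral_indicator_const measurableSet_Icc, Real.volume_Icc]
  simp only [hw, hyo]
  rw [lintegral_const_mul _ (by fun_prop), lintegral_const_mul _ (by fun_prop)]
  have h3 := le_lintegral_gauss hd m
  have e3 : β * x y + β * |x y| - (β * x y - β * |x y|) = 2 * β * |x y| := by ring
  have e4 : 2 * β * √(A o o) * |x y| = (2 * β * |x y|) * √(A o o) := by ring
  rw [e3, e4, ENNReal.ofReal_mul (p := 2 * β * |x y|) (by positivity)]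
  calc _ = ENNReal.ofReal (exp (-(1 / 2) * E₀)) * ENNReal.ofReal (2 * β * |x y|) * 1 := by
        rw [mul_one]
    _ ≤ ENNReal.ofReal (exp (-(1 / 2) * E₀)) * ENNReal.ofReal (2 * β * |x y|) *
        (ENNReal.ofReal √(A o o) *
          ∫⁻ u, ENNReal.ofReal (exp (-(1 / 2) * (A o o * (u - m) ^ 2)))) := by gcongr
    _ = _ := by ring

lemma lintegral_abs_le {A : Matrix κ κ ℝ} (hA : PD A) {y : κ} {h : κ → ℝ}
    (hh : A *ᵥ h = Pi.single y 1) (hy : 0 < h y) (c : κ → ℝ) :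
    ∫⁻ ψ, ENNReal.ofReal |ψ y| * gw A ∅ c ψ ≤
      ENNReal.ofReal (4 * √(h y)) * ∫⁻ ψ, gw A ∅ c ψ := by
  set s := (√(h y))⁻¹
  have hsq : 0 < √(h y) := Real.sqrt_pos.2 hy
  have hlin : ∀ r : ℝ, r ^ 2 * h y = 1 →
      ∫⁻ ψ : κ → ℝ, ENNReal.ofReal (exp (r * ψ y)) * gw A ∅ c ψ =
        ENNReal.ofReal (exp (1 / 2)) * ∫⁻ ψ, gw A ∅ c ψ := by
    intro r hr
    have h1 := lintegral_exp_linear hA (t := r • (Pi.single y 1 : κ → ℝ)) (h := r • h)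
      (by rw [mulVec_smul, hh]) c
    simp only [smul_dotProduct, dotProduct_smul, single_one_dotProduct, smul_eq_mul] at h1
    rw [h1]
    congr 3
    linear_combination (1 / 2) * hr
  have hs2 : s ^ 2 * h y = 1 := by
    simp only [s]
    rw [inv_pow, Real.sq_sqrt hy.le, inv_mul_cancel₀ hy.ne']
  have hpt : ∀ ψ : κ → ℝ, ENNReal.ofReal |ψ y| * gw A ∅ c ψ ≤ ENNReal.ofReal √(h y) *
      (ENNReal.ofReal (exp (s * ψ y)) * gw A ∅ c ψ +
        ENNReal.ofReal (exp (-s * ψ y)) * gw A ∅ c ψ) := by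
    intro ψ
    rw [← add_mul, ← mul_assoc, ← ENNReal.ofReal_add (exp_pos _).le (exp_pos _).le,
      ← ENNReal.ofReal_mul hsq.le]
    gcongr
    have h1 := add_one_le_exp (s * ψ y)
    have h2 := add_one_le_exp (-s * ψ y)
    have h3 := exp_pos (s * ψ y)
    have h4 := exp_pos (-s * ψ y)
    have h5 : |s * ψ y| ≤ exp (s * ψ y) + exp (-s * ψ y) := by
      rw [abs_le]
      constructor <;> linarith
    calc |ψ y| = √(h y) * |s * ψ y| := by
          rw [abs_mul, abs_of_pos (inv_pos.2 hsq : 0 < s), ← mul_assoc, mul_inv_cancel₀ hsq.ne',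
            one_mul]
      _ ≤ _ := by gcongr
  refine (lintegral_mono hpt).trans ?_
  rw [lintegral_const_mul _ (by fun_prop), lintegral_add_left (by fun_prop), hlin s hs2,
    hlin (-s) (by rw [neg_sq, hs2]), ← two_mul, ← mul_assoc, ← mul_assoc,
    show (2 : ℝ≥0∞) = ENNReal.ofReal 2 by simp, ← ENNReal.ofReal_mul hsq.le,
    ← ENNReal.ofReal_mul (by positivity)]
  gcongr ENNReal.ofReal ?_ * _
  have h6 : exp (1 / 2) ≤ 2 := by
    have h7 : exp (1 / 2) ^ 2 ≤ 2 ^ 2 := by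
      rw [← exp_nat_mul]
      have := Real.exp_one_lt_d9
      norm_num
      linarith
    exact le_of_sq_le_sq h7 (by norm_num)
  nlinarith

end Sign

end GaussianMixture
namespace GaussianMixture

open Matrix

section Sign

variable {κ : Type*} [Fintype κ] [DecidableEq κ]

/-- The factor `1 + sgn(a) sgn(b)`. -/
def sgnFac (a b : ℝ) : ℝ := 1 + Real.sign a * Real.sign b

lemma sgnFac_mem (a b : ℝ) : 0 ≤ sgnFac a b ∧ sgnFac a b ≤ 2 := by
  unfold sgnFac
  rcases Real.sign_apply_eq a with h | h | h <;> rcases Real.sign_apply_eq b with h' | h' | h' <;>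
    rw [h, h'] <;> norm_num

lemma measurable_sign : Measurable Real.sign := by
  unfold Real.sign
  exact Measurable.ite measurableSet_Iio measurable_const
    (Measurable.ite measurableSet_Ioi measurable_const measurable_const)

@[fun_prop]
lemma measurable_sgnFac {α : Type*} [MeasurableSpace α] {f g : α → ℝ} (hf : Measurable f)
    (hg : Measurable g) : Measurable fun x => sgnFac (f x) (g x) := by
  unfold sgnFac
  exact ((measurable_sign.comp hf).mul (measurable_sign.comp hg)).const_add 1

lemma lintegral_reflect {A : Matrix κ κ ℝ} (hA : PD A) {y : κ} {h : κ → ℝ}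
    (hh : A *ᵥ h = Pi.single y 1) (hy : 0 < h y) (c : κ → ℝ) {f : (κ → ℝ) → ℝ≥0∞}
    (hf : Measurable f) :
    ∫⁻ ψ, f ψ * gw A ∅ c ψ = ∫⁻ ψ, f (ψ - (2 * (ψ y / h y)) • h) * gw A ∅ c ψ := by
  set R : (κ → ℝ) →ₗ[ℝ] (κ → ℝ) :=
    LinearMap.id - (2 / h y) • (LinearMap.smulRight (LinearMap.proj y) h) with hR
  have hRv : ∀ ψ, R ψ = ψ - (2 * (ψ y / h y)) • h := by
    intro ψ
    ext j
    simp only [hR, LinearMap.sub_apply, LinearMap.id_apply, LinearMap.smul_apply,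
      LinearMap.smulRight_apply, LinearMap.proj_apply, Pi.sub_apply, Pi.smul_apply, smul_eq_mul]
    ring
  have hRy : ∀ ψ, R ψ y = -ψ y := by
    intro ψ
    rw [hRv]
    simp only [Pi.sub_apply, Pi.smul_apply, smul_eq_mul]
    field_simp
    ring
  have hRR : R ∘ₗ R = LinearMap.id := by
    refine LinearMap.ext fun ψ => ?_
    rw [LinearMap.comp_apply, hRv (R ψ), hRy, hRv]
    ext j
    simp only [Pi.sub_apply, Pi.smul_apply, smul_eq_mul, LinearMap.id_apply]
    ring
  have hdet : LinearMap.det R * LinearMap.det R = 1 := by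
    rw [← LinearMap.det_comp, hRR, LinearMap.det_id]
  have hdet0 : LinearMap.det R ≠ 0 := fun h0 => by simp [h0] at hdet
  have hdet1 : |(LinearMap.det R)⁻¹| = 1 := by
    rcases mul_self_eq_one_iff.1 hdet with h1 | h1 <;> rw [h1] <;> norm_num
  have hmap := Measure.map_linearMap_addHaar_eq_smul_addHaar (volume : Measure (κ → ℝ)) hdet0
  rw [hdet1, ENNReal.ofReal_one, one_smul] at hmap
  have hRm : Measurable R := R.continuous_of_finiteDimensional.measurable
  have hq : ∀ ψ, gw A ∅ c (R ψ) = gw A ∅ c ψ := by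
    intro ψ
    rw [gw_empty, gw_empty]
    congr 3
    rw [hRv, mulVec_sub, mulVec_smul, hh, sub_dotProduct, dotProduct_sub, dotProduct_sub,
      smul_dotProduct, smul_dotProduct, dotProduct_smul, dotProduct_smul, hA.symm h ψ, hh]
    simp only [dotProduct_single_one, smul_eq_mul]
    field_simp
    ring
  conv_lhs => rw [← hmap]
  rw [lintegral_map (by fun_prop) hRm]
  refine lintegral_congr fun ψ => ?_
  rw [hq, hRv]

lemma sgnFac_reflect {β p q : ℝ} (hβ : 0 ≤ β) :
    sgnFac p q + sgnFac (p - 2 * β * q) (-q) ≤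
      2 + 2 * (if |p - β * q| ≤ β * |q| then 1 else 0) := by
  split_ifs with h
  · have h1 := (sgnFac_mem p q).2
    have h2 := (sgnFac_mem (p - 2 * β * q) (-q)).2
    linarith
  · rw [not_le] at h
    have hs : Real.sign p = Real.sign (p - 2 * β * q) := by
      have h3 : β * |q| = |β * q| := by rw [abs_mul, abs_of_nonneg hβ]
      rw [h3] at h
      have h4 := le_abs_self (β * q)
      have h5 := neg_abs_le (β * q)
      rcases lt_abs.1 h with h6 | h6
      · rw [Real.sign_of_pos (by linarith), Real.sign_of_pos (by linarith)]
      · rw [Real.sign_of_neg (by linarith), Real.sign_of_neg (by linarith)]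
    unfold sgnFac
    rw [← hs, Real.sign_neg]
    linarith

lemma lintegral_sgnFac_le_base {A : Matrix κ κ ℝ} (hA : PD A) (hO : OffNonpos A) {o y : κ}
    (hoy : o ≠ y) {h : κ → ℝ} (hh : A *ᵥ h = Pi.single y 1) {K : ℝ} (hK : 0 ≤ K)
    (hhK : h o ^ 2 * A o o * A y y ≤ K ^ 2) (c : κ → ℝ) :
    ∫⁻ ψ, ENNReal.ofReal (sgnFac (ψ o) (ψ y)) * gw A ∅ c ψ ≤
      ENNReal.ofReal (1 + 8 * K) * ∫⁻ ψ, gw A ∅ c ψ := by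
  have hp := hA.nonneg_of_mulVec_nonneg hO (h := h) fun j => by
    rw [hh]
    by_cases hj : j = y
    · subst hj; simp
    · simp [hj]
  have h1y := hA.one_le_diag_mul hO hh
  have hdy := hA.diag_pos y
  have hdo := hA.diag_pos o
  have hy : 0 < h y := by
    rcases (hp y).eq_or_lt with h0 | h0
    · rw [← h0] at h1y; norm_num at h1y
    · exact h0
  set β := h o / h y
  have hβ : 0 ≤ β := div_nonneg (hp o) hy.le
  set Z := ∫⁻ ψ, gw A ∅ c ψ
  have hsq : 0 < √(h y) := Real.sqrt_pos.2 hy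
  have hβK : β * √(A o o) * √(h y) ≤ K := by
    refine le_of_sq_le_sq (le_trans ?_ hhK) hK
    have e : (β * √(A o o) * √(h y)) ^ 2 = h o ^ 2 * A o o / h y := by
      rw [mul_pow, mul_pow, Real.sq_sqrt hdo.le, Real.sq_sqrt hy.le]
      simp only [β]
      field_simp
    rw [e, div_le_iff₀ hy]
    have := mul_le_mul_of_nonneg_left h1y (mul_nonneg (sq_nonneg (h o)) hdo.le)
    linarith
  set I : (κ → ℝ) → ℝ≥0∞ := {ψ : κ → ℝ | |ψ o - β * ψ y| ≤ β * |ψ y|}.indicator 1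
  have hms : MeasurableSet {ψ : κ → ℝ | |ψ o - β * ψ y| ≤ β * |ψ y|} :=
    measurableSet_le (by fun_prop) (by fun_prop)
  have hI : Measurable I := measurable_one.indicator hms
  have hwin : ∫⁻ ψ, I ψ * gw A ∅ c ψ ≤ ENNReal.ofReal (8 * K) * Z := by
    refine (lintegral_window_le hA hoy hβ c).trans ?_
    have hb0 : 0 ≤ 2 * β * √(A o o) := by positivity
    simp_rw [ENNReal.ofReal_mul hb0, mul_assoc]
    rw [lintegral_const_mul _ (by fun_prop)]
    calc _ ≤ ENNReal.ofReal (2 * (β * √(A o o))) * (ENNReal.ofReal (4 * √(h y)) * Z) := by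
          gcongr
          exact lintegral_abs_le hA hh hy c
      _ = ENNReal.ofReal (8 * (β * √(A o o) * √(h y))) * Z := by
          rw [← mul_assoc, ← ENNReal.ofReal_mul (by positivity)]
          congr 2
          ring
      _ ≤ _ := by gcongr
  have hpt : ∀ ψ : κ → ℝ, ENNReal.ofReal (sgnFac (ψ o) (ψ y)) * gw A ∅ c ψ +
      ENNReal.ofReal (sgnFac ((ψ - (2 * (ψ y / h y)) • h) o) ((ψ - (2 * (ψ y / h y)) • h) y)) *
        gw A ∅ c ψ ≤ 2 * gw A ∅ c ψ + 2 * (I ψ * gw A ∅ c ψ) := by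
    intro ψ
    have e1 : (ψ - (2 * (ψ y / h y)) • h) o = ψ o - 2 * β * ψ y := by
      simp only [Pi.sub_apply, Pi.smul_apply, smul_eq_mul, β]
      ring
    have e2 : (ψ - (2 * (ψ y / h y)) • h) y = -ψ y := by
      simp only [Pi.sub_apply, Pi.smul_apply, smul_eq_mul]
      field_simp
      ring
    rw [e1, e2, ← add_mul, ← mul_assoc, ← add_mul, ← ENNReal.ofReal_add (sgnFac_mem _ _).1
      (sgnFac_mem _ _).1]
    gcongr
    refine (ENNReal.ofReal_le_ofReal (sgnFac_reflect hβ)).trans ?_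
    split_ifs with h3
    · rw [show I ψ = 1 from Set.indicator_of_mem (s := {ψ : κ → ℝ | _}) h3 _]
      norm_num
    · simp
  have hsum := lintegral_mono (μ := volume) hpt
  rw [lintegral_add_left (by fun_prop), lintegral_add_left (by fun_prop),
    ← lintegral_reflect hA hh hy c (f := fun ψ => ENNReal.ofReal (sgnFac (ψ o) (ψ y)))
      (by fun_prop), lintegral_const_mul _ (by fun_prop), lintegral_const_mul _ (by fun_prop),
    ← two_mul, ← mul_add] at hsum
  have h4 := (ENNReal.mul_le_mul_iff_right (by norm_num) (by norm_num)).1 hsum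
  refine h4.trans ?_
  rw [ENNReal.ofReal_add zero_le_one (by positivity), ENNReal.ofReal_one, add_mul, one_mul]
  gcongr

/-- Sign correlations of a Gaussian field with additional mass are controlled by the covariance. -/
theorem lintegral_sgnFac_le {o y : κ} (hoy : o ≠ y) {K : ℝ} (hK : 0 ≤ K) {c : κ → ℝ}
    (s : Finset κ) (hc : ∀ i ∈ s, 0 ≤ c i) : ∀ {A : Matrix κ κ ℝ}, PD A → OffNonpos A →
    ∀ {h : κ → ℝ}, A *ᵥ h = Pi.single y 1 → h o ^ 2 * A o o * A y y ≤ K ^ 2 →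
    ∫⁻ ψ, ENNReal.ofReal (sgnFac (ψ o) (ψ y)) * gw A s c ψ ≤
      ENNReal.ofReal (1 + 8 * K) * ∫⁻ ψ, gw A s c ψ := by
  induction s using Finset.induction_on with
  | empty =>
    intro A hA hO h hh hhK
    exact lintegral_sgnFac_le_base hA hO hoy hh hK hhK c
  | insert i s hi ih =>
    intro A hA hO h hh hhK
    have hci := hc i (Finset.mem_insert_self _ _)
    rw [lintegral_gw_insert A hi hci (by fun_prop)]
    have e2 := lintegral_gw_insert A hi hci (H := fun _ => 1) measurable_const
    simp only [one_mul] at e2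
    rw [e2, ← lintegral_const_mul' _ _ ENNReal.ofReal_ne_top]
    refine lintegral_mono fun n => ?_
    have hs : 0 ≤ (n ^ 2)⁻¹ * c i ^ 2 := by positivity
    obtain ⟨h', hh'⟩ := (hA.bump i hs).exists_mulVec_eq (Pi.single y (1 : ℝ))
    exact ih (fun j hj => hc j (Finset.mem_insert_of_mem hj)) (hA.bump i hs) (hO.bump i _) hh'
      ((hA.bump_bound hO hoy i hs hh hh').trans hhK)

end Sign

end GaussianMixture
namespace GaussianMixture

open Matrix

lemma eq_gaussianReal_of_lintegral_exp {μ : Measure ℝ} [IsProbabilityMeasure μ] {v : ℝ≥0}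
    (h : ∀ s : ℝ, ∫⁻ x, ENNReal.ofReal (exp (s * x)) ∂μ = ENNReal.ofReal (exp (v * s ^ 2 / 2))) :
    μ = gaussianReal 0 v := by
  have hmgf : mgf id μ = mgf id (gaussianReal 0 v) := by
    ext s
    rw [mgf_id_gaussianReal]
    unfold mgf
    rw [integral_eq_lintegral_of_nonneg_ae (Filter.Eventually.of_forall fun _ => (exp_pos _).le)
      (by fun_prop)]
    simp only [id_eq]
    rw [h s, ENNReal.toReal_ofReal (exp_pos _).le, zero_mul, zero_add]
  have hset : integrableExpSet id μ = Set.univ := by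
    rw [integrableExpSet_eq_of_mgf hmgf, integrableExpSet_id_gaussianReal]
  refine Measure.ext_of_complexMGF_id_eq ?_
  ext z
  refine eqOn_complexMGF_of_mgf hmgf ?_
  simp [hset]

/-- A random vector all of whose linear functionals are centered Gaussian has a density. -/
theorem eq_withDensity_gw {κ : Type*} [Fintype κ] {A G : Matrix κ κ ℝ} (hA : PD A)
    (hG : ∀ t, A *ᵥ (G *ᵥ t) = t) {m : Measure (κ → ℝ)} [IsProbabilityMeasure m]
    (hm : ∀ t : κ → ℝ, m.map (fun ψ => t ⬝ᵥ ψ) =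
      gaussianReal 0 (Real.toNNReal (t ⬝ᵥ G *ᵥ t))) (c : κ → ℝ) :
    m = (∫⁻ ψ, gw A ∅ c ψ)⁻¹ • volume.withDensity (gw A ∅ c) := by
  set Z := ∫⁻ ψ, gw A ∅ c ψ with hZ
  have hZ0 : Z ≠ 0 := lintegral_gw_ne_zero A ∅ c
  have hZt : Z ≠ ⊤ := hA.lintegral_gw_ne_top c
  set μ := Z⁻¹ • volume.withDensity (gw A ∅ c) with hμ
  have hμp : IsProbabilityMeasure μ := by
    constructor
    rw [hμ, Measure.smul_apply, withDensity_apply _ MeasurableSet.univ, setLIntegral_univ,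
      smul_eq_mul, ENNReal.inv_mul_cancel hZ0 hZt]
  have hlin : ∀ t : κ → ℝ, Measurable fun ψ : κ → ℝ => t ⬝ᵥ ψ := fun t => by
    simp only [dotProduct]
    fun_prop
  have hmap : ∀ t : κ → ℝ, μ.map (fun ψ => t ⬝ᵥ ψ) =
      gaussianReal 0 (Real.toNNReal (t ⬝ᵥ G *ᵥ t)) := by
    intro t
    have : IsProbabilityMeasure (μ.map (fun ψ => t ⬝ᵥ ψ)) :=
      Measure.isProbabilityMeasure_map (hlin t).aemeasurable
    refine eq_gaussianReal_of_lintegral_exp fun s => ?_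
    have hs := hlin t
    rw [lintegral_map (by fun_prop) hs, hμ, lintegral_smul_measure,
      lintegral_withDensity_eq_lintegral_mul _ (measurable_gw A ∅ c) (by fun_prop)]
    have h1 := lintegral_exp_linear hA (t := s • t) (h := s • (G *ᵥ t))
      (by rw [mulVec_smul, hG]) c
    simp only [smul_dotProduct, dotProduct_smul, smul_eq_mul] at h1
    simp only [Pi.mul_apply, smul_eq_mul]
    simp_rw [mul_comm (gw A ∅ c _)]
    rw [h1, mul_comm _ Z, ← mul_assoc, ENNReal.inv_mul_cancel hZ0 hZt, one_mul]
    have hnn : 0 ≤ t ⬝ᵥ G *ᵥ t := by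
      have := hA.nonneg (G *ᵥ t)
      rwa [hG, dotProduct_comm] at this
    rw [Real.coe_toNNReal _ hnn]
    congr 2
    ring
  refine Measure.ext_of_charFunDual ?_
  ext L
  have hL : (L : (κ → ℝ) → ℝ) = fun ψ => (fun i => L (Pi.single i 1)) ⬝ᵥ ψ := by
    ext ψ
    have h := LinearMap.pi_apply_eq_sum_univ (L : (κ → ℝ) →ₗ[ℝ] ℝ) ψ
    simp only [ContinuousLinearMap.coe_coe, smul_eq_mul] at h
    rw [h]
    refine Finset.sum_congr rfl fun i _ => ?_
    rw [mul_comm]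
    congr 2
    ext j
    simp [Pi.single_apply, eq_comm]
  rw [charFunDual_eq_charFun_map_one, charFunDual_eq_charFun_map_one, hL, hm, hmap]

end GaussianMixture

namespace GaussNet

open BondPerc

section Fields

variable {V : Type*}

/-- Gaussian edge weight. -/
def bond (w : V → V → ℝ) (ψ : V → ℝ) (x y : V) : ℝ := exp (-(1 / 2) * (w x y * (ψ x - ψ y) ^ 2))

/-- Sign-symmetrised Gaussian edge weight. -/
def absBond (w : V → V → ℝ) (ψ : V → ℝ) (x y : V) : ℝ :=
  exp (-(1 / 2) * (w x y * (|ψ x| + |ψ y|) ^ 2))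

/-- Conditional probability that an edge is closed. -/
def closed (w : V → V → ℝ) (ψ : V → ℝ) (x y : V) : ℝ := exp (-(2 * w x y * max (ψ x * ψ y) 0))

/-- Gaussian density of the network restricted to `N`. -/
def dens (w : V → V → ℝ) (N : Finset V) (ψ : V → ℝ) : ℝ := ∏ e ∈ edges N, bond w ψ e.1 e.2

/-- Dirichlet energy. -/
def en (w : V → V → ℝ) (N : Finset V) (f : V → ℝ) : ℝ :=
  ∑ e ∈ edges N, w e.1 e.2 * (f e.1 - f e.2) ^ 2

/-- Laplace matrix. -/
def lap (w : V → V → ℝ) (N : Finset V) (x y : V) : ℝ :=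
  (if x = y then ∑ v ∈ N, w x v else 0) - w x y

/-- Flip the signs on `T`. -/
def flip (T : Finset V) (ψ : V → ℝ) (x : V) : ℝ := if x ∈ T then -ψ x else ψ x

variable {w : V → V → ℝ} {N T O : Finset V} {ψ : V → ℝ}

lemma bond_mul_closed (w : V → V → ℝ) (ψ : V → ℝ) (x y : V) :
    bond w ψ x y * closed w ψ x y = absBond w ψ x y := by
  unfold bond closed absBond
  rw [← exp_add]
  congr 1
  have h : max (ψ x * ψ y) 0 = (ψ x * ψ y + |ψ x| * |ψ y|) / 2 := by
    rw [← abs_mul]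
    rcases le_total 0 (ψ x * ψ y) with h | h
    · rw [max_eq_left h, abs_of_nonneg h]; ring
    · rw [max_eq_right h, abs_of_nonpos h]; ring
  rw [h]
  linear_combination (-(1 / 2) * w x y) * (-sq_abs (ψ x) - sq_abs (ψ y))

lemma closed_symm (hw : ∀ x y, w x y = w y x) (ψ : V → ℝ) (x y : V) :
    closed w ψ x y = closed w ψ y x := by
  simp only [closed, hw x y, mul_comm (ψ x)]

lemma bond_symm (hw : ∀ x y, w x y = w y x) (ψ : V → ℝ) (x y : V) :
    bond w ψ x y = bond w ψ y x := by
  simp only [bond, hw x y]; congr 1; ring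

lemma closed_mem (hw : ∀ x y, 0 ≤ w x y) (ψ : V → ℝ) (x y : V) :
    closed w ψ x y ∈ Set.Icc (0 : ℝ) 1 := by
  refine ⟨(exp_pos _).le, exp_le_one_iff.2 ?_⟩
  have := mul_nonneg (hw x y) (le_max_right (ψ x * ψ y) 0)
  linarith

lemma mul_pos_of_closed_ne_one {x y : V} (h : closed w ψ x y ≠ 1) : 0 < ψ x * ψ y := by
  by_contra! h'
  exact h (by simp [closed, max_eq_right h'])

lemma dens_pos (w : V → V → ℝ) (N : Finset V) (ψ : V → ℝ) : 0 < dens w N ψ :=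
  Finset.prod_pos fun _ _ => exp_pos _

lemma dens_eq_exp (w : V → V → ℝ) (N : Finset V) (ψ : V → ℝ) :
    dens w N ψ = exp (-(1 / 2) * en w N ψ) := by
  unfold dens en bond
  rw [← exp_sum, ← Finset.mul_sum]

lemma measurable_closed (w : V → V → ℝ) (x y : V) : Measurable fun ψ => closed w ψ x y := by
  unfold closed
  fun_prop

lemma measurable_dens (w : V → V → ℝ) (N : Finset V) : Measurable fun ψ => dens w N ψ := by
  unfold dens bond
  fun_prop

lemma measurable_conn (w : V → V → ℝ) (S T : Finset V) :
    Measurable fun ψ => conn (closed w ψ) S T := by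
  unfold conn pr wt
  have := measurable_closed w
  fun_prop

lemma measurable_clus (w : V → V → ℝ) (N S T : Finset V) :
    Measurable fun ψ => clus (closed w ψ) N S T := by
  unfold clus
  have := measurable_closed w
  have := measurable_conn w S T
  fun_prop

lemma sum_edges_split {N O : Finset V} (hO : O ⊆ N) (s : V → V → ℝ)
    (hs : ∀ x y, s x y = s y x) :
    ∑ e ∈ edges N, s e.1 e.2 = (∑ e ∈ edges O, s e.1 e.2) +
      (∑ x ∈ O, ∑ z ∈ N \ O, s x z) + ∑ e ∈ edges (N \ O), s e.1 e.2 := by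
  have := prod_edges_split hO (fun x y => exp (s x y)) fun x y => by rw [hs]
  simp only [← exp_sum, ← exp_add] at this
  exact exp_injective this

lemma two_mul_sum_edges (N : Finset V) (s : V → V → ℝ) (hs : ∀ x y, s x y = s y x)
    (h0 : ∀ x, s x x = 0) :
    2 * ∑ e ∈ edges N, s e.1 e.2 = ∑ x ∈ N, ∑ y ∈ N, s x y := by
  rw [← Finset.sum_product' (f := s)]
  have h1 : ∑ e ∈ N ×ˢ N, s e.1 e.2 = ∑ e ∈ (N ×ˢ N).filter (fun e => WellOrderingRel e.1 e.2),
      s e.1 e.2 + ∑ e ∈ (N ×ˢ N).filter (fun e => WellOrderingRel e.2 e.1), s e.1 e.2 := by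
    rw [Finset.sum_filter, Finset.sum_filter, ← Finset.sum_add_distrib]
    refine Finset.sum_congr rfl fun e _ => ?_
    by_cases he : e.1 = e.2
    · rw [he, h0]; simp
    · rcases wor_total he with h | h
      · rw [if_pos h, if_neg (wor_asymm h), add_zero]
      · rw [if_pos h, if_neg (wor_asymm h), zero_add]
  have h2 : ∑ e ∈ (N ×ˢ N).filter (fun e => WellOrderingRel e.2 e.1), s e.1 e.2 =
      ∑ e ∈ edges N, s e.1 e.2 := by
    refine Finset.sum_nbij' Prod.swap Prod.swap ?_ ?_ (fun _ _ => rfl) (fun _ _ => rfl)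
      (fun e _ => hs _ _)
    · intro e he
      simp only [Finset.mem_filter, Finset.mem_product] at he
      exact mem_edges.2 ⟨⟨he.1.2, he.1.1⟩, he.2⟩
    · intro e he
      have := mem_edges.1 he
      simp only [Finset.mem_filter, Finset.mem_product]
      exact ⟨⟨this.1.2, this.1.1⟩, this.2⟩
  rw [h1, h2, two_mul]
  rfl

/-- Energy as a quadratic form. -/
lemma en_eq (hw : ∀ x y, w x y = w y x) (N : Finset V) (f : V → ℝ) :
    en w N f = ∑ x ∈ N, f x * ∑ y ∈ N, lap w N x y * f y := by
  have h := two_mul_sum_edges N (fun x y => w x y * (f x - f y) ^ 2)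
    (fun x y => by rw [hw x y]; ring) (fun x => by simp)
  have h1 : ∑ x ∈ N, ∑ y ∈ N, w x y * (f x - f y) ^ 2 =
      ∑ x ∈ N, ∑ y ∈ N, w x y * f x ^ 2 + ∑ x ∈ N, ∑ y ∈ N, w x y * f y ^ 2 -
        2 * ∑ x ∈ N, ∑ y ∈ N, w x y * f x * f y := by
    simp only [Finset.mul_sum, ← Finset.sum_add_distrib, ← Finset.sum_sub_distrib]
    exact Finset.sum_congr rfl fun x _ => Finset.sum_congr rfl fun y _ => by ring
  have h2 : ∑ x ∈ N, ∑ y ∈ N, w x y * f y ^ 2 = ∑ x ∈ N, ∑ y ∈ N, w x y * f x ^ 2 := by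
    rw [Finset.sum_comm]
    exact Finset.sum_congr rfl fun x _ => Finset.sum_congr rfl fun y _ => by rw [hw]
  have h3 : ∑ x ∈ N, f x * ∑ y ∈ N, lap w N x y * f y =
      ∑ x ∈ N, ∑ y ∈ N, w x y * f x ^ 2 - ∑ x ∈ N, ∑ y ∈ N, w x y * f x * f y := by
    rw [← Finset.sum_sub_distrib]
    refine Finset.sum_congr rfl fun x hx => ?_
    have : ∑ y ∈ N, lap w N x y * f y = (∑ v ∈ N, w x v) * f x - ∑ y ∈ N, w x y * f y := by
      simp only [lap, sub_mul, Finset.sum_sub_distrib, ite_mul, zero_mul]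
      rw [Finset.sum_ite_eq, if_pos hx]
    rw [this, mul_sub, Finset.sum_mul, Finset.mul_sum, Finset.mul_sum]
    congr 1
    · exact Finset.sum_congr rfl fun y _ => by ring
    · exact Finset.sum_congr rfl fun y _ => by ring
  unfold en
  linarith

lemma lap_symm (hw : ∀ x y, w x y = w y x) (N : Finset V) (x y : V) :
    lap w N x y = lap w N y x := by
  unfold lap
  by_cases h : x = y
  · rw [h]
  · rw [if_neg h, if_neg (Ne.symm h), hw]

/-- Cauchy-Schwarz inequality for the energy. -/
lemma en_cauchy (hw : ∀ x y, w x y = w y x) (hw0 : ∀ x y, 0 ≤ w x y) (N : Finset V)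
    (f h : V → ℝ) :
    (∑ x ∈ N, f x * ∑ y ∈ N, lap w N x y * h y) ^ 2 ≤ en w N f * en w N h := by
  set B := fun f h : V → ℝ => ∑ x ∈ N, f x * ∑ y ∈ N, lap w N x y * h y with hB
  have hs : B h f = B f h := by
    simp only [hB, Finset.mul_sum]
    rw [Finset.sum_comm]
    exact Finset.sum_congr rfl fun x _ => Finset.sum_congr rfl fun y _ => by
      rw [lap_symm hw]; ring
  have hq : ∀ t : ℝ, 0 ≤ en w N h * (t * t) + (2 * B f h) * t + en w N f := by
    intro t
    have h1 : en w N (fun x => f x + t * h x) = en w N f + t * B f h + t * B h f +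
        t ^ 2 * en w N h := by
      rw [en_eq hw, en_eq hw, en_eq hw]
      simp only [hB, Finset.mul_sum, ← Finset.sum_add_distrib]
      exact Finset.sum_congr rfl fun x _ => Finset.sum_congr rfl fun y _ => by ring
    have h2 : 0 ≤ en w N (fun x => f x + t * h x) :=
      Finset.sum_nonneg fun e _ => mul_nonneg (hw0 _ _) (sq_nonneg _)
    rw [h1, hs] at h2
    linarith
  have := discrim_le_zero hq
  unfold discrim at this
  change (B f h) ^ 2 ≤ _
  nlinarith

lemma dens_mul_prod_closed (hw : ∀ x y, w x y = w y x) (hO : O ⊆ N) :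
    dens w N ψ * ∏ x ∈ O, ∏ z ∈ N \ O, closed w ψ x z =
      dens w O ψ * (∏ x ∈ O, ∏ z ∈ N \ O, absBond w ψ x z) * dens w (N \ O) ψ := by
  have h := prod_edges_split hO (bond w ψ) (bond_symm hw ψ)
  have h2 : ∏ x ∈ O, ∏ z ∈ N \ O, absBond w ψ x z =
      (∏ x ∈ O, ∏ z ∈ N \ O, bond w ψ x z) * ∏ x ∈ O, ∏ z ∈ N \ O, closed w ψ x z := by
    simp only [← Finset.prod_mul_distrib, bond_mul_closed]
  unfold dens
  rw [h, h2]
  ring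

lemma dens_mul_clus (hw : ∀ x y, w x y = w y x) (hO : O ⊆ N) (S : Finset V) :
    dens w N ψ * clus (closed w ψ) N S O =
      conn (closed w ψ) S O * dens w O ψ * (∏ x ∈ O, ∏ z ∈ N \ O, absBond w ψ x z) *
        dens w (N \ O) ψ := by
  have h := dens_mul_prod_closed (ψ := ψ) hw hO
  unfold clus
  linear_combination conn (closed w ψ) S O * h

/-- Gaussian form of the density with all edges leaving `O` closed. -/
lemma dens_mul_prod_closed_eq_exp (hw : ∀ x y, w x y = w y x) (hO : O ⊆ N) :
    dens w N ψ * ∏ x ∈ O, ∏ z ∈ N \ O, closed w ψ x z =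
      exp (-(1 / 2) * (en w O ψ + ∑ x ∈ O, ∑ z ∈ N \ O, w x z * ψ x ^ 2)) *
        exp (-(1 / 2) * en w N (fun x => if x ∈ O then 0 else ψ x) -
          ∑ z ∈ N \ O, (∑ x ∈ O, w x z * |ψ x|) * |ψ z|) := by
  rw [dens_mul_prod_closed hw hO, dens_eq_exp, dens_eq_exp]
  simp only [absBond, ← exp_sum, ← exp_add]
  congr 1
  set f : V → ℝ := fun x => if x ∈ O then 0 else ψ x
  have h1 : en w N f = (∑ x ∈ O, ∑ z ∈ N \ O, w x z * ψ z ^ 2) + en w (N \ O) ψ := by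
    unfold en
    rw [sum_edges_split hO (fun x y => w x y * (f x - f y) ^ 2)
      (fun x y => by rw [hw x y]; ring)]
    have e1 : ∑ e ∈ edges O, w e.1 e.2 * (f e.1 - f e.2) ^ 2 = 0 :=
      Finset.sum_eq_zero fun e he => by simp [f, (mem_edges.1 he).1.1, (mem_edges.1 he).1.2]
    rw [e1, zero_add]
    congr 1
    · refine Finset.sum_congr rfl fun x hx => Finset.sum_congr rfl fun z hz => ?_
      simp [f, hx, (Finset.mem_sdiff.1 hz).2]
    · refine Finset.sum_congr rfl fun e he => ?_
      have := (mem_edges.1 he).1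
      simp [f, (Finset.mem_sdiff.1 this.1).2, (Finset.mem_sdiff.1 this.2).2]
  have h2 : ∑ x ∈ O, ∑ z ∈ N \ O, -(1 / 2) * (w x z * (|ψ x| + |ψ z|) ^ 2) =
      -(1 / 2) * (∑ x ∈ O, ∑ z ∈ N \ O, w x z * ψ x ^ 2) -
      (1 / 2) * (∑ x ∈ O, ∑ z ∈ N \ O, w x z * ψ z ^ 2) -
      ∑ z ∈ N \ O, (∑ x ∈ O, w x z * |ψ x|) * |ψ z| := by
    simp only [Finset.sum_mul]
    rw [Finset.sum_comm (s := N \ O)]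
    simp only [Finset.mul_sum, ← Finset.sum_sub_distrib]
    refine Finset.sum_congr rfl fun x _ => Finset.sum_congr rfl fun y _ => ?_
    linear_combination (-(1 / 2) * w x y) * (sq_abs (ψ x) + sq_abs (ψ y))
  rw [h1, h2]
  ring

lemma abs_flip (T : Finset V) (ψ : V → ℝ) (x : V) : |flip T ψ x| = |ψ x| := by
  unfold flip
  split_ifs <;> simp

lemma flip_of_notMem {x : V} (h : x ∉ T) : flip T ψ x = ψ x := if_neg h

lemma flip_of_mem {x : V} (h : x ∈ T) : flip T ψ x = -ψ x := if_pos h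

lemma absBond_flip (x y : V) : absBond w (flip T ψ) x y = absBond w ψ x y := by
  unfold absBond
  rw [abs_flip, abs_flip]

lemma conn_flip (S : Finset V) : conn (closed w (flip T ψ)) S T = conn (closed w ψ) S T :=
  conn_congr fun x hx y hy => by simp [closed, flip_of_mem hx, flip_of_mem hy]

lemma dens_flip : dens w T (flip T ψ) = dens w T ψ := by
  refine Finset.prod_congr rfl fun e he => ?_
  have := (mem_edges.1 he).1
  simp only [bond, flip_of_mem this.1, flip_of_mem this.2]
  congr 1; ring

lemma dens_congr {ψ' : V → ℝ} (h : ∀ x ∈ N, ψ x = ψ' x) : dens w N ψ = dens w N ψ' := by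
  refine Finset.prod_congr rfl fun e he => ?_
  have := (mem_edges.1 he).1
  simp only [bond, h _ this.1, h _ this.2]

lemma conn_field_congr {ψ' : V → ℝ} {S : Finset V} (h : ∀ x ∈ N, ψ x = ψ' x) :
    conn (closed w ψ) S N = conn (closed w ψ') S N :=
  conn_congr fun x hx y hy => by simp only [closed, h _ hx, h _ hy]

/-- Flipping the signs on a cluster leaves the joint weight invariant. -/
lemma dens_mul_clus_flip (hw : ∀ x y, w x y = w y x) (hT : T ⊆ N) (S : Finset V) :
    dens w N (flip T ψ) * clus (closed w (flip T ψ)) N S T =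
      dens w N ψ * clus (closed w ψ) N S T := by
  rw [dens_mul_clus hw hT, dens_mul_clus hw hT, conn_flip, dens_flip]
  simp only [absBond_flip]
  rw [dens_congr (N := N \ T) fun x hx => flip_of_notMem (Finset.mem_sdiff.1 hx).2]

/-- Joint weight of two disjoint clusters, one of which is flipped. -/
lemma dens_mul_clus_clus_flip (hw : ∀ x y, w x y = w y x) (hO : O ⊆ N) (hT : T ⊆ N \ O)
    (R S : Finset V) :
    dens w N (flip T ψ) * clus (closed w (flip T ψ)) N R O *
        clus (closed w (flip T ψ)) (N \ O) S T =
      dens w N ψ * clus (closed w ψ) N R O * clus (closed w ψ) (N \ O) S T := by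
  have h : ∀ x ∈ O, flip T ψ x = ψ x := fun x hx =>
    flip_of_notMem fun h => (Finset.mem_sdiff.1 (hT h)).2 hx
  rw [dens_mul_clus hw hO, dens_mul_clus hw hO, mul_assoc, dens_mul_clus_flip hw hT, ← mul_assoc,
    conn_field_congr h, dens_congr h]
  simp only [absBond_flip]

end Fields

end GaussNet

namespace GaussNet

open BondPerc GaussianMixture Matrix

/-- A finite electrical network on `insert bd F` grounded at `bd`, with its Green function. -/
structure Net (V : Type*) where
  w : V → V → ℝ
  F : Finset V
  bd : V
  G : V → V → ℝ
  w_symm : ∀ x y, w x y = w y x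
  w_nonneg : ∀ x y, 0 ≤ w x y
  bd_notMem : bd ∉ F
  G_symm : ∀ x y, G x y = G y x
  G_nonneg : ∀ x y, 0 ≤ G x y
  G_bd : ∀ y, G bd y = 0
  lap_G : ∀ x ∈ F, ∀ y ∈ F, ∑ z ∈ insert bd F, lap w (insert bd F) x z * G z y =
    if x = y then 1 else 0

namespace Net

variable {V : Type*} (K : Net V)

/-- All vertices of the network. -/
def N : Finset V := insert K.bd K.F

lemma F_subset : K.F ⊆ K.N := Finset.subset_insert _ _

lemma bd_mem : K.bd ∈ K.N := Finset.mem_insert_self _ _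

lemma sum_N (f : V → ℝ) : ∑ x ∈ K.N, f x = f K.bd + ∑ x ∈ K.F, f x :=
  Finset.sum_insert K.bd_notMem

/-- Pairing with a potential. -/
lemma pairing {f : V → ℝ} (hf : f K.bd = 0) {S : Finset V} (hS : S ⊆ K.F) (μ : V → ℝ) :
    ∑ x ∈ K.N, f x * ∑ y ∈ K.N, lap K.w K.N x y * ∑ v ∈ S, K.G y v * μ v =
      ∑ v ∈ S, f v * μ v := by
  rw [K.sum_N, hf, zero_mul, zero_add]
  have h : ∀ x ∈ K.F, ∑ y ∈ K.N, lap K.w K.N x y * ∑ v ∈ S, K.G y v * μ v =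
      ∑ v ∈ S, if x = v then μ v else 0 := by
    intro x hx
    simp only [Finset.mul_sum]
    rw [Finset.sum_comm]
    refine Finset.sum_congr rfl fun v hv => ?_
    have := K.lap_G x hx v (hS hv)
    simp only [← mul_assoc]
    rw [← Finset.sum_mul]
    change (∑ i ∈ insert K.bd K.F, lap K.w (insert K.bd K.F) x i * K.G i v) * μ v = _
    rw [this, ite_mul, one_mul, zero_mul]
  rw [Finset.sum_congr rfl fun x hx => by rw [h x hx]]
  simp only [Finset.mul_sum]
  rw [Finset.sum_comm]
  refine Finset.sum_congr rfl fun v hv => ?_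
  simp only [mul_ite, mul_zero]
  rw [Finset.sum_ite_eq', if_pos (hS hv)]

lemma en_potential {S : Finset V} (hS : S ⊆ K.F) (μ : V → ℝ) :
    en K.w K.N (fun y => ∑ v ∈ S, K.G y v * μ v) =
      ∑ x ∈ S, ∑ y ∈ S, μ x * K.G x y * μ y := by
  rw [en_eq K.w_symm, K.pairing (by simp [K.G_bd]) hS]
  refine Finset.sum_congr rfl fun x _ => ?_
  rw [Finset.sum_mul]
  exact Finset.sum_congr rfl fun y _ => by ring

lemma sq_pairing_le {f : V → ℝ} (hf : f K.bd = 0) {S : Finset V} (hS : S ⊆ K.F) (μ : V → ℝ) :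
    (∑ v ∈ S, f v * μ v) ^ 2 ≤ en K.w K.N f * ∑ x ∈ S, ∑ y ∈ S, μ x * K.G x y * μ y := by
  rw [← K.pairing hf hS μ, ← K.en_potential hS]
  exact en_cauchy K.w_symm K.w_nonneg _ _ _

/-- Dual bound for the capacity of `S`. -/
lemma capacity_le {f : V → ℝ} {b : ℝ} {S : Finset V} (hS : S ⊆ K.F) (h0 : ∀ x ∈ S, f x = 0)
    (hb : f K.bd = b) (μ : V → ℝ) :
    (b * ∑ x ∈ S, μ x) ^ 2 ≤ en K.w K.N f * ∑ x ∈ S, ∑ y ∈ S, μ x * K.G x y * μ y := by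
  have h1 := K.sq_pairing_le (f := fun x => b - f x) (by simp [hb]) hS μ
  have h2 : ∑ v ∈ S, (b - f v) * μ v = b * ∑ x ∈ S, μ x := by
    rw [Finset.mul_sum]
    exact Finset.sum_congr rfl fun x hx => by rw [h0 x hx, sub_zero]
  have h3 : en K.w K.N (fun x => b - f x) = en K.w K.N f :=
    Finset.sum_congr rfl fun e _ => by ring
  rwa [h2, h3] at h1

/-- The matrix of the Dirichlet form on functions supported on `U`. -/
def mat (U : Finset V) : Matrix U U ℝ := fun x y => lap K.w K.N x y

/-- Conductance to the ground. -/
def kill (U : Finset V) : U → ℝ := fun x => K.w x K.bd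

lemma dotProduct_mat (U : Finset V) (f g : V → ℝ) :
    (fun u : U => f u) ⬝ᵥ K.mat U *ᵥ (fun u : U => g u) =
      ∑ x ∈ U, f x * ∑ y ∈ U, lap K.w K.N x y * g y := by
  simp only [dotProduct, mulVec, mat]
  rw [← Finset.sum_coe_sort U (fun x => f x * ∑ y ∈ U, lap K.w K.N x y * g y)]
  refine Finset.sum_congr rfl fun x _ => ?_
  rw [← Finset.sum_coe_sort U (fun y => lap K.w K.N x y * g y)]

/-- Energy of a function living on `U` and at the ground. -/
lemma en_ext {U : Finset V} (hU : U ⊆ K.F) {f : V → ℝ} (hf : ∀ x ∈ K.F, x ∉ U → f x = 0) :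
    en K.w K.N f = (fun u : U => f u) ⬝ᵥ K.mat U *ᵥ (fun u : U => f u) -
      2 * f K.bd * (K.kill U ⬝ᵥ fun u : U => f u) + f K.bd ^ 2 * lap K.w K.N K.bd K.bd := by
  have hr : ∀ s : V → ℝ, (∀ x ∈ K.F, x ∉ U → s x = 0) →
      ∑ x ∈ K.N, s x = s K.bd + ∑ x ∈ U, s x := by
    intro s hs
    rw [K.sum_N, Finset.sum_subset hU hs]
  rw [en_eq K.w_symm, K.dotProduct_mat, hr _ fun x hx hxU => by rw [hf x hx hxU, zero_mul]]
  have hr2 : ∀ x, ∑ y ∈ K.N, lap K.w K.N x y * f y =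
      lap K.w K.N x K.bd * f K.bd + ∑ y ∈ U, lap K.w K.N x y * f y := fun x =>
    hr _ fun y hy hyU => by rw [hf y hy hyU, mul_zero]
  simp only [hr2, mul_add, Finset.sum_add_distrib]
  have hne : ∀ x ∈ U, lap K.w K.N x K.bd = -K.w x K.bd := fun x hx => by
    rw [lap, if_neg (fun (h : x = K.bd) => K.bd_notMem (hU (h ▸ hx))), zero_sub]
  have hk : K.kill U ⬝ᵥ (fun u : U => f u) = ∑ x ∈ U, K.w x K.bd * f x := by
    simp only [dotProduct, kill]
    rw [← Finset.sum_coe_sort U (fun x => K.w x K.bd * f x)]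
  have e1 : ∑ y ∈ U, lap K.w K.N K.bd y * f y = -∑ x ∈ U, K.w x K.bd * f x := by
    rw [← Finset.sum_neg_distrib]
    exact Finset.sum_congr rfl fun x hx => by rw [lap_symm K.w_symm, hne x hx]; ring
  have e2 : ∑ x ∈ U, f x * (lap K.w K.N x K.bd * f K.bd) =
      -(f K.bd * ∑ x ∈ U, K.w x K.bd * f x) := by
    rw [Finset.mul_sum, ← Finset.sum_neg_distrib]
    exact Finset.sum_congr rfl fun x hx => by rw [hne x hx]; ring
  rw [e1, e2, hk]
  ring

/-- Extension of a function on `U` by a constant. -/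
def ext (U : Finset V) (b : ℝ) (y : U → ℝ) : V → ℝ := Function.updateFinset (fun _ => b) U y

lemma ext_of_notMem {U : Finset V} {b : ℝ} {y : U → ℝ} {x : V} (h : x ∉ U) :
    ext U b y x = b := by
  simp [ext, Function.updateFinset, h]

lemma ext_coe {U : Finset V} {b : ℝ} {y : U → ℝ} : (fun u : U => ext U b y u) = y := by
  ext u
  simp [ext, Function.updateFinset]

lemma mat_pd {U : Finset V} (hU : U ⊆ K.F) : PD (K.mat U) := by
  refine ⟨Matrix.ext fun x y => lap_symm K.w_symm _ _ _, fun ψ hψ => ?_⟩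
  have hbd : ext U 0 ψ K.bd = 0 := ext_of_notMem fun h => K.bd_notMem (hU h)
  have h := K.en_ext hU (f := ext U 0 ψ) fun x _ hx => ext_of_notMem hx
  rw [hbd, ext_coe] at h
  have h' : en K.w K.N (ext U 0 ψ) = ψ ⬝ᵥ K.mat U *ᵥ ψ := by rw [h]; ring
  rw [← h']
  by_contra! hle
  refine hψ (funext fun u => ?_)
  have h0 : 0 ≤ en K.w K.N (ext U 0 ψ) :=
    Finset.sum_nonneg fun e _ => mul_nonneg (K.w_nonneg _ _) (sq_nonneg _)
  have h1 := K.sq_pairing_le hbd (S := {(u : V)}) (Finset.singleton_subset_iff.2 (hU u.2))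
    fun _ => 1
  rw [le_antisymm hle h0, zero_mul, Finset.sum_singleton, mul_one] at h1
  have h2 : ext U 0 ψ u = 0 := by
    have := le_antisymm h1 (sq_nonneg _)
    exact pow_eq_zero_iff two_ne_zero |>.1 this
  rw [← congrFun (ext_coe (U := U) (b := 0) (y := ψ)) u]
  exact h2

lemma mat_offNonpos (U : Finset V) : OffNonpos (K.mat U) := by
  intro i j hij
  have : (i : V) ≠ j := fun h => hij (Subtype.ext h)
  simp [mat, lap, this, K.w_nonneg]

/-- Integral over the field on `F`, the remaining values being `b`. -/
def I (b : ℝ) (H : (V → ℝ) → ℝ≥0∞) : ℝ≥0∞ :=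
  (∫⋯∫⁻_K.F, H ∂(fun _ => volume)) fun _ => b

lemma I_mono {b : ℝ} {H H' : (V → ℝ) → ℝ≥0∞} (h : ∀ ψ, ψ K.bd = b → H ψ ≤ H' ψ) :
    K.I b H ≤ K.I b H' :=
  lintegral_mono fun _ => h _ (ext_of_notMem K.bd_notMem)

lemma I_add {b : ℝ} {H H' : (V → ℝ) → ℝ≥0∞} (hH : Measurable H) :
    K.I b (fun ψ => H ψ + H' ψ) = K.I b H + K.I b H' :=
  lintegral_add_left (hH.comp measurable_updateFinset) _

lemma I_sum {ι : Type*} {b : ℝ} (s : Finset ι) {H : ι → (V → ℝ) → ℝ≥0∞}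
    (hH : ∀ i ∈ s, Measurable (H i)) :
    K.I b (fun ψ => ∑ i ∈ s, H i ψ) = ∑ i ∈ s, K.I b (H i) :=
  lintegral_finsetSum' _ fun i hi => ((hH i hi).comp measurable_updateFinset).aemeasurable

lemma I_const_mul {b : ℝ} {H : (V → ℝ) → ℝ≥0∞} (c : ℝ≥0∞) (hH : Measurable H) :
    K.I b (fun ψ => c * H ψ) = c * K.I b H :=
  lintegral_const_mul _ (hH.comp measurable_updateFinset)

lemma I_flip {b : ℝ} {H : (V → ℝ) → ℝ≥0∞} (hH : Measurable H) {T : Finset V} (hT : T ⊆ K.F) :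
    K.I b (fun ψ => H (flip T ψ)) = K.I b H := by
  unfold I lmarginal
  have hmp : MeasurePreserving (fun (y : K.F → ℝ) (u : K.F) => if (u : V) ∈ T then -y u else y u)
      (Measure.pi fun _ => volume) (Measure.pi fun _ => volume) := by
    have := measurePreserving_pi (fun _ : K.F => (volume : Measure ℝ)) (fun _ => volume)
      (f := fun u s => if (u : V) ∈ T then -s else s) fun u => by
        by_cases h : (u : V) ∈ T
        · simpa only [h, if_true] using Measure.measurePreserving_neg (volume : Measure ℝ)
        · simp only [h, if_false]
          exact MeasurePreserving.id (volume : Measure ℝ)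
    exact this
  refine Eq.trans ?_ (hmp.lintegral_comp (hH.comp measurable_updateFinset))
  refine lintegral_congr fun y => ?_
  beta_reduce
  congr 1
  ext x
  by_cases hx : x ∈ K.F
  · by_cases h : x ∈ T <;> simp [flip, Function.updateFinset, hx, h]
  · have h : x ∉ T := fun h => hx (hT h)
    simp [flip, Function.updateFinset, hx, h]

lemma I_shift (b : ℝ) (H : (V → ℝ) → ℝ≥0∞) :
    K.I b H = K.I 0 (fun ψ => H fun x => ψ x + b) := by
  unfold I lmarginal
  have := lintegral_add_right_eq_self (μ := (volume : Measure (K.F → ℝ)))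
    (fun y => H (Function.updateFinset (fun _ => b) K.F y)) (fun _ => b)
  change ∫⁻ y, _ ∂volume = ∫⁻ y, _ ∂volume
  rw [← this]
  refine lintegral_congr fun y => ?_
  congr 1
  ext x
  by_cases hx : x ∈ K.F <;> simp [Function.updateFinset, hx]

/-- The normalising constant. -/
def Z : ℝ≥0∞ := K.I 0 fun ψ => ENNReal.ofReal (dens K.w K.N ψ)

lemma I_dens (b : ℝ) : K.I b (fun ψ => ENNReal.ofReal (dens K.w K.N ψ)) = K.Z := by
  rw [K.I_shift]
  unfold Z dens bond
  simp only [add_sub_add_right_eq_sub]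

lemma dens_ext (y : K.F → ℝ) :
    ENNReal.ofReal (dens K.w K.N (ext K.F 0 y)) = gw (K.mat K.F) ∅ 0 y := by
  have hbd : ext K.F 0 y K.bd = 0 := ext_of_notMem K.bd_notMem
  have h := K.en_ext subset_rfl (f := ext K.F 0 y) fun x hx hx' => absurd hx hx'
  rw [hbd, ext_coe] at h
  rw [dens_eq_exp]
  unfold gw
  rw [h]
  simp

lemma Z_eq : K.Z = ∫⁻ y, gw (K.mat K.F) ∅ 0 y :=
  lintegral_congr fun y => K.dens_ext y

lemma Z_ne_zero : K.Z ≠ 0 := by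
  rw [Z_eq]
  exact lintegral_gw_ne_zero _ _ _

lemma Z_ne_top : K.Z ≠ ⊤ := by
  rw [Z_eq]
  exact (K.mat_pd subset_rfl).lintegral_gw_ne_top _

/-- Inner integral over the field outside a set of vertices all of whose edges are closed. -/
lemma lmarginal_inner {O U : Finset V} (hO : O ⊆ K.N) (hU : U ⊆ K.F) (hOU : Disjoint O U)
    (hcov : ∀ x ∈ K.F, x ∉ U → x ∈ O) {b : ℝ} (hb : K.bd ∈ O ∧ b = 0 ∨ K.bd ∉ O)
    (x : V → ℝ) (hx : K.bd ∉ O → x K.bd = b) (h : (V → ℝ) → ℝ≥0∞) :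
    (∫⋯∫⁻_U, (fun ψ => h ψ * ENNReal.ofReal (dens K.w K.N ψ *
      ∏ x ∈ O, ∏ z ∈ K.N \ O, closed K.w ψ x z)) ∂(fun _ => volume)) x =
    ENNReal.ofReal (exp (-(1 / 2) * (en K.w O x + ∑ v ∈ O, ∑ z ∈ K.N \ O, K.w v z * x v ^ 2))) *
      (ENNReal.ofReal (exp (-(1 / 2) * (b ^ 2 * lap K.w K.N K.bd K.bd) -
        (∑ v ∈ O, K.w v K.bd * |x v|) * |b|)) *
      ∫⁻ y, h (Function.updateFinset x U y) * (ENNReal.ofReal (exp ((b • K.kill U) ⬝ᵥ y)) *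
        gw (K.mat U) Finset.univ (fun u => ∑ v ∈ O, K.w v u * |x v|) y)) := by
  have hm1 : ∀ c : ℝ, (0 : ℝ) ≤ exp c := fun c => (exp_pos c).le
  rw [← lintegral_const_mul' _ _ ENNReal.ofReal_ne_top,
    ← lintegral_const_mul' _ _ ENNReal.ofReal_ne_top]
  refine lintegral_congr fun y => ?_
  set ψ := Function.updateFinset x U y with hψ
  have hψO : ∀ v, v ∉ U → ψ v = x v := fun v hv => by
    simp [ψ, Function.updateFinset, hv]
  have hO' : ∀ v ∈ O, ψ v = x v := fun v hv => hψO v (Finset.disjoint_left.1 hOU hv)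
  have hψU : (fun u : U => ψ u) = y := by
    ext u
    simp [ψ, Function.updateFinset]
  have hbdU : K.bd ∉ U := fun h => K.bd_notMem (hU h)
  beta_reduce
  rw [dens_mul_prod_closed_eq_exp K.w_symm hO]
  set f : V → ℝ := fun v => if v ∈ O then 0 else ψ v with hf
  have hfb : f K.bd = b := by
    simp only [hf]
    rcases hb with ⟨h, rfl⟩ | h
    · rw [if_pos h]
    · rw [if_neg h, hψO _ hbdU, hx h]
  have hfU : (fun u : U => f u) = y := by
    rw [← hψU]
    ext u
    simp only [hf]
    rw [if_neg (Finset.disjoint_right.1 hOU u.2)]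
  have h1 := K.en_ext hU (f := f) fun v hv hvU => by simp [hf, hcov v hv hvU]
  rw [hfb, hfU] at h1
  have h2 : en K.w O ψ = en K.w O x := Finset.sum_congr rfl fun e he => by
    have := (mem_edges.1 he).1
    rw [hO' _ this.1, hO' _ this.2]
  have h3 : ∑ v ∈ O, ∑ z ∈ K.N \ O, K.w v z * ψ v ^ 2 =
      ∑ v ∈ O, ∑ z ∈ K.N \ O, K.w v z * x v ^ 2 :=
    Finset.sum_congr rfl fun v hv => by rw [hO' v hv]
  have h4 : ∀ z, ∑ v ∈ O, K.w v z * |ψ v| = ∑ v ∈ O, K.w v z * |x v| := fun z =>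
    Finset.sum_congr rfl fun v hv => by rw [hO' v hv]
  have h5 : ∑ z ∈ K.N \ O, (∑ v ∈ O, K.w v z * |ψ v|) * |ψ z| =
      (∑ v ∈ O, K.w v K.bd * |x v|) * |b| +
        ∑ u ∈ (Finset.univ : Finset U), (∑ v ∈ O, K.w v u * |x v|) * |y u| := by
    simp only [h4]
    have h6 : ∑ u ∈ (Finset.univ : Finset U), (∑ v ∈ O, K.w v u * |x v|) * |y u| =
        ∑ z ∈ U, (∑ v ∈ O, K.w v z * |x v|) * |ψ z| := by
      rw [← Finset.sum_coe_sort U, ← hψU]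
    rw [h6]
    rcases hb with ⟨h, rfl⟩ | h
    · rw [abs_zero, mul_zero, zero_add]
      refine Finset.sum_congr ?_ fun _ _ => rfl
      ext v
      simp only [N, Finset.mem_sdiff, Finset.mem_insert]
      constructor
      · rintro ⟨rfl | hv, hvO⟩
        · exact absurd h hvO
        · by_contra hvU
          exact hvO (hcov v hv hvU)
      · exact fun hv => ⟨Or.inr (hU hv), Finset.disjoint_right.1 hOU hv⟩
    · have : K.N \ O = insert K.bd U := by
        ext v
        simp only [N, Finset.mem_sdiff, Finset.mem_insert]
        constructor
        · rintro ⟨rfl | hv, hvO⟩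
          · exact Or.inl rfl
          · refine Or.inr ?_
            by_contra hvU
            exact hvO (hcov v hv hvU)
        · rintro (rfl | hv)
          · exact ⟨Or.inl rfl, h⟩
          · exact ⟨Or.inr (hU hv), Finset.disjoint_right.1 hOU hv⟩
      rw [this, Finset.sum_insert hbdU, hψO _ hbdU, hx h]
  rw [h2, h3, h5, h1]
  unfold gw
  rw [ENNReal.ofReal_mul (hm1 _), mul_left_comm]
  congr 1
  rw [mul_left_comm, ← ENNReal.ofReal_mul (hm1 _), ← ENNReal.ofReal_mul (hm1 _), ← exp_add,
    ← exp_add, smul_dotProduct, smul_eq_mul]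
  congr 3
  ring

end Net

end GaussNet

namespace BondPerc

variable {V : Type*}

lemma reach_singleton_symm {A : Finset (V × V)} {x y : V} (h : y ∈ reach A {x}) :
    x ∈ reach A {y} := by
  obtain ⟨x', hx', h⟩ := h
  rw [Finset.mem_singleton] at hx'
  subst hx'
  refine ⟨y, Finset.mem_singleton_self _, ?_⟩
  have : Std.Symm fun u v => (u, v) ∈ A ∨ (v, u) ∈ A := ⟨fun _ _ h => h.symm⟩
  exact Relation.ReflTransGen.stdSymm.symm _ _ h

lemma reach_singleton_trans {A : Finset (V × V)} {x y z : V} (h : y ∈ reach A {x})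
    (hz : z ∈ reach A {y}) : z ∈ reach A {x} := by
  obtain ⟨x', hx', h⟩ := h
  obtain ⟨y', hy', hz⟩ := hz
  rw [Finset.mem_singleton] at hx' hy'
  subst hx' hy'
  exact ⟨_, Finset.mem_singleton_self _, h.trans hz⟩

/-- Decomposition of the law of a cluster according to another, disjoint cluster. -/
lemma clus_eq_sum {k : V → V → ℝ} (hk : ∀ x y, k x y = k y x) {N T : Finset V} {o p : V}
    (hp : p ∈ N) (hpT : p ∉ T) (ho : o ∈ T) (hT : T ⊆ N) :
    clus k N {o} T = ∑ O ∈ N.powerset with p ∈ O ∧ Disjoint O T,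
      clus k N {p} O * clus k (N \ O) {o} T := by
  have hfin : ∀ A ⊆ edges N, ∃ O : Finset V, O ⊆ N ∧ reach A {p} = O := by
    intro A hA
    have h1 := reach_subset hA (Finset.singleton_subset_iff.2 hp)
    refine ⟨(N.finite_toSet.subset h1).toFinset, ?_, ?_⟩
    · intro y hy
      exact h1 ((Set.Finite.mem_toFinset _).1 hy)
    · simp
  choose! f hf1 hf2 using hfin
  rw [clus_eq hk (Finset.singleton_subset_iff.2 ho) hT,
    ← sum_pr f (N.powerset.filter fun O => p ∈ O ∧ Disjoint O T)]
  · refine Finset.sum_congr rfl fun O hO => ?_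
    simp only [Finset.mem_filter, Finset.mem_powerset] at hO
    obtain ⟨hON, hpO, hd⟩ := hO
    have hTU : T ⊆ N \ O := Finset.subset_sdiff.2 ⟨hT, hd.symm⟩
    have hoO : o ∉ O := Finset.disjoint_right.1 hd ho
    rw [clus_eq hk (Finset.singleton_subset_iff.2 ho) hTU]
    unfold clus
    rw [← pr_cluster hk (Finset.singleton_subset_iff.2 hpO) hON]
    refine pr_congr_prop fun A hA => ?_
    have : f A = O ↔ reach A {p} = O := by
      rw [hf2 A hA]
      exact Finset.coe_inj.symm
    rw [this]
    refine and_congr_right fun h => ?_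
    rw [reach_of_reach_eq hA h (hT ho) hoO]
  · intro A hA h
    simp only [Finset.mem_filter, Finset.mem_powerset]
    have h2 := hf2 A hA
    refine ⟨hf1 A hA, ?_, ?_⟩
    · rw [← Finset.mem_coe, ← h2]
      exact subset_reach _ _ (by simp)
    · rw [Finset.disjoint_left]
      intro v hv hvT
      rw [← Finset.mem_coe, ← h2] at hv
      rw [← Finset.mem_coe, ← h] at hvT
      have : p ∈ reach A {o} := reach_singleton_trans hvT (reach_singleton_symm hv)
      rw [h] at this
      exact hpT this

end BondPerc

namespace GaussNet

open BondPerc GaussianMixture Matrix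

namespace Net

variable {V : Type*} (K : Net V)

/-- Density on the event that all edges leaving `O` are closed. -/
def sealed (O : Finset V) (ψ : V → ℝ) : ℝ :=
  dens K.w K.N ψ * ∏ x ∈ O, ∏ z ∈ K.N \ O, closed K.w ψ x z

lemma measurable_sealed (O : Finset V) : Measurable (K.sealed O) := by
  unfold sealed
  have := measurable_dens K.w K.N
  have := measurable_closed K.w
  fun_prop

lemma I_eq_inner {b : ℝ} {H : (V → ℝ) → ℝ≥0∞} (hH : Measurable H) {T U : Finset V}
    (hd : Disjoint T U) (hF : T ∪ U = K.F) :
    K.I b H = ∫⁻ y : T → ℝ, (∫⋯∫⁻_U, H ∂(fun _ => volume)) (ext T b y) := by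
  unfold I
  rw [← hF, lmarginal_union _ _ hH hd]
  rfl

lemma I_compare {T : Finset V} (hT : T ⊆ K.F) {b q : ℝ}
    (hq : ∀ f : V → ℝ, (∀ x ∈ T, f x = 0) → f K.bd = b → q ≤ en K.w K.N f)
    {H : (V → ℝ) → ℝ≥0∞} (hHm : Measurable H)
    (hH : ∀ ψ ψ' : V → ℝ, (∀ x ∈ T, ψ x = ψ' x) → H ψ = H ψ') :
    K.I b (fun ψ => H ψ * ENNReal.ofReal (K.sealed T ψ)) ≤
      ENNReal.ofReal (exp (-(q / 2))) * K.I 0 (fun ψ => H ψ * ENNReal.ofReal (K.sealed T ψ)) := by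
  have hm : Measurable fun ψ => H ψ * ENNReal.ofReal (K.sealed T ψ) :=
    hHm.mul (K.measurable_sealed T).ennreal_ofReal
  have hd : Disjoint T (K.F \ T) := Finset.disjoint_sdiff
  have hF : T ∪ K.F \ T = K.F := Finset.union_sdiff_of_subset hT
  have hbd : K.bd ∉ T := fun h => K.bd_notMem (hT h)
  rw [K.I_eq_inner hm hd hF, K.I_eq_inner hm hd hF,
    ← lintegral_const_mul' _ _ ENNReal.ofReal_ne_top]
  refine lintegral_mono fun y => ?_
  have hinner : ∀ c : ℝ, _ := fun c => K.lmarginal_inner (O := T) (U := K.F \ T)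
    (hT.trans K.F_subset) Finset.sdiff_subset hd (fun x hx hxU => by
      by_contra h; exact hxU (Finset.mem_sdiff.2 ⟨hx, h⟩)) (b := c) (Or.inr hbd) (ext T c y)
      (fun _ => ext_of_notMem hbd) H
  unfold sealed
  rw [hinner b, hinner 0]
  have hT' : ∀ c, ∀ x ∈ T, ext T c y x = ext T 0 y x := fun c x hx => by
    simp [ext, Function.updateFinset, hx]
  have e1 : en K.w T (ext T b y) = en K.w T (ext T 0 y) := Finset.sum_congr rfl fun e he => by
    have := (mem_edges.1 he).1
    rw [hT' b _ this.1, hT' b _ this.2]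
  have e2 : ∑ v ∈ T, ∑ z ∈ K.N \ T, K.w v z * ext T b y v ^ 2 =
      ∑ v ∈ T, ∑ z ∈ K.N \ T, K.w v z * ext T 0 y v ^ 2 :=
    Finset.sum_congr rfl fun v hv => by rw [hT' b v hv]
  have e3 : ∀ z, ∑ v ∈ T, K.w v z * |ext T b y v| = ∑ v ∈ T, K.w v z * |ext T 0 y v| := fun z =>
    Finset.sum_congr rfl fun v hv => by rw [hT' b v hv]
  have e4 : ∀ c z, H (Function.updateFinset (ext T c y) (K.F \ T) z) = H (ext T 0 y) :=
    fun c z => hH _ _ fun x hx => by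
      have : x ∉ K.F \ T := fun h => (Finset.mem_sdiff.1 h).2 hx
      rw [← hT' c x hx]
      simp [Function.updateFinset, this]
  rw [e1, e2]
  simp only [e3, e4]
  set c1 := ENNReal.ofReal (exp (-(1 / 2) * (en K.w T (ext T 0 y) +
    ∑ v ∈ T, ∑ z ∈ K.N \ T, K.w v z * ext T 0 y v ^ 2)))
  set A := K.mat (K.F \ T)
  set c : (K.F \ T : Finset V) → ℝ := fun u => ∑ v ∈ T, K.w v u * |ext T 0 y v|
  set d := ∑ v ∈ T, K.w v K.bd * |ext T 0 y v|
  have hc0 : ∀ z, 0 ≤ ∑ v ∈ T, K.w v z * |ext T 0 y v| := fun z =>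
    Finset.sum_nonneg fun v _ => mul_nonneg (K.w_nonneg _ _) (abs_nonneg _)
  set l := lap K.w K.N K.bd K.bd
  have htilt := lintegral_tilt_le (t := b • K.kill (K.F \ T)) (q := b ^ 2 * l - q) (c := c)
    Finset.univ (fun i _ => hc0 _) (K.mat_pd Finset.sdiff_subset) fun z => by
      have hbU : K.bd ∉ K.F \ T := fun h => K.bd_notMem (Finset.mem_sdiff.1 h).1
      have h0 : ext (K.F \ T) 0 z K.bd = 0 := ext_of_notMem hbU
      set f : V → ℝ := Function.update (ext (K.F \ T) 0 z) K.bd b with hf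
      have hfx : ∀ x, x ≠ K.bd → f x = ext (K.F \ T) 0 z x := fun x hx => by
        rw [hf, Function.update_of_ne hx]
      have hfb : f K.bd = b := by simp [hf]
      have hfT : ∀ x ∈ T, f x = 0 := fun x hx => by
        rw [hfx x (fun h => hbd (h ▸ hx))]
        exact ext_of_notMem fun h => (Finset.mem_sdiff.1 h).2 hx
      have h1 := hq f hfT hfb
      have h2 := K.en_ext (U := K.F \ T) Finset.sdiff_subset (f := f) fun x hx hxU => by
        refine hfT x ?_
        by_contra h; exact hxU (Finset.mem_sdiff.2 ⟨hx, h⟩)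
      have h3 : (fun u : (K.F \ T : Finset V) => f u) = z := by
        rw [← ext_coe (U := K.F \ T) (b := 0) (y := z)]
        ext u
        exact hfx u fun h => hbU (h ▸ u.2)
      rw [h3, hfb] at h2
      rw [smul_dotProduct, smul_eq_mul]
      linarith
  have hmt : ∀ t : (K.F \ T : Finset V) → ℝ, Measurable fun z => ENNReal.ofReal (exp (t ⬝ᵥ z)) *
      gw A Finset.univ c z := fun t => by
    have := measurable_gw A Finset.univ c
    simp only [dotProduct]
    fun_prop
  rw [lintegral_const_mul _ (hmt _), lintegral_const_mul _ (hmt _)]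
  have hexp : ENNReal.ofReal (exp (-(1 / 2) * (b ^ 2 * l) - d * |b|)) ≤
      ENNReal.ofReal (exp (-(1 / 2) * (b ^ 2 * l))) :=
    ENNReal.ofReal_le_ofReal (exp_le_exp.2 (by
      have := mul_nonneg (hc0 K.bd) (abs_nonneg b)
      linarith))
  have e0 : ENNReal.ofReal (exp (-(1 / 2) * ((0 : ℝ) ^ 2 * l) - d * |0|)) = 1 := by simp
  have e5 : ∀ z : (K.F \ T : Finset V) → ℝ,
      ENNReal.ofReal (exp (((0 : ℝ) • K.kill (K.F \ T)) ⬝ᵥ z)) * gw A Finset.univ c z =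
      gw A Finset.univ c z := fun z => by simp
  rw [e0, one_mul, lintegral_congr e5]
  calc c1 * (ENNReal.ofReal (exp (-(1 / 2) * (b ^ 2 * l) - d * |b|)) * (H (ext T 0 y) *
        ∫⁻ z, ENNReal.ofReal (exp ((b • K.kill (K.F \ T)) ⬝ᵥ z)) * gw A Finset.univ c z))
      ≤ c1 * (ENNReal.ofReal (exp (-(1 / 2) * (b ^ 2 * l))) * (H (ext T 0 y) *
        (ENNReal.ofReal (exp ((b ^ 2 * l - q) / 2)) * ∫⁻ z, gw A Finset.univ c z))) := by
        gcongr
    _ = (ENNReal.ofReal (exp (-(1 / 2) * (b ^ 2 * l))) *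
          ENNReal.ofReal (exp ((b ^ 2 * l - q) / 2))) *
          (c1 * (H (ext T 0 y) * ∫⁻ z, gw A Finset.univ c z)) := by ring
    _ = _ := by
        rw [← ENNReal.ofReal_mul (exp_pos _).le, ← exp_add]
        congr 3
        ring

lemma I_sgnFac_le {O : Finset V} (hO : O ⊆ K.N) (hbd : K.bd ∈ O) {b : ℝ}
    {o y : (K.N \ O : Finset V)} (hoy : o ≠ y) {κ : ℝ} (hκ : 0 ≤ κ)
    {h : (K.N \ O : Finset V) → ℝ} (hh : K.mat (K.N \ O) *ᵥ h = Pi.single y 1)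
    (hhκ : h o ^ 2 * K.mat (K.N \ O) o o * K.mat (K.N \ O) y y ≤ κ ^ 2)
    {H : (V → ℝ) → ℝ≥0∞} (hHm : Measurable H)
    (hH : ∀ ψ ψ' : V → ℝ, (∀ x ∈ O, ψ x = ψ' x) → H ψ = H ψ') :
    K.I b (fun ψ => ENNReal.ofReal (sgnFac (ψ o) (ψ y)) *
      (H ψ * ENNReal.ofReal (K.sealed O ψ))) ≤
      ENNReal.ofReal (1 + 8 * κ) * K.I b (fun ψ => H ψ * ENNReal.ofReal (K.sealed O ψ)) := by
  have hU : K.N \ O ⊆ K.F := fun x hx => by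
    obtain ⟨h1, h2⟩ := Finset.mem_sdiff.1 hx
    exact (Finset.mem_insert.1 h1).resolve_left fun h => h2 (h ▸ hbd)
  have hm : Measurable fun ψ => H ψ * ENNReal.ofReal (K.sealed O ψ) :=
    hHm.mul (K.measurable_sealed O).ennreal_ofReal
  have hm' : Measurable fun ψ : V → ℝ => ENNReal.ofReal (sgnFac (ψ o) (ψ y)) *
      (H ψ * ENNReal.ofReal (K.sealed O ψ)) := by
    have := measurable_sgnFac (measurable_pi_apply (X := fun _ : V => ℝ) (o : V))
      (measurable_pi_apply (y : V))
    fun_prop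
  have hd : Disjoint (K.F \ (K.N \ O)) (K.N \ O) := Finset.sdiff_disjoint
  have hF : K.F \ (K.N \ O) ∪ K.N \ O = K.F := Finset.sdiff_union_of_subset hU
  rw [K.I_eq_inner hm' hd hF, K.I_eq_inner hm hd hF,
    ← lintegral_const_mul' _ _ ENNReal.ofReal_ne_top]
  refine lintegral_mono fun z => ?_
  set x := ext (K.F \ (K.N \ O)) b z
  have hinner := K.lmarginal_inner hO hU Finset.disjoint_sdiff (fun v hv hvU => by
      by_contra h; exact hvU (Finset.mem_sdiff.2 ⟨K.F_subset hv, h⟩)) (b := 0)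
      (Or.inl ⟨hbd, rfl⟩) x (fun h => absurd hbd h)
  have e1 := hinner fun ψ => ENNReal.ofReal (sgnFac (ψ o) (ψ y)) * H ψ
  simp only [mul_assoc] at e1
  unfold sealed
  rw [e1, hinner H]
  have e4 : ∀ y', H (Function.updateFinset x (K.N \ O) y') = H x := fun y' => hH _ _ fun v hv => by
    have : v ∉ K.N \ O := fun h => (Finset.mem_sdiff.1 h).2 hv
    simp [Function.updateFinset, this]
  have e5 : ∀ (y' : (K.N \ O : Finset V) → ℝ) (u : (K.N \ O : Finset V)),
      Function.updateFinset x (K.N \ O) y' u = y' u := fun y' u => by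
    simp [Function.updateFinset]
  simp only [e4, e5, zero_smul, zero_dotProduct, exp_zero, ENNReal.ofReal_one, one_mul,
    mul_left_comm _ (H x)]
  set A := K.mat (K.N \ O)
  set c : (K.N \ O : Finset V) → ℝ := fun u => ∑ v ∈ O, K.w v u * |x v|
  have hgm := measurable_gw A Finset.univ c
  have hsm : Measurable fun y' : (K.N \ O : Finset V) → ℝ => sgnFac (y' o) (y' y) :=
    measurable_sgnFac (measurable_pi_apply o) (measurable_pi_apply y)
  rw [lintegral_const_mul _ hgm, lintegral_const_mul _ (by fun_prop)]
  have := lintegral_sgnFac_le hoy hκ (c := c) Finset.univ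
    (fun i _ => Finset.sum_nonneg fun v _ => mul_nonneg (K.w_nonneg _ _) (abs_nonneg _))
    (K.mat_pd hU) (K.mat_offNonpos _) hh hhκ
  rw [mul_left_comm (ENNReal.ofReal (1 + 8 * κ)), mul_left_comm (ENNReal.ofReal (1 + 8 * κ)),
    mul_left_comm (ENNReal.ofReal (1 + 8 * κ))]
  gcongr

end Net

end GaussNet

namespace GaussNet

open BondPerc GaussianMixture Matrix

lemma sgnFac_neg_left (a b : ℝ) : sgnFac (-a) b = 2 - sgnFac a b := by
  unfold sgnFac
  rw [Real.sign_neg]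
  ring

lemma sgnFac_of_mul_pos {a b : ℝ} (h : 0 < a * b) : sgnFac a b = 2 := by
  unfold sgnFac
  rcases mul_pos_iff.1 h with ⟨h1, h2⟩ | ⟨h1, h2⟩
  · rw [Real.sign_of_pos h1, Real.sign_of_pos h2]; norm_num
  · rw [Real.sign_of_neg h1, Real.sign_of_neg h2]; norm_num

/-- The field has a constant sign on a cluster. -/
lemma mul_pos_of_conn_ne_zero {V : Type*} {w : V → V → ℝ} (hw : ∀ x y, w x y = w y x) {ψ : V → ℝ}
    {o y : V} {T : Finset V} (h : conn (closed w ψ) {o} T ≠ 0) (hy : y ∈ T) (ho : ψ o ≠ 0) :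
    0 < ψ o * ψ y := by
  refine conn_induction (closed_symm hw ψ) h (P := fun v => 0 < ψ o * ψ v) ?_ ?_ y hy
  · intro x hx
    rw [Finset.mem_singleton.1 hx]
    exact mul_self_pos.2 ho
  · intro u _ v _ huv hu
    have h1 := mul_pos_of_closed_ne_one huv
    have h2 := mul_pos hu h1
    have h3 : 0 < ψ u ^ 2 := by
      have : ψ u ≠ 0 := fun h => by simp [h] at hu
      positivity
    nlinarith

lemma ne_zero_of_conn_ne_zero {V : Type*} {w : V → V → ℝ} (hw : ∀ x y, w x y = w y x)
    {ψ : V → ℝ} {o y : V} {T : Finset V} (h : conn (closed w ψ) {o} T ≠ 0) (hy : y ∈ T)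
    (hoy : y ≠ o) : ψ o ≠ 0 := by
  intro h0
  refine hoy (conn_induction (closed_symm hw ψ) h (P := fun v => v = o) ?_ ?_ y hy)
  · intro x hx
    exact Finset.mem_singleton.1 hx
  · rintro u _ v _ huv rfl
    have h1 := mul_pos_of_closed_ne_one huv
    simp [h0] at h1

namespace Net

variable {V : Type*} (K : Net V)

/-- Weight of the cluster `O` of `S`. -/
def weight (S O : Finset V) (ψ : V → ℝ) : ℝ≥0∞ :=
  ENNReal.ofReal (dens K.w K.N ψ * clus (closed K.w ψ) K.N S O)

lemma measurable_weight (S O : Finset V) : Measurable (K.weight S O) := by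
  unfold weight
  have := measurable_dens K.w K.N
  have := measurable_clus K.w K.N S O
  fun_prop

lemma weight_eq (S O : Finset V) (ψ : V → ℝ) : K.weight S O ψ =
    ENNReal.ofReal (conn (closed K.w ψ) S O) * ENNReal.ofReal (K.sealed O ψ) := by
  rw [← ENNReal.ofReal_mul (conn_nonneg (closed_mem K.w_nonneg ψ) S O), weight, clus, sealed]
  congr 1
  ring

lemma weight_le (S O : Finset V) (hS : S ⊆ O) (hO : O ⊆ K.N) (ψ : V → ℝ) :
    K.weight S O ψ ≤ ENNReal.ofReal (dens K.w K.N ψ) := by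
  refine ENNReal.ofReal_le_ofReal (mul_le_of_le_one_right (dens_pos _ _ _).le ?_)
  rw [clus_eq (closed_symm K.w_symm ψ) hS hO]
  exact pr_le_one (fun _ _ => closed_mem K.w_nonneg ψ _ _) _

lemma I_weight_ne_top (b : ℝ) (S O : Finset V) (hS : S ⊆ O) (hO : O ⊆ K.N) :
    K.I b (K.weight S O) ≠ ⊤ :=
  ne_top_of_le_ne_top K.Z_ne_top ((K.I_mono fun ψ _ => K.weight_le S O hS hO ψ).trans
    (K.I_dens b).le)

/-- Joint weight of the cluster `O` of the ground and of the cluster `T` of `o`. -/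
def pairWeight (o : V) (O T : Finset V) (ψ : V → ℝ) : ℝ≥0∞ :=
  K.weight {K.bd} O ψ * ENNReal.ofReal (clus (closed K.w ψ) (K.N \ O) {o} T)

lemma measurable_pairWeight (o : V) (O T : Finset V) : Measurable (K.pairWeight o O T) := by
  unfold pairWeight
  have := K.measurable_weight {K.bd} O
  have := measurable_clus K.w (K.N \ O) {o} T
  fun_prop

lemma pairWeight_flip (o : V) {O T : Finset V} (hO : O ⊆ K.N) (hT : T ⊆ K.N \ O) (ψ : V → ℝ) :
    K.pairWeight o O T (flip T ψ) = K.pairWeight o O T ψ := by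
  have hn : ∀ ψ, 0 ≤ dens K.w K.N ψ * clus (closed K.w ψ) K.N {K.bd} O := fun ψ =>
    mul_nonneg (dens_pos _ _ _).le (clus_nonneg (closed_mem K.w_nonneg ψ) _ _ _)
  unfold pairWeight weight
  rw [← ENNReal.ofReal_mul (hn _), ← ENNReal.ofReal_mul (hn _),
    dens_mul_clus_clus_flip K.w_symm hO hT]

lemma sum_pairWeight {o : V} {O : Finset V} (ho : o ∈ K.N \ O) (ψ : V → ℝ) :
    ∑ T ∈ (K.N \ O).powerset with o ∈ T, K.pairWeight o O T ψ = K.weight {K.bd} O ψ := by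
  unfold pairWeight
  rw [← Finset.mul_sum, ← ENNReal.ofReal_sum_of_nonneg fun T _ =>
    clus_nonneg (closed_mem K.w_nonneg ψ) _ _ _]
  have h := sum_clus (closed_symm K.w_symm ψ) (Finset.singleton_subset_iff.2 ho) fun _ => True
  simp only [and_true, Finset.singleton_subset_iff, implies_true, pr_true] at h
  rw [h, ENNReal.ofReal_one, mul_one]

lemma sum_pairWeight_le {o y : V} {O : Finset V} (hO : O ⊆ K.N) (hbd : K.bd ∈ O)
    (ho : o ∈ K.N \ O) (hy : y ∈ K.N \ O) (hoy : o ≠ y) (b : ℝ) {κ : ℝ} (hκ : 0 ≤ κ)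
    {h : (K.N \ O : Finset V) → ℝ}
    (hh : K.mat (K.N \ O) *ᵥ h = Pi.single ⟨y, hy⟩ 1)
    (hhκ : h ⟨o, ho⟩ ^ 2 * K.mat (K.N \ O) ⟨o, ho⟩ ⟨o, ho⟩ *
      K.mat (K.N \ O) ⟨y, hy⟩ ⟨y, hy⟩ ≤ κ ^ 2) :
    ∑ T ∈ (K.N \ O).powerset with o ∈ T ∧ y ∈ T, K.I b (K.pairWeight o O T) ≤
      ENNReal.ofReal (8 * κ) * K.I b (K.weight {K.bd} O) := by
  have hUF : K.N \ O ⊆ K.F := fun x hx => by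
    obtain ⟨h1, h2⟩ := Finset.mem_sdiff.1 hx
    exact (Finset.mem_insert.1 h1).resolve_left fun h => h2 (h ▸ hbd)
  have hsm : Measurable fun ψ : V → ℝ => sgnFac (ψ o) (ψ y) :=
    measurable_sgnFac (measurable_pi_apply o) (measurable_pi_apply y)
  have hsp : ∀ T, Measurable fun ψ : V → ℝ =>
      ENNReal.ofReal (sgnFac (ψ o) (ψ y)) * K.pairWeight o O T ψ := fun T =>
    hsm.ennreal_ofReal.mul (K.measurable_pairWeight o O T)
  have hle := K.I_sgnFac_le hO hbd (b := b) (o := ⟨o, ho⟩) (y := ⟨y, hy⟩)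
    (fun h => hoy (congrArg Subtype.val h)) hκ hh hhκ
    (H := fun ψ => ENNReal.ofReal (conn (closed K.w ψ) {K.bd} O))
    (measurable_conn _ _ _).ennreal_ofReal
    (fun ψ ψ' hψ => by rw [conn_field_congr hψ])
  simp only [← weight_eq] at hle
  set J := K.I b (K.weight {K.bd} O) with hJ
  have hJt : J ≠ ⊤ := K.I_weight_ne_top b _ _ (Finset.singleton_subset_iff.2 hbd) hO
  have hJsum : J = ∑ T ∈ (K.N \ O).powerset with o ∈ T, K.I b (K.pairWeight o O T) := by
    rw [← K.I_sum _ fun T _ => K.measurable_pairWeight o O T, hJ]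
    congr 1
    ext ψ
    rw [K.sum_pairWeight ho]
  have hin : ∀ T, o ∈ T → y ∈ T → T ⊆ K.N \ O →
      K.I b (fun ψ => ENNReal.ofReal (sgnFac (ψ o) (ψ y)) * K.pairWeight o O T ψ) =
        2 * K.I b (K.pairWeight o O T) := by
    intro T hoT hyT hT
    rw [← K.I_const_mul 2 (K.measurable_pairWeight o O T)]
    congr 1
    ext ψ
    by_cases hc : conn (closed K.w ψ) {o} T = 0
    · simp [pairWeight, clus, hc]
    · rw [sgnFac_of_mul_pos (mul_pos_of_conn_ne_zero K.w_symm hc hyT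
        (ne_zero_of_conn_ne_zero K.w_symm hc hyT hoy.symm))]
      norm_num
  have hout : ∀ T, o ∈ T → y ∉ T → T ⊆ K.N \ O →
      K.I b (fun ψ => ENNReal.ofReal (sgnFac (ψ o) (ψ y)) * K.pairWeight o O T ψ) =
        K.I b (K.pairWeight o O T) := by
    intro T hoT hyT hT
    have h1 := K.I_flip (b := b) (hsp T) (hT.trans hUF)
    have h2 : K.I b (fun ψ => ENNReal.ofReal (sgnFac (ψ o) (ψ y)) * K.pairWeight o O T ψ) +
        K.I b (fun ψ => ENNReal.ofReal (sgnFac (flip T ψ o) (flip T ψ y)) *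
          K.pairWeight o O T (flip T ψ)) = 2 * K.I b (K.pairWeight o O T) := by
      rw [← K.I_add (hsp T), ← K.I_const_mul 2 (K.measurable_pairWeight o O T)]
      congr 1
      ext ψ
      rw [K.pairWeight_flip o hO hT, flip_of_mem hoT, flip_of_notMem hyT, sgnFac_neg_left,
        ← add_mul, ← ENNReal.ofReal_add (sgnFac_mem _ _).1
          (by linarith [(sgnFac_mem (ψ o) (ψ y)).2])]
      norm_num
    rw [h1, ← two_mul] at h2
    exact (ENNReal.mul_right_inj two_ne_zero ENNReal.ofNat_ne_top).1 h2
  have hS : K.I b (fun ψ => ENNReal.ofReal (sgnFac (ψ o) (ψ y)) * K.weight {K.bd} O ψ) =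
      J + ∑ T ∈ (K.N \ O).powerset with o ∈ T ∧ y ∈ T, K.I b (K.pairWeight o O T) := by
    have h1 : (fun ψ : V → ℝ => ENNReal.ofReal (sgnFac (ψ o) (ψ y)) * K.weight {K.bd} O ψ) =
        fun ψ => ∑ T ∈ (K.N \ O).powerset with o ∈ T,
          ENNReal.ofReal (sgnFac (ψ o) (ψ y)) * K.pairWeight o O T ψ := by
      ext ψ
      rw [← Finset.mul_sum, K.sum_pairWeight ho]
    rw [h1, K.I_sum _ fun T _ => hsp T, hJsum, ← Finset.filter_filter,
      Finset.sum_filter (fun T => y ∈ T), ← Finset.sum_add_distrib]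
    refine Finset.sum_congr rfl fun T hT => ?_
    simp only [Finset.mem_filter, Finset.mem_powerset] at hT
    by_cases hyT : y ∈ T
    · rw [hin T hT.2 hyT hT.1, if_pos hyT, two_mul]
    · rw [hout T hT.2 hyT hT.1, if_neg hyT, add_zero]
  rw [hS, ENNReal.ofReal_add zero_le_one (by positivity), ENNReal.ofReal_one, add_mul, one_mul]
    at hle
  exact (ENNReal.add_le_add_iff_left hJt).1 hle

lemma weight_eq_sum {o : V} {T : Finset V} (ho : o ∈ T) (hT : T ⊆ K.F) (ψ : V → ℝ) :
    K.weight {o} T ψ = ∑ O ∈ K.N.powerset with K.bd ∈ O ∧ Disjoint O T,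
      K.pairWeight o O T ψ := by
  have hc : ∀ N S T, 0 ≤ clus (closed K.w ψ) N S T := clus_nonneg (closed_mem K.w_nonneg ψ)
  have hd := (dens_pos K.w K.N ψ).le
  unfold pairWeight weight
  rw [clus_eq_sum (closed_symm K.w_symm ψ) K.bd_mem (fun h => K.bd_notMem (hT h)) ho
    (hT.trans K.F_subset), Finset.mul_sum,
    ENNReal.ofReal_sum_of_nonneg fun O _ => mul_nonneg hd (mul_nonneg (hc _ _ _) (hc _ _ _))]
  refine Finset.sum_congr rfl fun O _ => ?_
  rw [← ENNReal.ofReal_mul (mul_nonneg hd (hc _ _ _)), mul_assoc]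

/-- Two-point bound: the cluster of `o` avoiding the ground is controlled by the Green function
killed on the cluster of the ground. -/
theorem sum_weight_le {o y : V} (hoy : o ≠ y) (b : ℝ) {κ : Finset V → ℝ}
    (hκ : ∀ O ⊆ K.N, K.bd ∈ O → ∀ ho : o ∈ K.N \ O, ∀ hy : y ∈ K.N \ O, 0 ≤ κ O ∧
      ∃ h : (K.N \ O : Finset V) → ℝ, K.mat (K.N \ O) *ᵥ h = Pi.single ⟨y, hy⟩ 1 ∧
        h ⟨o, ho⟩ ^ 2 * K.mat (K.N \ O) ⟨o, ho⟩ ⟨o, ho⟩ *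
          K.mat (K.N \ O) ⟨y, hy⟩ ⟨y, hy⟩ ≤ κ O ^ 2) :
    ∑ T ∈ K.F.powerset with o ∈ T ∧ y ∈ T, K.I b (K.weight {o} T) ≤
      ∑ O ∈ K.N.powerset with K.bd ∈ O ∧ o ∉ O ∧ y ∉ O,
        ENNReal.ofReal (8 * κ O) * K.I b (K.weight {K.bd} O) := by
  have h1 : ∀ T ∈ K.F.powerset.filter (fun T => o ∈ T ∧ y ∈ T), K.I b (K.weight {o} T) =
      ∑ O ∈ K.N.powerset with K.bd ∈ O ∧ Disjoint O T, K.I b (K.pairWeight o O T) := by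
    intro T hT
    simp only [Finset.mem_filter, Finset.mem_powerset] at hT
    rw [← K.I_sum _ fun O _ => K.measurable_pairWeight o O T]
    congr 1
    ext ψ
    exact K.weight_eq_sum hT.2.1 hT.1 ψ
  rw [Finset.sum_congr rfl h1, Finset.sum_comm' (t' := K.N.powerset.filter fun O =>
    K.bd ∈ O ∧ o ∉ O ∧ y ∉ O) (s' := fun O => (K.N \ O).powerset.filter fun T => o ∈ T ∧ y ∈ T)]
  · refine Finset.sum_le_sum fun O hO => ?_
    simp only [Finset.mem_filter, Finset.mem_powerset] at hO
    by_cases hon : o ∈ K.N ∧ y ∈ K.N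
    · have ho := Finset.mem_sdiff.2 ⟨hon.1, hO.2.2.1⟩
      have hy := Finset.mem_sdiff.2 ⟨hon.2, hO.2.2.2⟩
      obtain ⟨hk, h, hh, hhκ⟩ := hκ O hO.1 hO.2.1 ho hy
      exact K.sum_pairWeight_le hO.1 hO.2.1 ho hy hoy b hk hh hhκ
    · rw [Finset.sum_eq_zero_iff_of_nonneg (fun _ _ => zero_le) |>.2]
      · exact zero_le
      · intro T hT
        simp only [Finset.mem_filter, Finset.mem_powerset] at hT
        exact absurd ⟨(Finset.mem_sdiff.1 (hT.1 hT.2.1)).1, (Finset.mem_sdiff.1 (hT.1 hT.2.2)).1⟩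
          hon
  · intro T O
    simp only [Finset.mem_filter, Finset.mem_powerset]
    constructor
    · rintro ⟨⟨hT, ho, hy⟩, hO, hb, hd⟩
      exact ⟨⟨Finset.subset_sdiff.2 ⟨hT.trans K.F_subset, hd.symm⟩, ho, hy⟩, hO, hb,
        Finset.disjoint_right.1 hd ho, Finset.disjoint_right.1 hd hy⟩
    · rintro ⟨⟨hT, ho, hy⟩, hO, hb, _⟩
      obtain ⟨h1, h2⟩ := Finset.subset_sdiff.1 hT
      refine ⟨⟨fun x hx => ?_, ho, hy⟩, hO, hb, h2.symm⟩
      exact (Finset.mem_insert.1 (h1 hx)).resolve_left fun h =>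
        Finset.disjoint_left.1 h2 hx (h ▸ hb)

end Net

end GaussNet

namespace GaussNet

open BondPerc GaussianMixture Matrix

namespace Net

variable {V : Type*} (K : Net V)

lemma sum_weight {S : Finset V} (hS : S ⊆ K.N) (p : Finset V → Prop) [DecidablePred p] (ψ : V → ℝ) :
    ∑ T ∈ K.N.powerset with S ⊆ T ∧ p T, K.weight S T ψ =
      ENNReal.ofReal (dens K.w K.N ψ * pr (fun e => closed K.w ψ e.1 e.2) (edges K.N)
        fun A => ∀ T : Finset V, reach A S = T → p T) := by
  rw [← sum_clus (closed_symm K.w_symm ψ) hS, Finset.mul_sum, ENNReal.ofReal_sum_of_nonneg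
    fun O _ => mul_nonneg (dens_pos _ _ _).le (clus_nonneg (closed_mem K.w_nonneg ψ) _ _ _)]
  unfold weight
  congr!

/-- The cluster of the ground avoids `S` iff the cluster of `S` avoids the ground. -/
lemma sum_weight_avoid {S : Finset V} (hS : S ⊆ K.F) (ψ : V → ℝ) :
    ∑ O ∈ K.N.powerset with K.bd ∈ O ∧ Disjoint O S, K.weight {K.bd} O ψ =
      ∑ T ∈ K.N.powerset with S ⊆ T ∧ K.bd ∉ T, K.weight S T ψ := by
  have h1 := K.sum_weight (S := {K.bd}) (Finset.singleton_subset_iff.2 K.bd_mem)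
    (fun O => Disjoint O S) ψ
  simp only [Finset.singleton_subset_iff] at h1
  rw [h1, K.sum_weight (hS.trans K.F_subset) (fun T => K.bd ∉ T)]
  congr 2
  refine pr_congr_prop fun A hA => ?_
  have hfin : ∀ R : Finset V, R ⊆ K.N → ∃ T : Finset V, reach A R = T := fun R hR =>
    ⟨(K.N.finite_toSet.subset (reach_subset hA hR)).toFinset, by simp⟩
  constructor
  · intro h T hT hb
    obtain ⟨O, hO⟩ := hfin {K.bd} (Finset.singleton_subset_iff.2 K.bd_mem)
    have hb' : K.bd ∈ reach A S := by rw [hT]; exact hb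
    obtain ⟨x, hx, hxb⟩ := hb'
    have hxO : x ∈ reach A {K.bd} := reach_singleton_symm ⟨x, Finset.mem_singleton_self x, hxb⟩
    rw [hO] at hxO
    exact Finset.disjoint_left.1 (h O hO) hxO hx
  · intro h O hO
    rw [Finset.disjoint_left]
    intro x hxO hx
    obtain ⟨T, hT⟩ := hfin S (hS.trans K.F_subset)
    have hx' : x ∈ reach A {K.bd} := by rw [hO]; exact hxO
    obtain ⟨z, hz, hzb⟩ := reach_singleton_symm hx'
    rw [Finset.mem_singleton] at hz
    have : K.bd ∈ reach A S := ⟨x, hx, hz ▸ hzb⟩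
    rw [hT] at this
    exact h T hT this

lemma sum_weight_le_dens {S : Finset V} (hS : S ⊆ K.N) (p : Finset V → Prop) [DecidablePred p]
    (ψ : V → ℝ) :
    ∑ T ∈ K.N.powerset with S ⊆ T ∧ p T, K.weight S T ψ ≤ ENNReal.ofReal (dens K.w K.N ψ) := by
  rw [K.sum_weight hS]
  refine ENNReal.ofReal_le_ofReal (mul_le_of_le_one_right (dens_pos _ _ _).le
    (pr_le_one (fun e _ => closed_mem K.w_nonneg ψ _ _) _))

/-- Contribution of the clusters avoiding the ground, with boundary value `b`. -/
lemma sum_I_weight_le {S : Finset V} (hS : S ⊆ K.F) {b q : ℝ} (p : Finset V → Prop)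
    [DecidablePred p] (hq : ∀ T ⊆ K.F, S ⊆ T → p T → ∀ f : V → ℝ, (∀ x ∈ T, f x = 0) → f K.bd = b →
      q ≤ en K.w K.N f) :
    ∑ T ∈ K.N.powerset with S ⊆ T ∧ K.bd ∉ T ∧ p T, K.I b (K.weight S T) ≤
      ENNReal.ofReal (exp (-(q / 2))) * K.Z := by
  have h1 : ∀ T ∈ K.N.powerset.filter (fun T => S ⊆ T ∧ K.bd ∉ T ∧ p T),
      K.I b (K.weight S T) ≤ ENNReal.ofReal (exp (-(q / 2))) * K.I 0 (K.weight S T) := by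
    intro T hT
    simp only [Finset.mem_filter, Finset.mem_powerset] at hT
    have hTF : T ⊆ K.F := fun x hx => (Finset.mem_insert.1 (hT.1 hx)).resolve_left fun h =>
      hT.2.2.1 (h ▸ hx)
    have hw : K.weight S T = fun ψ => ENNReal.ofReal (conn (closed K.w ψ) S T) *
        ENNReal.ofReal (K.sealed T ψ) := funext fun ψ => K.weight_eq S T ψ
    rw [hw]
    exact K.I_compare hTF (hq T hTF hT.2.1 hT.2.2.2)
      (measurable_conn _ _ _).ennreal_ofReal
      (fun ψ ψ' h => by rw [conn_field_congr h])
  refine (Finset.sum_le_sum h1).trans ?_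
  rw [← Finset.mul_sum]
  gcongr
  rw [← K.I_sum _ fun T _ => K.measurable_weight S T]
  exact K.I_mono fun ψ _ => K.sum_weight_le_dens (hS.trans K.F_subset)
    (fun T => K.bd ∉ T ∧ p T) ψ

/-- Probability that the cluster of the ground avoids `S`, through the capacity of `S`. -/
lemma sum_I_weight_avoid_le {S : Finset V} (hS : S ⊆ K.F) (b : ℝ) (μ : V → ℝ) {t : ℝ}
    (ht : 0 < t) (hμ : ∑ x ∈ S, ∑ y ∈ S, μ x * K.G x y * μ y ≤ t) :
    ∑ O ∈ K.N.powerset with K.bd ∈ O ∧ Disjoint O S, K.I b (K.weight {K.bd} O) ≤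
      ENNReal.ofReal (exp (-((b * ∑ x ∈ S, μ x) ^ 2 / t / 2))) * K.Z := by
  rw [← K.I_sum _ fun O _ => K.measurable_weight _ O]
  simp only [K.sum_weight_avoid hS]
  rw [K.I_sum _ fun O _ => K.measurable_weight _ O]
  have := K.sum_I_weight_le hS (b := b) (q := (b * ∑ x ∈ S, μ x) ^ 2 / t) (fun _ => True)
    fun T hT hST _ f hf hfb => by
      have h := K.capacity_le hS (fun x hx => hf x (hST hx)) hfb μ
      rw [div_le_iff₀ ht]
      refine h.trans (mul_le_mul_of_nonneg_left hμ ?_)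
      exact Finset.sum_nonneg fun e _ => mul_nonneg (K.w_nonneg _ _) (sq_nonneg _)
  simpa only [and_true] using this

/-- Expected time spent in `U` before reaching its complement. -/
def time (U : Finset V) : U → ℝ := (K.mat U)⁻¹ *ᵥ 1

lemma isUnit_det_mat {U : Finset V} (hU : U ⊆ K.F) : IsUnit (K.mat U).det := by
  rw [← Matrix.isUnit_iff_isUnit_det, ← Matrix.mulVec_injective_iff_isUnit]
  intro x y hxy
  have h : K.mat U *ᵥ (x - y) = 0 := by rw [mulVec_sub]; exact sub_eq_zero.2 hxy
  exact sub_eq_zero.1 ((K.mat_pd hU).eq_zero (by rw [h, dotProduct_zero]))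

lemma mat_mulVec_time {U : Finset V} (hU : U ⊆ K.F) : K.mat U *ᵥ K.time U = 1 := by
  rw [time, mulVec_mulVec, Matrix.mul_nonsing_inv _ (K.isUnit_det_mat hU), one_mulVec]

lemma time_nonneg {U : Finset V} (hU : U ⊆ K.F) (x : U) : 0 ≤ K.time U x :=
  (K.mat_pd hU).nonneg_of_mulVec_nonneg (K.mat_offNonpos U)
    (fun i => by rw [K.mat_mulVec_time hU]; exact zero_le_one) x

lemma mat_mulVec_inv_single {U : Finset V} (hU : U ⊆ K.F) (y : U) :
    K.mat U *ᵥ (fun x => (K.mat U)⁻¹ x y) = Pi.single y 1 := by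
  have : (fun x => (K.mat U)⁻¹ x y) = (K.mat U)⁻¹ *ᵥ Pi.single y 1 := by
    ext x; simp
  rw [this, mulVec_mulVec, Matrix.mul_nonsing_inv _ (K.isUnit_det_mat hU), one_mulVec]

lemma mat_inv_nonneg {U : Finset V} (hU : U ⊆ K.F) (x y : U) : 0 ≤ (K.mat U)⁻¹ x y :=
  (K.mat_pd hU).nonneg_of_mulVec_nonneg (K.mat_offNonpos U)
    (h := fun x => (K.mat U)⁻¹ x y) (fun i => by
      rw [K.mat_mulVec_inv_single hU, Pi.single_apply]
      split_ifs
      exacts [zero_le_one, le_rfl]) x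

lemma time_le {U : Finset V} (hU : U ⊆ K.F) (x : U) : K.time U x ≤ ∑ y ∈ K.F, K.G x y := by
  have h : ∀ i, 0 ≤ (K.mat U *ᵥ ((fun x : U => ∑ y ∈ K.F, K.G x y) - K.time U)) i := by
    intro i
    rw [mulVec_sub, K.mat_mulVec_time hU, Pi.sub_apply, Pi.one_apply, sub_nonneg]
    have h1 : ∑ z ∈ K.N, lap K.w K.N i z * ∑ y ∈ K.F, K.G z y = 1 := by
      simp only [Finset.mul_sum]
      rw [Finset.sum_comm, Finset.sum_congr rfl fun y hy =>
        show ∑ z ∈ K.N, lap K.w K.N i z * K.G z y = _ from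
        K.lap_G i (hU i.2) y hy,
        Finset.sum_ite_eq, if_pos (hU i.2)]
    have h2 : (K.mat U *ᵥ fun x : U => ∑ y ∈ K.F, K.G x y) i =
        ∑ z ∈ U, lap K.w K.N i z * ∑ y ∈ K.F, K.G z y := by
      rw [← Finset.sum_coe_sort U (fun z => lap K.w K.N i z * ∑ y ∈ K.F, K.G z y)]
      rfl
    rw [h2, ← h1, ← Finset.sum_sdiff (hU.trans K.F_subset)]
    refine add_le_of_nonpos_left (Finset.sum_nonpos fun z hz => ?_)
    refine mul_nonpos_of_nonpos_of_nonneg ?_ (Finset.sum_nonneg fun y _ => K.G_nonneg _ _)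
    have : (i : V) ≠ z := fun h => (Finset.mem_sdiff.1 hz).2 (h ▸ i.2)
    simp [lap, this, K.w_nonneg]
  have := (K.mat_pd hU).nonneg_of_mulVec_nonneg (K.mat_offNonpos U) h x
  simpa [sub_nonneg] using this

/-- The time spent in `U`, extended by zero. -/
def time₀ (U : Finset V) (x : V) : ℝ := if h : x ∈ U then K.time U ⟨x, h⟩ else 0

lemma time₀_nonneg {U : Finset V} (hU : U ⊆ K.F) (x : V) : 0 ≤ K.time₀ U x := by
  unfold time₀
  split_ifs
  exacts [K.time_nonneg hU _, le_rfl]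

lemma time₀_of_notMem {U : Finset V} {x : V} (h : x ∉ U) : K.time₀ U x = 0 := dif_neg h

lemma sum_lap_time₀ {U : Finset V} (hU : U ⊆ K.F) {x : V} (hx : x ∈ U) :
    ∑ z ∈ U, lap K.w K.N x z * K.time₀ U z = 1 := by
  have := congrFun (K.mat_mulVec_time hU) ⟨x, hx⟩
  rw [Pi.one_apply] at this
  rw [← this, ← Finset.sum_coe_sort U (fun z => lap K.w K.N x z * K.time₀ U z)]
  refine Finset.sum_congr rfl fun z _ => ?_
  rw [time₀, dif_pos z.2]
  rfl

lemma time₀_le {U : Finset V} (hU : U ⊆ K.F) (x : V) :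
    K.time₀ U x ≤ ∑ y ∈ K.F, K.G x y := by
  unfold time₀
  split_ifs with h
  · exact K.time_le hU ⟨x, h⟩
  · exact Finset.sum_nonneg fun y _ => K.G_nonneg _ _

lemma subset_F_of_bd_mem {O : Finset V} (h : K.bd ∈ O) : K.N \ O ⊆ K.F := fun _ hx =>
  (Finset.mem_insert.1 (Finset.mem_sdiff.1 hx).1).resolve_left fun h' =>
    (Finset.mem_sdiff.1 hx).2 (h' ▸ h)

/-- The Green function killed outside `U`, extended by zero. -/
def green₀ (U : Finset V) (x y : V) : ℝ :=
  if h : x ∈ U ∧ y ∈ U then (K.mat U)⁻¹ ⟨x, h.1⟩ ⟨y, h.2⟩ else 0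

lemma green₀_nonneg {U : Finset V} (hU : U ⊆ K.F) (x y : V) : 0 ≤ K.green₀ U x y := by
  unfold green₀
  split_ifs
  exacts [K.mat_inv_nonneg hU _ _, le_rfl]

lemma sum_green₀ (U : Finset V) {x : V} (hx : x ∈ U) :
    ∑ y ∈ U, K.green₀ U x y = K.time₀ U x := by
  rw [← Finset.sum_coe_sort, time₀, dif_pos hx, time]
  simp [mulVec, dotProduct, green₀, hx]

/-- The mean volume of the cluster of `o` is controlled by the mean time before hitting the
cluster of the ground. -/
theorem sum_card_weight_le {o : V} (ho : o ∈ K.F) (b : ℝ) {Λ : ℝ}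
    (hΛ : ∀ x ∈ K.F, lap K.w K.N x x ≤ Λ) :
    ∑ T ∈ K.F.powerset with o ∈ T, (T.card : ℝ≥0∞) * K.I b (K.weight {o} T) ≤
      K.Z + ∑ O ∈ K.N.powerset with K.bd ∈ O ∧ o ∉ O,
        ENNReal.ofReal (8 * Λ * K.time₀ (K.N \ O) o) * K.I b (K.weight {K.bd} O) := by
  have hlap : ∀ U ⊆ K.F, ∀ x : U, 0 ≤ K.mat U x x := fun U hU x => ((K.mat_pd hU).diag_pos x).le
  have hΛ0 : 0 ≤ Λ := (hlap K.F subset_rfl ⟨o, ho⟩).trans (hΛ o ho)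
  have hcard : ∀ T ∈ K.F.powerset.filter (fun T => o ∈ T),
      (T.card : ℝ≥0∞) * K.I b (K.weight {o} T) =
        ∑ y ∈ K.F, if y ∈ T then K.I b (K.weight {o} T) else 0 := by
    intro T hT
    simp only [Finset.mem_filter, Finset.mem_powerset] at hT
    rw [← Finset.sum_filter, Finset.sum_const, nsmul_eq_mul, Finset.filter_mem_eq_inter,
      Finset.inter_eq_right.2 hT.1]
  rw [Finset.sum_congr rfl hcard, Finset.sum_comm, ← Finset.add_sum_erase _ _ ho]
  refine add_le_add ?_ ?_
  · rw [← K.I_dens b, ← Finset.sum_filter, Finset.filter_filter]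
    refine le_trans ?_ (K.I_mono fun ψ _ => K.sum_weight_le_dens (S := {o})
      (Finset.singleton_subset_iff.2 (K.F_subset ho)) (fun _ => True) ψ)
    rw [K.I_sum _ fun T _ => K.measurable_weight _ T]
    refine Finset.sum_le_sum_of_subset fun T hT => ?_
    simp only [Finset.mem_filter, Finset.mem_powerset, Finset.singleton_subset_iff] at hT ⊢
    exact ⟨hT.1.trans K.F_subset, hT.2.1, trivial⟩
  · have hy : ∀ y ∈ K.F.erase o,
        (∑ T ∈ K.F.powerset with o ∈ T, if y ∈ T then K.I b (K.weight {o} T) else 0) ≤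
        ∑ O ∈ K.N.powerset with K.bd ∈ O ∧ o ∉ O,
          ENNReal.ofReal (8 * (Λ * K.green₀ (K.N \ O) o y)) * K.I b (K.weight {K.bd} O) := by
      intro y hy
      rw [← Finset.sum_filter, Finset.filter_filter]
      refine (K.sum_weight_le (Finset.ne_of_mem_erase hy).symm b
        (κ := fun O => Λ * K.green₀ (K.N \ O) o y) ?_).trans ?_
      · intro O _ hO hoO hyO
        have hU := K.subset_F_of_bd_mem hO
        refine ⟨mul_nonneg hΛ0 (K.green₀_nonneg hU _ _), _, K.mat_mulVec_inv_single hU _, ?_⟩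
        have h1 : K.mat (K.N \ O) ⟨o, hoO⟩ ⟨o, hoO⟩ ≤ Λ := hΛ o (hU hoO)
        have h2 : K.mat (K.N \ O) ⟨y, hyO⟩ ⟨y, hyO⟩ ≤ Λ := hΛ y (hU hyO)
        rw [green₀, dif_pos ⟨hoO, hyO⟩, mul_pow, mul_comm, mul_comm _ (K.mat _ _ _), ← mul_assoc,
          sq Λ]
        exact mul_le_mul_of_nonneg_right (mul_le_mul h2 h1 (hlap _ hU _) hΛ0) (sq_nonneg _)
      · refine Finset.sum_le_sum_of_subset fun O hO => ?_
        simp only [Finset.mem_filter, Finset.mem_powerset] at hO ⊢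
        exact ⟨hO.1, hO.2.1, hO.2.2.1⟩
    refine (Finset.sum_le_sum hy).trans ?_
    rw [Finset.sum_comm]
    refine Finset.sum_le_sum fun O hO => ?_
    simp only [Finset.mem_filter, Finset.mem_powerset] at hO
    have hU := K.subset_F_of_bd_mem hO.2.1
    have hoU : o ∈ K.N \ O := Finset.mem_sdiff.2 ⟨K.F_subset ho, hO.2.2⟩
    rw [← Finset.sum_mul, ← ENNReal.ofReal_sum_of_nonneg fun y _ =>
      mul_nonneg (by norm_num) (mul_nonneg hΛ0 (K.green₀_nonneg hU _ _))]
    refine mul_le_mul_left (ENNReal.ofReal_le_ofReal ?_) _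
    rw [← Finset.mul_sum, ← Finset.mul_sum, ← mul_assoc, ← K.sum_green₀ _ hoU]
    refine mul_le_mul_of_nonneg_left ?_ (by positivity)
    have : ∑ y ∈ K.N \ O, K.green₀ (K.N \ O) o y = ∑ y ∈ K.F, K.green₀ (K.N \ O) o y :=
      Finset.sum_subset hU fun y _ hy => dif_neg fun h => hy h.2
    rw [this]
    exact Finset.sum_le_sum_of_subset_of_nonneg (Finset.erase_subset _ _) fun y _ _ =>
      K.green₀_nonneg hU _ _

end Net

end GaussNet

namespace GaussNet

open BondPerc GaussianMixture Matrix

namespace Net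

variable {V : Type*} (K : Net V) {Ω : Type*} [MeasurableSpace Ω]

/-- `φ` is a centred Gaussian field on `K.F` with covariance `K.G`. -/
structure IsField (P : Measure Ω) (φ : Ω → V → ℝ) : Prop where
  prob : IsProbabilityMeasure P
  meas : ∀ x, Measurable fun ω => φ ω x
  gauss : ∀ c : V → ℝ, P.map (fun ω => ∑ x ∈ K.F, c x * φ ω x) =
    gaussianReal 0 (Real.toNNReal (∑ x ∈ K.F, ∑ y ∈ K.F, c x * c y * K.G x y))

/-- The field set to zero outside `K.F`. -/
def field (φ : Ω → V → ℝ) (ω : Ω) (x : V) : ℝ := if x ∈ K.F then φ ω x else 0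

variable {K} {P : Measure Ω} {φ : Ω → V → ℝ}

/-- Expectation under the Gaussian field as an integral against its density. -/
theorem IsField.I_dens (hφ : K.IsField P φ) {H : (V → ℝ) → ℝ≥0∞} (hH : Measurable H) :
    K.I 0 (fun ψ => H ψ * ENNReal.ofReal (dens K.w K.N ψ)) =
      K.Z * ∫⁻ ω, H (K.field φ ω) ∂P := by
  have := hφ.prob
  have hm : Measurable fun ω (u : K.F) => φ ω u := measurable_pi_lambda _ fun u => hφ.meas u
  have : IsProbabilityMeasure (P.map fun ω (u : K.F) => φ ω u) :=
    Measure.isProbabilityMeasure_map hm.aemeasurable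
  have hext : Measurable fun y : K.F → ℝ => ext K.F 0 y := measurable_updateFinset
  have hHe : Measurable fun y : K.F → ℝ => H (ext K.F 0 y) := hH.comp hext
  have key := eq_withDensity_gw (K.mat_pd subset_rfl) (G := fun x y : K.F => K.G x y) ?_
    (m := P.map fun ω (u : K.F) => φ ω u) ?_ 0
  · have h1 : ∫⁻ ω, H (K.field φ ω) ∂P =
        ∫⁻ y, H (ext K.F 0 y) ∂(P.map fun ω (u : K.F) => φ ω u) := by
      rw [lintegral_map hHe hm]
      refine lintegral_congr fun ω => ?_
      rfl
    rw [h1, key, lintegral_smul_measure, lintegral_withDensity_eq_lintegral_mul _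
      (measurable_gw _ _ _) hHe, ← K.Z_eq, smul_eq_mul, ← mul_assoc,
      ENNReal.mul_inv_cancel K.Z_ne_zero K.Z_ne_top, one_mul]
    refine lintegral_congr fun y => ?_
    rw [Pi.mul_apply, ← K.dens_ext y, mul_comm]
    rfl
  · intro t
    ext x
    have hx := K.lap_G x x.2
    have h2 : ∀ v : K.F, ∑ z : K.F, K.mat K.F x z * K.G z v = if x = v then 1 else 0 := by
      intro v
      have := hx v v.2
      rw [Finset.sum_insert K.bd_notMem, K.G_bd, mul_zero, zero_add, ← Finset.sum_coe_sort] at this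
      simp only [Subtype.ext_iff]
      exact this
    simp only [mulVec, dotProduct, Finset.mul_sum]
    rw [Finset.sum_comm]
    simp only [← mul_assoc, ← Finset.sum_mul, h2]
    simp
  · intro t
    rw [Measure.map_map (by fun_prop) hm]
    set c : V → ℝ := fun x => if h : x ∈ K.F then t ⟨x, h⟩ else 0 with hc
    have hct : ∀ u : K.F, c u = t u := fun u => by simp [hc]
    have h3 := hφ.gauss c
    simp only [← Finset.sum_coe_sort K.F, hct] at h3
    refine (Eq.trans ?_ h3).trans ?_
    · rfl
    · congr 2
      simp only [dotProduct, mulVec, Finset.mul_sum]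
      exact Finset.sum_congr rfl fun x _ => Finset.sum_congr rfl fun y _ => by ring

lemma IsField.gauss_field (hφ : K.IsField P φ) (c : V → ℝ) {B : Finset V} (hB : B ⊆ K.F) :
    P.map (fun ω => ∑ x ∈ B, c x * K.field φ ω x) =
      gaussianReal 0 (Real.toNNReal (∑ x ∈ B, ∑ y ∈ B, c x * c y * K.G x y)) := by
  have h := hφ.gauss (fun x => if x ∈ B then c x else 0)
  have h1 : ∀ s : V → ℝ, ∑ x ∈ K.F, (if x ∈ B then c x else 0) * s x = ∑ x ∈ B, c x * s x := by
    intro s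
    simp only [ite_mul, zero_mul]
    rw [← Finset.sum_filter, Finset.filter_mem_eq_inter, Finset.inter_eq_right.2 hB]
  have h2 : ∑ x ∈ K.F, ∑ y ∈ K.F,
      (if x ∈ B then c x else 0) * (if y ∈ B then c y else 0) * K.G x y =
      ∑ x ∈ B, ∑ y ∈ B, c x * c y * K.G x y := by
    simp only [mul_assoc, ← Finset.mul_sum, h1]
  rw [h2] at h
  rw [← h]
  congr 1
  ext ω
  rw [h1]
  exact Finset.sum_congr rfl fun x hx => by rw [field, if_pos (hB hx)]

end Net

end GaussNet

namespace GaussianMixture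

/-- The pair `(U, X)` is centred Gaussian with covariance matrix `!![u, c; c, v]`. -/
structure IsGaussPair {Ω : Type*} [MeasurableSpace Ω] (P : Measure Ω) (U X : Ω → ℝ)
    (u c v : ℝ) : Prop where
  prob : IsProbabilityMeasure P
  measU : Measurable U
  measX : Measurable X
  form_nonneg : ∀ a b : ℝ, 0 ≤ a * a * u + 2 * (a * b) * c + b * b * v
  law : ∀ a b : ℝ, P.map (fun ω => a * U ω + b * X ω) =
    gaussianReal 0 (Real.toNNReal (a * a * u + 2 * (a * b) * c + b * b * v))

namespace IsGaussPair

variable {Ω : Type*} [MeasurableSpace Ω] {P : Measure Ω} {U X : Ω → ℝ} {u c v : ℝ}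

lemma measurable_lin (h : IsGaussPair P U X u c v) (a b : ℝ) :
    Measurable fun ω => a * U ω + b * X ω := (h.measU.const_mul a).add (h.measX.const_mul b)

lemma integrable_exp (h : IsGaussPair P U X u c v) (a b : ℝ) :
    Integrable (fun ω => Real.exp (a * U ω + b * X ω)) P := by
  have h1 := integrable_exp_mul_gaussianReal (μ := 0)
    (v := Real.toNNReal (a * a * u + 2 * (a * b) * c + b * b * v)) 1
  rw [← h.law a b, integrable_map_measure (by fun_prop) (h.measurable_lin a b).aemeasurable] at h1
  simpa [Function.comp_def] using h1

lemma integral_exp (h : IsGaussPair P U X u c v) (a b : ℝ) :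
    ∫ ω, Real.exp (a * U ω + b * X ω) ∂P =
      Real.exp ((a * a * u + 2 * (a * b) * c + b * b * v) / 2) := by
  have h1 := mgf_gaussianReal (h.law a b) 1
  rw [mgf] at h1
  simpa [Real.coe_toNNReal _ (h.form_nonneg a b)] using h1

lemma memLp_two (h : IsGaussPair P U X u c v) (a b : ℝ) :
    MemLp (fun ω => a * U ω + b * X ω) 2 P := by
  have h1 := memLp_id_gaussianReal (μ := 0)
    (v := Real.toNNReal (a * a * u + 2 * (a * b) * c + b * b * v)) 2
  rw [← h.law a b, memLp_map_measure_iff (by fun_prop) (h.measurable_lin a b).aemeasurable] at h1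
  exact_mod_cast h1

lemma integral_sq (h : IsGaussPair P U X u c v) (a b : ℝ) :
    ∫ ω, (a * U ω + b * X ω) ^ 2 ∂P = a * a * u + 2 * (a * b) * c + b * b * v := by
  have h1 := variance_id_gaussianReal (μ := 0)
    (v := Real.toNNReal (a * a * u + 2 * (a * b) * c + b * b * v))
  rw [variance_eq_integral (by fun_prop)] at h1
  simp only [id, integral_id_gaussianReal, sub_zero] at h1
  rw [Real.coe_toNNReal _ (h.form_nonneg a b), ← h.law a b,
    integral_map (h.measurable_lin a b).aemeasurable (by fun_prop)] at h1
  exact h1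

lemma integrable_mul (h : IsGaussPair P U X u c v) : Integrable (fun ω => U ω * X ω) P := by
  have h1 := h.memLp_two 1 0
  have h2 := h.memLp_two 0 1
  simp only [one_mul, zero_mul, add_zero, zero_add] at h1 h2
  exact h1.integrable_mul h2

lemma integral_mul (h : IsGaussPair P U X u c v) : ∫ ω, U ω * X ω ∂P = c := by
  have h1 := (h.memLp_two 1 1).integrable_sq
  have h2 := (h.memLp_two 1 (-1)).integrable_sq
  have h3 : ∫ ω, U ω * X ω ∂P =
      ∫ ω, 4⁻¹ * ((1 * U ω + 1 * X ω) ^ 2 - (1 * U ω + (-1) * X ω) ^ 2) ∂P :=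
    integral_congr_ae (.of_forall fun ω => by simp only; ring)
  rw [h3, integral_const_mul, integral_sub h1 h2, h.integral_sq, h.integral_sq]
  ring

lemma integral_mul_exp (h : IsGaussPair P U X u c v) (s : ℝ) :
    Integrable (fun ω => U ω * Real.exp (s * X ω)) P ∧
      ∫ ω, U ω * Real.exp (s * X ω) ∂P = s * c * Real.exp (s ^ 2 * v / 2) := by
  set f : Ω → ℝ≥0∞ := fun ω => ENNReal.ofReal (Real.exp (s * X ω)) with hf
  have hfm : Measurable f := (Real.measurable_exp.comp (h.measX.const_mul s)).ennreal_ofReal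
  have hft : ∀ᵐ ω ∂P, f ω < ⊤ := .of_forall fun ω => ENNReal.ofReal_lt_top
  have hfr : ∀ ω, (f ω).toReal = Real.exp (s * X ω) := fun ω =>
    ENNReal.toReal_ofReal (Real.exp_pos _).le
  have hset : integrableExpSet U (P.withDensity f) = Set.univ := by
    refine Set.eq_univ_of_forall fun t => ?_
    change Integrable _ _
    rw [integrable_withDensity_iff_integrable_smul' hfm hft]
    refine (h.integrable_exp t s).congr (.of_forall fun ω => ?_)
    simp only [hfr, smul_eq_mul, Real.exp_add]
    ring
  have hmgf : mgf U (P.withDensity f) = fun t =>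
      Real.exp ((t * t * u + 2 * (t * s) * c + s * s * v) / 2) := by
    ext t
    rw [mgf, integral_withDensity_eq_integral_toReal_smul hfm hft, ← h.integral_exp t s]
    refine integral_congr_ae (.of_forall fun ω => ?_)
    simp only [hfr, smul_eq_mul, Real.exp_add]
    ring
  have h0 : (0 : ℝ) ∈ interior (integrableExpSet U (P.withDensity f)) := by rw [hset]; simp
  have hd := hasDerivAt_mgf h0
  have hi := integrable_pow_mul_exp_of_mem_interior_integrableExpSet h0 1
  simp only [zero_mul, Real.exp_zero, mul_one, pow_one] at hd hi
  rw [integrable_withDensity_iff_integrable_smul' hfm hft] at hi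
  rw [integral_withDensity_eq_integral_toReal_smul hfm hft, hmgf] at hd
  simp only [hfr, smul_eq_mul] at hi hd
  have he : (fun ω => Real.exp (s * X ω) * U ω) = fun ω => U ω * Real.exp (s * X ω) :=
    funext fun ω => mul_comm _ _
  rw [he] at hi hd
  refine ⟨hi, hd.unique ?_⟩
  have h2 : HasDerivAt (fun t : ℝ => (t * t * u + 2 * (t * s) * c + s * s * v) / 2) (s * c) 0 := by
    have := ((((hasDerivAt_id' (0 : ℝ)).mul (hasDerivAt_id' 0)).mul_const u).add
      ((((hasDerivAt_id' (0 : ℝ)).mul_const s).const_mul 2).mul_const c)).add_const (s * s * v)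
      |>.div_const 2
    refine this.congr_deriv ?_
    ring
  refine h2.exp.congr_deriv ?_
  ring_nf

lemma integral_mul_sinh (h : IsGaussPair P U X u c v) (s : ℝ) :
    Integrable (fun ω => U ω * Real.sinh (s * X ω)) P ∧
      ∫ ω, U ω * Real.sinh (s * X ω) ∂P = s * c * Real.exp (s ^ 2 * v / 2) := by
  obtain ⟨i1, e1⟩ := h.integral_mul_exp s
  obtain ⟨i2, e2⟩ := h.integral_mul_exp (-s)
  have he : (fun ω => U ω * Real.sinh (s * X ω)) =
      fun ω => 2⁻¹ * (U ω * Real.exp (s * X ω) - U ω * Real.exp (-s * X ω)) := by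
    ext ω
    rw [Real.sinh_eq]
    ring_nf
  rw [he]
  refine ⟨(i1.sub i2).const_mul _, ?_⟩
  rw [integral_const_mul, integral_sub i1 i2, e1, e2, neg_sq]
  ring

lemma lintegral_exp_abs_le (h : IsGaussPair P U X u c v) :
    ∫⁻ ω, ENNReal.ofReal (Real.exp |U ω|) ∂P ≤ ENNReal.ofReal (2 * Real.exp (u / 2)) := by
  have i1 := h.integrable_exp 1 0
  have i2 := h.integrable_exp (-1) 0
  have e1 := h.integral_exp 1 0
  have e2 := h.integral_exp (-1) 0
  have h1 : ∫ ω, (Real.exp (1 * U ω + 0 * X ω) + Real.exp (-1 * U ω + 0 * X ω)) ∂P =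
      2 * Real.exp (u / 2) := by
    rw [integral_add i1 i2, e1, e2]
    ring_nf
  rw [← h1, ofReal_integral_eq_lintegral_ofReal
    (f := fun ω => Real.exp (1 * U ω + 0 * X ω) + Real.exp (-1 * U ω + 0 * X ω)) (i1.add i2)
    (.of_forall fun ω => by positivity)]
  refine lintegral_mono fun ω => ENNReal.ofReal_le_ofReal ?_
  rcases abs_cases (U ω) with ⟨e, -⟩ | ⟨e, -⟩ <;> rw [e] <;> simp <;> positivity

end IsGaussPair

end GaussianMixture

namespace GaussNet

open BondPerc GaussianMixture Matrix

namespace Net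

variable {V : Type*} (K : Net V)

lemma form_nonneg (c : V → ℝ) : 0 ≤ ∑ x ∈ K.F, ∑ y ∈ K.F, c x * c y * K.G x y := by
  have h := K.en_potential subset_rfl c
  have h0 : 0 ≤ en K.w K.N (fun y => ∑ v ∈ K.F, K.G y v * c v) :=
    Finset.sum_nonneg fun e _ => mul_nonneg (K.w_nonneg _ _) (sq_nonneg _)
  rw [h] at h0
  refine h0.trans_eq (Finset.sum_congr rfl fun x _ => Finset.sum_congr rfl fun y _ => by ring)

variable {K} in
lemma IsField.pair {Ω : Type*} [MeasurableSpace Ω] {P : Measure Ω} {φ : Ω → V → ℝ}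
    (hφ : K.IsField P φ) {o : V} (ho : o ∈ K.F) {B : Finset V} (hB : B ⊆ K.F) :
    IsGaussPair P (fun ω => K.field φ ω o) (fun ω => ∑ y ∈ B, K.field φ ω y) (K.G o o)
      (∑ y ∈ B, K.G o y) (∑ x ∈ B, ∑ y ∈ B, K.G x y) := by
  have hm : ∀ x, Measurable fun ω => K.field φ ω x := by
    intro x
    unfold field
    split_ifs
    · exact hφ.meas x
    · exact measurable_const
  have hs : ∀ (a b : ℝ) (f : V → ℝ), ∑ x ∈ K.F, ((if x = o then a else 0) +
      if x ∈ B then b else 0) * f x = a * f o + b * ∑ y ∈ B, f y := by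
    intro a b f
    simp only [add_mul, Finset.sum_add_distrib, ite_mul, zero_mul]
    rw [Finset.sum_ite_eq' K.F o, if_pos ho, ← Finset.sum_filter, Finset.filter_mem_eq_inter,
      Finset.inter_eq_right.2 hB, Finset.mul_sum]
  have hq : ∀ a b : ℝ, ∑ x ∈ K.F, ∑ y ∈ K.F, ((if x = o then a else 0) + if x ∈ B then b else 0) *
      ((if y = o then a else 0) + if y ∈ B then b else 0) * K.G x y =
      a * a * K.G o o + 2 * (a * b) * ∑ y ∈ B, K.G o y + b * b * ∑ x ∈ B, ∑ y ∈ B, K.G x y := by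
    intro a b
    simp only [mul_assoc, ← Finset.mul_sum, hs]
    rw [Finset.sum_add_distrib, ← Finset.mul_sum, ← Finset.mul_sum,
      Finset.sum_congr rfl fun y _ => K.G_symm y o]
    ring
  refine ⟨hφ.prob, hm o, Finset.measurable_sum _ fun y _ => hm y, fun a b => ?_, fun a b => ?_⟩
  · rw [← hq]
    exact K.form_nonneg _
  · rw [← hq, ← hφ.gauss_field _ subset_rfl]
    congr 1
    ext ω
    rw [hs]

/-- With free boundary value the cluster of `o` does not contain the ground. -/
lemma sum_weight_free {o : V} (ho : o ∈ K.F) {ψ : V → ℝ} (hψ : ψ K.bd = 0) :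
    ∑ T ∈ K.F.powerset with o ∈ T, K.weight {o} T ψ = ENNReal.ofReal (dens K.w K.N ψ) := by
  have h := K.sum_weight (S := {o}) (Finset.singleton_subset_iff.2 (K.F_subset ho))
    (fun _ => True) ψ
  simp only [and_true, Finset.singleton_subset_iff, implies_true, pr_true, mul_one] at h
  rw [← h]
  refine Finset.sum_subset ?_ fun T hT hT' => ?_
  · intro T
    simp only [Finset.mem_filter, Finset.mem_powerset]
    exact fun h => ⟨h.1.trans K.F_subset, h.2⟩
  · simp only [Finset.mem_filter, Finset.mem_powerset, not_and'] at hT hT'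
    have hbd : K.bd ∈ T := by
      by_contra hb
      refine hT' hT.2 fun x hx => ?_
      rcases Finset.mem_insert.1 (hT.1 hx) with rfl | h
      · exact absurd hx hb
      · exact h
    have hne : K.bd ≠ o := fun h => K.bd_notMem (h ▸ ho)
    rw [K.weight_eq]
    by_cases hc : conn (closed K.w ψ) {o} T = 0
    · rw [hc, ENNReal.ofReal_zero, zero_mul]
    · have h1 := ne_zero_of_conn_ne_zero K.w_symm hc hbd hne
      have h2 := mul_pos_of_conn_ne_zero K.w_symm hc hbd h1
      simp [hψ] at h2

lemma sum_I_weight_free {o : V} (ho : o ∈ K.F) {p : (V → ℝ) → ℝ≥0∞} (hp : Measurable p) :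
    ∑ T ∈ K.F.powerset with o ∈ T, K.I 0 (fun ψ => p ψ * K.weight {o} T ψ) =
      K.I 0 (fun ψ => p ψ * ENNReal.ofReal (dens K.w K.N ψ)) := by
  rw [← K.I_sum _ (H := fun T ψ => p ψ * K.weight {o} T ψ) fun T _ =>
    hp.mul (K.measurable_weight _ _)]
  refine le_antisymm (K.I_mono fun ψ hψ => ?_) (K.I_mono fun ψ hψ => ?_) <;>
    rw [← K.sum_weight_free ho hψ, Finset.mul_sum]

lemma weight_flip {S T : Finset V} (hT : T ⊆ K.F) (ψ : V → ℝ) :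
    K.weight S T (flip T ψ) = K.weight S T ψ := by
  rw [weight, weight, dens_mul_clus_flip K.w_symm (hT.trans K.F_subset)]

/-- Comparison after symmetrisation with respect to the sign of a cluster. -/
lemma I_weight_le_of_flip {S T : Finset V} (hT : T ⊆ K.F) {p q : (V → ℝ) → ℝ≥0∞}
    (hp : Measurable p) (hq : Measurable q)
    (h : ∀ ψ, K.weight S T ψ ≠ 0 → p ψ + p (flip T ψ) ≤ q ψ + q (flip T ψ)) :
    K.I 0 (fun ψ => p ψ * K.weight S T ψ) ≤ K.I 0 (fun ψ => q ψ * K.weight S T ψ) := by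
  have hw := K.measurable_weight S T
  have key : ∀ {p : (V → ℝ) → ℝ≥0∞}, Measurable p →
      K.I 0 (fun ψ => (p ψ + p (flip T ψ)) * K.weight S T ψ) =
        2 * K.I 0 (fun ψ => p ψ * K.weight S T ψ) := by
    intro p hp
    have h1 : (fun ψ => (p ψ + p (flip T ψ)) * K.weight S T ψ) = fun ψ =>
        p ψ * K.weight S T ψ + (fun ψ => p ψ * K.weight S T ψ) (flip T ψ) := by
      ext ψ
      simp only [K.weight_flip hT, add_mul]
    rw [h1, K.I_add (H := fun ψ => p ψ * K.weight S T ψ) (hp.mul hw),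
      K.I_flip (H := fun ψ => p ψ * K.weight S T ψ) (hp.mul hw) hT, two_mul]
  have h2 : 2 * K.I 0 (fun ψ => p ψ * K.weight S T ψ) ≤
      2 * K.I 0 (fun ψ => q ψ * K.weight S T ψ) := by
    rw [← key hp, ← key hq]
    refine K.I_mono fun ψ _ => ?_
    by_cases h0 : K.weight S T ψ = 0
    · simp [h0]
    · exact mul_le_mul_left (h ψ h0) _
  exact (ENNReal.mul_le_mul_iff_right two_ne_zero ENNReal.ofNat_ne_top).1 h2

/-- Mass of `|ψ|` on `T ∩ B`. -/
def vol (B T : Finset V) (ψ : V → ℝ) : ℝ := ∑ y ∈ T ∩ B, |ψ y|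

lemma vol_nonneg (B T : Finset V) (ψ : V → ℝ) : 0 ≤ vol B T ψ :=
  Finset.sum_nonneg fun _ _ => abs_nonneg _

lemma measurable_vol (B T : Finset V) : Measurable (vol B T) :=
  Finset.measurable_sum _ fun y _ => (measurable_pi_apply y).abs

lemma vol_flip (B T : Finset V) (ψ : V → ℝ) : vol B T (flip T ψ) = vol B T ψ :=
  Finset.sum_congr rfl fun _ _ => abs_flip _ _ _

lemma exists_sum_eq_of_weight_ne_zero {o : V} {T : Finset V} (B : Finset V)
    {ψ : V → ℝ} (h : K.weight {o} T ψ ≠ 0) : ψ o = 0 ∨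
      ∃ Y, (∑ y ∈ B, flip T ψ y = -(∑ y ∈ B, ψ y - Y) + Y) ∧
        (0 < ψ o ∧ ∑ y ∈ B, ψ y = vol B T ψ + Y ∨ ψ o < 0 ∧ ∑ y ∈ B, ψ y = -vol B T ψ + Y) := by
  rw [K.weight_eq] at h
  have hc : conn (closed K.w ψ) {o} T ≠ 0 := fun h0 => h (by simp [h0])
  refine or_iff_not_imp_left.2 fun h0 => ⟨∑ y ∈ B \ T, ψ y, ?_, ?_⟩
  · rw [← Finset.sum_sdiff (Finset.inter_subset_left : B ∩ T ⊆ B), Finset.sdiff_inter_self_left,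
      ← Finset.sum_sdiff (Finset.inter_subset_left : B ∩ T ⊆ B) (f := ψ),
      Finset.sdiff_inter_self_left, add_sub_cancel_left, add_comm]
    congr 1
    · rw [← Finset.sum_neg_distrib]
      exact Finset.sum_congr rfl fun y hy => flip_of_mem (Finset.mem_inter.1 hy).2
    · exact Finset.sum_congr rfl fun y hy => flip_of_notMem (Finset.mem_sdiff.1 hy).2
  · have hs : ∑ y ∈ B, ψ y = ∑ y ∈ T ∩ B, ψ y + ∑ y ∈ B \ T, ψ y := by
      rw [← Finset.sum_sdiff (Finset.inter_subset_left : B ∩ T ⊆ B), Finset.sdiff_inter_self_left,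
        add_comm, Finset.inter_comm]
    have hp : ∀ y ∈ T, 0 < ψ o * ψ y := fun y hy => mul_pos_of_conn_ne_zero K.w_symm hc hy h0
    rcases lt_or_gt_of_ne h0 with hlt | hgt
    · refine Or.inr ⟨hlt, ?_⟩
      rw [hs, vol, ← Finset.sum_neg_distrib]
      congr 1
      refine Finset.sum_congr rfl fun y hy => ?_
      have := hp y (Finset.mem_inter.1 hy).1
      rw [abs_of_neg (by nlinarith), neg_neg]
    · refine Or.inl ⟨hgt, ?_⟩
      rw [hs, vol]
      congr 1
      refine Finset.sum_congr rfl fun y hy => ?_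
      have := hp y (Finset.mem_inter.1 hy).1
      rw [abs_of_pos (pos_of_mul_pos_right this hgt.le)]

lemma two_mul_sinh_le {A Y : ℝ} (hA : 0 ≤ A) :
    2 * Real.sinh A ≤ Real.sinh (A + Y) + Real.sinh (A - Y) := by
  rw [Real.sinh_add, Real.sinh_sub]
  have := Real.sinh_nonneg_iff.2 hA
  nlinarith [Real.one_le_cosh Y]

lemma ofReal_eq_max (f : ℝ) : ENNReal.ofReal f = ENNReal.ofReal (max f 0) := by
  rcases le_total f 0 with h | h
  · rw [max_eq_right h, ENNReal.ofReal_zero, ENNReal.ofReal_of_nonpos h]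
  · rw [max_eq_left h]

lemma ofReal_add_le {f g h : ℝ} (H : f + g ≤ 2 * h) (hh : 0 ≤ h) :
    ENNReal.ofReal f + ENNReal.ofReal g ≤ (ENNReal.ofReal h + ENNReal.ofReal (-f)) +
      (ENNReal.ofReal h + ENNReal.ofReal (-g)) := by
  rw [ofReal_eq_max f, ofReal_eq_max g, ofReal_eq_max (-f), ofReal_eq_max (-g),
    ← ENNReal.ofReal_add (by positivity) (by positivity),
    ← ENNReal.ofReal_add (by positivity) (by positivity),
    ← ENNReal.ofReal_add (by positivity) (by positivity),
    ← ENNReal.ofReal_add (by positivity) (by positivity)]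
  refine ENNReal.ofReal_le_ofReal ?_
  rcases max_cases f 0 with ⟨e, _⟩ | ⟨e, _⟩ <;> rcases max_cases g 0 with ⟨e', _⟩ | ⟨e', _⟩ <;>
    rcases max_cases (-f) 0 with ⟨e'', _⟩ | ⟨e'', _⟩ <;>
    rcases max_cases (-g) 0 with ⟨e3, _⟩ | ⟨e3, _⟩ <;> rw [e, e', e'', e3] <;> linarith

lemma le_ofReal_add {f g h : ℝ} (H : 2 * h ≤ f + g) (hh : 0 ≤ h) :
    (ENNReal.ofReal h + ENNReal.ofReal (-f)) + (ENNReal.ofReal h + ENNReal.ofReal (-g)) ≤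
      ENNReal.ofReal f + ENNReal.ofReal g := by
  rw [ofReal_eq_max f, ofReal_eq_max g, ofReal_eq_max (-f), ofReal_eq_max (-g),
    ← ENNReal.ofReal_add (by positivity) (by positivity),
    ← ENNReal.ofReal_add (by positivity) (by positivity),
    ← ENNReal.ofReal_add (by positivity) (by positivity),
    ← ENNReal.ofReal_add (by positivity) (by positivity)]
  refine ENNReal.ofReal_le_ofReal ?_
  rcases max_cases f 0 with ⟨e, _⟩ | ⟨e, _⟩ <;> rcases max_cases g 0 with ⟨e', _⟩ | ⟨e', _⟩ <;>
    rcases max_cases (-f) 0 with ⟨e'', _⟩ | ⟨e'', _⟩ <;>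
    rcases max_cases (-g) 0 with ⟨e3, _⟩ | ⟨e3, _⟩ <;> rw [e, e', e'', e3] <;> linarith

variable {K} in
lemma IsField.I_real {Ω : Type*} [MeasurableSpace Ω] {P : Measure Ω} {φ : Ω → V → ℝ}
    (hφ : K.IsField P φ) {f : (V → ℝ) → ℝ} (hf : Measurable f) {c : ℝ} (hc : 0 ≤ c)
    (hi : Integrable (fun ω => f (K.field φ ω)) P) (he : ∫ ω, f (K.field φ ω) ∂P = c) :
    K.I 0 (fun ψ => ENNReal.ofReal (-f ψ) * ENNReal.ofReal (dens K.w K.N ψ)) ≠ ⊤ ∧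
    K.I 0 (fun ψ => ENNReal.ofReal (f ψ) * ENNReal.ofReal (dens K.w K.N ψ)) =
      K.Z * ENNReal.ofReal c +
      K.I 0 (fun ψ => ENNReal.ofReal (-f ψ) * ENNReal.ofReal (dens K.w K.N ψ)) := by
  have hp : ∫⁻ ω, ENNReal.ofReal (f (K.field φ ω)) ∂P ≠ ⊤ := by
    refine ne_top_of_le_ne_top hi.2.ne (lintegral_mono fun ω => ?_)
    rw [Real.enorm_eq_ofReal_abs]
    exact ENNReal.ofReal_le_ofReal (le_abs_self _)
  have hn : ∫⁻ ω, ENNReal.ofReal (-f (K.field φ ω)) ∂P ≠ ⊤ := by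
    refine ne_top_of_le_ne_top hi.2.ne (lintegral_mono fun ω => ?_)
    rw [Real.enorm_eq_ofReal_abs]
    exact ENNReal.ofReal_le_ofReal (neg_le_abs _)
  rw [hφ.I_dens (H := fun ψ => ENNReal.ofReal (-f ψ)) hf.neg.ennreal_ofReal,
    hφ.I_dens (H := fun ψ => ENNReal.ofReal (f ψ)) hf.ennreal_ofReal, ← mul_add]
  refine ⟨ENNReal.mul_ne_top K.Z_ne_top hn, ?_⟩
  congr 1
  rw [integral_eq_lintegral_pos_part_sub_lintegral_neg_part hi] at he
  rw [← ENNReal.toReal_eq_toReal_iff' hp (ENNReal.add_ne_top.2 ⟨ENNReal.ofReal_ne_top, hn⟩),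
    ENNReal.toReal_add ENNReal.ofReal_ne_top hn, ENNReal.toReal_ofReal hc]
  linarith

/-- Lower bound for a sum over clusters after symmetrisation. -/
lemma le_sum_I_of_flip {o : V} (ho : o ∈ K.F) {f : (V → ℝ) → ℝ} (hf : Measurable f)
    {h : Finset V → (V → ℝ) → ℝ} (hm : ∀ T, Measurable (h T)) (h0 : ∀ T ψ, 0 ≤ h T ψ)
    (hflip : ∀ T ψ, h T (flip T ψ) = h T ψ)
    (H : ∀ T ψ, o ∈ T → K.weight {o} T ψ ≠ 0 → f ψ + f (flip T ψ) ≤ 2 * h T ψ) :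
    K.I 0 (fun ψ => ENNReal.ofReal (f ψ) * ENNReal.ofReal (dens K.w K.N ψ)) ≤
      ∑ T ∈ K.F.powerset with o ∈ T, K.I 0 (fun ψ => ENNReal.ofReal (h T ψ) * K.weight {o} T ψ) +
      K.I 0 (fun ψ => ENNReal.ofReal (-f ψ) * ENNReal.ofReal (dens K.w K.N ψ)) := by
  rw [← K.sum_I_weight_free ho (p := fun ψ => ENNReal.ofReal (f ψ)) hf.ennreal_ofReal,
    ← K.sum_I_weight_free ho (p := fun ψ => ENNReal.ofReal (-f ψ)) hf.neg.ennreal_ofReal,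
    ← Finset.sum_add_distrib]
  refine Finset.sum_le_sum fun T hT => ?_
  rw [Finset.mem_filter, Finset.mem_powerset] at hT
  rw [← K.I_add (H := fun ψ => ENNReal.ofReal (h T ψ) * K.weight {o} T ψ)
    ((hm T).ennreal_ofReal.mul (K.measurable_weight _ _))]
  simp only [← add_mul]
  refine K.I_weight_le_of_flip hT.1 (p := fun ψ => ENNReal.ofReal (f ψ))
    (q := fun ψ => ENNReal.ofReal (h T ψ) + ENNReal.ofReal (-f ψ)) hf.ennreal_ofReal
    ((hm T).ennreal_ofReal.add hf.neg.ennreal_ofReal) fun ψ hψ => ?_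
  simp only [hflip]
  exact ofReal_add_le (H T ψ hT.2 hψ) (h0 T ψ)

/-- Upper bound for a sum over clusters after symmetrisation. -/
lemma sum_I_le_of_flip {o : V} (ho : o ∈ K.F) {f : (V → ℝ) → ℝ} (hf : Measurable f)
    {h : Finset V → (V → ℝ) → ℝ} (hm : ∀ T, Measurable (h T)) (h0 : ∀ T ψ, 0 ≤ h T ψ)
    (hflip : ∀ T ψ, h T (flip T ψ) = h T ψ)
    (H : ∀ T ψ, o ∈ T → K.weight {o} T ψ ≠ 0 → 2 * h T ψ ≤ f ψ + f (flip T ψ)) :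
    ∑ T ∈ K.F.powerset with o ∈ T, K.I 0 (fun ψ => ENNReal.ofReal (h T ψ) * K.weight {o} T ψ) +
      K.I 0 (fun ψ => ENNReal.ofReal (-f ψ) * ENNReal.ofReal (dens K.w K.N ψ)) ≤
    K.I 0 (fun ψ => ENNReal.ofReal (f ψ) * ENNReal.ofReal (dens K.w K.N ψ)) := by
  rw [← K.sum_I_weight_free ho (p := fun ψ => ENNReal.ofReal (f ψ)) hf.ennreal_ofReal,
    ← K.sum_I_weight_free ho (p := fun ψ => ENNReal.ofReal (-f ψ)) hf.neg.ennreal_ofReal,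
    ← Finset.sum_add_distrib]
  refine Finset.sum_le_sum fun T hT => ?_
  rw [Finset.mem_filter, Finset.mem_powerset] at hT
  rw [← K.I_add (H := fun ψ => ENNReal.ofReal (h T ψ) * K.weight {o} T ψ)
    ((hm T).ennreal_ofReal.mul (K.measurable_weight _ _))]
  simp only [← add_mul]
  refine K.I_weight_le_of_flip hT.1 (q := fun ψ => ENNReal.ofReal (f ψ))
    (p := fun ψ => ENNReal.ofReal (h T ψ) + ENNReal.ofReal (-f ψ))
    ((hm T).ennreal_ofReal.add hf.neg.ennreal_ofReal) hf.ennreal_ofReal fun ψ hψ => ?_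
  simp only [hflip]
  exact le_ofReal_add (H T ψ hT.2 hψ) (h0 T ψ)

variable {K} {Ω : Type*} [MeasurableSpace Ω] {P : Measure Ω} {φ : Ω → V → ℝ}

lemma sum_G_nonneg (B : Finset V) (o : V) : 0 ≤ ∑ y ∈ B, K.G o y :=
  Finset.sum_nonneg fun _ _ => K.G_nonneg _ _

/-- Mean volume of the cluster of `o` at the critical level, weighted by the field. -/
theorem IsField.le_sum_I_vol (hφ : K.IsField P φ) {o : V} (ho : o ∈ K.F) {B : Finset V}
    (hB : B ⊆ K.F) : K.Z * ENNReal.ofReal (∑ y ∈ B, K.G o y) ≤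
      ∑ T ∈ K.F.powerset with o ∈ T,
        K.I 0 (fun ψ => ENNReal.ofReal (|ψ o| * vol B T ψ) * K.weight {o} T ψ) := by
  have hf : Measurable fun ψ : V → ℝ => ψ o * ∑ y ∈ B, ψ y := by fun_prop
  have hp := hφ.pair ho hB
  obtain ⟨h1, h2⟩ := hφ.I_real hf (sum_G_nonneg B o) hp.integrable_mul hp.integral_mul
  have h3 := K.le_sum_I_of_flip ho hf (h := fun T ψ => |ψ o| * vol B T ψ)
    (fun T => (measurable_pi_apply o).abs.mul (measurable_vol B T))
    (fun T ψ => mul_nonneg (abs_nonneg _) (vol_nonneg B T ψ))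
    (fun T ψ => by simp only [abs_flip, vol_flip]) ?_
  · rw [h2] at h3
    exact (ENNReal.add_le_add_iff_right h1).1 h3
  · intro T ψ hoT hw
    simp only [flip_of_mem hoT]
    rcases K.exists_sum_eq_of_weight_ne_zero B hw with h0 | ⟨Y, e1, ⟨h, e2⟩ | ⟨h, e2⟩⟩
    · simp [h0]
    · rw [e1, e2, abs_of_pos h]
      linarith
    · rw [e1, e2, abs_of_neg h]
      linarith

theorem IsField.sum_I_sinh_le (hφ : K.IsField P φ) {o : V} (ho : o ∈ K.F) {B : Finset V}
    (hB : B ⊆ K.F) {s : ℝ} (hs : 0 ≤ s) :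
    ∑ T ∈ K.F.powerset with o ∈ T,
        K.I 0 (fun ψ => ENNReal.ofReal (|ψ o| * Real.sinh (s * vol B T ψ)) * K.weight {o} T ψ) ≤
      K.Z * ENNReal.ofReal (s * (∑ y ∈ B, K.G o y) *
        Real.exp (s ^ 2 * (∑ x ∈ B, ∑ y ∈ B, K.G x y) / 2)) := by
  have hf : Measurable fun ψ : V → ℝ => ψ o * Real.sinh (s * ∑ y ∈ B, ψ y) := by fun_prop
  have hp := (hφ.pair ho hB).integral_mul_sinh s
  obtain ⟨h1, h2⟩ := hφ.I_real hf
    (mul_nonneg (mul_nonneg hs (sum_G_nonneg B o)) (Real.exp_pos _).le) hp.1 hp.2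
  have h0 : ∀ T ψ, 0 ≤ s * vol B T ψ := fun T ψ => mul_nonneg hs (vol_nonneg B T ψ)
  have h3 := K.sum_I_le_of_flip ho hf (h := fun T ψ => |ψ o| * Real.sinh (s * vol B T ψ))
    (fun T => (measurable_pi_apply o).abs.mul
      (Real.measurable_sinh.comp ((measurable_vol B T).const_mul s)))
    (fun T ψ => mul_nonneg (abs_nonneg _) (Real.sinh_nonneg_iff.2 (h0 T ψ)))
    (fun T ψ => by simp only [abs_flip, vol_flip]) ?_
  · rw [h2] at h3
    exact (ENNReal.add_le_add_iff_right h1).1 h3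
  · intro T ψ hoT hw
    simp only [flip_of_mem hoT]
    rcases K.exists_sum_eq_of_weight_ne_zero B hw with h0' | ⟨Y, e1, ⟨h, e2⟩ | ⟨h, e2⟩⟩
    · simp [h0']
    · have := two_mul_sinh_le (Y := s * Y) (h0 T ψ)
      rw [e1, e2, abs_of_pos h, add_sub_cancel_right, mul_add, mul_add, mul_neg, neg_add_eq_sub,
        ← neg_sub (s * vol B T ψ), Real.sinh_neg]
      nlinarith
    · have := two_mul_sinh_le (Y := s * Y) (h0 T ψ)
      rw [e1, e2, abs_of_neg h, add_sub_cancel_right, neg_neg, mul_add, mul_add, mul_neg,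
        neg_add_eq_sub, ← neg_sub (s * vol B T ψ), Real.sinh_neg]
      nlinarith

end Net

end GaussNet

namespace GaussNet

open BondPerc GaussianMixture Matrix

lemma ofReal_abs_eq (x : ℝ) :
    ENNReal.ofReal |x| = ENNReal.ofReal (-x) + ENNReal.ofReal x := by
  rcases le_total x 0 with h | h
  · rw [abs_of_nonpos h, ENNReal.ofReal_of_nonpos h, add_zero]
  · rw [abs_of_nonneg h, ENNReal.ofReal_of_nonpos (neg_nonpos.2 h), zero_add]

lemma le_four_add_sinh {x : ℝ} (hx : 0 ≤ x) : x ≤ 4 + 2 / 9 * Real.sinh x := by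
  have h1 := Real.quadratic_le_exp_of_nonneg hx
  have h2 : Real.exp (-x) ≤ 1 := Real.exp_le_one_iff.2 (by linarith)
  rw [Real.sinh_eq]
  nlinarith [sq_nonneg (x - 8)]

lemma mul_le_sq_add_exp {x y L : ℝ} (hx : 0 ≤ x) (hy : 0 ≤ y) (hL : 0 < L) (p : ℕ) :
    x * y ≤ L ^ 2 + (p + 2).factorial / L ^ p * (Real.exp x + Real.exp y) := by
  have key : ∀ m : ℝ, 0 ≤ m → m ^ 2 ≤ L ^ 2 + (p + 2).factorial / L ^ p * Real.exp m := by
    intro m hm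
    have hpos : 0 ≤ (p + 2).factorial / L ^ p * Real.exp m := by positivity
    rcases le_total m L with h | h
    · have := pow_le_pow_left₀ hm h 2
      linarith
    · have h1 := Real.pow_div_factorial_le_exp m hm (p + 2)
      rw [div_le_iff₀ (by positivity)] at h1
      have h2 : m ^ 2 * L ^ p ≤ m ^ (p + 2) := by
        rw [pow_add, mul_comm]
        exact mul_le_mul_of_nonneg_right (pow_le_pow_left₀ hL.le h p) (by positivity)
      have h3 : m ^ 2 ≤ (p + 2).factorial / L ^ p * Real.exp m := by
        rw [div_mul_eq_mul_div, le_div_iff₀ (by positivity)]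
        linarith
      nlinarith
  have e : 0 ≤ (p + 2).factorial / L ^ p := by positivity
  rcases le_total x y with h | h
  · have h1 := key y hy
    have h2 := mul_nonneg e (Real.exp_pos x).le
    nlinarith
  · have h1 := key x hx
    have h2 := mul_nonneg e (Real.exp_pos y).le
    nlinarith

lemma dens_add {V : Type*} (w : V → V → ℝ) (N : Finset V) (ψ : V → ℝ) (b : ℝ) :
    dens w N (fun x => ψ x + b) = dens w N ψ := by
  unfold dens bond
  simp only [add_sub_add_right_eq_sub]

namespace Net

variable {V : Type*} (K : Net V)

lemma I_abs_weight (b : ℝ) (o : V) {T : Finset V} (hT : T ⊆ K.F) (ho : o ∈ T) :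
    K.I b (fun ψ => ENNReal.ofReal |ψ o| * K.weight {o} T ψ) =
      2 * K.I b (fun ψ => ENNReal.ofReal (-ψ o) * K.weight {o} T ψ) := by
  have hw := K.measurable_weight {o} T
  have hm : Measurable fun ψ : V → ℝ => ENNReal.ofReal (-ψ o) * K.weight {o} T ψ := by fun_prop
  have h := K.I_flip (b := b) hm hT
  rw [two_mul]
  nth_rw 2 [← h]
  rw [← K.I_add hm]
  congr 1
  ext ψ
  rw [K.weight_flip hT, flip_of_mem ho, neg_neg, ← add_mul, ofReal_abs_eq]

/-- If the ground is nonnegative, a negative vertex is not connected to it. -/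
lemma sum_neg_mul_weight {o : V} (ho : o ∈ K.F) {ψ : V → ℝ} (hψ : 0 ≤ ψ K.bd) :
    ∑ T ∈ K.F.powerset with o ∈ T, ENNReal.ofReal (-ψ o) * K.weight {o} T ψ =
      ENNReal.ofReal (-ψ o) * ENNReal.ofReal (dens K.w K.N ψ) := by
  have h := K.sum_weight (S := {o}) (Finset.singleton_subset_iff.2 (K.F_subset ho))
    (fun _ => True) ψ
  simp only [and_true, Finset.singleton_subset_iff, implies_true, pr_true, mul_one] at h
  rw [← h, Finset.mul_sum]
  refine Finset.sum_subset ?_ fun T hT hT' => ?_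
  · intro T
    simp only [Finset.mem_filter, Finset.mem_powerset]
    exact fun h => ⟨h.1.trans K.F_subset, h.2⟩
  · simp only [Finset.mem_filter, Finset.mem_powerset, not_and'] at hT hT'
    have hbd : K.bd ∈ T := by
      by_contra hb
      refine hT' hT.2 fun x hx => ?_
      rcases Finset.mem_insert.1 (hT.1 hx) with rfl | h
      · exact absurd hx hb
      · exact h
    have hne : K.bd ≠ o := fun h => K.bd_notMem (h ▸ ho)
    rw [K.weight_eq]
    by_cases hc : conn (closed K.w ψ) {o} T = 0
    · rw [hc, ENNReal.ofReal_zero, zero_mul, mul_zero]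
    · have h1 := ne_zero_of_conn_ne_zero K.w_symm hc hbd hne
      have h2 := mul_pos_of_conn_ne_zero K.w_symm hc hbd h1
      have h3 : 0 ≤ ψ o := by nlinarith
      rw [ENNReal.ofReal_of_nonpos (neg_nonpos.2 h3), zero_mul]

lemma sum_I_abs_weight {b : ℝ} (hb : 0 ≤ b) {o : V} (ho : o ∈ K.F) :
    ∑ T ∈ K.F.powerset with o ∈ T, K.I b (fun ψ => ENNReal.ofReal |ψ o| * K.weight {o} T ψ) =
      2 * K.I b (fun ψ => ENNReal.ofReal (-ψ o) * ENNReal.ofReal (dens K.w K.N ψ)) := by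
  have hw := K.measurable_weight {o}
  have h1 : ∀ T ∈ K.F.powerset.filter (o ∈ ·),
      K.I b (fun ψ => ENNReal.ofReal |ψ o| * K.weight {o} T ψ) =
        2 * K.I b (fun ψ => ENNReal.ofReal (-ψ o) * K.weight {o} T ψ) := by
    intro T hT
    rw [Finset.mem_filter, Finset.mem_powerset] at hT
    exact K.I_abs_weight b o hT.1 hT.2
  rw [Finset.sum_congr rfl h1, ← Finset.mul_sum,
    ← K.I_sum _ (H := fun T ψ => ENNReal.ofReal (-ψ o) * K.weight {o} T ψ) fun T _ => by
      have := hw T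
      fun_prop]
  congr 1
  refine le_antisymm (K.I_mono fun ψ hψ => ?_) (K.I_mono fun ψ hψ => ?_) <;>
    rw [K.sum_neg_mul_weight ho (hψ ▸ hb)]

/-- The effect of the boundary value on the mean modulus at `o`. -/
lemma sum_I_abs_weight_zero_le {b : ℝ} (hb : 0 ≤ b) {o : V} (ho : o ∈ K.F) :
    ∑ T ∈ K.F.powerset with o ∈ T, K.I 0 (fun ψ => ENNReal.ofReal |ψ o| * K.weight {o} T ψ) ≤
      ∑ T ∈ K.F.powerset with o ∈ T, K.I b (fun ψ => ENNReal.ofReal |ψ o| * K.weight {o} T ψ) +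
        ENNReal.ofReal (2 * b) * K.Z := by
  have hd := measurable_dens K.w K.N
  rw [K.sum_I_abs_weight le_rfl ho, K.sum_I_abs_weight hb ho, K.I_shift b]
  simp only [dens_add]
  rw [← K.I_dens 0, ← K.I_const_mul _ (by fun_prop), ← K.I_const_mul _ (by fun_prop),
    ← K.I_const_mul _ (by fun_prop), ← K.I_add (by fun_prop)]
  refine K.I_mono fun ψ _ => ?_
  rw [← mul_assoc, ← mul_assoc, ← add_mul]
  refine mul_le_mul_left ?_ _
  rw [ENNReal.ofReal_mul zero_le_two, ENNReal.ofReal_ofNat, ← mul_add]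
  refine mul_le_mul_right ?_ _
  exact (ENNReal.ofReal_le_ofReal (by linarith : -ψ o ≤ -(ψ o + b) + b)).trans
    ENNReal.ofReal_add_le

/-- Monotonicity in the boundary value of the integral of a function of the cluster. -/
lemma I_weight_antitone (b : ℝ) {S T : Finset V} (hT : T ⊆ K.F) {H : (V → ℝ) → ℝ≥0∞}
    (hHm : Measurable H) (hH : ∀ ψ ψ' : V → ℝ, (∀ x ∈ T, ψ x = ψ' x) → H ψ = H ψ') :
    K.I b (fun ψ => H ψ * K.weight S T ψ) ≤ K.I 0 (fun ψ => H ψ * K.weight S T ψ) := by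
  have hc := measurable_conn K.w S T
  have h := K.I_compare hT (b := b) (q := 0)
    (fun f _ _ => Finset.sum_nonneg fun e _ => mul_nonneg (K.w_nonneg _ _) (sq_nonneg _))
    (H := fun ψ => H ψ * ENNReal.ofReal (conn (closed K.w ψ) S T)) (by fun_prop) fun ψ ψ' h => by
      simp only [hH ψ ψ' h, conn_field_congr h]
  simp only [zero_div, neg_zero, Real.exp_zero, ENNReal.ofReal_one, one_mul, mul_assoc] at h
  simpa only [K.weight_eq] using h

variable {K} {Ω : Type*} [MeasurableSpace Ω] {P : Measure Ω} {φ : Ω → V → ℝ}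

lemma IsField.I_exp_abs_le (hφ : K.IsField P φ) {b g₀ : ℝ} (hb : 0 ≤ b) {y : V} (hy : y ∈ K.F)
    (hg : K.G y y ≤ g₀) :
    K.I b (fun ψ => ENNReal.ofReal (Real.exp |ψ y|) * ENNReal.ofReal (dens K.w K.N ψ)) ≤
      K.Z * ENNReal.ofReal (2 * Real.exp (b + g₀ / 2)) := by
  have hd := measurable_dens K.w K.N
  rw [K.I_shift]
  simp only [dens_add]
  have h1 := hφ.I_dens (H := fun ψ => ENNReal.ofReal (Real.exp b * Real.exp |ψ y|)) (by fun_prop)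
  have hp := (hφ.pair hy (Finset.empty_subset K.F)).lintegral_exp_abs_le
  refine (K.I_mono (H' := fun ψ => ENNReal.ofReal (Real.exp b * Real.exp |ψ y|) *
    ENNReal.ofReal (dens K.w K.N ψ)) fun ψ _ => mul_le_mul_left
      (ENNReal.ofReal_le_ofReal ?_) _).trans ?_
  · rw [← Real.exp_add]
    refine Real.exp_le_exp.2 ((abs_add_le _ _).trans ?_)
    rw [abs_of_nonneg hb, add_comm]
  · rw [h1]
    refine mul_le_mul_right ?_ _
    simp only [ENNReal.ofReal_mul (Real.exp_pos b).le]
    rw [lintegral_const_mul' _ _ ENNReal.ofReal_ne_top]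
    refine (mul_le_mul_right hp _).trans ?_
    rw [← ENNReal.ofReal_mul (Real.exp_pos b).le]
    refine ENNReal.ofReal_le_ofReal ?_
    rw [Real.exp_add, mul_left_comm]
    have := Real.exp_le_exp.2 (by linarith : K.G y y / 2 ≤ g₀ / 2)
    gcongr

lemma vol_congr {B T : Finset V} {ψ ψ' : V → ℝ} (h : ∀ x ∈ T, ψ x = ψ' x) :
    vol B T ψ = vol B T ψ' :=
  Finset.sum_congr rfl fun y hy => by rw [h y (Finset.mem_inter.1 hy).1]

/-- Mean volume of the cluster of `o`, weighted by the field, with boundary value `b`. -/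
theorem IsField.le_sum_I_vol_boundary (hφ : K.IsField P φ) {b : ℝ} (hb : 0 ≤ b) {o : V}
    (ho : o ∈ K.F) {B : Finset V} (hB : B ⊆ K.F) {s : ℝ} (hs : 0 ≤ s)
    (hsB : s ^ 2 * ∑ x ∈ B, ∑ y ∈ B, K.G x y ≤ 1) :
    K.Z * ENNReal.ofReal (s * ∑ y ∈ B, K.G o y) ≤
      ∑ T ∈ K.F.powerset with o ∈ T,
        K.I b (fun ψ => ENNReal.ofReal (|ψ o| * (s * vol B T ψ)) * K.weight {o} T ψ) +
      ENNReal.ofReal (8 * b) * K.Z + K.Z * ENNReal.ofReal (s / 2 * ∑ y ∈ B, K.G o y) := by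
  have hv := measurable_vol B
  have hw := K.measurable_weight {o}
  have hsv : ∀ T ψ, 0 ≤ s * vol B T ψ := fun T ψ => mul_nonneg hs (vol_nonneg B T ψ)
  have ha : Measurable fun ψ : V → ℝ => |ψ o| := (measurable_pi_apply o).abs
  have hsh : ∀ T : Finset V, Measurable fun ψ : V → ℝ => Real.sinh (s * vol B T ψ) := fun T =>
    Real.measurable_sinh.comp ((hv T).const_mul s)
  set Δ : Finset V → (V → ℝ) → ℝ := fun T ψ =>
    |ψ o| * (4 + 2 / 9 * Real.sinh (s * vol B T ψ) - s * vol B T ψ) with hΔ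
  have hΔ0 : ∀ T ψ, 0 ≤ Δ T ψ := fun T ψ => mul_nonneg (abs_nonneg _)
    (sub_nonneg.2 (le_four_add_sinh (hsv T ψ)))
  have hΔm : ∀ T, Measurable (Δ T) := fun T => by
    have := hv T
    have := hsh T
    simp only [hΔ]
    fun_prop
  set M : ℝ → (Finset V → (V → ℝ) → ℝ) → ℝ≥0∞ := fun b f =>
    ∑ T ∈ K.F.powerset with o ∈ T, K.I b (fun ψ => ENNReal.ofReal (f T ψ) * K.weight {o} T ψ)
    with hM
  have hMadd : ∀ b f g, (∀ T, Measurable (f T)) → (∀ T ψ, 0 ≤ f T ψ) → (∀ T ψ, 0 ≤ g T ψ) →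
      M b (fun T ψ => f T ψ + g T ψ) = M b f + M b g := by
    intro b f g hf hf0 hg0
    simp only [hM]
    rw [← Finset.sum_add_distrib]
    refine Finset.sum_congr rfl fun T _ => ?_
    rw [← K.I_add (by have := hf T; have := hw T; fun_prop)]
    congr 1
    ext ψ
    rw [ENNReal.ofReal_add (hf0 T ψ) (hg0 T ψ), add_mul]
  have hMmul : ∀ (b c : ℝ) f, (∀ T, Measurable (f T)) → 0 ≤ c →
      M b (fun T ψ => c * f T ψ) = ENNReal.ofReal c * M b f := by
    intro b c f hf hc
    simp only [hM]
    rw [Finset.mul_sum]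
    refine Finset.sum_congr rfl fun T _ => ?_
    rw [← K.I_const_mul _ (by have := hf T; have := hw T; fun_prop)]
    congr 1
    ext ψ
    rw [ENNReal.ofReal_mul hc, mul_assoc]
  have hMle : M b Δ ≤ M 0 Δ := by
    refine Finset.sum_le_sum fun T hT => ?_
    rw [Finset.mem_filter, Finset.mem_powerset] at hT
    refine K.I_weight_antitone b hT.1 (hΔm T).ennreal_ofReal fun ψ ψ' h => ?_
    simp only [hΔ, h o hT.2, vol_congr h]
  have e0 : ∀ b, M b Δ + M b (fun T ψ => |ψ o| * (s * vol B T ψ)) =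
      ENNReal.ofReal 4 * M b (fun _ ψ => |ψ o|) +
        ENNReal.ofReal (2 / 9) * M b (fun T ψ => |ψ o| * Real.sinh (s * vol B T ψ)) := by
    intro b
    have a1 : M b (fun _ ψ => 4 * |ψ o|) = _ := hMmul b 4 (fun _ ψ => |ψ o|) (fun _ => ha)
      (by norm_num)
    have a2 : M b (fun T ψ => 2 / 9 * (|ψ o| * Real.sinh (s * vol B T ψ))) = _ := hMmul b (2 / 9)
      (fun T ψ => |ψ o| * Real.sinh (s * vol B T ψ)) (fun T => ha.mul (hsh T)) (by norm_num)
    rw [← a1, ← a2, ← hMadd _ _ _ hΔm hΔ0 fun T ψ => mul_nonneg (abs_nonneg _) (hsv T ψ),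
      ← hMadd _ _ _ (fun _ => by fun_prop) (fun T ψ => by positivity) fun T ψ => mul_nonneg
        (by norm_num) (mul_nonneg (abs_nonneg _) (Real.sinh_nonneg_iff.2 (hsv T ψ)))]
    congr 1
    ext T ψ
    simp only [hΔ]
    ring
  have h4 : M 0 (fun _ ψ => |ψ o|) ≤ M b (fun _ ψ => |ψ o|) + ENNReal.ofReal (2 * b) * K.Z :=
    K.sum_I_abs_weight_zero_le hb ho
  have hfin : M b (fun _ ψ => |ψ o|) ≠ ⊤ := by
    simp only [hM]
    rw [K.sum_I_abs_weight hb ho]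
    refine ENNReal.mul_ne_top ENNReal.ofNat_ne_top (ne_top_of_le_ne_top (ENNReal.mul_ne_top
      K.Z_ne_top ENNReal.ofReal_ne_top) ((K.I_mono fun ψ _ => mul_le_mul_left
        (ENNReal.ofReal_le_ofReal ?_) _).trans (hφ.I_exp_abs_le hb ho le_rfl)))
    have := Real.add_one_le_exp |ψ o|
    linarith [neg_le_abs (ψ o)]
  have hlow : K.Z * ENNReal.ofReal (s * ∑ y ∈ B, K.G o y) ≤
      M 0 (fun T ψ => |ψ o| * (s * vol B T ψ)) := by
    have h := hφ.le_sum_I_vol ho hB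
    have e : (fun (T : Finset V) (ψ : V → ℝ) => |ψ o| * (s * vol B T ψ)) =
        fun T ψ => s * (|ψ o| * vol B T ψ) := by
      ext T ψ
      ring
    rw [e, hMmul 0 s (fun T ψ => |ψ o| * vol B T ψ) (fun T => ha.mul (hv T)) hs,
      ENNReal.ofReal_mul hs, mul_left_comm]
    exact mul_le_mul_right h _
  have hup : ENNReal.ofReal (2 / 9) * M 0 (fun T ψ => |ψ o| * Real.sinh (s * vol B T ψ)) ≤
      K.Z * ENNReal.ofReal (s / 2 * ∑ y ∈ B, K.G o y) := by
    refine (mul_le_mul_right (hφ.sum_I_sinh_le ho hB hs) _).trans ?_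
    rw [mul_left_comm, ← ENNReal.ofReal_mul (by norm_num)]
    refine mul_le_mul_right (ENNReal.ofReal_le_ofReal ?_) _
    have h1 : Real.exp (s ^ 2 * (∑ x ∈ B, ∑ y ∈ B, K.G x y) / 2) ≤ 9 / 4 := by
      refine (Real.exp_le_exp.2 (by linarith : _ ≤ (1 / 2 : ℝ))).trans ?_
      have h2 := Real.exp_one_lt_d9
      have h3 : Real.exp (1 / 2) ^ 2 = Real.exp 1 := by
        rw [← Real.exp_nat_mul]
        norm_num
      nlinarith [Real.exp_pos (1 / 2)]
    have h2 := mul_nonneg hs (sum_G_nonneg (K := K) B o)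
    nlinarith
  refine (ENNReal.add_le_add_iff_left (ENNReal.mul_ne_top (ENNReal.ofReal_ne_top (r := 4))
    hfin)).1 ?_
  calc ENNReal.ofReal 4 * M b (fun _ ψ => |ψ o|) + K.Z * ENNReal.ofReal (s * ∑ y ∈ B, K.G o y)
      ≤ (ENNReal.ofReal 4 * M b (fun _ ψ => |ψ o|) +
          ENNReal.ofReal (2 / 9) * M b (fun T ψ => |ψ o| * Real.sinh (s * vol B T ψ))) +
          M 0 (fun T ψ => |ψ o| * (s * vol B T ψ)) := add_le_add (le_add_right le_rfl) hlow
    _ ≤ (M 0 Δ + M b (fun T ψ => |ψ o| * (s * vol B T ψ))) +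
          M 0 (fun T ψ => |ψ o| * (s * vol B T ψ)) := by
        rw [← e0]
        gcongr
    _ = M b (fun T ψ => |ψ o| * (s * vol B T ψ)) + (ENNReal.ofReal 4 * M 0 (fun _ ψ => |ψ o|) +
        ENNReal.ofReal (2 / 9) * M 0 (fun T ψ => |ψ o| * Real.sinh (s * vol B T ψ))) := by
        rw [← e0]
        ring
    _ ≤ M b (fun T ψ => |ψ o| * (s * vol B T ψ)) +
        (ENNReal.ofReal 4 * (M b (fun _ ψ => |ψ o|) + ENNReal.ofReal (2 * b) * K.Z) +
        K.Z * ENNReal.ofReal (s / 2 * ∑ y ∈ B, K.G o y)) := by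
        gcongr
    _ = _ := by
        have e : ENNReal.ofReal (8 * b) = ENNReal.ofReal 4 * ENNReal.ofReal (2 * b) := by
          rw [← ENNReal.ofReal_mul (by norm_num)]
          ring_nf
        rw [e]
        ring

end Net

end GaussNet

namespace GaussNet

open BondPerc GaussianMixture Matrix

namespace Net

variable {V : Type*} (K : Net V)

lemma sum_I_mul_weight_le {o : V} (ho : o ∈ K.F) (b : ℝ) {p : (V → ℝ) → ℝ≥0∞}
    (hp : Measurable p) :
    ∑ T ∈ K.F.powerset with o ∈ T, K.I b (fun ψ => p ψ * K.weight {o} T ψ) ≤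
      K.I b (fun ψ => p ψ * ENNReal.ofReal (dens K.w K.N ψ)) := by
  rw [← K.I_sum _ (H := fun T ψ => p ψ * K.weight {o} T ψ) fun T _ =>
    hp.mul (K.measurable_weight _ _)]
  refine K.I_mono fun ψ _ => ?_
  rw [← Finset.mul_sum]
  refine mul_le_mul_right ((Finset.sum_le_sum_of_subset fun T => ?_).trans
    (K.sum_weight_le_dens (S := {o}) (Finset.singleton_subset_iff.2 (K.F_subset ho))
    (fun _ => True) ψ)) _
  simp only [Finset.mem_filter, Finset.mem_powerset, Finset.singleton_subset_iff, and_true]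
  exact fun h => ⟨h.1.trans K.F_subset, h.2⟩

variable {K} {Ω : Type*} [MeasurableSpace Ω] {P : Measure Ω} {φ : Ω → V → ℝ}

/-- Lower bound for the mean volume of the cluster of `o` with boundary value `b`. -/
theorem IsField.le_sum_card (hφ : K.IsField P φ) {b : ℝ} (hb : 0 ≤ b) {o : V}
    (ho : o ∈ K.F) {B : Finset V} (hB : B ⊆ K.F) {s : ℝ} (hs : 0 < s)
    (hsB : s ^ 2 * ∑ x ∈ B, ∑ y ∈ B, K.G x y ≤ 1) {L : ℝ} (hL : 0 < L) (p : ℕ) {g₀ : ℝ}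
    (hg : ∀ y ∈ K.F, K.G y y ≤ g₀) :
    K.Z * ENNReal.ofReal (((∑ y ∈ B, K.G o y) / 2 - 8 * b / s -
      B.card * ((p + 2).factorial / L ^ p * (4 * Real.exp (b + g₀ / 2)))) / L ^ 2) ≤
      ∑ T ∈ K.F.powerset with o ∈ T, (T.card : ℝ≥0∞) * K.I b (K.weight {o} T) := by
  have hd := measurable_dens K.w K.N
  have hw := K.measurable_weight {o}
  set c : ℝ := (p + 2).factorial / L ^ p with hc
  have hc0 : 0 ≤ c := by positivity
  set Q : (V → ℝ) → ℝ≥0∞ := fun ψ =>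
    ∑ y ∈ B, ENNReal.ofReal (s * c) * (ENNReal.ofReal (Real.exp |ψ o|) +
      ENNReal.ofReal (Real.exp |ψ y|)) with hQ
  have hQm : Measurable Q := by
    simp only [hQ]
    fun_prop
  set S := ∑ T ∈ K.F.powerset with o ∈ T, (T.card : ℝ≥0∞) * K.I b (K.weight {o} T) with hS
  have hpt : ∀ (T : Finset V) (ψ : V → ℝ), ENNReal.ofReal (|ψ o| * (s * vol B T ψ)) ≤
      ENNReal.ofReal (s * L ^ 2) * T.card + Q ψ := by
    intro T ψ
    have h1 : |ψ o| * (s * vol B T ψ) ≤ s * L ^ 2 * T.card +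
        ∑ y ∈ B, s * c * (Real.exp |ψ o| + Real.exp |ψ y|) := by
      have h2 : |ψ o| * vol B T ψ ≤
          ∑ y ∈ T ∩ B, (L ^ 2 + c * (Real.exp |ψ o| + Real.exp |ψ y|)) := by
        rw [vol, Finset.mul_sum]
        exact Finset.sum_le_sum fun y _ =>
          mul_le_sq_add_exp (abs_nonneg _) (abs_nonneg _) hL p
      have h3 : ∑ y ∈ T ∩ B, c * (Real.exp |ψ o| + Real.exp |ψ y|) ≤
          ∑ y ∈ B, c * (Real.exp |ψ o| + Real.exp |ψ y|) :=
        Finset.sum_le_sum_of_subset_of_nonneg Finset.inter_subset_right fun y _ _ => by positivity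
      have h4 : ((T ∩ B).card : ℝ) ≤ T.card :=
        Nat.cast_le.2 (Finset.card_le_card Finset.inter_subset_left)
      rw [Finset.sum_add_distrib, Finset.sum_const, nsmul_eq_mul] at h2
      have h5 := mul_le_mul_of_nonneg_right h4 (sq_nonneg L)
      simp only [mul_assoc, ← Finset.mul_sum] at h3 ⊢
      rw [mul_left_comm, ← mul_add]
      rw [← Finset.mul_sum] at h2
      refine mul_le_mul_of_nonneg_left ?_ hs.le
      linarith
    refine (ENNReal.ofReal_le_ofReal h1).trans ?_
    rw [ENNReal.ofReal_add (by positivity) (Finset.sum_nonneg fun y _ => by positivity),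
      ENNReal.ofReal_mul (by positivity), ENNReal.ofReal_natCast,
      ENNReal.ofReal_sum_of_nonneg fun y _ => by positivity]
    refine add_le_add le_rfl (Finset.sum_le_sum fun y _ => ?_)
    rw [ENNReal.ofReal_mul (by positivity), ENNReal.ofReal_add (by positivity) (by positivity)]
  have hQI : K.I b (fun ψ => Q ψ * ENNReal.ofReal (dens K.w K.N ψ)) ≤
      K.Z * ENNReal.ofReal (s * (B.card * (c * (4 * Real.exp (b + g₀ / 2))))) := by
    simp only [hQ, Finset.sum_mul, mul_assoc, add_mul]
    rw [K.I_sum _ (H := fun y ψ => ENNReal.ofReal (s * c) * (ENNReal.ofReal (Real.exp |ψ o|) *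
      ENNReal.ofReal (dens K.w K.N ψ) + ENNReal.ofReal (Real.exp |ψ y|) *
      ENNReal.ofReal (dens K.w K.N ψ))) fun y _ => by fun_prop]
    have h1 : ∀ y ∈ B, K.I b (fun ψ => ENNReal.ofReal (s * c) * (ENNReal.ofReal (Real.exp |ψ o|) *
        ENNReal.ofReal (dens K.w K.N ψ) + ENNReal.ofReal (Real.exp |ψ y|) *
        ENNReal.ofReal (dens K.w K.N ψ))) ≤
        K.Z * ENNReal.ofReal (s * (c * (4 * Real.exp (b + g₀ / 2)))) := by
      intro y hy
      rw [K.I_const_mul _ (by fun_prop), K.I_add (by fun_prop)]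
      refine (mul_le_mul_right (add_le_add (hφ.I_exp_abs_le hb ho (hg o ho))
        (hφ.I_exp_abs_le hb (hB hy) (hg y (hB hy)))) _).trans_eq ?_
      rw [← mul_add, ← ENNReal.ofReal_add (by positivity) (by positivity), mul_left_comm,
        ← ENNReal.ofReal_mul (by positivity)]
      congr 2
      ring
    refine (Finset.sum_le_sum h1).trans_eq ?_
    rw [Finset.sum_const, nsmul_eq_mul, mul_left_comm, ← ENNReal.ofReal_natCast,
      ← ENNReal.ofReal_mul (by positivity)]
    congr 2
    ring
  have hmain : ∑ T ∈ K.F.powerset with o ∈ T,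
      K.I b (fun ψ => ENNReal.ofReal (|ψ o| * (s * vol B T ψ)) * K.weight {o} T ψ) ≤
      ENNReal.ofReal (s * L ^ 2) * S +
        K.Z * ENNReal.ofReal (s * (B.card * (c * (4 * Real.exp (b + g₀ / 2))))) := by
    refine le_trans ?_ (add_le_add le_rfl ((K.sum_I_mul_weight_le ho b hQm).trans hQI))
    rw [hS, Finset.mul_sum, ← Finset.sum_add_distrib]
    refine Finset.sum_le_sum fun T _ => ?_
    have h1 := hw T
    rw [← mul_assoc, ← K.I_const_mul _ h1, ← K.I_add (by fun_prop)]
    refine K.I_mono fun ψ _ => ?_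
    rw [← add_mul]
    exact mul_le_mul_left (hpt T ψ) _
  have h := (hφ.le_sum_I_vol_boundary hb ho hB hs.le hsB).trans
    (add_le_add (add_le_add hmain le_rfl) le_rfl)
  set R := B.card * (c * (4 * Real.exp (b + g₀ / 2))) with hR
  have hR0 : 0 ≤ R := by positivity
  set C := ∑ y ∈ B, K.G o y with hC
  have hC0 : 0 ≤ C := sum_G_nonneg (K := K) B o
  by_cases hST : S = ⊤
  · rw [hST]
    exact le_top
  have hz : 0 < K.Z.toReal := ENNReal.toReal_pos K.Z_ne_zero K.Z_ne_top
  have h' := ENNReal.toReal_mono (by simp [ENNReal.mul_eq_top, hST, K.Z_ne_top]) h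
  have hm : ∀ {x : ℝ}, 0 ≤ x → K.Z * ENNReal.ofReal x = ENNReal.ofReal (K.Z.toReal * x) := by
    intro x hx
    rw [ENNReal.ofReal_mul hz.le, ENNReal.ofReal_toReal K.Z_ne_top]
  rw [← ENNReal.ofReal_toReal hST, ← ENNReal.ofReal_toReal K.Z_ne_top,
    ← ENNReal.ofReal_mul hz.le]
  refine ENNReal.ofReal_le_ofReal ?_
  have e2 : ∀ {x : ℝ}, 0 ≤ x → (K.Z * ENNReal.ofReal x).toReal = K.Z.toReal * x := by
    intro x hx
    rw [ENNReal.toReal_mul, ENNReal.toReal_ofReal hx]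
  have f1 : ∀ {x : ℝ}, K.Z * ENNReal.ofReal x ≠ ⊤ := fun {x} =>
    ENNReal.mul_ne_top K.Z_ne_top ENNReal.ofReal_ne_top
  have f2 : ENNReal.ofReal (s * L ^ 2) * S ≠ ⊤ := ENNReal.mul_ne_top ENNReal.ofReal_ne_top hST
  rw [mul_comm (ENNReal.ofReal (8 * b)), ENNReal.toReal_add
    (ENNReal.add_ne_top.2 ⟨ENNReal.add_ne_top.2 ⟨f2, f1⟩, f1⟩) f1,
    ENNReal.toReal_add (ENNReal.add_ne_top.2 ⟨f2, f1⟩) f1, ENNReal.toReal_add f2 f1,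
    e2 (by positivity), e2 (by positivity), e2 (by positivity), e2 (by positivity),
    ENNReal.toReal_mul, ENNReal.toReal_ofReal (by positivity)] at h'
  rw [mul_div_assoc', div_le_iff₀ (by positivity)]
  have e3 : s * (K.Z.toReal * (C / 2 - 8 * b / s - R)) =
      K.Z.toReal * (s * C) - K.Z.toReal * (s / 2 * C) - K.Z.toReal * (8 * b) -
        K.Z.toReal * (s * R) := by
    field_simp
    ring
  refine le_of_mul_le_mul_left ?_ hs
  rw [e3]
  linarith

end Net

end GaussNet

namespace WGraph

variable {M : WGraph}

/-- The neighbours of `x`, including `x` itself if there is a loop at `x`. -/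
def nbr (M : WGraph) (x : M.V) : Finset M.V := (M.locFin x).toFinset

lemma mem_nbr {x y : M.V} : y ∈ M.nbr x ↔ M.lam x y ≠ 0 := by
  simp [nbr, Function.mem_support]

lemma mem_nbr_iff_pos {x y : M.V} : y ∈ M.nbr x ↔ 0 < M.lam x y :=
  mem_nbr.trans (M.lam_nonneg x y).lt_iff_ne'.symm

lemma mem_nbr_comm {x y : M.V} : y ∈ M.nbr x ↔ x ∈ M.nbr y := by
  rw [mem_nbr, mem_nbr, M.lam_symm]

lemma lamTot_eq_sum (x : M.V) : M.lamTot x = ∑ y ∈ M.nbr x, M.lam x y :=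
  finsum_eq_sum_of_support_subset _ (by simp [nbr])

lemma lamTot_nonneg (x : M.V) : 0 ≤ M.lamTot x := by
  rw [lamTot_eq_sum]
  exact Finset.sum_nonneg fun y _ => M.lam_nonneg x y

lemma p_nonneg (x y : M.V) : 0 ≤ M.p x y := div_nonneg (M.lam_nonneg x y) (lamTot_nonneg x)

lemma p_eq_zero {x y : M.V} (h : y ∉ M.nbr x) : M.p x y = 0 := by
  rw [mem_nbr, not_not] at h
  rw [p, h, zero_div]

lemma pstep_succ (n : ℕ) (x y : M.V) :
    M.pstep (n + 1) x y = ∑ z ∈ M.nbr x, M.p x z * M.pstep n z y := by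
  rw [pstep]
  refine finsum_eq_sum_of_support_subset _ fun z hz => ?_
  rw [Function.mem_support] at hz
  by_contra h
  exact hz (by rw [p_eq_zero h, zero_mul])

lemma pstep_nonneg (n : ℕ) (x y : M.V) : 0 ≤ M.pstep n x y := by
  induction n generalizing x with
  | zero =>
    rw [pstep]
    split_ifs <;> norm_num
  | succ n ih =>
    rw [pstep_succ]
    exact Finset.sum_nonneg fun z _ => mul_nonneg (p_nonneg x z) (ih z)

lemma pstep_succ' (n : ℕ) (x y : M.V) :
    M.pstep (n + 1) x y = ∑ z ∈ M.nbr y, M.pstep n x z * M.p z y := by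
  induction n generalizing x with
  | zero =>
    rw [pstep_succ]
    simp only [pstep, mul_ite, mul_one, mul_zero, ite_mul, one_mul, zero_mul,
      Finset.sum_ite_eq, Finset.sum_ite_eq', mem_nbr_comm (x := y)]
  | succ n ih =>
    rw [pstep_succ]
    simp only [ih, Finset.mul_sum]
    rw [Finset.sum_comm]
    refine Finset.sum_congr rfl fun z _ => ?_
    rw [pstep_succ, Finset.sum_mul]
    exact Finset.sum_congr rfl fun u _ => by ring

lemma lamTot_mul_p {x : M.V} (hx : M.lamTot x ≠ 0) (y : M.V) :
    M.lamTot x * M.p x y = M.lam x y := mul_div_cancel₀ _ hx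

lemma pstep_reversible (hl : ∀ x, M.lamTot x ≠ 0) (n : ℕ) (x y : M.V) :
    M.lamTot x * M.pstep n x y = M.lamTot y * M.pstep n y x := by
  induction n generalizing x with
  | zero =>
    simp only [pstep]
    split_ifs with h h' h'
    · rw [h]
    · exact (h' h.symm).elim
    · exact (h h'.symm).elim
    · rw [mul_zero, mul_zero]
  | succ n ih =>
    rw [pstep_succ, pstep_succ', Finset.mul_sum, Finset.mul_sum]
    refine Finset.sum_congr rfl fun z _ => ?_
    rw [← mul_assoc, lamTot_mul_p (hl x), M.lam_symm, ← lamTot_mul_p (hl z), mul_right_comm,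
      ih z]
    ring

lemma summable_pstep (hT : M.Transient) (hl : ∀ x, M.lamTot x ≠ 0) (x y : M.V) :
    Summable fun n => M.pstep n x y := by
  have h := M.connectedG x y
  induction h with
  | refl => exact hT x
  | @tail z y _ hzy ih =>
    have hp : 0 < M.p y z :=
      div_pos (by rwa [M.lam_symm]) ((lamTot_nonneg y).lt_of_ne' (hl y))
    refine (((summable_nat_add_iff 1).2 ih).div_const (M.p y z)).of_nonneg_of_le
      (fun n => pstep_nonneg n x y) fun n => ?_
    rw [le_div_iff₀ hp, pstep_succ']
    exact Finset.single_le_sum (f := fun u => M.pstep n x u * M.p u z)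
      (fun u _ => mul_nonneg (pstep_nonneg _ _ _) (p_nonneg _ _))
      (mem_nbr_iff_pos.2 hzy)

lemma green_nonneg (x y : M.V) : 0 ≤ M.green x y :=
  div_nonneg (tsum_nonneg fun n => pstep_nonneg n x y) (lamTot_nonneg y)

lemma green_symm (hl : ∀ x, M.lamTot x ≠ 0) (x y : M.V) : M.green x y = M.green y x := by
  rw [green, green, div_eq_div_iff (hl y) (hl x), mul_comm, ← tsum_mul_left,
    mul_comm _ (M.lamTot y),
    ← tsum_mul_left]
  exact tsum_congr fun n => pstep_reversible hl n x y

lemma green_step (hT : M.Transient) (hl : ∀ x, M.lamTot x ≠ 0) (x y : M.V) :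
    M.green x y = (if x = y then (M.lamTot y)⁻¹ else 0) +
      ∑ z ∈ M.nbr x, M.p x z * M.green z y := by
  have h : ∑' n, M.pstep n x y = (if x = y then 1 else 0) +
      ∑ z ∈ M.nbr x, M.p x z * ∑' n, M.pstep n z y := by
    rw [(summable_pstep hT hl x y).tsum_eq_zero_add]
    simp only [pstep_succ]
    rw [Summable.tsum_finsetSum fun z _ => (summable_pstep hT hl z y).mul_left _]
    simp only [tsum_mul_left]
    rfl
  rw [green, h, add_div, Finset.sum_div]
  congr 1
  · split_ifs <;> simp
  · exact Finset.sum_congr rfl fun z _ => by rw [green, mul_div_assoc]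

lemma inv_lamTot_le_green (hT : M.Transient) (hl : ∀ x, M.lamTot x ≠ 0) (x : M.V) :
    (M.lamTot x)⁻¹ ≤ M.green x x := by
  rw [green_step hT hl, if_pos rfl]
  have := Finset.sum_nonneg fun z (_ : z ∈ M.nbr x) => mul_nonneg (p_nonneg x z) (green_nonneg z x)
  linarith

/-- The ball as a finset, when it is finite. -/
def fball (M : WGraph) (x : M.V) (r : ℝ) : Finset M.V :=
  if h : (M.ball x r).Finite then h.toFinset else ∅

lemma bddBelow_graphDist (x y : M.V) : BddBelow {r : ℝ | ∃ n : ℕ, r = n ∧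
    ∃ γ : Fin (n + 1) → M.V, γ 0 = x ∧ γ (Fin.last n) = y ∧
      ∀ i : Fin n, 0 < M.lam (γ i.castSucc) (γ i.succ)} :=
  ⟨0, by rintro _ ⟨n, rfl, _⟩; exact Nat.cast_nonneg n⟩

lemma graphDist_le_one {x y : M.V} (h : 0 < M.lam x y) : M.graphDist x y ≤ 1 := by
  refine csInf_le (bddBelow_graphDist x y) ⟨1, by simp, ![x, y], rfl, rfl, fun i => ?_⟩
  fin_cases i
  exact h

lemma exists_path (x y : M.V) : ∃ (n : ℕ) (γ : Fin (n + 1) → M.V), γ 0 = x ∧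
    γ (Fin.last n) = y ∧ ∀ i : Fin n, 0 < M.lam (γ i.castSucc) (γ i.succ) := by
  have h := M.connectedG x y
  induction h with
  | refl => exact ⟨0, fun _ => x, rfl, rfl, fun i => i.elim0⟩
  | @tail z y _ hzy ih =>
    obtain ⟨n, γ, h0, hn, hγ⟩ := ih
    refine ⟨n + 1, Fin.snoc γ y, ?_, by simp, fun i => ?_⟩
    · rw [← Fin.castSucc_zero, Fin.snoc_castSucc, h0]
    · induction i using Fin.lastCases with
      | last => rw [Fin.snoc_castSucc, hn, Fin.succ_last, Fin.snoc_last]; exact hzy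
      | cast j => rw [Fin.snoc_castSucc, Fin.succ_castSucc, Fin.snoc_castSucc]; exact hγ j

lemma one_le_graphDist {x y : M.V} (h : x ≠ y) : 1 ≤ M.graphDist x y := by
  refine le_csInf ?_ ?_
  · obtain ⟨n, γ, hγ⟩ := exists_path x y
    exact ⟨n, n, rfl, γ, hγ⟩
  · rintro _ ⟨n, rfl, γ, h0, hn, _⟩
    rcases n with _ | n
    · exact (h (h0.symm.trans hn)).elim
    · simp

/-- Quantitative form of the standing assumptions for the graph distance. -/
structure Reg (M : WGraph) (C : ℝ) : Prop where
  transient : M.Transient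
  one_le : 1 ≤ C
  ball_finite : ∀ x r, (M.ball x r).Finite
  lamTot_le : ∀ x, M.lamTot x ≤ C
  one_le_lamTot : ∀ x, 1 ≤ C * M.lamTot x
  card_le : ∀ x r, 1 ≤ r → ((M.fball x r).card : ℝ) ≤ C * r ^ M.α
  le_card : ∀ x r, 1 ≤ r → r ^ M.α ≤ C * (M.fball x r).card
  green_le : ∀ x y, M.green x y ≤ C * max 1 (M.d x y) ^ (-M.ν)
  le_green : ∀ x y, max 1 (M.d x y) ^ (-M.ν) ≤ C * M.green x y
  d_le_one : ∀ x y, 0 < M.lam x y → M.d x y ≤ 1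

lemma mem_fball_of_finite {x y : M.V} {r : ℝ} (h : (M.ball x r).Finite) :
    y ∈ M.fball x r ↔ M.d x y ≤ r := by
  rw [fball, dif_pos h, Set.Finite.mem_toFinset]
  rfl

theorem Standing.exists_reg (hS : M.Standing) (hd : ∀ x y, M.d x y = M.graphDist x y) :
    ∃ C, M.Reg C := by
  obtain ⟨hT, ⟨c, hc, C, hC, hV⟩, c', hc', C', hC', hgd, hg⟩ := hS
  have hl : ∀ x, M.lamTot x ≠ 0 := by
    intro x h
    have := (hgd x).1
    rw [green, h, div_zero] at this
    linarith
  have hlp : ∀ x, 0 < M.lamTot x := fun x => (lamTot_nonneg x).lt_of_ne' (hl x)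
  have hfin1 : ∀ x r, 1 ≤ r → (M.ball x r).Finite := by
    intro x r hr
    by_contra hinf
    have h := (hV x r hr).1
    have h0 : 0 < c * r ^ M.α := by positivity
    rw [finsum_mem_def, finsum_of_infinite_support] at h
    · linarith
    · refine Set.Infinite.mono (fun y hy => ?_) hinf
      rw [Function.mem_support, Set.indicator_of_mem hy]
      exact hl y
  have hfin : ∀ x r, (M.ball x r).Finite := fun x r =>
    (hfin1 x (max 1 r) (le_max_left _ _)).subset fun y (hy : M.d x y ≤ r) =>
      show M.d x y ≤ _ from hy.trans (le_max_right _ _)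
  have hsum : ∀ x r, ∑ᶠ y ∈ M.ball x r, M.lamTot y = ∑ y ∈ M.fball x r, M.lamTot y := by
    intro x r
    rw [fball, dif_pos (hfin x r)]
    exact finsum_mem_eq_finite_toFinset_sum _ (hfin x r)
  simp only [hsum] at hV
  have hlle : ∀ x, M.lamTot x ≤ C := by
    intro x
    have h := (hV x 1 le_rfl).2
    rw [one_rpow, mul_one] at h
    refine le_trans (Finset.single_le_sum (fun y _ => lamTot_nonneg y) ?_) h
    rw [mem_fball_of_finite (hfin x 1), M.d_self]
    exact zero_le_one
  have hlge : ∀ x, 1 ≤ C' * M.lamTot x := by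
    intro x
    have h := (inv_lamTot_le_green hT hl x).trans (hgd x).2
    rwa [inv_le_iff_one_le_mul₀ (hlp x)] at h
  set D := 1 + C + C' + C * C' + C / c + 1 / c' with hD
  have p1 : 0 < C * C' := by positivity
  have p2 : 0 < C / c := by positivity
  have p3 : 0 < 1 / c' := by positivity
  have hg' : ∀ x y, M.green x y ≤ C' * max 1 (M.d x y) ^ (-M.ν) ∧
      c' * max 1 (M.d x y) ^ (-M.ν) ≤ M.green x y := by
    intro x y
    rcases eq_or_ne x y with rfl | h
    · rw [M.d_self, max_eq_left zero_le_one, one_rpow, mul_one, mul_one]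
      exact ⟨(hgd x).2, (hgd x).1⟩
    · rw [max_eq_right (by rw [hd]; exact one_le_graphDist h)]
      exact ⟨(hg x y h).2, (hg x y h).1⟩
  refine ⟨D, hT, by linarith, hfin, fun x => (hlle x).trans (by linarith), fun x =>
    (hlge x).trans (mul_le_mul_of_nonneg_right (by linarith) (lamTot_nonneg x)), fun x r hr => ?_,
    fun x r hr => ?_, fun x y => (hg' x y).1.trans ?_, fun x y => ?_, fun x y h => ?_⟩
  · have hr0 : 0 < r ^ M.α := by positivity
    have h : ((M.fball x r).card : ℝ) ≤ C' * ∑ y ∈ M.fball x r, M.lamTot y := by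
      rw [Finset.mul_sum, Finset.cast_card]
      exact Finset.sum_le_sum fun y _ => hlge y
    have h2 := mul_le_mul_of_nonneg_left (hV x r hr).2 hC'.le
    have h3 : (C * C') * r ^ M.α ≤ D * r ^ M.α := mul_le_mul_of_nonneg_right (by linarith) hr0.le
    linarith
  · have h : ∑ y ∈ M.fball x r, M.lamTot y ≤ C * (M.fball x r).card := by
      rw [Finset.cast_card, Finset.mul_sum]
      exact Finset.sum_le_sum fun y _ => by rw [mul_one]; exact hlle y
    have h2 := (hV x r hr).1.trans h
    rw [mul_comm, ← le_div_iff₀ hc] at h2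
    refine h2.trans ?_
    rw [mul_div_right_comm]
    exact mul_le_mul_of_nonneg_right (by linarith) (Nat.cast_nonneg _)
  · exact mul_le_mul_of_nonneg_right (by linarith) (rpow_nonneg (by positivity) _)
  · have h := (hg' x y).2
    rw [mul_comm, ← le_div_iff₀ hc', div_eq_mul_one_div, mul_comm] at h
    exact h.trans (mul_le_mul_of_nonneg_right (by linarith) (green_nonneg x y))
  · rw [hd]
    exact graphDist_le_one h

end WGraph

namespace WGraph

variable {M : WGraph} {C : ℝ}

namespace Reg

lemma pos (hR : M.Reg C) : 0 < C := zero_lt_one.trans_le hR.one_le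

lemma lamTot_pos (hR : M.Reg C) (x : M.V) : 0 < M.lamTot x :=
  pos_of_mul_pos_right (zero_lt_one.trans_le (hR.one_le_lamTot x)) hR.pos.le

lemma lamTot_ne (hR : M.Reg C) (x : M.V) : M.lamTot x ≠ 0 := (hR.lamTot_pos x).ne'

lemma inv_lamTot_le (hR : M.Reg C) (x : M.V) : (M.lamTot x)⁻¹ ≤ C :=
  (inv_le_iff_one_le_mul₀ (hR.lamTot_pos x)).2 (hR.one_le_lamTot x)

lemma sum_p (hR : M.Reg C) (x : M.V) : ∑ y ∈ M.nbr x, M.p x y = 1 := by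
  simp only [p]
  rw [← Finset.sum_div, ← lamTot_eq_sum, div_self (hR.lamTot_ne x)]

lemma p_pos (hR : M.Reg C) {x y : M.V} (h : 0 < M.lam x y) : 0 < M.p x y :=
  div_pos h (hR.lamTot_pos x)

lemma symm (hR : M.Reg C) (x y : M.V) : M.green x y = M.green y x := green_symm hR.lamTot_ne x y

lemma step (hR : M.Reg C) (x y : M.V) :
    M.green x y = (if x = y then (M.lamTot y)⁻¹ else 0) +
      ∑ z ∈ M.nbr x, M.p x z * M.green z y := green_step hR.transient hR.lamTot_ne x y

lemma mem_fball (hR : M.Reg C) {x y : M.V} {r : ℝ} : y ∈ M.fball x r ↔ M.d x y ≤ r :=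
  mem_fball_of_finite (hR.ball_finite x r)

lemma self_mem_fball (hR : M.Reg C) (x : M.V) {r : ℝ} (hr : 0 ≤ r) : x ∈ M.fball x r := by
  rwa [hR.mem_fball, M.d_self]

lemma fball_mono (hR : M.Reg C) (x : M.V) {r s : ℝ} (h : r ≤ s) : M.fball x r ⊆ M.fball x s :=
  fun _ hy => hR.mem_fball.2 ((hR.mem_fball.1 hy).trans h)

lemma nbr_subset_fball (hR : M.Reg C) {o x : M.V} {r : ℝ} (hx : x ∈ M.fball o r) :
    M.nbr x ⊆ M.fball o (r + 1) := fun y hy => hR.mem_fball.2 <|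
  (M.d_triangle o x y).trans
    (add_le_add (hR.mem_fball.1 hx) (hR.d_le_one x y (mem_nbr_iff_pos.1 hy)))

lemma green_le_const (hR : M.Reg C) (hν : 0 < M.ν) (x y : M.V) : M.green x y ≤ C :=
  (hR.green_le x y).trans (mul_le_of_le_one_right hR.pos.le
    (rpow_le_one_of_one_le_of_nonpos (le_max_left _ _) (by linarith)))

lemma infinite (hR : M.Reg C) (hα : 0 < M.α) : Infinite M.V := by
  by_contra h
  rw [not_infinite_iff_finite] at h
  have := Fintype.ofFinite M.V
  obtain ⟨r, hr1, hr⟩ := (((tendsto_rpow_atTop hα).eventually_gt_atTop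
    (C * Fintype.card M.V)).and (eventually_ge_atTop 1)).exists
  have h2 := hR.le_card M.o r hr
  have h3 : ((M.fball M.o r).card : ℝ) ≤ Fintype.card M.V := Nat.cast_le.2 (Finset.card_le_univ _)
  have h4 := mul_le_mul_of_nonneg_left h3 hR.pos.le
  linarith

lemma tendsto_green (hR : M.Reg C) (hν : 0 < M.ν) (y : M.V) :
    Tendsto (fun x => M.green x y) cofinite (𝓝 0) := by
  have hd : Tendsto (fun x => M.d y x) cofinite atTop := by
    refine tendsto_atTop.2 fun r => ?_
    refine (hR.ball_finite y r).subset fun x hx => ?_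
    simp only [Set.mem_compl_iff, Set.mem_ofPred_eq, not_le] at hx
    exact hx.le
  have h1 : Tendsto (fun x => C * max 1 (M.d y x) ^ (-M.ν)) cofinite (𝓝 (C * 0)) :=
    ((tendsto_rpow_neg_atTop hν).comp
      (tendsto_atTop_mono (fun x => le_max_right _ _) hd)).const_mul C
  rw [mul_zero] at h1
  exact squeeze_zero (fun x => green_nonneg x y)
    (fun x => by rw [hR.symm]; exact hR.green_le y x) h1

/-- Maximum principle. -/
lemma nonpos_of_subharmonic (hR : M.Reg C) (hα : 0 < M.α) {u : M.V → ℝ}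
    (hu : Tendsto u cofinite (𝓝 0)) {F : Set M.V} (hF : ∀ x ∈ F, u x ≤ 0)
    (h : ∀ x ∉ F, u x ≤ ∑ z ∈ M.nbr x, M.p x z * u z) (x : M.V) : u x ≤ 0 := by
  by_contra! hx
  have hfin : {y | u x ≤ u y}.Finite := by
    refine (hu.eventually_lt_const hx).subset fun y (hy : u x ≤ u y) => ?_
    exact not_lt.2 hy
  obtain ⟨x₁, hx₁, hmax⟩ := Set.exists_max_image _ u hfin ⟨x, le_refl (u x)⟩
  have hm : 0 < u x₁ := hx.trans_le hx₁
  have hle : ∀ y, u y ≤ u x₁ := fun y => by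
    by_cases hy : u x ≤ u y
    · exact hmax y hy
    · exact (not_le.1 hy).le.trans hx₁
  have hall : ∀ y, u y = u x₁ := by
    intro y
    have hc := M.connectedG x₁ y
    induction hc with
    | refl => rfl
    | @tail z y _ hzy ih =>
      have hz : z ∉ F := fun hz => by linarith [hF z hz]
      refine (hle y).antisymm (le_of_not_gt fun hlt => ?_)
      have h1 := h z hz
      have h2 : ∑ v ∈ M.nbr z, M.p z v * u v < ∑ v ∈ M.nbr z, M.p z v * u x₁ :=
        Finset.sum_lt_sum (fun v _ => mul_le_mul_of_nonneg_left (hle v) (p_nonneg z v))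
          ⟨y, mem_nbr_iff_pos.2 hzy, mul_lt_mul_of_pos_left hlt (hR.p_pos hzy)⟩
      rw [← Finset.sum_mul, hR.sum_p, one_mul] at h2
      linarith
  have := hR.infinite hα
  exact Set.infinite_univ (hfin.subset fun y _ => (hx₁.trans_eq (hall y).symm : u x ≤ u y))

/-- Radial sums. -/
lemma exists_sum_rpow_le (hR : M.Reg C) {s : ℝ} (hs : 0 ≤ s) (hsα : s < M.α) :
    ∃ K, 0 < K ∧ ∀ x r, 1 ≤ r →
      ∑ y ∈ M.fball x r, max 1 (M.d x y) ^ (-s) ≤ K * r ^ (M.α - s) := by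
  have h2 : (1 : ℝ) < 2 ^ (M.α - s) := one_lt_rpow one_lt_two (by linarith)
  have hC := hR.pos
  set θ : ℝ := 1 - (2 ^ (M.α - s))⁻¹ with hθ
  have hθ0 : 0 < θ := sub_pos.2 (inv_lt_one_of_one_lt₀ h2)
  set K := C * 2 ^ M.α + C * 2 ^ s / θ with hK
  refine ⟨K, by positivity, ?_⟩
  have hterm : ∀ x y, max 1 (M.d x y) ^ (-s) ≤ 1 := fun x y =>
    rpow_le_one_of_one_le_of_nonpos (le_max_left _ _) (by linarith)
  have key : ∀ (n : ℕ) (x : M.V) (r : ℝ), 1 ≤ r → r ≤ 2 ^ (n + 1) →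
      ∑ y ∈ M.fball x r, max 1 (M.d x y) ^ (-s) ≤ K * r ^ (M.α - s) := by
    intro n
    induction n with
    | zero =>
      intro x r hr hr2
      rw [zero_add, pow_one] at hr2
      calc ∑ y ∈ M.fball x r, max 1 (M.d x y) ^ (-s) ≤ ∑ y ∈ M.fball x r, 1 :=
            Finset.sum_le_sum fun y _ => hterm x y
        _ = (M.fball x r).card := by simp
        _ ≤ C * r ^ M.α := hR.card_le x r hr
        _ ≤ C * 2 ^ M.α := by
            refine mul_le_mul_of_nonneg_left (rpow_le_rpow (by linarith) hr2 (by linarith)) hC.le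
        _ ≤ K := by
            have : 0 < C * 2 ^ s / θ := by positivity
            linarith
        _ ≤ K * r ^ (M.α - s) :=
            le_mul_of_one_le_right (by positivity) (one_le_rpow hr (by linarith))
    | succ n ih =>
      intro x r hr hr2
      rcases le_or_gt r 2 with h | h
      · exact ih x r hr (h.trans (le_self_pow₀ one_le_two (by omega)))
      have hr0 : 0 < r := by linarith
      have h1 := ih x (r / 2) (by linarith) (by rw [pow_succ] at hr2; linarith)
      have hsub := hR.fball_mono x (half_le_self hr0.le)
      rw [← Finset.sum_sdiff hsub]
      have h3 : ∑ y ∈ M.fball x r \ M.fball x (r / 2), max 1 (M.d x y) ^ (-s) ≤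
          (M.fball x r).card * (r / 2) ^ (-s) := by
        refine (Finset.sum_le_card_nsmul _ _ ((r / 2) ^ (-s)) fun y hy => ?_).trans ?_
        · rw [Finset.mem_sdiff, hR.mem_fball, hR.mem_fball, not_le] at hy
          exact rpow_le_rpow_of_nonpos (by linarith) (hy.2.le.trans (le_max_right _ _))
            (by linarith)
        · rw [nsmul_eq_mul]
          exact mul_le_mul_of_nonneg_right
            (Nat.cast_le.2 (Finset.card_le_card Finset.sdiff_subset)) (by positivity)
      have h4 := mul_le_mul_of_nonneg_right (hR.card_le x r hr)
        (show 0 ≤ (r / 2) ^ (-s) by positivity)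
      have e1 : C * r ^ M.α * (r / 2) ^ (-s) = C * 2 ^ s * r ^ (M.α - s) := by
        rw [div_rpow hr0.le two_pos.le, rpow_sub hr0, rpow_neg hr0.le, rpow_neg two_pos.le]
        field_simp
      have e2 : K * (r / 2) ^ (M.α - s) = K * r ^ (M.α - s) - K * θ * r ^ (M.α - s) := by
        rw [div_rpow hr0.le two_pos.le, hθ]
        ring
      have h5 : C * 2 ^ s ≤ K * θ := by
        rw [hK, add_mul, div_mul_cancel₀ _ hθ0.ne']
        have : 0 < C * 2 ^ M.α * θ := by positivity
        linarith
      have h6 := mul_le_mul_of_nonneg_right h5 (show 0 ≤ r ^ (M.α - s) by positivity)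
      linarith
  intro x r hr
  obtain ⟨n, hn⟩ := pow_unbounded_of_one_lt r one_lt_two
  exact key n x r hr (hn.le.trans (pow_le_pow_right₀ one_le_two (by omega)))

end Reg

end WGraph

namespace WGraph

variable {M : WGraph} {C : ℝ}

/-- Expectation of a functional of the first `n` positions of the random walk started at `x`
and of its position at time `n`. -/
def walk (M : WGraph) : ℕ → M.V → (List M.V → M.V → ℝ) → ℝ
  | 0, x, Φ => Φ [] x
  | n + 1, x, Φ => ∑ z ∈ M.nbr x, M.p x z * walk M n z fun l y => Φ (x :: l) y

/-- The energy of an occupation measure with respect to the Green function. -/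
def energy (M : WGraph) (l : List M.V) : ℝ := (l.map fun s => (l.map (M.green s)).sum).sum

lemma walk_mono {n : ℕ} {x : M.V} {Φ Ψ : List M.V → M.V → ℝ}
    (h : ∀ l y, l.length = n → Φ l y ≤ Ψ l y) : M.walk n x Φ ≤ M.walk n x Ψ := by
  induction n generalizing x Φ Ψ with
  | zero => exact h _ _ rfl
  | succ n ih =>
    exact Finset.sum_le_sum fun z _ => mul_le_mul_of_nonneg_left
      (ih fun l y hl => h _ _ (by simp [hl])) (p_nonneg x z)

lemma walk_add (n : ℕ) (x : M.V) (Φ Ψ : List M.V → M.V → ℝ) :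
    M.walk n x (fun l y => Φ l y + Ψ l y) = M.walk n x Φ + M.walk n x Ψ := by
  induction n generalizing x Φ Ψ with
  | zero => rfl
  | succ n ih =>
    simp only [walk, ih, mul_add, Finset.sum_add_distrib]

lemma walk_const_mul (n : ℕ) (x : M.V) (c : ℝ) (Φ : List M.V → M.V → ℝ) :
    M.walk n x (fun l y => c * Φ l y) = c * M.walk n x Φ := by
  induction n generalizing x Φ with
  | zero => rfl
  | succ n ih =>
    simp only [walk, ih, Finset.mul_sum, mul_left_comm]

lemma walk_sum {ι : Type*} (n : ℕ) (x : M.V) (s : Finset ι) (Φ : ι → List M.V → M.V → ℝ) :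
    M.walk n x (fun l y => ∑ i ∈ s, Φ i l y) = ∑ i ∈ s, M.walk n x (Φ i) := by
  induction n generalizing x Φ with
  | zero => rfl
  | succ n ih =>
    simp only [walk, ih, Finset.mul_sum]
    exact Finset.sum_comm

lemma walk_append (m n : ℕ) (x : M.V) (Φ : List M.V → M.V → ℝ) :
    M.walk (m + n) x Φ = M.walk m x fun l y => M.walk n y fun l' y' => Φ (l ++ l') y' := by
  induction m generalizing x Φ with
  | zero => simp [walk]
  | succ m ih =>
    rw [Nat.succ_add]
    simp only [walk, ih, List.cons_append]

namespace Reg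

lemma walk_const (hR : M.Reg C) (n : ℕ) (x : M.V) (c : ℝ) : M.walk n x (fun _ _ => c) = c := by
  induction n generalizing x with
  | zero => rfl
  | succ n ih =>
    simp only [walk, ih]
    rw [← Finset.sum_mul, hR.sum_p, one_mul]

lemma walk_nonneg (hR : M.Reg C) {n : ℕ} {x : M.V} {Φ : List M.V → M.V → ℝ}
    (h : ∀ l y, 0 ≤ Φ l y) : 0 ≤ M.walk n x Φ := by
  rw [← hR.walk_const n x 0]
  exact walk_mono fun l y _ => h l y

lemma walk_succ_add (hR : M.Reg C) (n : ℕ) (x : M.V) (f : ℝ) (Φ : List M.V → M.V → ℝ) :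
    ∑ z ∈ M.nbr x, M.p x z * M.walk n z (fun l y => f + Φ l y) =
      f + ∑ z ∈ M.nbr x, M.p x z * M.walk n z Φ := by
  simp only [walk_add, hR.walk_const, mul_add, Finset.sum_add_distrib]
  rw [← Finset.sum_mul, hR.sum_p, one_mul]

lemma walk_occupation_le (hR : M.Reg C) (B : Finset M.V) {f : M.V → ℝ} (hf : ∀ y, 0 ≤ f y)
    {δ : ℝ} (hδ : 0 ≤ δ) (hB : ∀ y ∉ B, f y ≤ δ) (n : ℕ) (x : M.V) :
    M.walk n x (fun l _ => (l.map f).sum) ≤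
      (∑ y ∈ B, M.lamTot y * M.green x y * f y) + n * δ := by
  induction n generalizing x with
  | zero =>
    simp only [walk, List.map_nil, List.sum_nil, Nat.cast_zero, zero_mul, add_zero]
    exact Finset.sum_nonneg fun y _ =>
      mul_nonneg (mul_nonneg (lamTot_nonneg y) (green_nonneg x y)) (hf y)
  | succ n ih =>
    simp only [walk, List.map_cons, List.sum_cons]
    rw [hR.walk_succ_add]
    have h1 := Finset.sum_le_sum fun z (_ : z ∈ M.nbr x) =>
      mul_le_mul_of_nonneg_left (ih z) (p_nonneg x z)
    simp only [mul_add, Finset.sum_add_distrib] at h1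
    rw [← Finset.sum_mul, hR.sum_p, one_mul] at h1
    have h2 : ∑ z ∈ M.nbr x, M.p x z * ∑ y ∈ B, M.lamTot y * M.green z y * f y =
        ∑ y ∈ B, M.lamTot y * M.green x y * f y - ∑ y ∈ B, if x = y then f y else 0 := by
      simp only [Finset.mul_sum]
      rw [Finset.sum_comm, ← Finset.sum_sub_distrib]
      refine Finset.sum_congr rfl fun y _ => ?_
      rw [hR.step x y, mul_add, add_mul, mul_ite, mul_inv_cancel₀ (hR.lamTot_ne y), mul_zero,
        ite_mul, one_mul, zero_mul, add_sub_cancel_left, Finset.mul_sum, Finset.sum_mul]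
      exact Finset.sum_congr rfl fun z _ => by ring
    have h3 : f x ≤ (∑ y ∈ B, if x = y then f y else 0) + δ := by
      rw [Finset.sum_ite_eq]
      split_ifs with h
      · linarith
      · linarith [hB x h]
    push_cast
    linarith

lemma exists_walk_green_le (hR : M.Reg C) (hν : 0 < M.ν) (hα : 2 * M.ν < M.α) :
    ∃ K, 0 < K ∧ ∀ m n : ℕ, 1 ≤ m → n ≤ m → ∀ x,
      M.walk n x (fun l _ => (l.map (M.green x)).sum) ≤
        K * (m : ℝ) ^ (1 - M.ν / (M.α - M.ν)) := by
  have hC := hR.pos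
  have hβ : 0 < M.α - M.ν := by linarith
  obtain ⟨K, hK, hrad⟩ := hR.exists_sum_rpow_le (s := 2 * M.ν) (by linarith) hα
  refine ⟨C * C ^ 2 * K + C, by positivity, fun m n hm hnm x => ?_⟩
  have hm1 : (1 : ℝ) ≤ m := by exact_mod_cast hm
  have hm0 : (0 : ℝ) < m := by linarith
  set ρ : ℝ := (m : ℝ) ^ (1 / (M.α - M.ν)) with hρ
  have hρ1 : 1 ≤ ρ := one_le_rpow hm1 (by positivity)
  have hρ0 : 0 < ρ := by linarith
  have h := hR.walk_occupation_le (M.fball x ρ) (f := M.green x) (green_nonneg x)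
    (δ := C * ρ ^ (-M.ν)) (by positivity) (fun y hy => ?_) n x
  · refine h.trans ?_
    have h1 : ∑ y ∈ M.fball x ρ, M.lamTot y * M.green x y * M.green x y ≤
        C * C ^ 2 * ∑ y ∈ M.fball x ρ, max 1 (M.d x y) ^ (-(2 * M.ν)) := by
      rw [Finset.mul_sum]
      refine Finset.sum_le_sum fun y _ => ?_
      have hm0 : 0 < max 1 (M.d x y) := by positivity
      have e : max 1 (M.d x y) ^ (-(2 * M.ν)) = (max 1 (M.d x y) ^ (-M.ν)) ^ 2 := by
        rw [← rpow_natCast, ← rpow_mul hm0.le]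
        congr 1
        push_cast
        ring
      rw [e, mul_assoc, mul_assoc, ← mul_pow, ← sq]
      exact mul_le_mul (hR.lamTot_le y) (pow_le_pow_left₀ (green_nonneg x y) (hR.green_le x y) 2)
        (sq_nonneg _) hC.le
    have h2 := mul_le_mul_of_nonneg_left (hrad x ρ hρ1) (show 0 ≤ C * C ^ 2 by positivity)
    have h3 : (n : ℝ) * (C * ρ ^ (-M.ν)) ≤ m * (C * ρ ^ (-M.ν)) :=
      mul_le_mul_of_nonneg_right (Nat.cast_le.2 hnm) (by positivity)
    have e1 : ρ ^ (M.α - 2 * M.ν) = (m : ℝ) ^ (1 - M.ν / (M.α - M.ν)) := by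
      rw [hρ, ← rpow_mul hm0.le]
      congr 1
      field_simp
      ring
    have e2 : (m : ℝ) * (C * ρ ^ (-M.ν)) = C * (m : ℝ) ^ (1 - M.ν / (M.α - M.ν)) := by
      rw [hρ, ← rpow_mul hm0.le, sub_eq_add_neg 1, rpow_add hm0, rpow_one]
      ring_nf
    rw [e1] at h2
    rw [e2] at h3
    linarith
  · rw [hR.mem_fball, not_le] at hy
    exact (hR.green_le x y).trans (mul_le_mul_of_nonneg_left (rpow_le_rpow_of_nonpos hρ0
      (hy.le.trans (le_max_right _ _)) (by linarith)) hC.le)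

lemma energy_cons_le (hR : M.Reg C) (x : M.V) (l : List M.V) :
    M.energy (x :: l) ≤ 2 * ((x :: l).map (M.green x)).sum + M.energy l := by
  have h : (l.map fun s => M.green s x + (l.map (M.green s)).sum).sum =
      (l.map (M.green x)).sum + M.energy l := by
    rw [List.sum_map_add, energy]
    congr 3
    ext s
    exact hR.symm _ _
  simp only [energy, List.map_cons, List.sum_cons]
  rw [h, energy]
  linarith [green_nonneg x x]

lemma exists_walk_energy_le (hR : M.Reg C) (hν : 0 < M.ν) (hα : 2 * M.ν < M.α) :
    ∃ K, 0 < K ∧ ∀ m : ℕ, 1 ≤ m → ∀ x, M.walk m x (fun l _ => M.energy l) ≤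
      K * (m : ℝ) ^ (2 - M.ν / (M.α - M.ν)) := by
  obtain ⟨K, hK, h⟩ := hR.exists_walk_green_le hν hα
  refine ⟨2 * K, by positivity, fun m hm x => ?_⟩
  have hm0 : (0 : ℝ) < m := by exact_mod_cast hm
  have key : ∀ n ≤ m, ∀ x, M.walk n x (fun l _ => M.energy l) ≤
      n * (2 * (K * (m : ℝ) ^ (1 - M.ν / (M.α - M.ν)))) := by
    intro n
    induction n with
    | zero => intro _ x; simp [walk, energy]
    | succ n ih =>
      intro hn x
      have h1 : M.walk (n + 1) x (fun l _ => M.energy l) ≤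
          2 * M.walk (n + 1) x (fun l _ => (l.map (M.green x)).sum) +
            ∑ z ∈ M.nbr x, M.p x z * M.walk n z (fun l _ => M.energy l) := by
        rw [← walk_const_mul]
        simp only [walk]
        rw [← Finset.sum_add_distrib]
        refine Finset.sum_le_sum fun z _ => ?_
        rw [← mul_add, ← walk_add]
        exact mul_le_mul_of_nonneg_left (walk_mono fun l _ _ => hR.energy_cons_le x l)
          (p_nonneg x z)
      have h2 := h m (n + 1) hm hn x
      have h3 := Finset.sum_le_sum fun z (_ : z ∈ M.nbr x) =>
        mul_le_mul_of_nonneg_left (ih (by omega) z) (p_nonneg x z)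
      rw [← Finset.sum_mul, hR.sum_p, one_mul] at h3
      push_cast
      linarith
  refine (key m le_rfl x).trans_eq ?_
  rw [show (2 : ℝ) - M.ν / (M.α - M.ν) = 1 + (1 - M.ν / (M.α - M.ν)) by ring, rpow_add hm0,
    rpow_one]
  ring

/-- If a block of low energy makes `obs` small, then `obs` decays along many blocks. -/
lemma walk_blocks_le (hR : M.Reg C) {m : ℕ} {t : ℝ} (ht : 0 < t)
    (hE : ∀ x, M.walk m x (fun l _ => M.energy l) ≤ t / 2) {obs : List M.V → ℝ}
    (h1 : ∀ l, obs l ≤ 1) {e : ℝ} (he : 0 ≤ e)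
    (h_obs : ∀ l l', l' ⊆ l → l'.length = m → M.energy l' ≤ t → obs l ≤ e) (k : ℕ)
    (l₀ : List M.V) (x : M.V) :
    M.walk (k * m) x (fun l _ => obs (l₀ ++ l)) ≤ (2⁻¹ : ℝ) ^ k + e := by
  induction k generalizing l₀ x with
  | zero =>
    rw [zero_mul, pow_zero, walk]
    linarith [h1 (l₀ ++ [])]
  | succ k ih =>
    rw [add_one_mul, add_comm, walk_append]
    have hpt : ∀ (l : List M.V) (y : M.V), l.length = m →
        M.walk (k * m) y (fun l' _ => obs (l₀ ++ (l ++ l'))) ≤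
          e + (2⁻¹ : ℝ) ^ k / t * M.energy l := by
      intro l y hl
      have hE0 : 0 ≤ M.energy l := List.sum_nonneg fun a ha => by
        obtain ⟨s, _, rfl⟩ := List.mem_map.1 ha
        exact List.sum_nonneg fun a ha => by
          obtain ⟨u, _, rfl⟩ := List.mem_map.1 ha
          exact green_nonneg s u
      rcases le_or_gt (M.energy l) t with h | h
      · have h2 : M.walk (k * m) y (fun l' _ => obs (l₀ ++ (l ++ l'))) ≤ e := by
          refine (walk_mono fun l' _ _ => h_obs _ l (fun a ha => by simp [ha]) hl h).trans_eq ?_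
          exact hR.walk_const _ _ _
        have : 0 ≤ (2⁻¹ : ℝ) ^ k / t * M.energy l := by positivity
        linarith
      · have h2 := ih (l₀ ++ l) y
        simp only [List.append_assoc] at h2
        have h3 : (2⁻¹ : ℝ) ^ k ≤ (2⁻¹ : ℝ) ^ k / t * M.energy l := by
          rw [div_mul_eq_mul_div, le_div_iff₀ ht]
          exact mul_le_mul_of_nonneg_left h.le (by positivity)
        linarith
    refine (walk_mono hpt).trans ?_
    rw [walk_add, hR.walk_const, walk_const_mul]
    have h4 := mul_le_mul_of_nonneg_left (hE x) (show 0 ≤ (2⁻¹ : ℝ) ^ k / t by positivity)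
    have h5 : (2⁻¹ : ℝ) ^ k / t * (t / 2) = (2⁻¹ : ℝ) ^ (k + 1) := by
      field_simp
      ring
    linarith

lemma walk_antitone (hR : M.Reg C) {obs : List M.V → ℝ} (h_obs : ∀ l l', l ⊆ l' → obs l' ≤ obs l)
    {m n : ℕ} (h : m ≤ n) (x : M.V) :
    M.walk n x (fun l _ => obs l) ≤ M.walk m x (fun l _ => obs l) := by
  obtain ⟨k, rfl⟩ := Nat.exists_eq_add_of_le h
  rw [walk_append]
  refine walk_mono fun l y _ => (walk_mono fun l' _ _ =>
    h_obs l (l ++ l') (List.subset_append_left _ _)).trans_eq ?_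
  exact hR.walk_const _ _ _

end Reg

lemma exp_neg_le_mul_rpow {q : ℝ} (hq : 0 < q) {y : ℝ} (hy : 0 < y) :
    rexp (-y) ≤ q ^ q * y ^ (-q) := by
  have h1 : (y / q) ^ q ≤ rexp y := by
    refine (rpow_le_rpow (by positivity) ((by linarith : y / q ≤ y / q + 1).trans
      (add_one_le_exp _)) hq.le).trans_eq ?_
    rw [← exp_mul, div_mul_cancel₀ _ hq.ne']
  rw [div_rpow hy.le hq.le, div_le_iff₀ (by positivity)] at h1
  rw [exp_neg, rpow_neg hy.le, inv_le_iff_one_le_mul₀ (exp_pos _), mul_right_comm,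
    ← div_eq_mul_inv, le_div_iff₀ (by positivity), one_mul, mul_comm]
  exact h1

namespace Reg

/-- Stretched-exponential-type decay, stated with arbitrary polynomial rates. -/
theorem exists_walk_avoid_le (hR : M.Reg C) (hν : 0 < M.ν) (hα : 2 * M.ν < M.α) {s q : ℝ}
    (hs : 0 < s) (hsβ : s < M.ν / (M.α - M.ν)) (hq : 0 < q) :
    ∃ K, 0 < K ∧ ∀ (b : ℝ) (obs : List M.V → ℝ), 0 < b → b ≤ 1 → (∀ l, obs l ≤ 1) →
      (∀ l l', l ⊆ l' → obs l' ≤ obs l) →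
      (∀ l l' (t : ℝ), l' ⊆ l → 0 < t → M.energy l' ≤ t →
        obs l ≤ rexp (-((b * l'.length) ^ 2 / t / 2))) →
      ∀ n : ℕ, 1 ≤ n → ∀ x,
        M.walk n x (fun l _ => obs l) ≤ K * (b ^ 2 * (n : ℝ) ^ s) ^ (-q) := by
  obtain ⟨K₁, hK₁, hE⟩ := hR.exists_walk_energy_le hν hα
  have hβ : 0 < M.α - M.ν := by linarith
  set r := M.ν / (M.α - M.ν) with hr
  have hr0 : 0 < r := by positivity
  set ε := 1 - s / r with hε
  have hsr : s / r < 1 := (div_lt_one hr0).2 hsβ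
  have hε0 : 0 < ε := by linarith
  have hsr0 : 0 < s / r := by positivity
  set p := s * q / ε with hp
  have hp0 : 0 < p := by positivity
  have hlog : 0 < Real.log 2 := log_pos one_lt_two
  set c := (2⁻¹ : ℝ) ^ r / (8 * K₁) with hc
  have hc0 : 0 < c := by positivity
  refine ⟨p ^ p * (Real.log 2 / 2) ^ (-p) + q ^ q * c ^ (-q), by positivity, ?_⟩
  intro b obs hb hb1 h1 hanti h_obs n hn x
  have hn1 : (1 : ℝ) ≤ n := by exact_mod_cast hn
  have hn0 : (0 : ℝ) < n := by linarith
  have hfl : ∀ y : ℝ, 1 ≤ y → y / 2 ≤ ⌊y⌋₊ ∧ (⌊y⌋₊ : ℝ) ≤ y := fun y hy => by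
    have h3 := Nat.lt_floor_add_one y
    have h4 : (1 : ℝ) ≤ ⌊y⌋₊ := by exact_mod_cast (Nat.one_le_floor_iff y).2 hy
    exact ⟨by linarith, Nat.floor_le (by linarith)⟩
  obtain ⟨hk1, hk2⟩ := hfl ((n : ℝ) ^ ε) (one_le_rpow hn1 hε0.le)
  obtain ⟨hm1, hm2⟩ := hfl ((n : ℝ) ^ (s / r)) (one_le_rpow hn1 hsr0.le)
  set k := ⌊(n : ℝ) ^ ε⌋₊ with hk
  set m := ⌊(n : ℝ) ^ (s / r)⌋₊ with hm
  have hmpos : 1 ≤ m := (Nat.one_le_floor_iff _).2 (one_le_rpow hn1 hsr0.le)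
  have hm0 : (0 : ℝ) < m := by exact_mod_cast hmpos
  have hkm : k * m ≤ n := by
    have h : (k : ℝ) * m ≤ (n : ℝ) ^ ε * (n : ℝ) ^ (s / r) :=
      mul_le_mul hk2 hm2 hm0.le (by positivity)
    rw [← rpow_add hn0, hε, sub_add_cancel, rpow_one] at h
    exact_mod_cast h
  set t := 2 * (K₁ * (m : ℝ) ^ (2 - r)) with ht
  have ht0 : 0 < t := by positivity
  have hw := hR.walk_blocks_le ht0 (m := m) (fun x => (hE m hmpos x).trans_eq (by
    rw [ht]; ring)) h1 (exp_pos (-((b * m) ^ 2 / t / 2))).le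
    (fun l l' hl hlen hen => by rw [← hlen]; exact h_obs l l' t hl ht0 hen) k [] x
  simp only [List.nil_append] at hw
  refine (hR.walk_antitone hanti hkm x).trans (hw.trans ?_)
  rw [add_mul]
  refine add_le_add ?_ ?_
  · have e1 : (2⁻¹ : ℝ) ^ k = rexp (-(k * Real.log 2)) := by
      rw [exp_neg, mul_comm, exp_mul, exp_log two_pos, rpow_natCast, inv_pow]
    rw [e1]
    have h2 : (n : ℝ) ^ ε * (Real.log 2 / 2) ≤ k * Real.log 2 := by
      have := mul_le_mul_of_nonneg_right hk1 hlog.le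
      linarith
    refine (Real.exp_le_exp.2 (neg_le_neg h2)).trans
      ((exp_neg_le_mul_rpow hp0 (by positivity)).trans ?_)
    rw [mul_rpow (by positivity) (by positivity), ← rpow_mul hn0.le, mul_comm (_ ^ (ε * -p)),
      ← mul_assoc]
    refine mul_le_mul_of_nonneg_left ?_ (by positivity)
    have e2 : ε * -p = s * -q := by
      rw [hp]
      field_simp
    rw [e2, rpow_mul hn0.le]
    refine rpow_le_rpow_of_nonpos (by positivity) ?_ (by linarith)
    exact mul_le_of_le_one_left (by positivity) (pow_le_one₀ hb.le hb1)
  · have h2 : c * (b ^ 2 * (n : ℝ) ^ s) ≤ (b * m) ^ 2 / t / 2 := by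
      have e3 : (b * m) ^ 2 / t / 2 = b ^ 2 * (m : ℝ) ^ r / (4 * K₁) := by
        rw [ht, rpow_sub hm0, rpow_two]
        field_simp
        ring
      have h3 : ((n : ℝ) ^ (s / r) / 2) ^ r ≤ (m : ℝ) ^ r :=
        rpow_le_rpow (by positivity) hm1 hr0.le
      rw [div_eq_mul_inv, mul_rpow (by positivity) (by positivity), ← rpow_mul hn0.le,
        div_mul_cancel₀ _ hr0.ne'] at h3
      rw [e3, le_div_iff₀ (by positivity)]
      refine le_trans (le_of_eq ?_) ((mul_le_mul_of_nonneg_left h3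
        (show 0 ≤ b ^ 2 / 2 by positivity)).trans ?_)
      · rw [hc]
        field_simp
        ring
      · have : 0 ≤ b ^ 2 * (m : ℝ) ^ r := by positivity
        linarith
    refine (Real.exp_le_exp.2 (neg_le_neg h2)).trans
      ((exp_neg_le_mul_rpow hq (by positivity)).trans_eq ?_)
    rw [mul_rpow hc0.le (by positivity), mul_assoc]

end Reg

end WGraph

namespace WGraph

open GaussNet

variable {M : WGraph} {C : ℝ}

/-- The potential of a charge `c` on `F`. -/
def pot (M : WGraph) (F : Finset M.V) (c : M.V → ℝ) (v : M.V) : ℝ := ∑ i ∈ F, M.green v i * c i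

/-- The Green function of the network `K` is that of the graph, and edges of the graph which do
not touch the boundary keep their weight. -/
structure IsTrace (M : WGraph) (C : ℝ) (K : Net M.V) : Prop where
  G_eq : ∀ x ∈ K.F, ∀ y ∈ K.F, K.G x y = M.green x y
  lap_le : ∀ x ∈ K.F, lap K.w K.N x x ≤ C
  lap_eq : ∀ x ∈ K.F, M.nbr x ⊆ K.F → ∀ y ∈ K.F,
    lap K.w K.N x y = (if x = y then M.lamTot x else 0) - M.lam x y
  w_eq : ∀ x ∈ K.F, M.nbr x ⊆ K.F → ∀ y, y ≠ x → K.w x y = M.lam x y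

namespace Reg

lemma pot_step (hR : M.Reg C) (F : Finset M.V) (c : M.V → ℝ) (v : M.V) :
    M.pot F c v = (if v ∈ F then c v / M.lamTot v else 0) +
      ∑ z ∈ M.nbr v, M.p v z * M.pot F c z := by
  have h : ∀ i ∈ F, M.green v i * c i = (if v = i then c i / M.lamTot i else 0) +
      ∑ z ∈ M.nbr v, M.p v z * (M.green z i * c i) := by
    intro i _
    rw [hR.step v i, add_mul, Finset.sum_mul]
    congr 1
    · split_ifs <;> ring
    · exact Finset.sum_congr rfl fun z _ => by ring
  rw [pot, Finset.sum_congr rfl h, Finset.sum_add_distrib, Finset.sum_ite_eq, Finset.sum_comm]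
  simp only [pot, Finset.mul_sum]

lemma tendsto_pot (hR : M.Reg C) (hν : 0 < M.ν) (F : Finset M.V) (c : M.V → ℝ) :
    Tendsto (M.pot F c) cofinite (𝓝 0) := by
  have h := tendsto_finsetSum F fun i _ => (hR.tendsto_green hν i).mul_const (c i)
  simp only [zero_mul, Finset.sum_const_zero] at h
  exact h

lemma pot_nonneg (hR : M.Reg C) (hν : 0 < M.ν) (hα : 0 < M.α) {F : Finset M.V} {c : M.V → ℝ}
    (h : ∀ v ∈ F, 0 ≤ M.pot F c v) (v : M.V) : 0 ≤ M.pot F c v := by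
  have := hR.nonpos_of_subharmonic hα (u := fun v => -M.pot F c v) (F := F)
    (by simpa using (hR.tendsto_pot hν F c).neg)
    (fun x hx => neg_nonpos.2 (h x hx)) (fun x hx => ?_) v
  · exact neg_nonpos.1 this
  · rw [hR.pot_step, if_neg (by simpa using hx), zero_add]
    simp [Finset.sum_neg_distrib]

lemma pot_le_one (hR : M.Reg C) (hν : 0 < M.ν) (hα : 0 < M.α) {F : Finset M.V} {c : M.V → ℝ}
    (h : ∀ v ∈ F, M.pot F c v ≤ 1) (v : M.V) : M.pot F c v ≤ 1 := by
  have := hR.nonpos_of_subharmonic hα (u := fun v => max (M.pot F c v - 1) 0) (F := F)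
    (by
      have := ((hR.tendsto_pot hν F c).sub_const 1).max (tendsto_const_nhds (x := (0 : ℝ)))
      simpa using this)
    (fun x hx => (max_eq_right (sub_nonpos.2 (h x hx))).le) (fun x hx => ?_) v
  · exact sub_nonpos.1 ((le_max_left _ _).trans this)
  · refine max_le ?_ (Finset.sum_nonneg fun z _ => mul_nonneg (p_nonneg x z) (le_max_right _ _))
    rw [hR.pot_step, if_neg (by simpa using hx), zero_add]
    have e : ∑ z ∈ M.nbr x, M.p x z * M.pot F c z - 1 =
        ∑ z ∈ M.nbr x, (M.p x z * M.pot F c z - M.p x z) := by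
      rw [Finset.sum_sub_distrib, hR.sum_p]
    rw [e]
    refine Finset.sum_le_sum fun z _ => ?_
    rw [← mul_sub_one]
    exact mul_le_mul_of_nonneg_left (le_max_left _ _) (p_nonneg x z)

lemma charge_eq_zero (hR : M.Reg C) (hν : 0 < M.ν) (hα : 0 < M.α) {F : Finset M.V}
    {c : M.V → ℝ} (h : ∀ v ∈ F, M.pot F c v = 0) : ∀ v ∈ F, c v = 0 := by
  have h1 := hR.pot_nonneg hν hα fun v hv => (h v hv).ge
  have h2 := hR.pot_nonneg (c := fun v => -c v) hν hα fun v hv => by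
    have := h v hv
    simp only [pot, mul_neg, Finset.sum_neg_distrib] at this ⊢
    rw [this, neg_zero]
  have h0 : ∀ v, M.pot F c v = 0 := fun v => by
    have h3 := h2 v
    simp only [pot, mul_neg, Finset.sum_neg_distrib] at h3
    exact le_antisymm (neg_nonneg.1 h3) (h1 v)
  intro v hv
  have h3 := hR.pot_step F c v
  simp only [h0, mul_zero, Finset.sum_const_zero, add_zero, if_pos hv] at h3
  exact (div_eq_zero_iff.1 h3.symm).resolve_right (hR.lamTot_ne v)

lemma exists_charge (hR : M.Reg C) (hν : 0 < M.ν) (hα : 0 < M.α) (F : Finset M.V)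
    (f : M.V → ℝ) : ∃ c : M.V → ℝ, ∀ v ∈ F, M.pot F c v = f v := by
  set A : (F → ℝ) →ₗ[ℝ] (F → ℝ) :=
    Matrix.toLin' (Matrix.of fun i j : F => M.green i j) with hA
  have hAe : ∀ (c : M.V → ℝ) (v : F), A (fun i => c i) v = M.pot F c v := by
    intro c v
    rw [hA, Matrix.toLin'_apply, Matrix.mulVec, dotProduct, pot, ← Finset.sum_coe_sort F]
    rfl
  have hinj : Function.Injective A := by
    rw [injective_iff_map_eq_zero]
    intro c hc
    set c' : M.V → ℝ := fun v => if h : v ∈ F then c ⟨v, h⟩ else 0 with hc'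
    have e : (fun i : F => c' i) = c := by
      ext i
      simp [hc']
    have h := hR.charge_eq_zero hν hα (F := F) (c := c') fun v hv => by
      rw [← hAe c' ⟨v, hv⟩, e, hc]
      rfl
    rw [← e]
    ext i
    exact h i i.2
  obtain ⟨c, hc⟩ := (LinearMap.injective_iff_surjective.1 hinj) fun v => f v
  refine ⟨fun v => if h : v ∈ F then c ⟨v, h⟩ else 0, fun v hv => ?_⟩
  rw [← hAe _ ⟨v, hv⟩]
  have e : (fun i : F => if h : (i : M.V) ∈ F then c ⟨i, h⟩ else 0) = c := by
    ext i
    simp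
  rw [e, hc]

/-- The network obtained by sending all of the complement of a finite set to the ground. -/
theorem exists_net (hR : M.Reg C) (hν : 0 < M.ν) (hα : 0 < M.α) {F : Finset M.V} {bd : M.V}
    (hbd : bd ∉ F) : ∃ K : Net M.V, K.F = F ∧ M.IsTrace C K := by
  choose q hq using fun x => hR.exists_charge hν hα F fun v => if v = x then 1 else 0
  have hsym : ∀ x ∈ F, ∀ y ∈ F, q x y = q y x := by
    have h : ∀ x ∈ F, ∀ y ∈ F, q x y = ∑ v ∈ F, q x v * M.pot F (q y) v := by
      intro x _ y hy
      rw [Finset.sum_congr rfl fun v hv => by rw [hq y v hv]]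
      simp [hy]
    intro x hx y hy
    rw [h x hx y hy, h y hy x hx]
    simp only [pot, Finset.mul_sum]
    rw [Finset.sum_comm]
    refine Finset.sum_congr rfl fun v _ => Finset.sum_congr rfl fun u _ => ?_
    rw [hR.symm u v]
    ring
  have hpot0 : ∀ x v, 0 ≤ M.pot F (q x) v := fun x => hR.pot_nonneg hν hα fun v hv => by
    rw [hq x v hv]
    split_ifs <;> norm_num
  have hpot1 : ∀ v, ∑ x ∈ F, M.pot F (q x) v ≤ 1 := by
    have e : ∀ v, ∑ x ∈ F, M.pot F (q x) v = M.pot F (fun i => ∑ x ∈ F, q x i) v := by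
      intro v
      simp only [pot, Finset.mul_sum]
      exact Finset.sum_comm
    intro v
    rw [e]
    refine hR.pot_le_one hν hα (fun v hv => ?_) v
    rw [← e, Finset.sum_congr rfl fun x _ => hq x v hv, Finset.sum_ite_eq, if_pos hv]
  have hqe : ∀ x, ∀ y ∈ F, q x y = M.lamTot y * ((if y = x then 1 else 0) -
      ∑ z ∈ M.nbr y, M.p y z * M.pot F (q x) z) := by
    intro x y hy
    have h := hR.pot_step F (q x) y
    rw [hq x y hy, if_pos hy] at h
    rw [h, add_sub_cancel_right, mul_div_cancel₀ _ (hR.lamTot_ne y)]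
  have hsum0 : ∀ x y, 0 ≤ ∑ z ∈ M.nbr y, M.p y z * M.pot F (q x) z := fun x y =>
    Finset.sum_nonneg fun z _ => mul_nonneg (p_nonneg y z) (hpot0 x z)
  have hoff : ∀ x, ∀ y ∈ F, y ≠ x → q x y ≤ 0 := by
    intro x y hy hyx
    rw [hqe x y hy, if_neg hyx, zero_sub, mul_neg, neg_nonpos]
    exact mul_nonneg (lamTot_nonneg y) (hsum0 x y)
  have hrow : ∀ y ∈ F, 0 ≤ ∑ x ∈ F, q y x := by
    intro y hy
    rw [Finset.sum_congr rfl fun x hx => (hsym y hy x hx).trans (hqe x y hy), ← Finset.mul_sum,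
      Finset.sum_sub_distrib, Finset.sum_ite_eq, if_pos hy, Finset.sum_comm]
    refine mul_nonneg (lamTot_nonneg y) (sub_nonneg.2 ?_)
    rw [← hR.sum_p y]
    refine Finset.sum_le_sum fun z _ => ?_
    rw [← Finset.mul_sum]
    exact mul_le_of_le_one_right (p_nonneg y z) (hpot1 z)
  have hlam : ∀ x ∈ F, M.nbr x ⊆ F → ∀ y ∈ F, q x y =
      (if x = y then M.lamTot x else 0) - M.lam x y := by
    intro x hx hn y hy
    rw [hsym x hx y hy, hqe y x hx, Finset.sum_congr rfl fun z hz => by rw [hq y z (hn hz)]]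
    simp only [mul_ite, mul_one, mul_zero, Finset.sum_ite_eq', mul_sub]
    congr 1
    split_ifs with h
    · exact lamTot_mul_p (hR.lamTot_ne x) y
    · rw [mem_nbr, not_not] at h
      exact h.symm
  set w : M.V → M.V → ℝ := fun x y =>
    if x ∈ F ∧ y ∈ F then (if x = y then 0 else -q x y)
    else if x ∈ F ∧ y = bd then ∑ v ∈ F, q x v
    else if y ∈ F ∧ x = bd then ∑ v ∈ F, q y v else 0 with hw
  have hlap : ∀ x ∈ F, ∀ y ∈ F, lap w (insert bd F) x y = q x y := by
    intro x hx y hy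
    rw [lap]
    rcases eq_or_ne x y with rfl | hxy
    · rw [if_pos rfl, Finset.sum_insert hbd]
      have e1 : w x bd = ∑ v ∈ F, q x v := by simp [hw, hx, hbd]
      have e2 : ∑ v ∈ F, w x v = ∑ v ∈ F, ((if x = v then q x v else 0) - q x v) :=
        Finset.sum_congr rfl fun v hv => by
          simp only [hw, hx, hv, and_self, if_true]
          split_ifs <;> ring
      have e3 : w x x = 0 := by simp [hw, hx]
      rw [e1, e2, e3, Finset.sum_sub_distrib, Finset.sum_ite_eq, if_pos hx]
      ring
    · rw [if_neg hxy]
      simp [hw, hx, hy, hxy]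
  refine ⟨{ w := w, F := F, bd := bd
            G := fun x y => if x ∈ F ∧ y ∈ F then M.green x y else 0
            w_symm := fun x y => ?_
            w_nonneg := fun x y => ?_
            bd_notMem := hbd
            G_symm := fun x y => ?_
            G_nonneg := fun x y => ?_
            G_bd := fun y => by simp [hbd]
            lap_G := fun x hx y hy => ?_ }, rfl,
    ⟨fun x hx y hy => if_pos ⟨hx, hy⟩, fun x hx => ?_, fun x hx hn y hy => ?_,
      fun x hx hn y hyx => ?_⟩⟩
  · simp only [hw]
    by_cases hx : x ∈ F <;> by_cases hy : y ∈ F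
    · simp only [hx, hy, and_self, if_true, eq_comm (a := y), hsym x hx y hy]
    · simp [hx, hy]
    · simp [hx, hy]
    · simp [hx, hy]
  · simp only [hw]
    split_ifs with h1 h2 h3 h4
    · exact le_rfl
    · exact neg_nonneg.2 (hoff x y h1.2 (Ne.symm h2))
    · exact hrow x h3.1
    · exact hrow y h4.1
    · exact le_rfl
  · simp only [and_comm, hR.symm y x]
  · split_ifs
    exacts [green_nonneg x y, le_rfl]
  · rw [Finset.sum_insert hbd]
    simp only [hbd, false_and, if_false, mul_zero, zero_add]
    rw [Finset.sum_congr rfl fun z hz => by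
      rw [hlap x hx z hz, if_pos ⟨hz, hy⟩, hR.symm, mul_comm]]
    have := hq x y hy
    rw [pot] at this
    rw [this]
    simp only [eq_comm]
  · change lap w (insert bd F) x x ≤ C
    change x ∈ F at hx
    rw [hlap x hx x hx, hqe x x hx, if_pos rfl]
    refine (mul_le_of_le_one_right (lamTot_nonneg x) ?_).trans (hR.lamTot_le x)
    linarith [hsum0 x x]
  · change x ∈ F at hx
    change M.nbr x ⊆ F at hn
    change y ∈ F at hy
    exact (hlap x hx y hy).trans (hlam x hx hn y hy)
  · change x ∈ F at hx
    change M.nbr x ⊆ F at hn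
    by_cases hy : y ∈ F
    · have h := hlam x hx hn y hy
      simp only [hw, hx, hy, and_self, if_true, if_neg hyx.symm] at h ⊢
      linarith
    · have h0 : M.lam x y = 0 := by
        by_contra h
        exact hy (hn (mem_nbr.2 h))
      simp only [hw, hx, hy, and_false, if_false, true_and, false_and, h0]
      split_ifs
      · rw [Finset.sum_congr rfl fun v hv => hlam x hx hn v hv, Finset.sum_sub_distrib,
          Finset.sum_ite_eq, if_pos hx, sub_eq_zero, lamTot_eq_sum]
        refine Finset.sum_subset hn fun v _ hv => ?_
        rwa [mem_nbr, not_not] at hv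
      · rfl

end Reg

end WGraph

namespace WGraph

open GaussNet

variable {M : WGraph} {C : ℝ}

namespace IsTrace

variable {K : Net M.V}

lemma time₀_eq (hR : M.Reg C) (hK : M.IsTrace C K) {U : Finset M.V} (hU : U ⊆ K.F) {x : M.V}
    (hx : x ∈ U) (hn : M.nbr x ⊆ K.F) :
    K.time₀ U x = (M.lamTot x)⁻¹ + ∑ z ∈ M.nbr x, M.p x z * K.time₀ U z := by
  have h := K.sum_lap_time₀ hU hx
  rw [Finset.sum_congr rfl fun z hz => by rw [hK.lap_eq x (hU hx) hn z (hU hz)]] at h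
  simp only [sub_mul, ite_mul, zero_mul] at h
  rw [Finset.sum_sub_distrib, Finset.sum_ite_eq, if_pos hx] at h
  have e : ∑ z ∈ U, M.lam x z * K.time₀ U z = ∑ z ∈ M.nbr x, M.lam x z * K.time₀ U z := by
    have h1 : ∑ z ∈ U, M.lam x z * K.time₀ U z = ∑ z ∈ U ∪ M.nbr x, M.lam x z * K.time₀ U z :=
      Finset.sum_subset Finset.subset_union_left fun z _ hz => by
        rw [K.time₀_of_notMem hz, mul_zero]
    rw [h1]
    refine (Finset.sum_subset Finset.subset_union_right fun z _ hz => ?_).symm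
    rw [mem_nbr, not_not] at hz
    rw [hz, zero_mul]
  rw [e] at h
  have h0 := hR.lamTot_ne x
  have e2 : ∑ z ∈ M.nbr x, M.p x z * K.time₀ U z =
      (M.lamTot x)⁻¹ * ∑ z ∈ M.nbr x, M.lam x z * K.time₀ U z := by
    rw [Finset.mul_sum]
    refine Finset.sum_congr rfl fun z _ => ?_
    rw [p]
    ring
  rw [e2]
  field_simp
  linarith

lemma time₀_le_walk (hR : M.Reg C) (hK : M.IsTrace C K) {U : Finset M.V} (hU : U ⊆ K.F) {Λ : ℝ}
    (hΛ : ∀ x, K.time₀ U x ≤ Λ) (n : ℕ) (x : M.V) (hx : M.fball x n ⊆ K.F) :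
    K.time₀ U x ≤ C * ∑ j ∈ Finset.range n,
      M.walk (j + 1) x (fun l _ => if ∀ v ∈ l, v ∈ U then (1 : ℝ) else 0) +
      Λ * M.walk n x fun l _ => if ∀ v ∈ l, v ∈ U then (1 : ℝ) else 0 := by
  have hC := hR.pos
  have hi : ∀ l : List M.V, (0 : ℝ) ≤ if ∀ v ∈ l, v ∈ U then (1 : ℝ) else 0 := fun l => by
    split_ifs <;> norm_num
  have hΛ0 : 0 ≤ Λ := (K.time₀_nonneg hU x).trans (hΛ x)
  induction n generalizing x with
  | zero => simpa [walk] using hΛ x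
  | succ n ih =>
    by_cases hxU : x ∈ U
    · have hsub : ∀ z ∈ M.nbr x, M.fball z n ⊆ M.fball x ((n + 1 : ℕ) : ℝ) := by
        intro z hz y hy
        rw [hR.mem_fball] at hy ⊢
        have h1 := hR.d_le_one x z (mem_nbr_iff_pos.1 hz)
        have h2 := M.d_triangle x z y
        push_cast
        linarith
      have hn : M.nbr x ⊆ K.F := fun z hz => hx (hsub z hz (hR.self_mem_fball z (by positivity)))
      have hw : ∀ m, M.walk (m + 1) x (fun l _ => if ∀ v ∈ l, v ∈ U then (1 : ℝ) else 0) =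
          ∑ z ∈ M.nbr x, M.p x z *
            M.walk m z fun l _ => if ∀ v ∈ l, v ∈ U then (1 : ℝ) else 0 := by
        intro m
        simp only [walk, List.forall_mem_cons, hxU, true_and]
      have h1 : ∑ z ∈ M.nbr x, M.p x z * K.time₀ U z ≤ C * ∑ j ∈ Finset.range n,
          M.walk (j + 1 + 1) x (fun l _ => if ∀ v ∈ l, v ∈ U then (1 : ℝ) else 0) +
          Λ * M.walk (n + 1) x fun l _ => if ∀ v ∈ l, v ∈ U then (1 : ℝ) else 0 := by
        refine (Finset.sum_le_sum fun z hz => mul_le_mul_of_nonneg_left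
          (ih z ((hsub z hz).trans hx)) (p_nonneg x z)).trans (le_of_eq ?_)
        simp only [hw _, mul_add, Finset.sum_add_distrib, Finset.mul_sum]
        rw [Finset.sum_comm]
        simp only [mul_left_comm]
      have h2 : M.walk (0 + 1) x (fun l _ => if ∀ v ∈ l, v ∈ U then (1 : ℝ) else 0) = 1 := by
        rw [hw]
        simp only [walk, List.not_mem_nil, false_imp_iff, implies_true, if_true, mul_one]
        exact hR.sum_p x
      rw [hK.time₀_eq hR hU hxU hn, Finset.sum_range_succ', h2]
      have h3 := hR.inv_lamTot_le x
      linarith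
    · rw [K.time₀_of_notMem hxU]
      exact add_nonneg (mul_nonneg hC.le (Finset.sum_nonneg fun j _ =>
        hR.walk_nonneg fun l _ => hi l)) (mul_nonneg hΛ0 (hR.walk_nonneg fun l _ => hi l))

end IsTrace

/-- Probability that the points of `l` avoid the cluster of the ground. -/
def avoid (K : Net M.V) (b : ℝ) (l : List M.V) : ℝ :=
  ∑ O ∈ K.N.powerset with K.bd ∈ O, (K.I b (K.weight {K.bd} O) / K.Z).toReal *
    if ∀ v ∈ l, v ∈ K.N \ O then (1 : ℝ) else 0

lemma avoid_antitone (K : Net M.V) (b : ℝ) {l l' : List M.V} (h : l ⊆ l') :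
    avoid K b l' ≤ avoid K b l := by
  refine Finset.sum_le_sum fun O _ => mul_le_mul_of_nonneg_left ?_ ENNReal.toReal_nonneg
  split_ifs with h1 h2
  exacts [le_rfl, absurd (fun v hv => h1 v (h hv)) h2, zero_le_one, le_rfl]

lemma div_Z_ne_top (K : Net M.V) (b : ℝ) {O : Finset M.V} (hO : O ∈ K.N.powerset)
    (hb : K.bd ∈ O) : K.I b (K.weight {K.bd} O) / K.Z ≠ ⊤ :=
  ENNReal.div_ne_top (K.I_weight_ne_top b _ _ (Finset.singleton_subset_iff.2 hb)
    (Finset.mem_powerset.1 hO)) K.Z_ne_zero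

lemma avoid_le_of_subset (K : Net M.V) (b : ℝ) {l : List M.V} {S : Finset M.V} (hS : S ⊆ K.F)
    (hl : ∀ v ∈ S, v ∈ l) (μ : M.V → ℝ) {t : ℝ} (ht : 0 < t)
    (hμ : ∑ x ∈ S, ∑ y ∈ S, μ x * K.G x y * μ y ≤ t) :
    avoid K b l ≤ exp (-((b * ∑ x ∈ S, μ x) ^ 2 / t / 2)) := by
  have h := K.sum_I_weight_avoid_le hS b μ ht hμ
  have h1 : avoid K b l ≤ ∑ O ∈ K.N.powerset with K.bd ∈ O ∧ Disjoint O S,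
      (K.I b (K.weight {K.bd} O) / K.Z).toReal := by
    unfold avoid
    simp only [mul_ite, mul_one, mul_zero]
    rw [← Finset.sum_filter, Finset.filter_filter]
    refine Finset.sum_le_sum_of_subset_of_nonneg (fun O hO => ?_)
      fun O _ _ => ENNReal.toReal_nonneg
    simp only [Finset.mem_filter] at hO ⊢
    refine ⟨hO.1, hO.2.1, Finset.disjoint_right.2 fun v hv => ?_⟩
    exact (Finset.mem_sdiff.1 (hO.2.2 v (hl v hv))).2
  refine h1.trans ?_
  rw [← ENNReal.toReal_sum fun O hO => by
    simp only [Finset.mem_filter] at hO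
    exact div_Z_ne_top K b hO.1 hO.2.1]
  refine ENNReal.toReal_le_of_le_ofReal (exp_pos _).le ?_
  simp only [div_eq_mul_inv] at h ⊢
  rw [← Finset.sum_mul, ← div_eq_mul_inv]
  exact ENNReal.div_le_of_le_mul h

lemma avoid_le_one (K : Net M.V) (b : ℝ) (l : List M.V) : avoid K b l ≤ 1 := by
  have := avoid_le_of_subset K b (l := l) (Finset.empty_subset K.F) (by simp) (fun _ => 0)
    one_pos (by simp)
  simpa using this

lemma IsTrace.avoid_le {K : Net M.V} (hK : M.IsTrace C K) (b : ℝ) {l l' : List M.V} {t : ℝ}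
    (hl : l' ⊆ l) (ht : 0 < t) (he : M.energy l' ≤ t) :
    avoid K b l ≤ exp (-((b * l'.length) ^ 2 / t / 2)) := by
  by_cases hF : ∀ v ∈ l', v ∈ K.F
  · have h := avoid_le_of_subset K b (l := l) (S := l'.toFinset)
      (fun v hv => hF v (List.mem_toFinset.1 hv)) (fun v hv => hl (List.mem_toFinset.1 hv))
      (fun v => (l'.count v : ℝ)) ht (le_trans (le_of_eq ?_) he)
    · have e : ∑ x ∈ l'.toFinset, (l'.count x : ℝ) = l'.length := by
        exact_mod_cast l'.sum_toFinset_count_eq_length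
      rwa [e] at h
    · rw [energy, Finset.sum_list_map_count]
      refine Finset.sum_congr rfl fun x hx => ?_
      rw [Finset.sum_list_map_count, nsmul_eq_mul, Finset.mul_sum]
      refine Finset.sum_congr rfl fun y hy => ?_
      rw [hK.G_eq x (hF x (List.mem_toFinset.1 hx)) y (hF y (List.mem_toFinset.1 hy)),
        nsmul_eq_mul]
      ring
  · push Not at hF
    obtain ⟨v, hv, hvF⟩ := hF
    have : avoid K b l = 0 := by
      refine Finset.sum_eq_zero fun O hO => ?_
      rw [if_neg, mul_zero]
      intro h
      exact hvF (K.subset_F_of_bd_mem (Finset.mem_filter.1 hO).2 (h v (hl hv)))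
    rw [this]
    exact (exp_pos _).le

namespace IsTrace

variable {K : Net M.V}

lemma sum_time₀_le (hR : M.Reg C) (hK : M.IsTrace C K) (b : ℝ) {Λ : ℝ}
    (hΛ : ∀ U ⊆ K.F, ∀ x, K.time₀ U x ≤ Λ) {n : ℕ} {o : M.V} (ho : M.fball o n ⊆ K.F) :
    ∑ O ∈ K.N.powerset with K.bd ∈ O, (K.I b (K.weight {K.bd} O) / K.Z).toReal *
        K.time₀ (K.N \ O) o ≤
      C * ∑ j ∈ Finset.range n, M.walk (j + 1) o (fun l _ => avoid K b l) +
        Λ * M.walk n o fun l _ => avoid K b l := by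
  refine (Finset.sum_le_sum fun O hO => mul_le_mul_of_nonneg_left (hK.time₀_le_walk hR
    (K.subset_F_of_bd_mem (Finset.mem_filter.1 hO).2)
    (hΛ _ (K.subset_F_of_bd_mem (Finset.mem_filter.1 hO).2)) n o ho)
    ENNReal.toReal_nonneg).trans (le_of_eq ?_)
  have e : ∀ m, M.walk m o (fun l _ => avoid K b l) =
      ∑ O ∈ K.N.powerset with K.bd ∈ O, (K.I b (K.weight {K.bd} O) / K.Z).toReal *
        M.walk m o fun l _ => if ∀ v ∈ l, v ∈ K.N \ O then (1 : ℝ) else 0 := by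
    intro m
    unfold avoid
    rw [walk_sum]
    simp only [walk_const_mul]
  simp only [e, Finset.mul_sum, mul_add, Finset.sum_add_distrib]
  rw [Finset.sum_comm]
  simp only [mul_left_comm]

lemma sum_card_weight_le (hR : M.Reg C) (hK : M.IsTrace C K) (b : ℝ) {Λ : ℝ}
    (hΛ : ∀ U ⊆ K.F, ∀ x, K.time₀ U x ≤ Λ) {n : ℕ} {o : M.V} (ho : M.fball o n ⊆ K.F) :
    ∑ T ∈ K.F.powerset with o ∈ T, (T.card : ℝ≥0∞) * K.I b (K.weight {o} T) ≤
      ENNReal.ofReal (1 + 8 * C *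
        (C * ∑ j ∈ Finset.range n, M.walk (j + 1) o (fun l _ => avoid K b l) +
          Λ * M.walk n o fun l _ => avoid K b l)) * K.Z := by
  have hC := hR.pos
  have hoF : o ∈ K.F := ho (hR.self_mem_fball o (by positivity))
  have hs : 0 ≤ ∑ O ∈ K.N.powerset with K.bd ∈ O, (K.I b (K.weight {K.bd} O) / K.Z).toReal *
        K.time₀ (K.N \ O) o :=
    Finset.sum_nonneg fun O hO => mul_nonneg ENNReal.toReal_nonneg
      (K.time₀_nonneg (K.subset_F_of_bd_mem (Finset.mem_filter.1 hO).2) _)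
  have hle := hK.sum_time₀_le hR b hΛ ho
  refine (K.sum_card_weight_le hoF b hK.lap_le).trans ?_
  rw [ENNReal.ofReal_add zero_le_one (mul_nonneg (by positivity) (hs.trans hle)), add_mul,
    ENNReal.ofReal_one, one_mul]
  refine add_le_add le_rfl ?_
  refine le_trans ?_ (mul_le_mul_left (ENNReal.ofReal_le_ofReal
    (mul_le_mul_of_nonneg_left hle (by positivity))) _)
  rw [Finset.mul_sum, ENNReal.ofReal_sum_of_nonneg fun O hO => mul_nonneg (by positivity)
    (mul_nonneg ENNReal.toReal_nonneg
      (K.time₀_nonneg (K.subset_F_of_bd_mem (Finset.mem_filter.1 hO).2) _)), Finset.sum_mul]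
  refine (Finset.sum_le_sum_of_subset (t := K.N.powerset.filter fun O => K.bd ∈ O)
    fun O hO => ?_).trans (Finset.sum_le_sum fun O hO => le_of_eq ?_)
  · simp only [Finset.mem_filter] at hO ⊢
    exact ⟨hO.1, hO.2.1⟩
  · rw [Finset.mem_filter] at hO
    have e : K.I b (K.weight {K.bd} O) =
        ENNReal.ofReal (K.I b (K.weight {K.bd} O) / K.Z).toReal * K.Z := by
      rw [ENNReal.ofReal_toReal (div_Z_ne_top K b hO.1 hO.2),
        ENNReal.div_mul_cancel K.Z_ne_zero K.Z_ne_top]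
    conv_lhs => rw [e]
    rw [← mul_assoc, ← ENNReal.ofReal_mul (mul_nonneg (by positivity)
      (K.time₀_nonneg (K.subset_F_of_bd_mem hO.2) _))]
    congr 2
    ring

end IsTrace

namespace Reg

/-- Upper bound for the mean volume of a cluster in large balls. -/
theorem exists_sum_card_weight_le (hR : M.Reg C) (hν : 0 < M.ν) (hα : 2 * M.ν < M.α) {θ : ℝ}
    (hθ : 2 * (M.α - M.ν) / M.ν < θ) : ∃ K₀, 0 < K₀ ∧ ∀ b : ℝ, 0 < b → b ≤ 1 → ∀ o,
      ∀ᶠ n : ℕ in atTop, ∀ K : Net M.V, M.IsTrace C K → K.F = M.fball o n →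
        ∑ T ∈ K.F.powerset with o ∈ T, (T.card : ℝ≥0∞) * K.I b (K.weight {o} T) ≤
          ENNReal.ofReal (K₀ * b ^ (-θ)) * K.Z := by
  have hC := hR.pos
  have hβ : 0 < M.α - M.ν := by linarith
  have hθ0 : 0 < θ := lt_of_le_of_lt (by positivity) hθ
  have hs' : 2 / θ < M.ν / (M.α - M.ν) := by
    rw [div_lt_iff₀ hν] at hθ
    rw [div_lt_div_iff₀ hθ0 hβ]
    linarith
  obtain ⟨s, hs1, hs2⟩ := exists_between hs'
  have hs : 0 < s := lt_trans (by positivity) hs1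
  have hsθ : 1 < s * (θ / 2) := by
    rw [div_lt_iff₀ hθ0] at hs1
    linarith
  have hα0 : 0 < M.α := by linarith
  have hq' : 0 < (M.α + 1) / s := by positivity
  obtain ⟨K₁, hK₁, h1⟩ := hR.exists_walk_avoid_le hν hα hs hs2 (q := θ / 2) (by positivity)
  obtain ⟨K₂, hK₂, h2⟩ := hR.exists_walk_avoid_le hν hα hs hs2 hq'
  have hsum : Summable fun j : ℕ => ((j + 1 : ℕ) : ℝ) ^ (-(s * (θ / 2))) :=
    (summable_nat_add_iff 1).2 (Real.summable_nat_rpow.2 (by linarith))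
  set A := ∑' j : ℕ, ((j + 1 : ℕ) : ℝ) ^ (-(s * (θ / 2))) with hA
  have hA0 : 0 ≤ A := tsum_nonneg fun j => by positivity
  refine ⟨1 + 8 * C * (C * (K₁ * A) + 1), by positivity, fun b hb hb1 o => ?_⟩
  have hlim : Tendsto (fun n : ℕ => C * C * K₂ * (b ^ 2) ^ (-((M.α + 1) / s)) * (n : ℝ)⁻¹) atTop
      (𝓝 0) := by
    simpa using (tendsto_inv_atTop_nhds_zero_nat (𝕜 := ℝ)).const_mul
      (C * C * K₂ * (b ^ 2) ^ (-((M.α + 1) / s)))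
  filter_upwards [hlim.eventually (ge_mem_nhds one_pos), eventually_ge_atTop 1]
    with n hn hn1 K hK hKF
  have hn0 : (1 : ℝ) ≤ n := by exact_mod_cast hn1
  have hnp : (0 : ℝ) < n := by linarith
  have hΛ : ∀ U ⊆ K.F, ∀ x, K.time₀ U x ≤ C * (C * (n : ℝ) ^ M.α) := by
    intro U hU x
    by_cases hx : x ∈ U
    · refine (K.time₀_le hU x).trans ?_
      refine (Finset.sum_le_card_nsmul _ _ C fun y hy => ?_).trans ?_
      · rw [hK.G_eq x (hU hx) y hy]
        exact hR.green_le_const hν x y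
      · rw [nsmul_eq_mul, mul_comm, hKF]
        exact mul_le_mul_of_nonneg_left (hR.card_le o n hn0) hC.le
    · rw [K.time₀_of_notMem hx]
      positivity
  have hpow : ∀ m : ℕ, 1 ≤ m → ∀ q : ℝ, (b ^ 2 * (m : ℝ) ^ s) ^ (-q) =
      (b ^ 2) ^ (-q) * (m : ℝ) ^ (-(s * q)) := by
    intro m hm q
    rw [Real.mul_rpow (by positivity) (by positivity), ← Real.rpow_mul (by positivity),
      mul_neg]
  have hbθ : (b ^ 2) ^ (-(θ / 2)) = b ^ (-θ) := by
    rw [← Real.rpow_natCast b 2, ← Real.rpow_mul hb.le]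
    congr 1
    push_cast
    ring
  have hbθ1 : 1 ≤ b ^ (-θ) := Real.one_le_rpow_of_pos_of_le_one_of_nonpos hb hb1 (by linarith)
  have hw1 : ∀ j : ℕ, M.walk (j + 1) o (fun l _ => avoid K b l) ≤
      K₁ * b ^ (-θ) * ((j + 1 : ℕ) : ℝ) ^ (-(s * (θ / 2))) := by
    intro j
    have := h1 b (avoid K b) hb hb1 (avoid_le_one K b) (fun l l' => avoid_antitone K b)
      (fun l l' t => hK.avoid_le b) (j + 1) (by omega) o
    rwa [hpow _ (by omega), hbθ, ← mul_assoc] at this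
  have hw2 : C * (C * (n : ℝ) ^ M.α) * M.walk n o (fun l _ => avoid K b l) ≤ 1 := by
    have := h2 b (avoid K b) hb hb1 (avoid_le_one K b) (fun l l' => avoid_antitone K b)
      (fun l l' t => hK.avoid_le b) n hn1 o
    rw [hpow _ hn1, mul_div_cancel₀ _ hs.ne'] at this
    refine (mul_le_mul_of_nonneg_left this (by positivity)).trans (le_trans (le_of_eq ?_) hn)
    rw [neg_add, Real.rpow_add hnp, Real.rpow_neg_one, Real.rpow_neg hnp.le M.α]
    have := (Real.rpow_pos_of_pos hnp M.α).ne'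
    field_simp
  have hw3 : ∑ j ∈ Finset.range n, M.walk (j + 1) o (fun l _ => avoid K b l) ≤
      K₁ * A * b ^ (-θ) := by
    refine (Finset.sum_le_sum fun j _ => hw1 j).trans ?_
    rw [← Finset.mul_sum]
    refine (mul_le_mul_of_nonneg_left (hsum.sum_le_tsum _ fun j _ => by positivity)
      (by positivity)).trans (le_of_eq (by ring))
  refine (hK.sum_card_weight_le hR b hΛ (n := n) (o := o) (by rw [hKF])).trans
    (mul_le_mul_left (ENNReal.ofReal_le_ofReal ?_) _)
  have h3 := mul_le_mul_of_nonneg_left (add_le_add (mul_le_mul_of_nonneg_left hw3 hC.le) hw2)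
    (show 0 ≤ 8 * C by positivity)
  have h4 : 8 * C * 1 ≤ 8 * C * b ^ (-θ) := mul_le_mul_of_nonneg_left hbθ1 (by positivity)
  linarith

end Reg

end WGraph

namespace GaussNet.Net

lemma I_zero {V : Type*} (K : Net V) (b : ℝ) : K.I b (fun _ => 0) = 0 := by
  have := K.I_const_mul (b := b) 0 (H := fun _ => 0) measurable_const
  simpa using this

end GaussNet.Net

namespace WGraph

open GaussNet BondPerc

variable {M : WGraph} {C : ℝ}

namespace IsTrace

variable {K : Net M.V}

/-- A cluster of `o` which is not contained in a ball is large. -/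
lemma le_card_of_weight_ne_zero (hR : M.Reg C) (hK : M.IsTrace C K) {n : ℕ} {o : M.V}
    (hF : M.fball o (n + 1) ⊆ K.F) {T : Finset M.V} (ho : o ∈ T) (hT : ¬ T ⊆ M.fball o n)
    {ψ : M.V → ℝ} (hw : K.weight {o} T ψ ≠ 0) : n + 1 ≤ T.card := by
  have hc : BondPerc.conn (closed K.w ψ) {o} T ≠ 0 := by
    intro h
    rw [K.weight_eq, h, ENNReal.ofReal_zero, zero_mul] at hw
    exact hw rfl
  have hlev : ∀ m ∈ Finset.range (n + 1), m ∈ T.image fun y => ⌊M.d o y⌋₊ := by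
    intro m hm
    rw [Finset.mem_range] at hm
    by_contra hmT
    have hmT : ∀ y ∈ T, ⌊M.d o y⌋₊ ≠ m := fun y hy h =>
      hmT (Finset.mem_image.2 ⟨y, hy, h⟩)
    refine hT fun y hy => ?_
    have hy' : ⌊M.d o y⌋₊ < m := by
      refine conn_induction (closed_symm K.w_symm ψ) hc (P := fun y => ⌊M.d o y⌋₊ < m) ?_ ?_ y hy
      · intro x hx
        rw [Finset.mem_singleton.1 hx, M.d_self, Nat.floor_zero]
        have := hmT o ho
        rw [M.d_self, Nat.floor_zero] at this
        omega
      · intro u hu v hv huv hum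
        have hdu : M.d o u ≤ n := by
          have := Nat.lt_of_floor_lt hum
          have : (m : ℝ) ≤ n := by exact_mod_cast Nat.lt_succ_iff.1 hm
          linarith
        have hw0 : K.w u v ≠ 0 := fun h => huv (by simp [closed, h])
        rcases eq_or_ne v u with rfl | hvu
        · exact hum
        rw [hK.w_eq u (hF (hR.mem_fball.2 (by linarith)))
          ((hR.nbr_subset_fball (hR.mem_fball.2 hdu)).trans hF) v hvu] at hw0
        have hd := hR.d_le_one u v ((M.lam_nonneg u v).lt_of_ne' hw0)
        have h1 : ⌊M.d o v⌋₊ ≤ ⌊M.d o u⌋₊ + 1 := by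
          rw [← Nat.floor_add_one (by
            rcases eq_or_ne o u with rfl | h
            · exact (M.d_self _).ge
            · exact (M.d_pos o u h).le)]
          exact Nat.floor_le_floor (by linarith [M.d_triangle o u v])
        have := hmT v hv
        omega
    rw [hR.mem_fball]
    have := Nat.lt_of_floor_lt hy'
    have : (m : ℝ) ≤ n := by exact_mod_cast Nat.lt_succ_iff.1 hm
    linarith
  calc n + 1 = (Finset.range (n + 1)).card := (Finset.card_range _).symm
    _ ≤ (T.image fun y => ⌊M.d o y⌋₊).card := Finset.card_le_card hlev
    _ ≤ T.card := Finset.card_image_le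

end IsTrace

namespace Reg

lemma exists_sum_green_le (hR : M.Reg C) (hν : 0 < M.ν) (hα : M.ν < M.α) :
    ∃ A, 0 < A ∧ ∀ T : Finset M.V, T.Nonempty →
      ∑ x ∈ T, ∑ y ∈ T, M.green x y ≤ A * (T.card : ℝ) ^ (2 - M.ν / M.α) := by
  have hC := hR.pos
  obtain ⟨A, hA, h⟩ := hR.exists_sum_rpow_le hν.le hα
  refine ⟨C * (A + 1), by positivity, fun T hT => ?_⟩
  have hα0 : 0 < M.α := by linarith
  have hT1 : (1 : ℝ) ≤ T.card := by exact_mod_cast hT.card_pos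
  have hT0 : (0 : ℝ) < T.card := by linarith
  set r : ℝ := (T.card : ℝ) ^ (1 / M.α) with hr
  have hr1 : 1 ≤ r := one_le_rpow hT1 (by positivity)
  have hr0 : 0 < r := by linarith
  have hrν : r ^ (-M.ν) = (T.card : ℝ) ^ (-(M.ν / M.α)) := by
    rw [hr, ← rpow_mul hT0.le]
    congr 1
    field_simp
  have hrβ : r ^ (M.α - M.ν) = (T.card : ℝ) ^ (1 - M.ν / M.α) := by
    rw [hr, ← rpow_mul hT0.le]
    congr 1
    field_simp
  have hrow : ∀ x ∈ T, ∑ y ∈ T, M.green x y ≤ C * (A + 1) * (T.card : ℝ) ^ (1 - M.ν / M.α) := by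
    intro x _
    have h1 : ∑ y ∈ T, max 1 (M.d x y) ^ (-M.ν) ≤
        (∑ y ∈ M.fball x r, max 1 (M.d x y) ^ (-M.ν)) + T.card * r ^ (-M.ν) := by
      rw [← Finset.sum_filter_add_sum_filter_not T (fun y => y ∈ M.fball x r)]
      refine add_le_add (Finset.sum_le_sum_of_subset_of_nonneg
        (fun y hy => (Finset.mem_filter.1 hy).2) fun y _ _ => by positivity) ?_
      refine (Finset.sum_le_card_nsmul _ _ (r ^ (-M.ν)) fun y hy => ?_).trans ?_
      · have := (Finset.mem_filter.1 hy).2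
        rw [hR.mem_fball, not_le] at this
        exact rpow_le_rpow_of_nonpos hr0 (this.le.trans (le_max_right _ _)) (by linarith)
      · rw [nsmul_eq_mul]
        exact mul_le_mul_of_nonneg_right
          (Nat.cast_le.2 (Finset.card_le_card (Finset.filter_subset _ _))) (by positivity)
    have h2 := h x r hr1
    rw [hrβ] at h2
    have e : (T.card : ℝ) * r ^ (-M.ν) = (T.card : ℝ) ^ (1 - M.ν / M.α) := by
      rw [hrν, sub_eq_add_neg, rpow_add hT0, rpow_one]
    rw [e] at h1
    calc ∑ y ∈ T, M.green x y ≤ ∑ y ∈ T, C * max 1 (M.d x y) ^ (-M.ν) :=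
          Finset.sum_le_sum fun y _ => hR.green_le x y
      _ = C * ∑ y ∈ T, max 1 (M.d x y) ^ (-M.ν) := by rw [Finset.mul_sum]
      _ ≤ C * ((A + 1) * (T.card : ℝ) ^ (1 - M.ν / M.α)) :=
          mul_le_mul_of_nonneg_left (by linarith) hC.le
      _ = _ := by ring
  refine (Finset.sum_le_card_nsmul _ _ _ hrow).trans (le_of_eq ?_)
  rw [nsmul_eq_mul, show (2 : ℝ) - M.ν / M.α = 1 + (1 - M.ν / M.α) by ring, rpow_add hT0,
    rpow_one]
  ring

/-- Clusters that are not contained in large balls do not contribute. -/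
theorem eventually_sum_card_weight_le (hR : M.Reg C) (hν : 0 < M.ν) (hα : M.ν < M.α) {b : ℝ}
    (hb : 0 < b) {η : ℝ} (hη : 0 < η) (o : M.V) : ∀ᶠ n : ℕ in atTop, ∀ K : Net M.V,
      M.IsTrace C K → K.F = M.fball o (n + 1) →
      ∑ T ∈ K.F.powerset with o ∈ T ∧ ¬ T ⊆ M.fball o n,
        (T.card : ℝ≥0∞) * K.I b (K.weight {o} T) ≤ ENNReal.ofReal η * K.Z := by
  have hC := hR.pos
  have hα0 : 0 < M.α := by linarith
  obtain ⟨A, hA, hE⟩ := hR.exists_sum_green_le hν hα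
  set κ := M.ν / M.α with hκ
  have hκ0 : 0 < κ := by positivity
  have hlim : Tendsto (fun n : ℕ => C * (((n : ℝ) + 1) ^ M.α *
      exp (-(b ^ 2 / A * ((n : ℝ) + 1) ^ κ / 2)))) atTop (𝓝 0) := by
    have h1 := (tendsto_rpow_mul_exp_neg_mul_atTop_nhds_zero (M.α / κ) (b ^ 2 / A / 2)
      (by positivity)).comp ((tendsto_rpow_atTop hκ0).comp
        (tendsto_atTop_add_const_right atTop (1 : ℝ) tendsto_natCast_atTop_atTop))
    have h2 := h1.const_mul C
    rw [mul_zero] at h2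
    refine h2.congr fun n => ?_
    simp only [Function.comp_apply]
    rw [← rpow_mul (by positivity), mul_div_cancel₀ _ hκ0.ne']
    congr 3
    ring
  filter_upwards [hlim.eventually (ge_mem_nhds hη)] with n hn K hK hKF
  have hn1 : (1 : ℝ) ≤ n + 1 := by linarith [Nat.cast_nonneg (α := ℝ) n]
  have hoF : o ∈ K.F := by
    rw [hKF]
    exact hR.self_mem_fball o (by linarith)
  have h1 := K.sum_I_weight_le (S := {o}) (Finset.singleton_subset_iff.2 hoF) (b := b)
    (q := b ^ 2 / A * ((n : ℝ) + 1) ^ κ) (fun T => n + 1 ≤ T.card) fun T hTF hoT hT f hf hfb => by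
      have hTne : T.Nonempty := ⟨o, Finset.singleton_subset_iff.1 hoT⟩
      have hc := K.capacity_le hTF hf hfb fun _ => 1
      simp only [one_mul, mul_one, Finset.sum_const, nsmul_eq_mul] at hc
      rw [Finset.sum_congr rfl fun x hx => Finset.sum_congr rfl fun y hy =>
        hK.G_eq x (hTF hx) y (hTF hy)] at hc
      have hT0 : (0 : ℝ) < T.card := by exact_mod_cast hTne.card_pos
      have hen : 0 ≤ en K.w K.N f :=
        Finset.sum_nonneg fun e _ => mul_nonneg (K.w_nonneg _ _) (sq_nonneg _)
      have h2 := hc.trans (mul_le_mul_of_nonneg_left (hE T hTne) hen)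
      rw [rpow_sub hT0, rpow_two] at h2
      have h3 : ((n : ℝ) + 1) ^ κ ≤ (T.card : ℝ) ^ κ :=
        rpow_le_rpow (by linarith) (by exact_mod_cast hT) hκ0.le
      have h4 : b ^ 2 * (T.card : ℝ) ^ κ ≤ en K.w K.N f * A := by
        have h5 : 0 < (T.card : ℝ) ^ κ := by positivity
        have h6 : en K.w K.N f * (A * ((T.card : ℝ) ^ 2 / (T.card : ℝ) ^ κ)) =
          en K.w K.N f * A * (T.card : ℝ) ^ 2 / (T.card : ℝ) ^ κ := by ring
        rw [h6, le_div_iff₀ h5] at h2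
        have h7 : 0 < (T.card : ℝ) ^ 2 := by positivity
        refine le_of_mul_le_mul_right ?_ h7
        linarith
      rw [div_mul_eq_mul_div, div_le_iff₀ hA]
      exact (mul_le_mul_of_nonneg_left h3 (by positivity)).trans h4
  have h2 : ∑ T ∈ K.F.powerset with o ∈ T ∧ ¬ T ⊆ M.fball o n,
        (T.card : ℝ≥0∞) * K.I b (K.weight {o} T) ≤ (K.F.card : ℝ≥0∞) *
      ∑ T ∈ K.N.powerset with {o} ⊆ T ∧ K.bd ∉ T ∧ n + 1 ≤ T.card, K.I b (K.weight {o} T) := by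
    have hz : ∀ T ∈ K.F.powerset.filter (fun T => o ∈ T ∧ ¬ T ⊆ M.fball o n),
        (T.card : ℝ≥0∞) * K.I b (K.weight {o} T) ≠ 0 →
        T ∈ K.N.powerset.filter (fun T => {o} ⊆ T ∧ K.bd ∉ T ∧ n + 1 ≤ T.card) := by
      intro T hT hne
      simp only [Finset.mem_filter, Finset.mem_powerset] at hT ⊢
      refine ⟨hT.1.trans K.F_subset, Finset.singleton_subset_iff.2 hT.2.1,
        fun h => K.bd_notMem (hT.1 h), ?_⟩
      by_contra hcard
      have h0 : K.weight {o} T = fun _ => 0 := funext fun ψ => by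
        by_contra h
        exact hcard (hK.le_card_of_weight_ne_zero hR hKF.ge hT.2.1 hT.2.2 h)
      refine hne ?_
      rw [h0, K.I_zero, mul_zero]
    rw [Finset.mul_sum]
    refine (Finset.sum_le_sum_of_ne_zero hz).trans (Finset.sum_le_sum fun T hT => ?_)
    simp only [Finset.mem_filter, Finset.mem_powerset] at hT
    have hTF : T ⊆ K.F := fun v hv => (Finset.mem_insert.1 (hT.1 hv)).resolve_left fun h =>
      hT.2.2.1 (h ▸ hv)
    exact mul_le_mul_left (Nat.cast_le.2 (Finset.card_le_card hTF)) _
  refine h2.trans ((mul_le_mul_right h1 _).trans ?_)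
  rw [← mul_assoc]
  refine mul_le_mul_left ?_ _
  rw [← ENNReal.ofReal_natCast, ← ENNReal.ofReal_mul (by positivity)]
  refine ENNReal.ofReal_le_ofReal (le_trans ?_ hn)
  rw [← mul_assoc]
  refine mul_le_mul_of_nonneg_right ?_ (exp_pos _).le
  rw [hKF]
  exact hR.card_le o _ hn1

end Reg

end WGraph

namespace WGraph.Reg

open GaussNet

variable {M : WGraph} {C : ℝ}

lemma exists_sum_sum_green_le (hR : M.Reg C) (hν : 0 < M.ν) (hα : M.ν < M.α) :
    ∃ A, 0 < A ∧ ∀ o r, 1 ≤ r →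
      ∑ x ∈ M.fball o r, ∑ y ∈ M.fball o r, M.green x y ≤ A * r ^ (2 * M.α - M.ν) := by
  have hC := hR.pos
  obtain ⟨A, hA, h⟩ := hR.exists_sum_green_le hν hα
  have hα0 : 0 < M.α := by linarith
  have he : 0 < 2 - M.ν / M.α := by
    have : M.ν / M.α < 1 := (div_lt_one hα0).2 hα
    linarith
  refine ⟨A * C ^ (2 - M.ν / M.α), by positivity, fun o r hr => ?_⟩
  have hr0 : 0 < r := by linarith
  refine (h _ ⟨o, hR.self_mem_fball o hr0.le⟩).trans ?_
  rw [mul_assoc]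
  refine mul_le_mul_of_nonneg_left ?_ hA.le
  refine (rpow_le_rpow (by positivity) (hR.card_le o r hr) he.le).trans (le_of_eq ?_)
  rw [mul_rpow hC.le (by positivity), ← rpow_mul hr0.le]
  congr 2
  field_simp

lemma rpow_le_sum_green (hR : M.Reg C) (hν : 0 < M.ν) (o : M.V) {r : ℝ} (hr : 1 ≤ r) :
    (C ^ 2)⁻¹ * r ^ (M.α - M.ν) ≤ ∑ y ∈ M.fball o r, M.green o y := by
  have hC := hR.pos
  have hr0 : 0 < r := by linarith
  have h1 : ∀ y ∈ M.fball o r, C⁻¹ * r ^ (-M.ν) ≤ M.green o y := by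
    intro y hy
    rw [inv_mul_le_iff₀ hC]
    refine le_trans ?_ (hR.le_green o y)
    exact rpow_le_rpow_of_nonpos (lt_of_lt_of_le one_pos (le_max_left _ _))
      (max_le hr (hR.mem_fball.1 hy)) (by linarith)
  refine le_trans ?_ (Finset.card_nsmul_le_sum _ _ _ h1)
  have h2 := hR.le_card o r hr
  rw [nsmul_eq_mul, sub_eq_add_neg, rpow_add hr0, inv_mul_le_iff₀ (by positivity)]
  calc r ^ M.α * r ^ (-M.ν) ≤ C * (M.fball o r).card * r ^ (-M.ν) :=
        mul_le_mul_of_nonneg_right h2 (by positivity)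
    _ = _ := by
        field_simp

/-- Lower bound for the mean volume of a cluster in large balls. -/
theorem exists_le_sum_card_weight (hR : M.Reg C) (hν : 0 < M.ν) (hα : M.ν < M.α) {θ : ℝ}
    (hθ : θ < 2 * (M.α - M.ν) / M.ν) {Ω : Type*} [MeasurableSpace Ω] {P : Measure Ω}
    {φ : Ω → M.V → ℝ} : ∃ c, 0 < c ∧ ∀ᶠ b : ℝ in 𝓝[>] 0, ∀ o, ∀ᶠ n : ℕ in atTop,
      ∀ K : Net M.V, M.IsTrace C K → K.F = M.fball o n → K.IsField P φ →
        ENNReal.ofReal (c * b ^ (-θ)) * K.Z ≤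
          ∑ T ∈ K.F.powerset with o ∈ T, (T.card : ℝ≥0∞) * K.I b (K.weight {o} T) := by
  have hC := hR.pos
  have hα0 : 0 < M.α := by linarith
  obtain ⟨A, hA, hE⟩ := hR.exists_sum_sum_green_le hν hα
  set β := M.α - M.ν with hβ
  have hβ0 : 0 < β := by linarith
  set ε := (β - θ * M.ν / 2) / 2 with hε
  have hε0 : 0 < ε := by
    rw [lt_div_iff₀ hν] at hθ
    linarith
  obtain ⟨p, hp⟩ := exists_nat_gt (M.α / ε)
  rw [div_lt_iff₀ hε0] at hp
  set δ := (C ^ 2)⁻¹ / (32 * √A) with hδ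
  have hA' : 0 < √A := Real.sqrt_pos.2 hA
  have hδ0 : 0 < δ := by positivity
  set D := C * ((p + 2).factorial * (4 * exp (1 + C / 2))) with hD
  have hlim : Tendsto (fun b : ℝ => (δ / b) ^ (2 / M.ν)) (𝓝[>] 0) atTop :=
    (tendsto_rpow_atTop (by positivity)).comp
      ((tendsto_inv_nhdsGT_zero).const_mul_atTop hδ0)
  have hlim' := (tendsto_rpow_atTop hβ0).comp hlim
  refine ⟨(C ^ 2)⁻¹ / 8 * δ ^ θ, by positivity, ?_⟩
  filter_upwards [hlim.eventually_ge_atTop 1, hlim'.eventually_ge_atTop (D / ((C ^ 2)⁻¹ / 8)),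
    Ioo_mem_nhdsGT one_pos] with b hr1 hrD hb o
  set r := (δ / b) ^ (2 / M.ν) with hr
  obtain ⟨hb0, hb1⟩ := hb
  have hr0 : 0 < r := by linarith
  have hδb : 0 < δ / b := by positivity
  have hbr : b = δ * r ^ (-(M.ν / 2)) := by
    rw [hr, ← rpow_mul hδb.le, show 2 / M.ν * -(M.ν / 2) = -1 by field_simp, rpow_neg_one]
    field_simp
  filter_upwards [eventually_ge_atTop ⌈r⌉₊] with n hn K hK hKF hφ
  have hB : M.fball o r ⊆ K.F := by
    rw [hKF]
    exact hR.fball_mono o (Nat.ceil_le.1 hn)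
  have hoB : o ∈ M.fball o r := hR.self_mem_fball o hr0.le
  set σ := √A * r ^ ((2 * M.α - M.ν) / 2) with hσ
  have hσ0 : 0 < σ := by positivity
  have hσ2 : σ ^ 2 = A * r ^ (2 * M.α - M.ν) := by
    rw [hσ, mul_pow, Real.sq_sqrt hA.le, ← rpow_mul_natCast hr0.le]
    congr 2
    push_cast
    ring
  have h := hφ.le_sum_card hb0.le (hB hoB) hB (s := σ⁻¹) (by positivity) (by
    rw [inv_pow, hσ2, inv_mul_le_one₀ (by positivity),
      Finset.sum_congr rfl fun x hx => Finset.sum_congr rfl fun y hy =>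
        hK.G_eq x (hB hx) y (hB hy)]
    exact hE o r hr1) (L := r ^ ε) (by positivity) p (g₀ := C) fun y hy => by
      rw [hK.G_eq y hy y hy]
      exact hR.green_le_const hν y y
  refine le_trans ?_ h
  rw [mul_comm]
  refine mul_le_mul_right (ENNReal.ofReal_le_ofReal ?_) _
  rw [le_div_iff₀ (by positivity), Finset.sum_congr rfl fun y hy => hK.G_eq o (hB hoB) y (hB hy)]
  have h1 := hR.rpow_le_sum_green hν o hr1
  rw [← hβ] at h1
  have h2 : 8 * b / σ⁻¹ = (C ^ 2)⁻¹ / 4 * r ^ β := by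
    rw [div_inv_eq_mul, hbr, hσ]
    have e : r ^ β = r ^ (-(M.ν / 2)) * r ^ ((2 * M.α - M.ν) / 2) := by
      rw [← rpow_add hr0]
      congr 1
      rw [hβ]
      ring
    rw [e, hδ]
    field_simp
    ring
  have h3 : ((M.fball o r).card : ℝ) *
      ((p + 2).factorial / (r ^ ε) ^ p * (4 * exp (b + C / 2))) ≤ D := by
    have h4 : ((M.fball o r).card : ℝ) ≤ C * (r ^ ε) ^ p := by
      refine (hR.card_le o r hr1).trans (mul_le_mul_of_nonneg_left ?_ hC.le)
      rw [← rpow_mul_natCast hr0.le]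
      exact rpow_le_rpow_of_exponent_le hr1 (by linarith)
    calc ((M.fball o r).card : ℝ) * ((p + 2).factorial / (r ^ ε) ^ p * (4 * exp (b + C / 2)))
        ≤ (C * (r ^ ε) ^ p) * ((p + 2).factorial / (r ^ ε) ^ p * (4 * exp (1 + C / 2))) := by
          refine mul_le_mul h4 ?_ (by positivity) (by positivity)
          refine mul_le_mul_of_nonneg_left ?_ (by positivity)
          exact mul_le_mul_of_nonneg_left (exp_le_exp.2 (by linarith)) (by norm_num)
      _ = D := by
          rw [hD]
          field_simp
  have h5 : D ≤ (C ^ 2)⁻¹ / 8 * r ^ β := by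
    have h : D / ((C ^ 2)⁻¹ / 8) ≤ r ^ β := hrD
    rwa [div_le_iff₀' (by positivity)] at h
  have h6 : (C ^ 2)⁻¹ / 8 * δ ^ θ * b ^ (-θ) * (r ^ ε) ^ 2 = (C ^ 2)⁻¹ / 8 * r ^ β := by
    have e : δ ^ θ * b ^ (-θ) = r ^ (θ * M.ν / 2) := by
      rw [rpow_neg hb0.le, ← div_eq_mul_inv, ← div_rpow hδ0.le hb0.le, hr, ← rpow_mul hδb.le]
      congr 1
      field_simp
    rw [mul_assoc, mul_assoc, ← mul_assoc (δ ^ θ), e, ← rpow_mul_natCast hr0.le, ← rpow_add hr0]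
    congr 2
    rw [hε]
    push_cast
    ring
  rw [h6, h2]
  linarith

end WGraph.Reg

namespace Model

open BondPerc GaussNet

variable {M : Model}

/-- Conditional probability, given the field `f`, that an edge is closed at level `a`. -/
def shut (M : Model) (a : ℝ) (f : M.V → ℝ) (x y : M.V) : ℝ :=
  exp (-(2 * M.lam x y * max (f x - a) 0 * max (f y - a) 0))

lemma shut_symm (a : ℝ) (f : M.V → ℝ) (x y : M.V) : M.shut a f x y = M.shut a f y x := by
  unfold shut
  rw [M.lam_symm]
  ring_nf

lemma shut_mem (a : ℝ) (f : M.V → ℝ) (x y : M.V) : M.shut a f x y ∈ Set.Icc (0 : ℝ) 1 := by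
  refine ⟨(exp_pos _).le, exp_le_one_iff.2 (neg_nonpos.2 ?_)⟩
  have := M.lam_nonneg x y
  positivity

lemma shut_eq_one {a : ℝ} {f : M.V → ℝ} {x y : M.V} (h : f x ≤ a ∨ f y ≤ a) :
    M.shut a f x y = 1 := by
  unfold shut
  rcases h with h | h <;> rw [max_eq_right (sub_nonpos.2 h)] <;> simp

/-- The open edges inside `N`. -/
def openEdges (M : Model) (a : ℝ) (ω : M.Ω) (N : Finset M.V) : Finset (M.V × M.V) :=
  (edges N).filter fun e => M.opn a ω e.1 e.2

lemma openEdges_eq_iff {a : ℝ} {ω : M.Ω} {N : Finset M.V} {A : Finset (M.V × M.V)}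
    (hA : A ⊆ edges N) : M.openEdges a ω N = A ↔
      (∀ e ∈ A, M.opn a ω e.1 e.2) ∧ ∀ e ∈ edges N \ A, ¬ M.opn a ω e.1 e.2 := by
  constructor
  · rintro rfl
    exact ⟨fun e he => (Finset.mem_filter.1 he).2, fun e he h =>
      (Finset.mem_sdiff.1 he).2 (Finset.mem_filter.2 ⟨(Finset.mem_sdiff.1 he).1, h⟩)⟩
  · rintro ⟨h1, h2⟩
    refine Finset.Subset.antisymm (fun e he => ?_) fun e he =>
      Finset.mem_filter.2 ⟨hA he, h1 e he⟩
    obtain ⟨h3, h4⟩ := Finset.mem_filter.1 he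
    by_contra h5
    exact h2 e (Finset.mem_sdiff.2 ⟨h3, h5⟩) h4

lemma opn_of_mem_openEdges {a : ℝ} {ω : M.Ω} {N : Finset M.V} {u v : M.V}
    (h : (u, v) ∈ M.openEdges a ω N ∨ (v, u) ∈ M.openEdges a ω N) : M.opn a ω u v :=
  h.elim (fun h => (Finset.mem_filter.1 h).2)
    fun h => M.opn_symm _ _ _ _ (Finset.mem_filter.1 h).2

lemma mem_openEdges_of_opn {a : ℝ} {ω : M.Ω} {N : Finset M.V} {u v : M.V} (hu : u ∈ N)
    (hv : v ∈ N) (huv : u ≠ v) (h : M.opn a ω u v) :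
    (u, v) ∈ M.openEdges a ω N ∨ (v, u) ∈ M.openEdges a ω N :=
  (wor_total huv).imp (fun h' => Finset.mem_filter.2 ⟨mem_edges.2 ⟨⟨hu, hv⟩, h'⟩, h⟩)
    fun h' => Finset.mem_filter.2 ⟨mem_edges.2 ⟨⟨hv, hu⟩, h'⟩, M.opn_symm _ _ _ _ h⟩

lemma cluster_eq_iff {a : ℝ} {ω : M.Ω} {N T : Finset M.V} {o : M.V} (hTN : T ⊆ N)
    (hT : ∀ x ∈ T, M.nbr x ⊆ N) :
    M.cluster a ω o = T ↔ reach (M.openEdges a ω N) {o} = T := by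
  have hsub : reach (M.openEdges a ω N) {o} ⊆ M.cluster a ω o := fun y hy => by
    refine reach_induction (P := fun y => y ∈ M.cluster a ω o) ?_ ?_ y hy
    · intro x hx
      rw [Finset.mem_singleton.1 hx]
      exact Relation.ReflTransGen.refl
    · exact fun u v _ hu huv => Relation.ReflTransGen.tail hu (opn_of_mem_openEdges huv)
  have hstep : ∀ u v, u ∈ T → u ∈ reach (M.openEdges a ω N) {o} → M.opn a ω u v →
      v ∈ reach (M.openEdges a ω N) {o} := fun u v hu hur huv => by
    by_cases h : u = v
    · exact h ▸ hur
    · exact reach_step hur (mem_openEdges_of_opn (hTN hu)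
        (hT u hu (WGraph.mem_nbr_iff_pos.2 (M.opn_edge _ _ _ _ huv))) h huv)
  have ho' : o ∈ reach (M.openEdges a ω N) {o} := subset_reach _ _ (by simp)
  constructor
  · intro h
    refine Set.Subset.antisymm (h ▸ hsub) ?_
    rw [← h]
    intro y hy
    have hy' : M.conn a ω o y := hy
    unfold conn at hy'
    induction hy' with
    | refl => exact ho'
    | @tail u v hou huv ih =>
      have hu : u ∈ (T : Set M.V) := h ▸ (show u ∈ M.cluster a ω o from hou)
      exact hstep u v hu (ih hou) huv
  · intro h
    refine Set.Subset.antisymm ?_ (h ▸ hsub)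
    intro y hy
    have hy' : M.conn a ω o y := hy
    unfold conn at hy'
    rw [← h]
    induction hy' with
    | refl => exact ho'
    | @tail u v hou huv ih =>
      have hu := ih hou
      exact hstep u v (by rw [h] at hu; exact hu) hu huv

lemma measurable_field : Measurable M.φ := measurable_pi_iff.2 M.φ_meas

lemma measurableSet_openEdges (a : ℝ) {N : Finset M.V} {A : Finset (M.V × M.V)}
    (hA : A ⊆ edges N) : MeasurableSet {ω | M.openEdges a ω N = A} := by
  have : {ω | M.openEdges a ω N = A} = (⋂ e ∈ A, {ω | M.opn a ω e.1 e.2}) ∩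
      ⋂ e ∈ edges N \ A, {ω | M.opn a ω e.1 e.2}ᶜ := by
    ext ω
    show M.openEdges a ω N = A ↔ _
    rw [openEdges_eq_iff hA]
    simp
  rw [this]
  exact (Finset.measurableSet_biInter _ fun e _ => M.opn_meas a e.1 e.2).inter
    (Finset.measurableSet_biInter _ fun e _ => (M.opn_meas a e.1 e.2).compl)

lemma inter_cluster_eq {N T : Finset M.V} {o : M.V} (a : ℝ) (hTN : T ⊆ N)
    (hT : ∀ x ∈ T, M.nbr x ⊆ N) (S : Set M.Ω) : S ∩ {ω | M.cluster a ω o = T} =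
      ⋃ A ∈ (edges N).powerset.filter fun A : Finset (M.V × M.V) => reach A {o} = (T : Set M.V),
        S ∩ {ω | M.openEdges a ω N = A} := by
  ext ω
  simp only [Set.mem_iUnion, Set.mem_inter_iff, Finset.mem_filter, Finset.mem_powerset,
    exists_prop]
  show ω ∈ S ∧ M.cluster a ω o = T ↔
    ∃ A, (A ⊆ edges N ∧ reach A {o} = T) ∧ ω ∈ S ∧ M.openEdges a ω N = A
  rw [cluster_eq_iff hTN hT]
  constructor
  · rintro ⟨h1, h2⟩
    exact ⟨_, ⟨Finset.filter_subset _ _, h2⟩, h1, rfl⟩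
  · rintro ⟨A, ⟨-, h2⟩, h3, rfl⟩
    exact ⟨h3, h2⟩

lemma measurableSet_cluster_eq (a : ℝ) (o : M.V) (T : Finset M.V) :
    MeasurableSet {ω | M.cluster a ω o = T} := by
  rw [← Set.univ_inter {ω | M.cluster a ω o = T}, inter_cluster_eq (N := T ∪ T.biUnion M.nbr) a
    Finset.subset_union_left fun x hx => (Finset.subset_biUnion_of_mem _ hx).trans
      Finset.subset_union_right]
  exact Finset.measurableSet_biUnion _ fun A hA => MeasurableSet.univ.inter
    (measurableSet_openEdges a (Finset.mem_powerset.1 (Finset.mem_filter.1 hA).1))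

/-- Law of the open cluster, conditionally on the field. -/
theorem measure_inter_cluster {N T : Finset M.V} {o : M.V} (a : ℝ) (ho : o ∈ T) (hTN : T ⊆ N)
    (hT : ∀ x ∈ T, M.nbr x ⊆ N) {B : Set (M.V → ℝ)} (hB : MeasurableSet B) :
    M.P ({ω | M.φ ω ∈ B} ∩ {ω | M.cluster a ω o = T}) =
      ∫⁻ ω in {ω | M.φ ω ∈ B}, ENNReal.ofReal (clus (M.shut a (M.φ ω)) N {o} T) ∂M.P := by
  have hBm : MeasurableSet {ω | M.φ ω ∈ B} := measurable_field hB
  have hwt : ∀ A, Measurable fun ω => wt (fun e => M.shut a (M.φ ω) e.1 e.2) (edges N) A := by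
    intro A
    have := M.φ_meas
    unfold wt shut
    fun_prop
  rw [inter_cluster_eq a hTN hT, measure_biUnion_finset]
  · have h1 : ∀ ω, ENNReal.ofReal (clus (M.shut a (M.φ ω)) N {o} T) =
        ∑ A ∈ (edges N).powerset with reach A {o} = (T : Set M.V),
          ENNReal.ofReal (wt (fun e => M.shut a (M.φ ω) e.1 e.2) (edges N) A) := fun ω => by
      rw [clus_eq (shut_symm a _) (Finset.singleton_subset_iff.2 ho) hTN, pr,
        ENNReal.ofReal_sum_of_nonneg]
      · congr!
      · intro A hA
        have hA' := Finset.mem_powerset.1 (Finset.mem_filter.1 hA).1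
        exact wt_nonneg (fun _ _ => shut_mem _ _ _ _) hA'
    simp only [h1]
    rw [lintegral_finsetSum _ fun A _ => (hwt A).ennreal_ofReal]
    refine Finset.sum_congr rfl fun A hA => ?_
    have hA' := Finset.mem_powerset.1 (Finset.mem_filter.1 hA).1
    have h2 := M.opn_law a A (edges N \ A) Finset.disjoint_sdiff (fun e he f hf _ h => by
      rw [Finset.union_sdiff_of_subset hA'] at he hf
      have h3 := (mem_edges.1 he).2
      rw [h] at h3
      exact wor_asymm (mem_edges.1 hf).2 h3) B hB
    have h4 : {ω | M.openEdges a ω N = A} = {ω | (∀ e ∈ A, M.opn a ω e.1 e.2) ∧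
        ∀ e ∈ edges N \ A, ¬ M.opn a ω e.1 e.2} := by
      ext ω
      exact openEdges_eq_iff hA'
    rw [h4, h2]
    rfl
  · intro A _ A' _ hne
    refine Set.disjoint_left.2 fun ω h1 h2 => hne ?_
    have h3 : M.openEdges a ω N = A := h1.2
    have h4 : M.openEdges a ω N = A' := h2.2
    rw [← h3, h4]
  · exact fun A hA => hBm.inter
      (measurableSet_openEdges a (Finset.mem_powerset.1 (Finset.mem_filter.1 hA).1))

/-- Below the level the cluster is trivial. -/
lemma measure_lt_inter_cluster {N T : Finset M.V} {o : M.V} (a : ℝ) (ho : o ∈ T) (hTN : T ⊆ N)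
    (hT : ∀ x ∈ T, M.nbr x ⊆ N) (hne : T ≠ {o}) :
    M.P ({ω | M.φ ω o < a} ∩ {ω | M.cluster a ω o = T}) = 0 := by
  have hm : MeasurableSet {f : M.V → ℝ | f o < a} :=
    measurableSet_lt (measurable_pi_apply o) measurable_const
  refine (measure_inter_cluster a ho hTN hT hm).trans ?_
  refine (setLIntegral_congr_fun (measurable_field hm) (g := fun _ => 0) fun ω hω => ?_).trans
    (by simp)
  have hω' : M.φ ω o < a := hω
  have : BondPerc.conn (M.shut a (M.φ ω)) {o} T = 0 := by
    by_contra h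
    have h1 := conn_induction (shut_symm a _) h (P := fun v => v = o) (by simp)
      fun u _ v _ huv hu => absurd (shut_eq_one (Or.inl (hu ▸ hω'.le))) huv
    exact hne (Finset.eq_singleton_iff_unique_mem.2 ⟨ho, h1⟩)
  show ENNReal.ofReal (clus _ _ _ _) = 0
  rw [clus, this]
  simp

end Model

namespace Model

open BondPerc GaussNet

variable {M : Model} {C : ℝ} {K : Net M.V}

lemma isField (hK : M.IsTrace C K) {σ : ℝ} (hσ : σ * σ = 1) :
    K.IsField M.P fun ω x => σ * M.φ ω x where
  prob := M.Pprob
  meas x := (M.φ_meas x).const_mul σ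
  gauss c := by
    have h := M.φ_gauss K.F fun x => c x * σ
    have h1 : ∀ ω, ∑ x ∈ K.F, c x * σ * M.φ ω x = ∑ x ∈ K.F, c x * (σ * M.φ ω x) := fun ω =>
      Finset.sum_congr rfl fun x _ => mul_assoc _ _ _
    simp only [h1] at h
    rw [h]
    congr 2
    refine Finset.sum_congr rfl fun x hx => Finset.sum_congr rfl fun y hy => ?_
    rw [hK.G_eq x hx y hy]
    linear_combination (c x * c y * M.green x y) * hσ

lemma shut_eq_closed (hK : M.IsTrace C K) {a : ℝ} {f ψ : M.V → ℝ} {x z : M.V}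
    (hψ : ∀ y ∈ K.F, ψ x * ψ y = (f x - a) * (f y - a)) (hx : x ∈ K.F) (hxF : M.nbr x ⊆ K.F)
    (hz : z ∈ K.N) (hxz : z ≠ x) (h0 : 0 ≤ f x - a) : M.shut a f x z = closed K.w ψ x z := by
  unfold shut closed
  rw [hK.w_eq x hx hxF z hxz]
  rcases Finset.mem_insert.1 hz with h | h
  · have : M.lam x z = 0 := by
      by_contra h1
      exact K.bd_notMem (h ▸ hxF (WGraph.mem_nbr.2 h1))
    simp [this]
  · rw [hψ z h, max_eq_left h0, mul_assoc (2 * M.lam x z), mul_max_of_nonneg _ _ h0, mul_zero]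

/-- Above the level, the law of the cluster depends only on products of the shifted field. -/
lemma clus_shut_eq (hK : M.IsTrace C K) {a : ℝ} {f ψ : M.V → ℝ} {o : M.V} {T : Finset M.V}
    (hTF : T ⊆ K.F) (hT : ∀ x ∈ T, M.nbr x ⊆ K.F)
    (hψ : ∀ x ∈ K.F, ∀ y ∈ K.F, ψ x * ψ y = (f x - a) * (f y - a)) (h0 : a ≤ f o) :
    clus (M.shut a f) K.N {o} T = clus (closed K.w ψ) K.N {o} T := by
  have hTN : T ⊆ K.N := hTF.trans K.F_subset
  by_cases hpos : ∀ v ∈ T, 0 ≤ f v - a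
  · unfold clus
    congr 1
    · refine pr_congr (fun e he => ?_) _
      obtain ⟨⟨h1, h2⟩, h3⟩ := mem_edges.1 he
      refine shut_eq_closed hK (hψ _ (hTF h1)) (hTF h1) (hT _ h1) (hTN h2) ?_ (hpos _ h1)
      intro h
      rw [h] at h3
      exact wor_irrefl _ h3
    · refine Finset.prod_congr rfl fun x hx => Finset.prod_congr rfl fun z hz => ?_
      obtain ⟨h1, h2⟩ := Finset.mem_sdiff.1 hz
      exact shut_eq_closed hK (hψ _ (hTF hx)) (hTF hx) (hT _ hx) h1 (fun h => h2 (h ▸ hx))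
        (hpos _ hx)
  · have h1 : BondPerc.conn (M.shut a f) {o} T = 0 := by
      by_contra h
      refine hpos (conn_induction (shut_symm a f) h (P := fun v => 0 ≤ f v - a)
        (by simpa using h0) fun u _ v _ huv _ => ?_)
      by_contra hv
      exact huv (shut_eq_one (Or.inr (by linarith)))
    have h2 : BondPerc.conn (closed K.w ψ) {o} T = 0 := by
      by_contra h
      refine hpos (conn_induction (closed_symm K.w_symm ψ) h (P := fun v => 0 ≤ f v - a)
        (by simpa using h0) fun u hu v hv huv hu0 => ?_)
      have := mul_pos_of_closed_ne_one huv
      rw [hψ u (hTF hu) v (hTF hv)] at this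
      by_contra hv0
      exact absurd this (mul_nonpos_of_nonneg_of_nonpos hu0 (not_le.1 hv0).le).not_gt
    rw [clus, clus, h1, h2, zero_mul, zero_mul]

/-- Probability of a cluster above the level as an integral against the network density. -/
theorem Z_mul_measure (hK : M.IsTrace C K) {a b σ : ℝ} (hσ : σ * σ = 1) (hab : σ * b = -a)
    {o : M.V} {T : Finset M.V} (ho : o ∈ T) (hTF : T ⊆ K.F) (hT : ∀ x ∈ T, M.nbr x ⊆ K.F) :
    K.Z * M.P ({ω | a ≤ M.φ ω o} ∩ {ω | M.cluster a ω o = T}) =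
      K.I b (fun ψ => (if 0 ≤ σ * ψ o then 1 else 0) * K.weight {o} T ψ) := by
  have hoF := hTF ho
  have hm : MeasurableSet {f : M.V → ℝ | a ≤ f o} :=
    measurableSet_le measurable_const (measurable_pi_apply o)
  have hmH : Measurable fun ψ : M.V → ℝ => (if 0 ≤ σ * (ψ o + b) then (1 : ℝ≥0∞) else 0) *
      ENNReal.ofReal (clus (closed K.w fun x => ψ x + b) K.N {o} T) := by
    refine (Measurable.ite ?_ measurable_const measurable_const).mul
      ((measurable_clus K.w K.N {o} T).comp ?_).ennreal_ofReal
    · exact measurableSet_le measurable_const (by fun_prop)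
    · fun_prop
  have h1 : M.P ({ω | a ≤ M.φ ω o} ∩ {ω | M.cluster a ω o = T}) =
      ∫⁻ ω, (if 0 ≤ σ * (K.field (fun ω x => σ * M.φ ω x) ω o + b) then (1 : ℝ≥0∞) else 0) *
        ENNReal.ofReal (clus (closed K.w fun x => K.field (fun ω x => σ * M.φ ω x) ω x + b)
          K.N {o} T) ∂M.P := by
    refine (measure_inter_cluster a ho (hTF.trans K.F_subset)
      (fun x hx => (hT x hx).trans K.F_subset) hm).trans ?_
    have hm' : MeasurableSet {ω | M.φ ω ∈ {f : M.V → ℝ | a ≤ f o}} := measurable_field hm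
    rw [← lintegral_indicator hm']
    refine lintegral_congr fun ω => ?_
    have hval : ∀ x ∈ K.F, K.field (fun ω x => σ * M.φ ω x) ω x + b = σ * (M.φ ω x - a) :=
      fun x hx => by
        rw [Net.field, if_pos hx]
        linear_combination (-b) * hσ + σ * hab
    have hsig : σ * (K.field (fun ω x => σ * M.φ ω x) ω o + b) = M.φ ω o - a := by
      rw [hval o hoF]
      linear_combination (M.φ ω o - a) * hσ
    rw [hsig]
    by_cases h : a ≤ M.φ ω o
    · have hmem : ω ∈ {ω | M.φ ω ∈ {f : M.V → ℝ | a ≤ f o}} := h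
      rw [if_pos (by linarith), one_mul, Set.indicator_of_mem hmem,
        clus_shut_eq hK hTF hT (fun x hx y hy => ?_) h]
      rw [hval x hx, hval y hy]
      linear_combination ((M.φ ω x - a) * (M.φ ω y - a)) * hσ
    · have hmem : ω ∉ {ω | M.φ ω ∈ {f : M.V → ℝ | a ≤ f o}} := h
      rw [if_neg (by linarith), zero_mul, Set.indicator_of_notMem hmem]
  rw [h1, ← (isField hK hσ).I_dens hmH, K.I_shift b]
  congr 1
  funext ψ
  rw [mul_assoc, Net.weight, dens_add, mul_comm (dens _ _ _),
    ENNReal.ofReal_mul (clus_nonneg (closed_mem K.w_nonneg _) _ _ _)]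

variable {a b σ : ℝ} {o : M.V} {T : Finset M.V}

lemma Z_mul_measure_le (hK : M.IsTrace C K) (hσ : σ * σ = 1) (hab : σ * b = -a)
    (ho : o ∈ T) (hTF : T ⊆ K.F) (hT : ∀ x ∈ T, M.nbr x ⊆ K.F) :
    K.Z * M.P ({ω | a ≤ M.φ ω o} ∩ {ω | M.cluster a ω o = T}) ≤ K.I b (K.weight {o} T) := by
  rw [Z_mul_measure hK hσ hab ho hTF hT]
  refine K.I_mono fun ψ _ => ?_
  split_ifs <;> simp

lemma le_Z_mul_measure (hK : M.IsTrace C K) (hσ : σ * σ = 1) (hab : σ * b = -a)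
    (ho : o ∈ T) (hTF : T ⊆ K.F) (hT : ∀ x ∈ T, M.nbr x ⊆ K.F) :
    K.I b (K.weight {o} T) ≤
      2 * (K.Z * M.P ({ω | a ≤ M.φ ω o} ∩ {ω | M.cluster a ω o = T})) := by
  rw [Z_mul_measure hK hσ hab ho hTF hT, two_mul]
  have hm : Measurable fun ψ : M.V → ℝ =>
      (if 0 ≤ σ * ψ o then (1 : ℝ≥0∞) else 0) * K.weight {o} T ψ := by
    refine (Measurable.ite ?_ measurable_const measurable_const).mul (K.measurable_weight {o} T)
    exact measurableSet_le measurable_const (by fun_prop)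
  nth_rw 2 [← K.I_flip hm hTF]
  rw [← K.I_add hm]
  refine K.I_mono fun ψ _ => ?_
  rw [K.weight_flip hTF, flip_of_mem ho, ← add_mul]
  refine le_mul_of_one_le_left' ?_
  by_cases h : 0 ≤ σ * ψ o
  · rw [if_pos h]
    exact le_self_add
  · rw [if_neg h, if_pos (by linarith), zero_add]

end Model

namespace Model

open BondPerc GaussNet

variable {M : Model} {C θ : ℝ}

lemma mem_cluster (a : ℝ) (ω : M.Ω) (o : M.V) : o ∈ M.cluster a ω o := Relation.ReflTransGen.refl

lemma measure_cluster_eq_zero {a : ℝ} {o : M.V} {T : Finset M.V} (ho : o ∉ T) (S : Set M.Ω) :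
    M.P (S ∩ {ω | M.cluster a ω o = T}) = 0 := by
  have : S ∩ {ω | M.cluster a ω o = T} = ∅ := by
    refine Set.eq_empty_of_forall_notMem fun ω hω => ho ?_
    have h : M.cluster a ω o = T := hω.2
    rw [← Finset.mem_coe, ← h]
    exact mem_cluster a ω o
  rw [this, measure_empty]

/-- The truncated mean cluster volume as a sum over clusters. -/
lemma clusterVol_eq_tsum (a : ℝ) (o : M.V) : M.clusterVol a o =
    ∑' T : Finset M.V, (T.card : ℝ≥0∞) * M.P {ω | M.cluster a ω o = T} := by
  have := M.countableV
  have hm := measurableSet_cluster_eq (M := M) a o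
  have h : ∀ ω, (if (M.cluster a ω o).Finite then ((M.cluster a ω o).ncard : ℝ≥0∞) else 0) =
      ∑' T : Finset M.V, {ω | M.cluster a ω o = T}.indicator (fun _ => (T.card : ℝ≥0∞)) ω := by
    intro ω
    split_ifs with hf
    · rw [tsum_eq_single hf.toFinset]
      · have hmem : ω ∈ {ω | M.cluster a ω o = hf.toFinset} := by
          show M.cluster a ω o = hf.toFinset
          simp
        rw [Set.indicator_of_mem hmem, Set.ncard_eq_toFinset_card _ hf]
      · intro T hT
        refine Set.indicator_of_notMem (fun hmem => hT ?_) _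
        have : M.cluster a ω o = T := hmem
        apply Finset.coe_injective
        simp [this]
    · refine (ENNReal.tsum_eq_zero.2 fun T => ?_).symm
      refine Set.indicator_of_notMem (fun hmem => hf ?_) _
      have : M.cluster a ω o = T := hmem
      rw [this]
      exact T.finite_toSet
  unfold clusterVol
  rw [lintegral_congr h, lintegral_tsum fun T => (measurable_const.indicator (hm T)).aemeasurable]
  refine tsum_congr fun T => ?_
  rw [lintegral_indicator (hm T), setLIntegral_const]

lemma clusterVol_le (a : ℝ) (o : M.V) : M.clusterVol a o ≤
    1 + ∑' T : Finset M.V,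
      (T.card : ℝ≥0∞) * M.P ({ω | a ≤ M.φ ω o} ∩ {ω | M.cluster a ω o = T}) := by
  have := M.Pprob
  have h1 : ∀ T : Finset M.V, (T.card : ℝ≥0∞) * M.P {ω | M.cluster a ω o = T} ≤
      (T.card : ℝ≥0∞) * M.P ({ω | M.φ ω o < a} ∩ {ω | M.cluster a ω o = T}) +
        (T.card : ℝ≥0∞) * M.P ({ω | a ≤ M.φ ω o} ∩ {ω | M.cluster a ω o = T}) := fun T => by
    rw [← mul_add]
    refine mul_le_mul_right ((measure_mono fun ω hω => ?_).trans (measure_union_le _ _)) _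
    exact (lt_or_ge (M.φ ω o) a).imp (fun h => ⟨h, hω⟩) fun h => ⟨h, hω⟩
  rw [clusterVol_eq_tsum]
  refine (ENNReal.tsum_le_tsum h1).trans ?_
  rw [ENNReal.tsum_add]
  refine add_le_add_left ?_ _
  rw [tsum_eq_single {o}]
  · rw [Finset.card_singleton, Nat.cast_one, one_mul]
    exact prob_le_one
  · intro T hT
    refine mul_eq_zero_of_right _ ?_
    by_cases ho : o ∈ T
    · exact measure_lt_inter_cluster (N := T ∪ T.biUnion M.nbr) a ho Finset.subset_union_left
        (fun x hx => (Finset.subset_biUnion_of_mem _ hx).trans Finset.subset_union_right) hT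
    · exact measure_cluster_eq_zero ho _

lemma exists_sign (a : ℝ) : ∃ σ : ℝ, σ * σ = 1 ∧ σ * |a| = -a := by
  rcases le_total 0 a with h | h
  · exact ⟨-1, by norm_num, by rw [abs_of_nonneg h]; ring⟩
  · exact ⟨1, by norm_num, by rw [abs_of_nonpos h]; ring⟩

lemma exists_trace (hR : M.Reg C) (hν : 0 < M.ν) (hα : 0 < M.α) (F : Finset M.V) :
    ∃ K : Net M.V, K.F = F ∧ M.IsTrace C K := by
  have := hR.infinite hα
  obtain ⟨bd, hbd⟩ := Infinite.exists_notMem_finset F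
  exact hR.exists_net hν hα hbd

theorem exists_clusterVol_le (hR : M.Reg C) (hν : 0 < M.ν) (hα : 2 * M.ν < M.α)
    (hθ : 2 * (M.α - M.ν) / M.ν < θ) : ∃ K₀, 0 < K₀ ∧ ∀ a, a ≠ 0 → |a| ≤ 1 → ∀ o,
      M.clusterVol a o ≤ 1 + ENNReal.ofReal (K₀ * |a| ^ (-θ)) := by
  obtain ⟨K₀, hK₀, H⟩ := hR.exists_sum_card_weight_le hν hα hθ
  refine ⟨K₀, hK₀, fun a ha ha1 o => (clusterVol_le a o).trans (add_le_add_right ?_ _)⟩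
  obtain ⟨σ, hσ, hab⟩ := exists_sign a
  rw [ENNReal.tsum_eq_iSup_sum]
  refine iSup_le fun s => ?_
  have hev := (tendsto_add_atTop_nat 1).eventually (H |a| (abs_pos.2 ha) ha1 o)
  have hev2 : ∀ᶠ n : ℕ in atTop, ∀ x ∈ s.biUnion id, M.d o x ≤ n := by
    rw [Filter.eventually_all_finset]
    exact fun x _ => (tendsto_natCast_atTop_atTop (R := ℝ)).eventually_ge_atTop _
  obtain ⟨n, hn, hn2⟩ := (hev.and hev2).exists
  obtain ⟨K, hKF, hK⟩ := exists_trace hR hν (by linarith) (M.fball o (n + 1 : ℕ))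
  have hsum := hn K hK hKF
  have hsub : ∀ T ∈ s, ∀ x ∈ T, x ∈ M.fball o n := fun T hT x hx =>
    hR.mem_fball.2 (hn2 x (Finset.mem_biUnion.2 ⟨T, hT, hx⟩))
  have hcast : M.fball o ((n + 1 : ℕ) : ℝ) = M.fball o (n + 1) := by push_cast; rfl
  have hsF : ∀ T ∈ s, T ⊆ K.F := fun T hT x hx => by
    rw [hKF, hcast]
    exact hR.fball_mono o (by linarith) (hsub T hT x hx)
  have hsN : ∀ T ∈ s, ∀ x ∈ T, M.nbr x ⊆ K.F := fun T hT x hx => by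
    rw [hKF, hcast]
    exact hR.nbr_subset_fball (hsub T hT x hx)
  have hle : K.Z * ∑ T ∈ s, (T.card : ℝ≥0∞) *
      M.P ({ω | a ≤ M.φ ω o} ∩ {ω | M.cluster a ω o = T}) ≤
        ∑ T ∈ K.F.powerset with o ∈ T, (T.card : ℝ≥0∞) * K.I |a| (K.weight {o} T) := by
    rw [Finset.mul_sum]
    calc _ ≤ ∑ T ∈ s with o ∈ T, (T.card : ℝ≥0∞) * K.I |a| (K.weight {o} T) := by
          rw [Finset.sum_filter]
          refine Finset.sum_le_sum fun T hT => ?_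
          split_ifs with ho
          · rw [mul_left_comm]
            exact mul_le_mul_right (Z_mul_measure_le hK hσ hab ho (hsF T hT) (hsN T hT)) _
          · rw [measure_cluster_eq_zero ho, mul_zero, mul_zero]
      _ ≤ _ := Finset.sum_le_sum_of_subset fun T hT => by
          obtain ⟨h1, h2⟩ := Finset.mem_filter.1 hT
          exact Finset.mem_filter.2 ⟨Finset.mem_powerset.2 (hsF T h1), h2⟩
  have := hle.trans hsum
  rw [mul_comm _ K.Z] at this
  exact (ENNReal.mul_le_mul_iff_right K.Z_ne_zero K.Z_ne_top).1 this

theorem exists_le_clusterVol (hR : M.Reg C) (hν : 0 < M.ν) (hα : M.ν < M.α)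
    (hθ : θ < 2 * (M.α - M.ν) / M.ν) : ∃ c, 0 < c ∧ ∀ᶠ a in 𝓝[≠] (0 : ℝ), ∀ o,
      ENNReal.ofReal (c * |a| ^ (-θ)) ≤ M.clusterVol a o := by
  obtain ⟨c, hc, H⟩ := hR.exists_le_sum_card_weight hν hα hθ (P := M.P)
    (φ := fun ω x => 1 * M.φ ω x)
  refine ⟨c / 4, by positivity, ?_⟩
  have habs : Tendsto (fun a : ℝ => |a|) (𝓝[≠] 0) (𝓝[>] 0) := tendsto_abs_nhdsNE_zero
  filter_upwards [habs.eventually H, self_mem_nhdsWithin] with a h ha o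
  have ha0 : 0 < |a| := abs_pos.2 ha
  obtain ⟨σ, hσ, hab⟩ := exists_sign a
  set η := c * |a| ^ (-θ) / 2 with hη
  have hη0 : 0 < η := by positivity
  obtain ⟨n, hn, hn2⟩ := (((tendsto_add_atTop_nat 1).eventually (h o)).and
    (hR.eventually_sum_card_weight_le hν hα ha0 hη0 o)).exists
  have hcast : M.fball o ((n + 1 : ℕ) : ℝ) = M.fball o (n + 1) := by push_cast; rfl
  rw [hcast] at hn
  obtain ⟨K, hKF, hK⟩ := exists_trace hR hν (by linarith) (M.fball o (n + 1))
  have hlow := hn K hK hKF (isField hK (one_mul 1))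
  have hbad := hn2 K hK hKF
  have hgood : ∑ T ∈ K.F.powerset with o ∈ T ∧ T ⊆ M.fball o n,
      (T.card : ℝ≥0∞) * K.I |a| (K.weight {o} T) ≤ 2 * (K.Z * M.clusterVol a o) := by
    rw [clusterVol_eq_tsum]
    refine le_trans ?_ (mul_le_mul_right (mul_le_mul_right (ENNReal.sum_le_tsum
      (K.F.powerset.filter fun T => o ∈ T ∧ T ⊆ M.fball o n)) _) _)
    rw [Finset.mul_sum, Finset.mul_sum]
    refine Finset.sum_le_sum fun T hT => ?_
    obtain ⟨h1, ho, h2⟩ := Finset.mem_filter.1 hT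
    rw [mul_left_comm K.Z, mul_left_comm 2]
    refine mul_le_mul_right ((le_Z_mul_measure hK hσ hab ho (Finset.mem_powerset.1 h1)
      fun x hx => ?_).trans ?_) _
    · rw [hKF]
      exact hR.nbr_subset_fball (h2 hx)
    · exact mul_le_mul_right (mul_le_mul_right (measure_mono Set.inter_subset_right) _) _
  have hsplit : ∑ T ∈ K.F.powerset with o ∈ T, (T.card : ℝ≥0∞) * K.I |a| (K.weight {o} T) =
      (∑ T ∈ K.F.powerset with o ∈ T ∧ T ⊆ M.fball o n,
        (T.card : ℝ≥0∞) * K.I |a| (K.weight {o} T)) +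
      ∑ T ∈ K.F.powerset with o ∈ T ∧ ¬ T ⊆ M.fball o n,
        (T.card : ℝ≥0∞) * K.I |a| (K.weight {o} T) := by
    rw [← Finset.filter_filter, ← Finset.filter_filter, Finset.sum_filter_add_sum_filter_not]
  have hmain : ENNReal.ofReal η * K.Z + ENNReal.ofReal η * K.Z ≤
      2 * (K.Z * M.clusterVol a o) + ENNReal.ofReal η * K.Z := by
    rw [← add_mul, ← ENNReal.ofReal_add hη0.le hη0.le, hη, add_halves]
    exact hlow.trans (hsplit.le.trans (add_le_add hgood hbad))
  have hfin : ENNReal.ofReal η * K.Z ≠ ⊤ := ENNReal.mul_ne_top ENNReal.ofReal_ne_top K.Z_ne_top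
  have h3 := (ENNReal.add_le_add_iff_right hfin).1 hmain
  rw [mul_left_comm, mul_comm _ K.Z] at h3
  have h4 := (ENNReal.mul_le_mul_iff_right K.Z_ne_zero K.Z_ne_top).1 h3
  have h5 : ENNReal.ofReal η = 2 * ENNReal.ofReal (c / 4 * |a| ^ (-θ)) := by
    rw [← ENNReal.ofReal_ofNat 2, ← ENNReal.ofReal_mul (by norm_num), hη]
    congr 1
    ring
  rw [h5] at h4
  exact (ENNReal.mul_le_mul_iff_right (by norm_num) (by norm_num)).1 h4

end Model

/-- A function squeezed between constant multiples of powers with exponents arbitrarily close to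
`-β` has logarithmic exponent `-β`. -/
lemma tendsto_log_div_log_abs {f : ℝ → ℝ} {β : ℝ}
    (hup : ∀ θ, β < θ → ∃ K, 0 < K ∧ ∀ᶠ a in 𝓝[≠] (0 : ℝ), f a ≤ K * |a| ^ (-θ))
    (hlow : ∀ θ, θ < β → ∃ c, 0 < c ∧ ∀ᶠ a in 𝓝[≠] (0 : ℝ), c * |a| ^ (-θ) ≤ f a) :
    Tendsto (fun a => Real.log (f a) / Real.log |a|) (𝓝[≠] 0) (𝓝 (-β)) := by
  have habs : Tendsto (fun a : ℝ => |a|) (𝓝[≠] 0) (𝓝[>] 0) := tendsto_abs_nhdsNE_zero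
  have hlog : Tendsto (fun a : ℝ => Real.log |a|) (𝓝[≠] 0) atBot :=
    Real.tendsto_log_nhdsGT_zero.comp habs
  have hconst : ∀ D θ : ℝ, Tendsto (fun a : ℝ => D / Real.log |a| - θ) (𝓝[≠] 0) (𝓝 (-θ)) :=
    fun D θ => by
      have := (hlog.const_div_atBot D).sub_const θ
      rwa [zero_sub] at this
  have hform : ∀ D θ a : ℝ, 0 < D → a ≠ 0 → Real.log |a| < 0 →
      Real.log (D * |a| ^ (-θ)) / Real.log |a| = Real.log D / Real.log |a| - θ :=
    fun D θ a hD ha hl => by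
      have ha' := abs_pos.2 ha
      rw [Real.log_mul hD.ne' (rpow_pos_of_pos ha' _).ne', Real.log_rpow ha', add_div,
        mul_div_assoc, div_self hl.ne]
      ring
  obtain ⟨c₀, hc₀, h₀⟩ := hlow (β - 1) (by linarith)
  have hpos : ∀ᶠ a in 𝓝[≠] (0 : ℝ), 0 < f a := by
    filter_upwards [h₀, self_mem_nhdsWithin] with a ha ha0
    have := abs_pos.2 (show a ≠ 0 from ha0)
    exact lt_of_lt_of_le (by positivity) ha
  rw [tendsto_order]
  constructor
  · intro l hl
    obtain ⟨K, hK, h⟩ := hup ((β - l) / 2) (by linarith)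
    filter_upwards [h, hpos, self_mem_nhdsWithin, hlog.eventually_lt_atBot 0,
      (hconst (Real.log K) ((β - l) / 2)).eventually_const_lt (u := l) (by linarith)]
      with a h1 h2 h3 h4 h5
    rw [← hform K _ a hK h3 h4] at h5
    exact h5.trans_le (div_le_div_of_nonpos_of_le h4.le (Real.log_le_log h2 h1))
  · intro l hl
    obtain ⟨c, hc, h⟩ := hlow ((β - l) / 2) (by linarith)
    filter_upwards [h, self_mem_nhdsWithin, hlog.eventually_lt_atBot 0,
      (hconst (Real.log c) ((β - l) / 2)).eventually_lt_const (u := l) (by linarith)]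
      with a h1 h3 h4 h5
    rw [← hform c _ a hc h3 h4] at h5
    have := abs_pos.2 (show a ≠ 0 from h3)
    exact (div_le_div_of_nonpos_of_le h4.le (Real.log_le_log (by positivity) h1)).trans_lt h5

/-- **Critical exponent `γ` for the average cluster volume (Corollary 1.4, (1.17)).** -/
theorem gamma_exponent (M : Model)
    (hS : M.toWGraph.Standing) (hν1 : 1 ≤ M.ν) (hνα : M.ν < M.α / 2) (hν3 : M.ν < 3)
    (hgr : ∀ x y, M.d x y = M.toWGraph.graphDist x y) (x : M.V) :
    Filter.Tendsto (fun a : ℝ => Real.log (M.clusterVol a x).toReal / Real.log |a|)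
      (𝓝[≠] (0:ℝ)) (nhds (-(2 * M.α / M.ν - 2))) := by
  have hν : 0 < M.ν := by linarith
  have hβ : 2 * M.α / M.ν - 2 = 2 * (M.α - M.ν) / M.ν := by
    field_simp
  obtain ⟨C, hR⟩ := hS.exists_reg hgr
  rw [hβ]
  have hβ0 : 0 < 2 * (M.α - M.ν) / M.ν := div_pos (by linarith) hν
  have hup : ∀ θ, 2 * (M.α - M.ν) / M.ν < θ → ∃ K, 0 < K ∧ ∀ᶠ a in 𝓝[≠] (0 : ℝ),
      M.clusterVol a x ≤ ENNReal.ofReal (K * |a| ^ (-θ)) := fun θ hθ => by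
    obtain ⟨K, hK, h⟩ := Model.exists_clusterVol_le hR hν (by linarith) hθ
    refine ⟨1 + K, by positivity, ?_⟩
    have h1 : ∀ᶠ a in 𝓝[≠] (0 : ℝ), |a| ≤ 1 :=
      (tendsto_abs_nhdsNE_zero.mono_right nhdsWithin_le_nhds).eventually_le_const one_pos
    filter_upwards [self_mem_nhdsWithin, h1] with a ha ha1
    have ha0 : 0 < |a| := abs_pos.2 ha
    refine (h a ha ha1 x).trans ?_
    rw [← ENNReal.ofReal_one, ← ENNReal.ofReal_add zero_le_one (by positivity)]
    refine ENNReal.ofReal_le_ofReal ?_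
    have := one_le_rpow_of_pos_of_le_one_of_nonpos ha0 ha1 (by linarith : -θ ≤ 0)
    linarith
  refine tendsto_log_div_log_abs (fun θ hθ => ?_) fun θ hθ => ?_
  · obtain ⟨K, hK, h⟩ := hup θ hθ
    exact ⟨K, hK, h.mono fun a ha => ENNReal.toReal_le_of_le_ofReal (by positivity) ha⟩
  · obtain ⟨c, hc, h⟩ := Model.exists_le_clusterVol hR hν (by linarith) hθ
    obtain ⟨K, -, hK⟩ := hup _ (lt_add_one _)
    refine ⟨c, hc, ?_⟩
    filter_upwards [h, hK] with a ha hKa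
    exact (ENNReal.ofReal_le_iff_le_toReal (ne_top_of_le_ne_top ENNReal.ofReal_ne_top hKa)).1
      (ha x)
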